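/- Fix R ≥ 1 and K > 1. Assume W_{1,k},…,W_{K−1,k} ∈ ℤ[T] are multiplicatively independent with ∑_{i=1}^{K−1} deg W_{i,k} > 1, and that W_{K,k} = ∏_{i=1}^{K−1} W_{i,k}^{λ_i} for some nonnegative integers (λ_1,…,λ_{K−1}) ≠ (0,…,0). Then there exist constants C = C(W_{1,k},…,W_{K−1,k}) > 0, c > 0 and X_0 such that for all x > X_0, all k-admissible moduli q ≤ (log x)^{K_0} all of whose prime factors ℓ satisfy ℓ > C and gcd(ℓ−1, β(W_{1,k},…,W_{K−1,k})) = 1, and all residues a_1,…,a_K ∈ U_q with a_K ≡ ∏_{i=1}^{K−1} a_i^{λ_i} (mod q): #{n ≤ x : P_{Rk}(n) > q and f_i(n) ≡ a_i (mod q) for all i ∈ {1,…,K}} ≥ c · φ(q)^{−(K−1)} · x^{1/k} (log log x)^{R−2} / log x. -/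

import Mathlib

open Polynomial
open scoped Classical

noncomputable section

/-- `f : ℕ → ℤ` is a multiplicative arithmetic function. -/
def IsMultFn (f : ℕ → ℤ) : Prop :=
  f 1 = 1 ∧ ∀ m n : ℕ, Nat.Coprime m n → f (m * n) = f m * f n

/-- The polynomials `F i` are multiplicatively independent over `ℤ`:
no nonzero integer tuple `c` makes `∏ i, (F i) ^ (c i)` identically constant in `ℚ(T)`. -/
def MultIndep {m : ℕ} (F : Fin m → Polynomial ℤ) : Prop :=
  ¬ ∃ c : Fin m → ℤ, c ≠ 0 ∧ ∃ r : ℚ,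
      (∏ i, (algebraMap (Polynomial ℚ) (RatFunc ℚ) ((F i).map (Int.castRingHom ℚ))) ^ (c i))
        = algebraMap ℚ (RatFunc ℚ) r

/-- `β` is the last invariant factor of the exponent matrix of the family `F`
(for some factorization of the `F i` into pairwise non-associated primitive irreducibles,
via a Smith normal form of the exponent matrix). -/
def IsLastInvFactor {m : ℕ} (F : Fin m → Polynomial ℤ) (β : ℤ) : Prop :=
  ∃ (M : ℕ) (G : Fin M → Polynomial ℤ) (c : Fin m → ℤ) (μ : Fin M → Fin m → ℕ),
    (∀ j, Irreducible (G j)) ∧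
    (∀ j, (G j).IsPrimitive) ∧
    (∀ j j', j ≠ j' → ¬ Associated (G j) (G j')) ∧
    (∀ i, F i = Polynomial.C (c i) * ∏ j, G j ^ μ j i) ∧
    (∀ j, ∃ i, 0 < μ j i) ∧
    ∃ (P : Matrix (Fin M) (Fin M) ℤ) (Q : Matrix (Fin m) (Fin m) ℤ),
      IsUnit P.det ∧ IsUnit Q.det ∧
      (∀ (s : Fin M) (t : Fin m), (s : ℕ) ≠ (t : ℕ) →
        (P * (Matrix.of fun u v => (μ u v : ℤ)) * Q) s t = 0) ∧
      (∀ (s s' : Fin M) (t t' : Fin m), (s : ℕ) = (t : ℕ) → (s' : ℕ) = (t' : ℕ) →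
        (s : ℕ) + 1 = (s' : ℕ) →
        (P * (Matrix.of fun u v => (μ u v : ℤ)) * Q) s t ∣
          (P * (Matrix.of fun u v => (μ u v : ℤ)) * Q) s' t') ∧
      (∀ (s : Fin M) (t : Fin m), (s : ℕ) = (t : ℕ) → (s : ℕ) + 1 = min M m →
        β = (P * (Matrix.of fun u v => (μ u v : ℤ)) * Q) s t)

/-- Invariant Factor Hypothesis `IFH(F; B₀)` for the modulus `q`. -/
def IFH {m : ℕ} (F : Fin m → Polynomial ℤ) (B₀ : ℝ) (q : ℕ) : Prop :=
  ∀ β : ℤ, IsLastInvFactor F β →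
    ∀ ℓ : ℕ, ℓ.Prime → ℓ ∣ q → B₀ < (ℓ : ℝ) → Int.gcd ((ℓ : ℤ) - 1) β = 1

/-- `alphaRatio q P`: the proportion of units `u` mod `q` with `P(u)` a unit mod `q`. -/
def alphaRatio (q : ℕ) (P : Polynomial ℤ) : ℝ :=
  (Nat.card {u : (ZMod q)ˣ // IsUnit (Polynomial.aeval ((u : ZMod q)) P)} : ℝ)
    / (Nat.totient q : ℝ)

/-- `q` is `k`-admissible with respect to the family of products `Wprod v`. -/
def KAdmissible (Wprod : ℕ → Polynomial ℤ) (k q : ℕ) : Prop :=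
  (∃ u : (ZMod q)ˣ, IsUnit (Polynomial.aeval ((u : ZMod q)) (Wprod k))) ∧
  ∀ v, 1 ≤ v → v < k → ¬ ∃ u : (ZMod q)ˣ, IsUnit (Polynomial.aeval ((u : ZMod q)) (Wprod v))

/-- Narkiewicz's set `Q(k; f_1, …, f_K)`. -/
def NarkSet {K : ℕ} (k : ℕ) (f : Fin K → ℕ → ℤ) (W : Fin K → ℕ → Polynomial ℤ) : Set ℕ :=
  {q | KAdmissible (fun v => ∏ i, W i v) k q ∧
    ∀ χ : Fin K → DirichletCharacter ℂ q, χ ≠ (fun _ => 1) →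
      (∀ u : (ZMod q)ˣ, IsUnit (Polynomial.aeval ((u : ZMod q)) (∏ i, W i k)) →
          (∏ i, (χ i) (Polynomial.aeval ((u : ZMod q)) (W i k))) = 1) →
      ∃ p : ℕ, p.Prime ∧
        (∑' j : ℕ, (∏ i, (χ i) ((f i (p ^ j) : ZMod q))) *
            ((((p : ℝ) ^ (-(j : ℝ) / (k : ℝ))) : ℝ) : ℂ)) = 0}

/-- `Pj j n`: the `j`-th largest prime factor of `n` counted with multiplicity,
equal to `1` if `Ω(n) < j`. -/
def Pj (j n : ℕ) : ℕ := (n.primeFactorsList.reverse).getD (j - 1) 1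

/-- `nPart k n` is `n_k`, the largest positive integer whose `k`-th power is a
unitary divisor of `n`. -/
def nPart (k n : ℕ) : ℕ :=
  ∏ p ∈ n.primeFactors, if k ∣ n.factorization p then p ^ (n.factorization p / k) else 1

/-- A polynomial is squarefull in `ℤ[T]` iff every complex root has multiplicity at least 2. -/
def SquarefullPoly (F : Polynomial ℤ) : Prop :=
  ∀ z : ℂ, (F.map (Int.castRingHom ℂ)).IsRoot z →
    2 ≤ (F.map (Int.castRingHom ℂ)).rootMultiplicity z

/-- `n` is convenient (with respect to exponent `k`, threshold `y` and length `J`). -/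
def Convenient (k : ℕ) (y : ℝ) (J : ℕ) (n : ℕ) : Prop :=
  ∃ (m : ℕ) (P : Fin J → ℕ), 0 < m ∧ (∀ t, (P t).Prime) ∧
    (∀ s t : Fin J, s < t → P t < P s) ∧
    (∀ t, y < (P t : ℝ) ∧ Pj 1 m < P t) ∧
    n = m * (∏ t, P t) ^ k

/-- The solution count `Ṽ_{N,K}(q; (w_i))`. -/
def VNK {K N : ℕ} (F : Fin K → Fin N → Polynomial ℤ) (q : ℕ) (w : Fin K → ZMod q) : ℕ :=
  Nat.card {v : Fin N → (ZMod q)ˣ //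
    ∀ i, (∏ j, Polynomial.aeval ((v j : ZMod q)) (F i j)) = w i}

/-- `α*_N(q) = ∏_j α̃_j(q)`. -/
def alphaStarN {K N : ℕ} (F : Fin K → Fin N → Polynomial ℤ) (q : ℕ) : ℝ :=
  ∏ j, alphaRatio q (∏ i, F i j)

/-- `n` is `r`-full: every prime dividing `n` divides it to the `r`-th power. -/
def IsRFull (r n : ℕ) : Prop := ∀ p : ℕ, p.Prime → p ∣ n → p ^ r ∣ n

/-- The `k`-free part of `n`. -/
def kfreePart (k n : ℕ) : ℕ :=
  ∏ p ∈ n.primeFactors, if n.factorization p < k then p ^ n.factorization p else 1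

/-- Kummer's irreducibility criterion over a field containing the `n`-th roots of unity. -/
lemma irreducible_X_pow_sub_C_of_primitiveRoot {E : Type*} [Field E] {n : ℕ} (hn : 0 < n) {ζ : E}
    (hζ : IsPrimitiveRoot ζ n) {a : E}
    (ha : ∀ r : ℕ, r.Prime → r ∣ n → ∀ b : E, b ^ r ≠ a) : Irreducible (X ^ n - C a) := by
  by_cases hn1 : n = 1
  · subst hn1; simpa using irreducible_X_sub_C a
  have ha0 : a ≠ 0 := by
    rintro rfl
    obtain ⟨r, hr, hrn⟩ := Nat.exists_prime_and_dvd hn1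
    exact ha r hr hrn 0 (zero_pow hr.ne_zero)
  let A := AlgebraicClosure E
  obtain ⟨α, hα⟩ := IsAlgClosed.exists_pow_nat_eq (algebraMap E A a) hn
  have hα0 : α ≠ 0 := by
    rintro rfl
    rw [zero_pow hn.ne'] at hα
    exact ha0 ((map_eq_zero (algebraMap E A)).1 hα.symm)
  have hmon : (X ^ n - C a : E[X]).Monic := monic_X_pow_sub_C a hn.ne'
  have hprod : (X ^ n - C (algebraMap E A a) : A[X])
      = ∏ i ∈ Finset.range n, (X - C ((algebraMap E A ζ) ^ i * α)) :=
    X_pow_sub_C_eq_prod (hζ.map_of_injective (algebraMap E A).injective) hn hα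
  rw [hmon.irreducible_iff_natDegree']
  refine ⟨fun h => ?_, ?_⟩
  · have := congrArg natDegree h
    rw [natDegree_X_pow_sub_C, natDegree_one] at this
    omega
  intro f g hf hg hfg hgd
  rw [natDegree_X_pow_sub_C, Finset.mem_Ioc] at hgd
  set s := g.natDegree with hs
  -- the roots of `g` are of the form `ζ^i α`
  have hgdvd : g.map (algebraMap E A) ∣ (X ^ n - C (algebraMap E A a) : A[X]) := by
    have : g ∣ (X ^ n - C a : E[X]) := ⟨f, by rw [← hfg, mul_comm]⟩
    simpa using Polynomial.map_dvd (algebraMap E A) this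
  have hroots : ∀ z ∈ (g.map (algebraMap E A)).roots, ∃ e : E, z = algebraMap E A e * α := by
    intro z hz
    have hz0 : eval z (X ^ n - C (algebraMap E A a) : A[X]) = 0 := by
      obtain ⟨h, hh⟩ := hgdvd
      rw [hh, eval_mul, (mem_roots'.1 hz).2.eq_zero, zero_mul]
    rw [hprod, eval_prod, Finset.prod_eq_zero_iff] at hz0
    obtain ⟨i, -, hi⟩ := hz0
    refine ⟨ζ ^ i, ?_⟩
    simpa [sub_eq_zero] using hi
  have hsplit : (g.map (algebraMap E A)).Splits := IsAlgClosed.splits _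
  have hprodroots : ∀ S : Multiset A, (∀ z ∈ S, ∃ e : E, z = algebraMap E A e * α) →
      ∃ e : E, S.prod = algebraMap E A e * α ^ S.card := by
    intro S
    induction S using Multiset.induction_on with
    | empty => intro _; exact ⟨1, by simp⟩
    | cons z S ih =>
      intro h
      obtain ⟨e, he⟩ := ih fun w hw => h w (Multiset.mem_cons_of_mem hw)
      obtain ⟨e', he'⟩ := h z (Multiset.mem_cons_self z S)
      refine ⟨e' * e, ?_⟩
      rw [Multiset.prod_cons, he, he', Multiset.card_cons, map_mul]
      ring
  obtain ⟨e, he⟩ := hprodroots _ hroots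
  have hcard : (g.map (algebraMap E A)).roots.card = s := by
    rw [← hsplit.natDegree_eq_card_roots, natDegree_map]
  have hαs : ∃ b : E, α ^ s = algebraMap E A b := by
    have h1 := (hsplit.coeff_zero_eq_prod_roots_of_monic (hg.map _))
    rw [he, hcard, coeff_map] at h1
    have he0 : e ≠ 0 := by
      rintro rfl
      have h2 : (g.map (algebraMap E A)).eval 0 = 0 := by
        rw [← coeff_zero_eq_eval_zero, coeff_map, h1]; simp
      obtain ⟨h, hh⟩ := hgdvd
      have h3 := congrArg (eval 0) hh
      rw [eval_mul, h2] at h3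
      simp [hn.ne'] at h3
      exact ha0 h3
    refine ⟨(-1) ^ s * g.coeff 0 / e, ?_⟩
    rw [map_div₀, eq_div_iff ((_root_.map_ne_zero _).2 he0), map_mul, h1]
    simp only [natDegree_map, map_pow, map_neg, map_one, ← hs]
    rw [← mul_assoc, ← mul_pow, neg_one_mul, neg_neg, one_pow, one_mul, mul_comm]
  -- the set of exponents `t` with `α^t ∈ E`
  let L : Subfield A := (algebraMap E A).fieldRange
  have hLs : α ^ s ∈ L := by
    obtain ⟨b, hb⟩ := hαs
    exact ⟨b, hb.symm⟩
  have hLn : α ^ n ∈ L := ⟨a, hα.symm⟩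
  have hLd : α ^ (Nat.gcd s n) ∈ L := by
    have : α ^ (Nat.gcd s n) = (α ^ s) ^ (Nat.gcdA s n) * (α ^ n) ^ (Nat.gcdB s n) := by
      rw [← zpow_natCast α (Nat.gcd s n), Nat.gcd_eq_gcd_ab, zpow_add₀ hα0, zpow_mul, zpow_mul,
        zpow_natCast, zpow_natCast]
    rw [this]
    exact L.mul_mem (L.zpow_mem hLs _) (L.zpow_mem hLn _)
  set d := Nat.gcd s n
  obtain ⟨n', hn'⟩ : d ∣ n := Nat.gcd_dvd_right s n
  have hdle : d ≤ s := Nat.gcd_le_left n hgd.1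
  have hn'1 : n' ≠ 1 := by
    rintro rfl
    omega
  obtain ⟨r, hr, hrn⟩ := Nat.exists_prime_and_dvd hn'1
  obtain ⟨t, rfl⟩ := hrn
  obtain ⟨b, hb⟩ : α ^ (d * t) ∈ L := by rw [pow_mul]; exact L.pow_mem hLd _
  refine ha r hr ⟨d * t, by rw [hn']; ring⟩ b ((algebraMap E A).injective ?_)
  rw [map_pow, hb, ← hα, ← pow_mul, hn']
  congr 1
  ring

/-- A product of powers of pairwise coprime squarefree polynomials, evaluated at an independent
variable, is not a perfect `r`-th power when some exponent is prime to `r`. -/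
lemma generic_quotient_ne_pow {L : Type*} [Field L] {ι : Type*} [Fintype ι] (G : ι → L[X])
    (hsq : ∀ j, Squarefree (G j)) (hco : Pairwise fun i j => IsCoprime (G i) (G j))
    (hdeg : ∀ j, 0 < (G j).natDegree) (e : ι → ℕ) {r : ℕ} {j : ι} (hr : ¬ r ∣ e j)
    (b : FractionRing L[X][X]) :
    b ^ r ≠ algebraMap L[X][X] _ (C (∏ j, G j ^ e j)) /
      algebraMap L[X][X] _ ((∏ j, G j ^ e j).map C) := by
  intro hb
  have hG0 : ∀ i, G i ≠ 0 := fun i h => by simpa [h] using hdeg i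
  set F := ∏ j, G j ^ e j with hF
  have hF0 : F ≠ 0 := Finset.prod_ne_zero_iff.2 fun i _ => pow_ne_zero _ (hG0 i)
  have hFm0 : F.map (C : L →+* L[X]) ≠ 0 := by
    rwa [Polynomial.map_ne_zero_iff C_injective]
  have hnu : ¬ IsUnit (G j) := fun h => by
    have := natDegree_eq_zero_of_isUnit h
    have := hdeg j
    omega
  obtain ⟨π, hπ, hπG⟩ := WfDvdMonoid.exists_irreducible_factor hnu (hG0 j)
  have hπp : Prime π := hπ.prime
  obtain ⟨H, hH⟩ := hπG
  have hπH : ¬ π ∣ H := by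
    rintro ⟨t, rfl⟩
    exact hπ.not_isUnit (hsq j π ⟨t, by rw [hH]; ring⟩)
  have hother : ∀ i, i ≠ j → ¬ π ∣ G i := fun i hij h =>
    hπ.not_isUnit ((hco hij).isUnit_of_dvd' h ⟨H, hH⟩)
  obtain ⟨T, hT, hπT⟩ : ∃ T, F = π ^ e j * T ∧ ¬ π ∣ T := by
    refine ⟨H ^ e j * ∏ i ∈ Finset.univ.erase j, G i ^ e i, ?_, ?_⟩
    · rw [hF, ← Finset.mul_prod_erase _ _ (Finset.mem_univ j), hH]
      ring
    · rw [hπp.dvd_mul, not_or]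
      refine ⟨fun h => hπH (hπp.dvd_of_dvd_pow h), fun h => ?_⟩
      obtain ⟨i, hi, h⟩ := hπp.exists_mem_finset_dvd h
      exact hother i (Finset.ne_of_mem_erase hi) (hπp.dvd_of_dvd_pow h)
  obtain ⟨u, v, hv, rfl⟩ := IsFractionRing.div_surjective (A := L[X][X]) b
  have hv0 : v ≠ 0 := nonZeroDivisors.ne_zero hv
  have hinj := IsFractionRing.injective L[X][X] (FractionRing L[X][X])
  have hvE : algebraMap L[X][X] (FractionRing L[X][X]) v ≠ 0 := fun h =>
    hv0 (hinj (by rw [h, map_zero]))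
  have hFE : algebraMap L[X][X] (FractionRing L[X][X]) (F.map C) ≠ 0 := fun h =>
    hFm0 (hinj (by rw [h, map_zero]))
  have key : u ^ r * F.map C = C F * v ^ r := by
    apply hinj
    rw [div_pow, div_eq_div_iff (pow_ne_zero _ hvE) hFE] at hb
    simpa using hb
  have hP : Prime (C π : L[X][X]) := prime_C_iff.2 hπp
  have hu0 : u ≠ 0 := by
    rintro rfl
    have hr0 : r ≠ 0 ∨ r = 0 := (em _).symm
    rcases hr0 with h | h
    · rw [zero_pow h, zero_mul] at key
      exact mul_ne_zero (C_ne_zero.2 hF0) (pow_ne_zero _ hv0) key.symm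
    · rw [h, pow_zero, pow_zero, one_mul, mul_one] at key
      have h1 : (F.map C).natDegree = 0 := by rw [key, natDegree_C]
      rw [natDegree_map_eq_of_injective C_injective] at h1
      have h2 : G j ^ e j ∣ F := Finset.dvd_prod_of_mem _ (Finset.mem_univ j)
      have h3 := natDegree_le_of_dvd h2 hF0
      rw [natDegree_pow, h1] at h3
      have := hdeg j
      have h4 : e j = 0 := by nlinarith
      exact hr (h4 ▸ dvd_zero r)
  have hPF : ¬ (C π : L[X][X]) ∣ F.map C := by
    intro h
    rw [C_dvd_iff_dvd_coeff] at h
    have := h F.natDegree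
    rw [coeff_map, coeff_natDegree] at this
    exact hπ.not_isUnit (isUnit_of_dvd_unit this
      (isUnit_C.2 (isUnit_iff_ne_zero.2 (leadingCoeff_ne_zero.2 hF0))))
  have hPT : ¬ (C π : L[X][X]) ∣ C T := by
    rw [C_dvd_iff_dvd_coeff]
    intro h
    have := h 0
    rw [coeff_C_zero] at this
    exact hπT this
  have fu : FiniteMultiplicity (C π) u := FiniteMultiplicity.of_prime_left hP hu0
  have fv : FiniteMultiplicity (C π) v := FiniteMultiplicity.of_prime_left hP hv0
  have h1 : emultiplicity (C π) (u ^ r * F.map C) = ((r * multiplicity (C π) u : ℕ) : ℕ∞) := by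
    rw [emultiplicity_mul hP, emultiplicity_eq_zero.2 hPF, add_zero, emultiplicity_pow hP,
      fu.emultiplicity_eq_multiplicity]
    push_cast; rfl
  have h2 : emultiplicity (C π) (C F * v ^ r)
      = ((e j + r * multiplicity (C π) v : ℕ) : ℕ∞) := by
    rw [hT, map_mul, map_pow, emultiplicity_mul hP, emultiplicity_mul hP,
      emultiplicity_eq_zero.2 hPT, add_zero, emultiplicity_pow hP, emultiplicity_pow hP,
      fv.emultiplicity_eq_multiplicity,
      (FiniteMultiplicity.of_prime_left hP hP.ne_zero).emultiplicity_self]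
    push_cast; rw [mul_one]
  rw [key, h2, Nat.cast_inj] at h1
  exact hr ((Nat.dvd_add_left (Dvd.intro _ rfl)).1 (h1 ▸ Dvd.intro _ rfl))

lemma irreducible_generic_kummer {L : Type*} [Field L] {n : ℕ} (hn : 0 < n) {ζ : L}
    (hζ : IsPrimitiveRoot ζ n) {ι : Type*} [Fintype ι] (G : ι → L[X])
    (hsq : ∀ j, Squarefree (G j)) (hco : Pairwise fun i j => IsCoprime (G i) (G j))
    (hdeg : ∀ j, 0 < (G j).natDegree) (e : ι → ℕ)
    (he : ∀ r : ℕ, r.Prime → r ∣ n → ∃ j, ¬ r ∣ e j) :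
    Irreducible (X ^ n - C (algebraMap L[X][X] (FractionRing L[X][X]) (C (∏ j, G j ^ e j)) /
      algebraMap L[X][X] (FractionRing L[X][X]) ((∏ j, G j ^ e j).map C))) := by
  have hζ' : IsPrimitiveRoot (algebraMap L[X][X] (FractionRing L[X][X]) (C (C ζ))) n :=
    (hζ.map_of_injective (f := (C : L[X] →+* L[X][X]).comp (C : L →+* L[X]))
      (C_injective.comp C_injective)).map_of_injective
      (IsFractionRing.injective L[X][X] (FractionRing L[X][X]))
  refine irreducible_X_pow_sub_C_of_primitiveRoot hn hζ' fun r hr hrn b => ?_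
  obtain ⟨j, hj⟩ := he r hr hrn
  exact generic_quotient_ne_pow G hsq hco hdeg e hj b

lemma natDegree_det_le_card_mul {R : Type*} [CommRing R] {κ : Type*} [Fintype κ]
    [DecidableEq κ] (M : Matrix κ κ R[X]) (B : ℕ) (hM : ∀ i j, (M i j).natDegree ≤ B) :
    M.det.natDegree ≤ Fintype.card κ * B := by
  rw [Matrix.det_apply]
  refine natDegree_sum_le_of_forall_le _ _ fun σ _ => ?_
  refine (natDegree_smul_le _ _).trans ((natDegree_prod_le _ _).trans ?_)
  refine (Finset.sum_le_card_nsmul _ _ B fun i _ => hM _ _).trans ?_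
  simp

/-- The substitution `X' ↦ x ^ N` on polynomials in `x` over `L[X']`. -/
def substPow (L : Type*) [Field L] (N : ℕ) : L[X][X] →+* L[X] :=
  eval₂RingHom (expand L N : L[X] →ₐ[L] L[X]).toRingHom X

lemma substPow_C {L : Type*} [Field L] (N : ℕ) (p : L[X]) : substPow L N (C p) = expand L N p := by
  simp [substPow]

lemma substPow_map_C {L : Type*} [Field L] (N : ℕ) (p : L[X]) : substPow L N (p.map C) = p := by
  rw [substPow, coe_eval₂RingHom, eval₂_map]
  have : ((expand L N : L[X] →ₐ[L] L[X]).toRingHom.comp C) = (C : L →+* L[X]) := by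
    ext; simp
  rw [this]
  exact eval₂_C_X

lemma substPow_injective {L : Type*} [Field L] {N : ℕ} {p : L[X][X]}
    (hp : p.natDegree < N) (h : substPow L N p = 0) : p = 0 := by
  ext t u
  by_cases ht : t < N
  swap
  · have hz : p.coeff t = 0 := coeff_eq_zero_of_natDegree_lt (by omega)
    simp [hz]
  have h1 := congrArg (fun f => f.coeff (N * u + t)) h
  simp only [substPow, coe_eval₂RingHom, eval₂_eq_sum_range, finsetSum_coeff, coeff_zero] at h1
  rw [Finset.sum_eq_single t] at h1
  · rw [coeff_mul_X_pow] at h1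
    have hN : 0 < N := by omega
    have : ((expand L N : L[X] →ₐ[L] L[X]).toRingHom (p.coeff t)).coeff (N * u)
      = (p.coeff t).coeff u := by
      rw [AlgHom.toRingHom_eq_coe, RingHom.coe_coe, mul_comm, coeff_expand_mul hN]
    rw [this] at h1
    simpa using h1
  · intro s hs hst
    rw [Finset.mem_range] at hs
    rw [coeff_mul_X_pow']
    split_ifs with hle
    · rw [AlgHom.toRingHom_eq_coe, RingHom.coe_coe, coeff_expand (by omega)]
      rw [if_neg]
      intro hd
      apply hst
      have h2 : (N : ℤ) ∣ (t : ℤ) - s := by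
        have h3 : (N : ℤ) ∣ ((N * u + t - s : ℕ) : ℤ) := by exact_mod_cast hd
        rw [Nat.cast_sub hle] at h3
        push_cast at h3
        have h4 : (N : ℤ) ∣ N * u := Dvd.intro _ rfl
        have h5 := dvd_sub h3 h4
        rwa [show (N : ℤ) * u + t - s - N * u = t - s by ring] at h5
      obtain ⟨c, hc⟩ := h2
      have hc0 : c = 0 := by
        by_contra hc0
        rcases lt_or_gt_of_ne hc0 with h | h
        · nlinarith
        · nlinarith
      subst hc0
      omega
    · rfl
  · intro ht'
    rw [Finset.mem_range, not_lt] at ht'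
    have hz : p.coeff t = 0 := coeff_eq_zero_of_natDegree_lt (by omega)
    simp [hz]

/-- Stepanov's auxiliary polynomial does not vanish. -/
lemma stepanov_nonvanishing {L : Type*} [Field L] {n : ℕ} (hn : 0 < n) {ζ : L}
    (hζ : IsPrimitiveRoot ζ n) {ι : Type*} [Fintype ι] (G : ι → L[X])
    (hsq : ∀ j, Squarefree (G j)) (hco : Pairwise fun i j => IsCoprime (G i) (G j))
    (hdeg : ∀ j, 0 < (G j).natDegree) (e : ι → ℕ)
    (he : ∀ r : ℕ, r.Prime → r ∣ n → ∃ j, ¬ r ∣ e j)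
    {N t B : ℕ} (hN : N = n * t + 1)
    (hF : (∏ j, G j ^ e j) ^ N = expand L N (∏ j, G j ^ e j))
    (hFB : (∏ j, G j ^ e j).natDegree ≤ B) (hB : 2 * n * B < N)
    (k : ℕ → L[X][X]) (hk : ∀ i < n, (k i).natDegree ≤ B)
    (h0 : ∑ i ∈ Finset.range n, substPow L N (k i) * ((∏ j, G j ^ e j) ^ t) ^ i = 0) :
    ∀ i < n, k i = 0 := by
  have hirr := irreducible_generic_kummer hn hζ G hsq hco hdeg e he
  have hG0 : ∀ i, G i ≠ 0 := fun i h => by simpa [h] using hdeg i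
  set F := ∏ j, G j ^ e j with hFdef
  have hF0 : F ≠ 0 := Finset.prod_ne_zero_iff.2 fun i _ => pow_ne_zero _ (hG0 i)
  have hFm0 : F.map (C : L →+* L[X]) ≠ 0 := by
    rwa [Polynomial.map_ne_zero_iff C_injective]
  set i₀ := algebraMap L[X][X] (FractionRing L[X][X]) with hi₀
  have hinj : Function.Injective i₀ := IsFractionRing.injective L[X][X] (FractionRing L[X][X])
  have hFE : i₀ (F.map C) ≠ 0 := fun h => hFm0 (hinj (by rw [h, map_zero]))
  set P : L[X][X][X] := ∑ i ∈ Finset.range n, C (k i) * X ^ i with hP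
  set H : L[X][X][X] := C (F.map C) * X ^ n - C (C F) with hH
  have hPcoeff : ∀ i, P.coeff i = if i < n then k i else 0 := by
    intro i
    simp only [hP, finsetSum_coeff, coeff_C_mul, coeff_X_pow, mul_ite, mul_one, mul_zero]
    simp
  by_contra hcon
  push Not at hcon
  obtain ⟨i₁, hi₁, hki₁⟩ := hcon
  have hP0 : P ≠ 0 := fun h => hki₁ (by
    have := hPcoeff i₁
    rw [h, if_pos hi₁] at this
    simpa using this.symm)
  have hPdeg : P.natDegree < n := by
    rw [natDegree_lt_iff_degree_lt hP0, degree_lt_iff_coeff_zero]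
    intro m hm
    rw [hPcoeff, if_neg (by omega)]
  have hHdeg : H.natDegree ≤ n := by
    rw [hH]
    compute_degree
  have hHcoeff : ∀ i, (H.coeff i).natDegree ≤ B := by
    intro i
    rw [hH, coeff_sub, coeff_C_mul, coeff_X_pow, coeff_C]
    refine (natDegree_sub_le _ _).trans (max_le ?_ ?_)
    · split_ifs
      · rw [mul_one]; exact natDegree_map_le.trans hFB
      · simp
    · split_ifs <;> simp
  have hHE : H.map i₀ = C (i₀ (F.map C)) * (X ^ n - C (i₀ (C F) / i₀ (F.map C))) := by
    rw [hH, Polynomial.map_sub, Polynomial.map_mul, Polynomial.map_pow, map_X, map_C, map_C,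
      mul_sub, ← C_mul, mul_div_cancel₀ _ hFE]
  have hHEdeg : (H.map i₀).natDegree = n := by
    rw [hHE, natDegree_C_mul hFE, natDegree_X_pow_sub_C]
  have hHirr : Irreducible (H.map i₀) := by
    rw [hHE]
    exact (irreducible_isUnit_mul (isUnit_C.2 hFE.isUnit)).2 hirr
  have hHdeg' : H.natDegree = n := by
    rw [← hHEdeg, natDegree_map_eq_of_injective hinj]
  have hPE0 : P.map i₀ ≠ 0 := by rwa [Polynomial.map_ne_zero_iff hinj]
  have hcop : IsCoprime (H.map i₀) (P.map i₀) := by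
    rw [hHirr.coprime_iff_not_dvd]
    intro h
    have := natDegree_le_of_dvd h hPE0
    rw [hHEdeg, natDegree_map_eq_of_injective hinj] at this
    omega
  have hres : resultant H P ≠ 0 := by
    have h1 := resultant_ne_zero _ _ hcop
    rw [natDegree_map_eq_of_injective hinj, natDegree_map_eq_of_injective hinj,
      resultant_map_map] at h1
    exact fun h => h1 (by rw [h, map_zero])
  have hresdeg : (resultant H P).natDegree < N := by
    rw [resultant]
    refine (natDegree_det_le_card_mul _ B fun i j => ?_).trans_lt ?_
    · rw [sylvester, Matrix.of_apply]
      induction j using Fin.addCases with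
      | left j =>
        simp only [Fin.addCases_left]
        split_ifs
        · rw [hPcoeff]; split_ifs with h
          · exact hk _ h
          · simp
        · simp
      | right j =>
        simp only [Fin.addCases_right]
        split_ifs
        · exact hHcoeff _
        · simp
    · rw [Fintype.card_fin]
      refine lt_of_le_of_lt (Nat.mul_le_mul_right B ?_) hB
      omega
  refine hres (substPow_injective hresdeg ?_)
  obtain ⟨p, q, -, -, hpq⟩ := exists_mul_add_mul_eq_C_resultant (m := H.natDegree)
    (n := P.natDegree) H P le_rfl le_rfl (Or.inl (by omega))
  have h1 := congrArg (eval₂ (substPow L N) (F ^ t)) hpq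
  rw [eval₂_add, eval₂_mul, eval₂_mul, eval₂_C] at h1
  rw [← h1]
  have hH0 : eval₂ (substPow L N) (F ^ t) H = 0 := by
    rw [hH, eval₂_sub, eval₂_mul, eval₂_C, eval₂_C, eval₂_pow, eval₂_X, substPow_C, substPow_map_C,
      ← hF, hN]
    ring
  have hPz : eval₂ (substPow L N) (F ^ t) P = 0 := by
    rw [← h0, hP, eval₂_finsetSum]
    refine Finset.sum_congr rfl fun i _ => ?_
    rw [eval₂_mul, eval₂_C, eval₂_pow, eval₂_X]
  rw [hH0, hPz]; ring

lemma exists_linear_relation_of_natDegree_lt {L : Type*} [Field L] {ι : Type*} [Fintype ι]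
    (p : ι → L[X]) (D : ℕ) (hp : ∀ u, (p u).natDegree < D) (hD : D < Fintype.card ι) :
    ∃ a : ι → L, a ≠ 0 ∧ ∑ u, C (a u) * p u = 0 := by
  let M : Matrix (Fin D) ι L := Matrix.of fun s u => (p u).coeff s
  have h : LinearMap.ker M.mulVecLin ≠ ⊥ := LinearMap.ker_ne_bot_of_finrank_lt (by simpa using hD)
  obtain ⟨a, ha, ha0⟩ := Submodule.exists_mem_ne_zero_of_ne_bot h
  refine ⟨a, ha0, ?_⟩
  ext s
  rw [finsetSum_coeff, coeff_zero]
  by_cases hs : s < D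
  · have := congrFun (LinearMap.mem_ker.1 ha) ⟨s, hs⟩
    rw [Matrix.mulVecLin_apply, Matrix.mulVec, dotProduct] at this
    simpa [M, mul_comm] using this
  · refine Finset.sum_eq_zero fun u _ => ?_
    rw [coeff_C_mul, coeff_eq_zero_of_natDegree_lt (by have := hp u; omega), mul_zero]

/-- Stepanov's method: an upper bound for the number of `α` in a finite field for which
`F(α)` lies in a given coset of the `n`-th powers. -/
lemma stepanov_bound {L : Type*} [Field L] [Fintype L] {n : ℕ} (hn : 2 ≤ n) {ζ : L}
    (hζ : IsPrimitiveRoot ζ n) {ι : Type*} [Fintype ι] (G : ι → L[X])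
    (hsq : ∀ j, Squarefree (G j)) (hco : Pairwise fun i j => IsCoprime (G i) (G j))
    (hdeg : ∀ j, 0 < (G j).natDegree) (e : ι → ℕ)
    (he : ∀ r : ℕ, r.Prime → r ∣ n → ∃ j, ¬ r ∣ e j)
    {N t Q w d : ℕ} (hN : N = n * t + 1) (hQ : Q = n * w + 1) (hL : Fintype.card L = Q * N)
    (hF : (∏ j, G j ^ e j) ^ N = expand L N (∏ j, G j ^ e j))
    (hd : (∏ j, G j ^ e j).natDegree = d) (hB : 2 * n * (Q * (d + 1)) < N)
    {c : L} (hc : c ≠ 0) :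
    n * (Finset.univ.filter fun α : L => (∏ j, G j ^ e j).eval α ^ (w * N + t) = c).card
      ≤ Q * N + n * ((Q + N) * (d + 1)) := by
  have hnv := stepanov_nonvanishing (B := Q * (d + 1)) (by omega) hζ G hsq hco hdeg e he hN hF
    (by
      rw [hd]
      have := Nat.le_mul_of_pos_left (d + 1) (show 0 < Q by omega)
      omega) hB
  set F := ∏ j, G j ^ e j with hFdef
  set J := w + 2 with hJ
  set A := Q * (d + 1) with hA
  have hQ1 : 1 ≤ Q := by omega
  have hA1 : 1 ≤ A := Nat.mul_pos hQ1 (by omega)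
  -- the auxiliary coefficients
  obtain ⟨a, ha0, ha⟩ := exists_linear_relation_of_natDegree_lt
    (fun u : Fin n × Fin J × Fin A =>
      (X ^ (Q * u.2.2.1) * C (c ^ u.1.1) * F ^ ((n - 1 - u.1.1) * w) * X ^ u.2.1.1 : L[X]))
    (Q * A + (n - 1) * w * d + J)
    (by
      rintro ⟨i, j, s⟩
      refine lt_of_le_of_lt (natDegree_mul_le.trans (Nat.add_le_add_right (natDegree_mul_le.trans
        (Nat.add_le_add_right natDegree_mul_le _)) _)) ?_
      rw [natDegree_X_pow, natDegree_C, natDegree_X_pow, natDegree_pow, hd]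
      have h1 : Q * s.1 ≤ Q * A := Nat.mul_le_mul_left _ s.2.le
      have h2 : (n - 1 - i.1) * w * d ≤ (n - 1) * w * d :=
        Nat.mul_le_mul_right _ (Nat.mul_le_mul_right _ (Nat.sub_le _ _))
      have h3 := j.2
      simp only
      omega)
    (by
      simp only [Fintype.card_prod, Fintype.card_fin]
      obtain ⟨n', rfl⟩ : ∃ n', n = n' + 2 := ⟨n - 2, by omega⟩
      have h1 : (n' + 2 - 1) * w * d ≤ Q * d := by
        gcongr; rw [hQ]; simp; nlinarith
      have h2 : J ≤ Q + 1 := by rw [hQ]; nlinarith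
      have h3 : (n' + 2) * (J * A) = (Q + 2 * n' + 3) * A := by
        rw [hJ, hQ]; ring
      rw [h3]
      have h4 : A = Q * d + Q := by rw [hA]; ring
      nlinarith)
  set p : Fin n → Fin J → L[X] := fun i j => ∑ s : Fin A, C (a (i, j, s)) * X ^ s.1 with hp
  have hpdeg : ∀ i j, (p i j).natDegree < A := by
    intro i j
    have : (p i j).natDegree ≤ A - 1 := natDegree_sum_le_of_forall_le _ _ fun s _ =>
      (natDegree_C_mul_X_pow_le _ _).trans (by have := s.2; omega)
    omega
  have hpcoeff : ∀ i j (s : Fin A), (p i j).coeff s.1 = a (i, j, s) := by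
    intro i j s
    simp only [hp, finsetSum_coeff, coeff_C_mul, coeff_X_pow]
    simp [Fin.val_inj]
  have hid : ∑ i : Fin n, ∑ j : Fin J,
      expand L Q (p i j) * C (c ^ i.1) * F ^ ((n - 1 - i.1) * w) * X ^ j.1 = 0 := by
    rw [← ha, Fintype.sum_prod_type]
    refine Finset.sum_congr rfl fun i _ => ?_
    rw [Fintype.sum_prod_type]
    refine Finset.sum_congr rfl fun j _ => ?_
    simp only [hp, map_sum, map_mul, expand_C, map_pow, expand_X, Finset.sum_mul]
    refine Finset.sum_congr rfl fun s _ => ?_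
    rw [← pow_mul]; ring
  set k : ℕ → L[X][X] := fun i =>
    if h : i < n then ∑ j : Fin J, (p ⟨i, h⟩ j).map C * C (X ^ j.1) else 0 with hk
  have hkdeg : ∀ i < n, (k i).natDegree ≤ A := by
    intro i hi
    simp only [hk, dif_pos hi]
    refine natDegree_sum_le_of_forall_le _ _ fun j _ => ?_
    refine (natDegree_mul_C_le _ _).trans (natDegree_map_le.trans (hpdeg _ _).le)
  set Ψ : L[X] := ∑ i ∈ Finset.range n, substPow L N (k i) * (F ^ t) ^ i with hΨ
  have hkΨ : ∀ i : Fin n, substPow L N (k i) = ∑ j : Fin J, p i j * X ^ (N * j.1) := by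
    intro i
    simp only [hk, dif_pos i.2, map_sum, map_mul, substPow_map_C, substPow_C, map_pow, expand_X,
      ← pow_mul]
  have hΨ' : Ψ = ∑ i : Fin n, ∑ j : Fin J, p i j * X ^ (N * j.1) * (F ^ t) ^ i.1 := by
    rw [hΨ, ← Fin.sum_univ_eq_sum_range (fun i => substPow L N (k i) * (F ^ t) ^ i)]
    refine Finset.sum_congr rfl fun i _ => ?_
    rw [hkΨ, Finset.sum_mul]
  have hΨ0 : Ψ ≠ 0 := by
    intro h
    apply ha0
    funext ⟨i, j, s⟩
    have h1 := hnv k hkdeg h i.1 i.2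
    have h2 := congrArg (fun f : L[X][X] => (f.coeff s.1).coeff j.1) h1
    simp only [hk, dif_pos i.2, finsetSum_coeff, coeff_mul_C, coeff_map, coeff_zero,
      coeff_C_mul, coeff_X_pow] at h2
    rw [Finset.sum_eq_single j] at h2
    · simpa [hpcoeff] using h2
    · intro j' _ hj
      rw [if_neg (fun h => hj (Fin.ext h.symm)), mul_zero]
    · simp
  have hΨdeg : Ψ.natDegree ≤ A + d * N + N * (w + 1) := by
    rw [hΨ']
    refine natDegree_sum_le_of_forall_le _ _ fun i _ => ?_
    refine natDegree_sum_le_of_forall_le _ _ fun j _ => ?_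
    refine (natDegree_mul_le.trans (Nat.add_le_add_right natDegree_mul_le _)).trans ?_
    rw [natDegree_X_pow, natDegree_pow, natDegree_pow, hd]
    have h1 := (hpdeg i j).le
    have h2 : N * j.1 ≤ N * (w + 1) := Nat.mul_le_mul_left _ (by have := j.2; omega)
    have h3 : i.1 * (t * d) ≤ d * N := by
      have : i.1 * t ≤ N := by
        rw [hN]
        exact (Nat.mul_le_mul_right _ i.2.le).trans (Nat.le_succ _)
      calc i.1 * (t * d) = d * (i.1 * t) := by ring
        _ ≤ _ := Nat.mul_le_mul_left _ this
    omega
  have hroot : ∀ α : L, F.eval α ^ (w * N + t) = c → Ψ.IsRoot α := by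
    intro α hα
    set β := α ^ N with hβ
    have hβQ : β ^ Q = α := by
      rw [hβ, ← pow_mul, mul_comm, ← hL, FiniteField.pow_card]
    have hFβ : F.eval β = F.eval α ^ N := by
      have := congrArg (eval α) hF
      rw [eval_pow, expand_eval] at this
      exact this.symm
    have hrel : F.eval β ^ w * F.eval α ^ t = c := by
      rw [hFβ, ← hα]; ring
    have hFβ0 : F.eval β ^ w ≠ 0 := by
      intro h
      rw [h, zero_mul] at hrel
      exact hc hrel.symm
    have h1 := congrArg (eval β) hid
    rw [eval_finsetSum, eval_zero] at h1
    have h2 : (F.eval β ^ w) ^ (n - 1) * Ψ.eval α = 0 := by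
      rw [← h1, hΨ', eval_finsetSum, Finset.mul_sum]
      refine Finset.sum_congr rfl fun i _ => ?_
      rw [eval_finsetSum, eval_finsetSum, Finset.mul_sum]
      refine Finset.sum_congr rfl fun j _ => ?_
      have hi : n - 1 = (n - 1 - i.1) + i.1 := by have := i.2; omega
      simp only [eval_mul, eval_pow, eval_X, eval_C, expand_eval, hβQ]
      rw [pow_mul α N, ← hβ, ← hrel]
      conv_lhs => rw [hi, pow_add]
      rw [mul_comm (n - 1 - i.1) w, pow_mul, mul_pow]
      ring
    exact (mul_eq_zero.1 h2).resolve_left (pow_ne_zero _ hFβ0)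
  have hcard : (Finset.univ.filter fun α : L => F.eval α ^ (w * N + t) = c).card
      ≤ Ψ.natDegree := by
    refine le_trans (Finset.card_le_card (t := Ψ.roots.toFinset) fun α hα => ?_)
      ((Multiset.toFinset_card_le _).trans (card_roots' _))
    rw [Multiset.mem_toFinset, mem_roots hΨ0]
    exact hroot α (Finset.mem_filter.1 hα).2
  calc n * _ ≤ n * (A + d * N + N * (w + 1)) := Nat.mul_le_mul_left _ (hcard.trans hΨdeg)
    _ ≤ _ := by rw [hA, hQ]; nlinarith

section MonicSums

variable {F : Type*} [Field F] [Finite F]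

lemma finite_monic_natDegree (F : Type*) [Field F] [Finite F] (n : ℕ) :
    {g : F[X] | g.Monic ∧ g.natDegree = n}.Finite := by
  have : Finite (degreeLT F n) := Finite.of_equiv _ (degreeLTEquiv F n).toEquiv.symm
  exact Finite.of_equiv _ (monicEquivDegreeLT (R := F) n).symm

/-- The monic polynomials of degree `n` over a finite field. -/
def monicsOfDegree (F : Type*) [Field F] [Finite F] (n : ℕ) : Finset F[X] :=
  (finite_monic_natDegree F n).toFinset

lemma mem_monicsOfDegree {n : ℕ} {g : F[X]} :
    g ∈ monicsOfDegree F n ↔ g.Monic ∧ g.natDegree = n := by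
  simp [monicsOfDegree]

/-- The monic irreducible polynomials of degree `n` over a finite field. -/
def irreduciblesOfDegree (F : Type*) [Field F] [Finite F] (n : ℕ) : Finset F[X] :=
  (monicsOfDegree F n).filter Irreducible

lemma mem_irreduciblesOfDegree {n : ℕ} {g : F[X]} :
    g ∈ irreduciblesOfDegree F n ↔ (g.Monic ∧ g.natDegree = n) ∧ Irreducible g := by
  simp [irreduciblesOfDegree, mem_monicsOfDegree]

lemma sum_natDegree_of_pow_dvd {n : ℕ} {g : F[X]} (hg : g ∈ monicsOfDegree F n) :
    ∑ d ∈ Finset.Icc 1 n, ∑ P ∈ irreduciblesOfDegree F d, ∑ j ∈ Finset.Icc 1 n,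
      (if P ^ j ∣ g then d else 0) = n := by
  rw [mem_monicsOfDegree] at hg
  obtain ⟨hm, hn⟩ := hg
  have hg0 : g ≠ 0 := hm.ne_zero
  set s := UniqueFactorizationMonoid.normalizedFactors g with hs
  have hmem : ∀ P ∈ s, P.Monic ∧ Irreducible P ∧ P ∣ g := fun P hP => by
    have h1 := UniqueFactorizationMonoid.irreducible_of_normalized_factor P hP
    refine ⟨?_, h1, UniqueFactorizationMonoid.dvd_of_mem_normalizedFactors hP⟩
    rw [← UniqueFactorizationMonoid.normalize_normalized_factor P hP]
    exact monic_normalize h1.ne_zero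
  have hcount : ∀ d ∈ Finset.Icc 1 n, ∀ P ∈ irreduciblesOfDegree F d,
      ∑ j ∈ Finset.Icc 1 n, (if P ^ j ∣ g then d else 0) = s.count P * P.natDegree := by
    intro d _ P hP
    rw [mem_irreduciblesOfDegree] at hP
    obtain ⟨⟨hPm, hPd⟩, hPi⟩ := hP
    have hem := UniqueFactorizationMonoid.emultiplicity_eq_count_normalizedFactors hPi hg0
    rw [hPm.normalize_eq_self] at hem
    have hle : s.count P ≤ n := by
      have h1 : P ^ s.count P ∣ g := pow_dvd_of_le_emultiplicity hem.ge
      have h2 := natDegree_le_of_dvd h1 hg0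
      rw [natDegree_pow, hn] at h2
      have := hPi.natDegree_pos
      nlinarith
    have : ∀ j, (P ^ j ∣ g) ↔ j ≤ s.count P := by
      intro j
      rw [pow_dvd_iff_le_emultiplicity, hem, Nat.cast_le]
    simp only [this]
    rw [← Finset.sum_filter, Finset.sum_const, smul_eq_mul, hPd]
    congr 1
    rw [show (Finset.Icc 1 n).filter (fun j => j ≤ s.count P) = Finset.Icc 1 (s.count P) by
      ext j; simp only [Finset.mem_filter, Finset.mem_Icc]; omega]
    simp
  rw [Finset.sum_congr rfl fun d hd => Finset.sum_congr rfl (hcount d hd)]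
  rw [Finset.sum_sigma']
  have hdeg : (s.map natDegree).sum = n := by
    rw [← hn, ← natDegree_multiset_prod_of_monic _ (fun P hP => (hmem P hP).1)]
    exact natDegree_eq_of_degree_eq (degree_eq_degree_of_associated
      (UniqueFactorizationMonoid.prod_normalizedFactors hg0))
  rw [← hdeg, Finset.sum_multiset_map_count]
  refine (Finset.sum_of_injOn (fun P => ⟨P.natDegree, P⟩) ?_ ?_ ?_ ?_).symm
  · intro P _ Q _ h
    simp only [Sigma.mk.injEq] at h
    exact eq_of_heq h.2
  · intro P hP
    have hP' := hmem P (by simpa using hP)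
    simp only [Finset.coe_sigma, Set.mem_sigma_iff, Finset.mem_coe, Finset.mem_Icc,
      mem_irreduciblesOfDegree]
    have hle := natDegree_le_of_dvd hP'.2.2 hg0
    rw [hn, ← hdeg, Finset.sum_multiset_map_count] at hle
    exact ⟨⟨hP'.2.1.natDegree_pos, hle⟩, ⟨hP'.1, trivial⟩, hP'.2.1⟩
  · rintro ⟨d, P⟩ hdP hnot
    simp only [Finset.mem_sigma, mem_irreduciblesOfDegree] at hdP
    have : P ∉ s := by
      intro h
      apply hnot
      simp only [Set.mem_image, Finset.mem_coe, Multiset.mem_toFinset]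
      exact ⟨P, h, by rw [hdP.2.1.2]⟩
    simp [Multiset.count_eq_zero_of_notMem this]
  · intro P _
    simp

variable (ψ : F[X] → ℂ)

/-- The `k`-th power sum attached to a completely multiplicative function of monic polynomials. -/
def irredPowerSum (k : ℕ) : ℂ :=
  ∑ x ∈ k.divisorsAntidiagonal, ∑ P ∈ irreduciblesOfDegree F x.1, (x.1 : ℂ) * ψ P ^ x.2

lemma newton_monic_sums (h1 : ψ 1 = 1)
    (hmul : ∀ g h : F[X], g.Monic → h.Monic → ψ (g * h) = ψ g * ψ h) (n : ℕ) :
    (n : ℂ) * ∑ g ∈ monicsOfDegree F n, ψ g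
      = ∑ k ∈ Finset.Icc 1 n, irredPowerSum ψ k * ∑ g ∈ monicsOfDegree F (n - k), ψ g := by
  have hpow : ∀ (P : F[X]) (j : ℕ), P.Monic → ψ (P ^ j) = ψ P ^ j := by
    intro P j hP
    induction j with
    | zero => simp [h1]
    | succ j ih => rw [pow_succ, hmul _ _ (hP.pow j) hP, ih, pow_succ]
  have hinner : ∀ (d j : ℕ) (P : F[X]), P ∈ irreduciblesOfDegree F d →
      ∑ g ∈ monicsOfDegree F n, (if P ^ j ∣ g then ψ g else 0)
        = if d * j ≤ n then ψ P ^ j * ∑ h ∈ monicsOfDegree F (n - d * j), ψ h else 0 := by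
    intro d j P hP
    rw [mem_irreduciblesOfDegree] at hP
    obtain ⟨⟨hPm, hPd⟩, hPi⟩ := hP
    have hPj : (P ^ j).Monic := hPm.pow j
    have hPjd : (P ^ j).natDegree = d * j := by rw [natDegree_pow, hPd, mul_comm]
    split_ifs with hle
    · rw [← Finset.sum_filter, Finset.mul_sum]
      symm
      refine Finset.sum_bij (fun h _ => P ^ j * h) ?_ ?_ ?_ ?_
      · intro h hh
        rw [mem_monicsOfDegree] at hh
        rw [Finset.mem_filter, mem_monicsOfDegree]
        refine ⟨⟨hPj.mul hh.1, ?_⟩, Dvd.intro _ rfl⟩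
        rw [hPj.natDegree_mul hh.1, hPjd, hh.2]
        omega
      · intro a _ b _ hab
        exact mul_left_cancel₀ hPj.ne_zero hab
      · intro g hg
        rw [Finset.mem_filter, mem_monicsOfDegree] at hg
        obtain ⟨⟨hgm, hgd⟩, h, rfl⟩ := hg
        have hhm : h.Monic := hPj.of_mul_monic_left hgm
        refine ⟨h, ?_, rfl⟩
        rw [mem_monicsOfDegree]
        refine ⟨hhm, ?_⟩
        rw [hPj.natDegree_mul hhm, hPjd] at hgd
        omega
      · intro h hh
        rw [hmul _ _ hPj (mem_monicsOfDegree.1 hh).1, hpow _ _ hPm]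
    · refine Finset.sum_eq_zero fun g hg => if_neg fun hd => hle ?_
      rw [mem_monicsOfDegree] at hg
      have := natDegree_le_of_dvd hd hg.1.ne_zero
      rwa [hPjd, hg.2] at this
  have hleft : (n : ℂ) * ∑ g ∈ monicsOfDegree F n, ψ g
      = ∑ d ∈ Finset.Icc 1 n, ∑ j ∈ Finset.Icc 1 n, if d * j ≤ n then
          (∑ P ∈ irreduciblesOfDegree F d, (d : ℂ) * ψ P ^ j) *
            ∑ h ∈ monicsOfDegree F (n - d * j), ψ h else 0 := by
    calc (n : ℂ) * ∑ g ∈ monicsOfDegree F n, ψ g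
        = ∑ g ∈ monicsOfDegree F n, ∑ d ∈ Finset.Icc 1 n, ∑ P ∈ irreduciblesOfDegree F d,
            ∑ j ∈ Finset.Icc 1 n, (d : ℂ) * (if P ^ j ∣ g then ψ g else 0) := by
          rw [Finset.mul_sum]
          refine Finset.sum_congr rfl fun g hg => ?_
          conv_lhs => rw [← sum_natDegree_of_pow_dvd hg]
          push_cast
          rw [Finset.sum_mul]
          refine Finset.sum_congr rfl fun d _ => ?_
          rw [Finset.sum_mul]
          refine Finset.sum_congr rfl fun P _ => ?_
          rw [Finset.sum_mul]
          refine Finset.sum_congr rfl fun j _ => ?_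
          split_ifs <;> simp
      _ = ∑ d ∈ Finset.Icc 1 n, ∑ P ∈ irreduciblesOfDegree F d, ∑ j ∈ Finset.Icc 1 n,
            (d : ℂ) * ∑ g ∈ monicsOfDegree F n, (if P ^ j ∣ g then ψ g else 0) := by
          rw [Finset.sum_comm]
          refine Finset.sum_congr rfl fun d _ => ?_
          rw [Finset.sum_comm]
          refine Finset.sum_congr rfl fun P _ => ?_
          rw [Finset.sum_comm]
          refine Finset.sum_congr rfl fun j _ => ?_
          rw [Finset.mul_sum]
      _ = _ := by
          refine Finset.sum_congr rfl fun d _ => ?_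
          rw [Finset.sum_comm]
          refine Finset.sum_congr rfl fun j _ => ?_
          rw [Finset.sum_congr rfl fun P hP => by rw [hinner d j P hP]]
          split_ifs
          · rw [Finset.sum_mul]
            refine Finset.sum_congr rfl fun P _ => by ring
          · simp
  rw [hleft, ← Finset.sum_product', ← Finset.sum_filter]
  symm
  simp only [irredPowerSum, Finset.sum_mul (Nat.divisorsAntidiagonal _)]
  rw [Finset.sum_sigma']
  refine Finset.sum_bij (fun x _ => x.2) ?_ ?_ ?_ ?_
  · rintro ⟨k, d, j⟩ h
    simp only [Finset.mem_sigma, Finset.mem_Icc, Nat.mem_divisorsAntidiagonal] at h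
    obtain ⟨⟨h1, h2⟩, rfl, h3⟩ := h
    simp only [Finset.mem_filter, Finset.mem_product, Finset.mem_Icc]
    have hd : 0 < d := Nat.pos_of_ne_zero fun h => h3 (by simp [h])
    have hj : 0 < j := Nat.pos_of_ne_zero fun h => h3 (by simp [h])
    refine ⟨⟨⟨hd, ?_⟩, hj, ?_⟩, h2⟩ <;> nlinarith
  · rintro ⟨k, d, j⟩ h ⟨k', d', j'⟩ h' he
    simp only [Finset.mem_sigma, Finset.mem_Icc, Nat.mem_divisorsAntidiagonal] at h h'
    simp only [Prod.mk.injEq] at he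
    obtain ⟨rfl, rfl⟩ := he
    obtain ⟨_, rfl, _⟩ := h
    obtain ⟨_, rfl, _⟩ := h'
    rfl
  · rintro ⟨d, j⟩ h
    simp only [Finset.mem_filter, Finset.mem_product, Finset.mem_Icc] at h
    refine ⟨⟨d * j, d, j⟩, ?_, rfl⟩
    simp only [Finset.mem_sigma, Finset.mem_Icc, Nat.mem_divisorsAntidiagonal]
    have : 1 ≤ d * j := Nat.mul_pos h.1.1.1 h.1.2.1
    exact ⟨⟨this, h.2⟩, trivial, by omega⟩
  · rintro ⟨k, d, j⟩ h
    simp only [Finset.mem_sigma, Finset.mem_Icc, Nat.mem_divisorsAntidiagonal] at h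
    obtain ⟨_, rfl, _⟩ := h
    rfl

end MonicSums

section NormResultant

variable {K L : Type*} [Field K] [Field L] [Algebra K L]

lemma prod_galois_orbit [FiniteDimensional K L] [IsGalois K L] (h : L → L) (α : L) {c : ℕ}
    (hc : (minpoly K α).natDegree * c = Module.finrank K L) :
    ∏ σ : Gal(L/K), h (σ α) = (((minpoly K α).aroots L).map h).prod ^ c := by
  have h_int : IsIntegral K α := Algebra.IsIntegral.isIntegral α
  set S := ((minpoly K α).aroots L).toFinset with hS
  have hnd : ((minpoly K α).aroots L).Nodup :=
    nodup_roots (Separable.map (Algebra.IsSeparable.isSeparable K α))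
  have hsplit : ((minpoly K α).map (algebraMap K L)).Splits := Normal.splits' α
  have hcard : S.card = (minpoly K α).natDegree := by
    rw [hS, Multiset.toFinset_card_of_nodup hnd, aroots_def, ← hsplit.natDegree_eq_card_roots,
      natDegree_map]
  have hmem : ∀ β, β ∈ S ↔ ∃ σ : Gal(L/K), σ α = β := by
    intro β
    rw [hS, Multiset.mem_toFinset, mem_aroots]
    constructor
    · rintro ⟨_, h⟩
      exact minpoly.exists_algEquiv_of_root' h_int.isAlgebraic h
    · rintro ⟨σ, rfl⟩
      refine ⟨minpoly.ne_zero h_int, ?_⟩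
      have : aeval (σ α) (minpoly K α) = σ (aeval α (minpoly K α)) :=
        aeval_algHom_apply σ.toAlgHom α (minpoly K α)
      rw [this, minpoly.aeval, map_zero]
  set s := (Finset.univ.filter fun σ : Gal(L/K) => σ α = α).card with hs
  have hfib : ∀ β ∈ S, (Finset.univ.filter fun σ : Gal(L/K) => σ α = β).card = s := by
    intro β hβ
    obtain ⟨τ, rfl⟩ := (hmem β).1 hβ
    refine Finset.card_bij' (fun σ _ => τ⁻¹ * σ) (fun σ _ => τ * σ) ?_ ?_ ?_ ?_
    · intro σ h
      simp only [Finset.mem_filter, Finset.mem_univ, true_and] at h ⊢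
      rw [AlgEquiv.mul_apply, h, ← AlgEquiv.mul_apply, inv_mul_cancel, AlgEquiv.one_apply]
    · intro σ h
      simp only [Finset.mem_filter, Finset.mem_univ, true_and] at h ⊢
      rw [AlgEquiv.mul_apply, h]
    · intro σ _; simp
    · intro σ _; simp
  have htot : S.card * s = Module.finrank K L := by
    rw [← IsGalois.card_aut_eq_finrank, Nat.card_eq_fintype_card, ← Finset.card_univ,
      Finset.card_eq_sum_card_fiberwise (t := S) (f := fun σ : Gal(L/K) => σ α)
        (fun σ _ => (hmem _).2 ⟨σ, rfl⟩), Finset.sum_congr rfl hfib]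
    simp
  have hsc : s = c := by
    rw [hcard, ← hc] at htot
    exact Nat.eq_of_mul_eq_mul_left (minpoly.natDegree_pos h_int) htot
  rw [← Finset.prod_fiberwise_of_maps_to (s := Finset.univ) (t := S)
    (g := fun σ : Gal(L/K) => σ α) (fun σ _ => (hmem _).2 ⟨σ, rfl⟩)]
  have : ∀ β ∈ S, ∏ σ with (σ : Gal(L/K)) α = β, h (σ α) = h β ^ c := by
    intro β hβ
    rw [Finset.prod_congr rfl fun σ hσ => by rw [(Finset.mem_filter.1 hσ).2], Finset.prod_const,
      hfib β hβ, hsc]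
  rw [Finset.prod_congr rfl this, Finset.prod_pow]
  congr 1
  rw [Finset.prod, hS, Multiset.toFinset_val, hnd.dedup]

lemma norm_aeval_eq_resultant_pow [FiniteDimensional K L] [IsGalois K L] (F : K[X]) (α : L) {c : ℕ}
    (hc : (minpoly K α).natDegree * c = Module.finrank K L) :
    Algebra.norm K (aeval α F) = resultant (minpoly K α) F ^ c := by
  apply (algebraMap K L).injective
  have h_int : IsIntegral K α := Algebra.IsIntegral.isIntegral α
  have hsplit : ((minpoly K α).map (algebraMap K L)).Splits := Normal.splits' α
  have h1 := resultant_eq_prod_eval ((minpoly K α).map (algebraMap K L))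
    (F.map (algebraMap K L)) F.natDegree (natDegree_map_le) hsplit
  rw [natDegree_map, resultant_map_map, ((minpoly.monic h_int).map _).leadingCoeff, one_pow,
    one_mul] at h1
  rw [Algebra.norm_eq_prod_automorphisms, map_pow, h1, ← aroots_def,
    ← prod_galois_orbit (fun x => eval x (F.map (algebraMap K L))) α hc]
  refine Finset.prod_congr rfl fun σ _ => ?_
  rw [eval_map_algebraMap]
  exact (aeval_algHom_apply σ.toAlgHom α F).symm

variable [Finite K] [Finite L]

lemma card_filter_minpoly_eq {P : K[X]} (hP : P.Monic) (hPi : Irreducible P)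
    [Fintype L] (hd : P.natDegree ∣ Module.finrank K L) :
    (Finset.univ.filter fun α : L => minpoly K α = P).card = P.natDegree := by
  have hsplitX : (P.map (algebraMap K L)).Splits ∧ (P.aroots L).Nodup := by
    have h1 := (hPi.natDegree_dvd_iff_dvd_X_pow_card_pow_sub_X).1 hd
    have hcard : Nat.card K ^ Module.finrank K L = Fintype.card L := by
      rw [← Nat.card_eq_fintype_card, ← Module.natCard_eq_pow_finrank]
    rw [hcard] at h1
    have h2 := Polynomial.map_dvd (algebraMap K L) h1
    simp only [Polynomial.map_sub, Polynomial.map_pow, map_X] at h2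
    have hne : (X ^ Fintype.card L - X : L[X]) ≠ 0 :=
      FiniteField.X_pow_card_sub_X_ne_zero L Fintype.one_lt_card
    constructor
    · refine Splits.of_dvd ?_ hne h2
      refine splits_iff_card_roots.2 ?_
      rw [FiniteField.roots_X_pow_card_sub_X,
        FiniteField.X_pow_card_sub_X_natDegree_eq L Fintype.one_lt_card]
      rfl
    · refine Multiset.nodup_of_le (roots.le_of_dvd hne h2) ?_
      rw [FiniteField.roots_X_pow_card_sub_X]
      exact Finset.univ.nodup
  rw [show (Finset.univ.filter fun α : L => minpoly K α = P) = (P.aroots L).toFinset by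
    ext α
    simp only [Finset.mem_filter, Finset.mem_univ, true_and, Multiset.mem_toFinset]
    rw [mem_aroots]
    constructor
    · rintro rfl
      exact ⟨hP.ne_zero, minpoly.aeval _ _⟩
    · rintro ⟨_, h⟩
      exact (minpoly.eq_of_irreducible_of_monic hPi h hP).symm,
    Multiset.toFinset_card_of_nodup hsplitX.2, aroots_def, ← hsplitX.1.natDegree_eq_card_roots,
      natDegree_map]

lemma irredPowerSum_resultant (η : MulChar K ℂ) (F : K[X]) [Fintype L] :
    irredPowerSum (fun g : K[X] => η (resultant g F)) (Module.finrank K L)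
      = ∑ α : L, η (Algebra.norm K (aeval α F)) := by
  have hfr : 0 < Module.finrank K L := Module.finrank_pos
  rw [irredPowerSum, Finset.sum_sigma']
  rw [← Finset.sum_fiberwise_of_maps_to (s := (Finset.univ : Finset L))
    (t := Finset.sigma (Module.finrank K L).divisorsAntidiagonal
      fun x => irreduciblesOfDegree K x.1)
    (g := fun α => ⟨((minpoly K α).natDegree,
      Module.finrank K L / (minpoly K α).natDegree), minpoly K α⟩)]
  · refine Finset.sum_congr rfl ?_
    rintro ⟨⟨d, j⟩, P⟩ h
    simp only [Finset.mem_sigma, Nat.mem_divisorsAntidiagonal, mem_irreduciblesOfDegree] at h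
    obtain ⟨⟨hdj, _⟩, ⟨hPm, hPd⟩, hPi⟩ := h
    have hset : (Finset.univ.filter fun α : L => (⟨((minpoly K α).natDegree,
        Module.finrank K L / (minpoly K α).natDegree), minpoly K α⟩ : (_ : ℕ × ℕ) × K[X])
          = ⟨(d, j), P⟩) = Finset.univ.filter fun α : L => minpoly K α = P := by
      ext α
      simp only [Finset.mem_filter, Finset.mem_univ, true_and, Sigma.mk.injEq, Prod.mk.injEq]
      constructor
      · rintro ⟨_, h⟩
        exact eq_of_heq h
      · rintro rfl
        refine ⟨⟨hPd, ?_⟩, HEq.rfl⟩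
        rw [hPd, ← hdj]
        exact Nat.mul_div_cancel_left _ (hPd ▸ hPi.natDegree_pos)
    rw [hset]
    rw [Finset.sum_congr rfl fun α hα => by
      have hα' := (Finset.mem_filter.1 hα).2
      rw [norm_aeval_eq_resultant_pow F α (c := j) (by rw [hα', hPd, hdj]), hα', map_pow]]
    rw [Finset.sum_const, card_filter_minpoly_eq hPm hPi (by rw [hPd]; exact Dvd.intro _ hdj), hPd,
      nsmul_eq_mul]
  · intro α _
    have h_int : IsIntegral K α := Algebra.IsIntegral.isIntegral α
    simp only [Finset.mem_sigma, Nat.mem_divisorsAntidiagonal, mem_irreduciblesOfDegree]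
    exact ⟨⟨Nat.mul_div_cancel' (minpoly.degree_dvd h_int), hfr.ne'⟩,
      ⟨minpoly.monic h_int, trivial⟩, minpoly.irreducible h_int⟩

end NormResultant

section NormCharSum

variable {K L : Type*} [Field K] [Fintype K] [Field L] [Fintype L] [Algebra K L]

lemma orderOf_mulChar_dvd (η : MulChar K ℂ) : orderOf η ∣ Fintype.card K - 1 := by
  rw [← Fintype.card_units]
  exact orderOf_dvd_of_pow_eq_one η.pow_card_eq_one

lemma mulChar_eq_one_of_pow_eq_one (η : MulChar K ℂ) {e : ℕ}
    (he : e * orderOf η = Fintype.card K - 1) {u : Kˣ} (hu : u ^ e = 1) : η u = 1 := by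
  have he' : e * orderOf η = Fintype.card Kˣ := by rw [he, Fintype.card_units]
  have hpos : 0 < orderOf η := η.orderOf_pos
  obtain ⟨g, hg⟩ := IsCyclic.exists_generator (α := Kˣ)
  obtain ⟨i, rfl⟩ := (Submonoid.mem_powers_iff _ _).1 (mem_powers_iff_mem_zpowers.2 (hg u))
  have hord : orderOf g = Fintype.card Kˣ := by
    rw [orderOf_eq_card_of_forall_mem_zpowers hg, Nat.card_eq_fintype_card]
  rw [← pow_mul] at hu
  have h1 := orderOf_dvd_of_pow_eq_one hu
  rw [hord, ← he', mul_comm i] at h1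
  have hepos : 0 < e := Nat.pos_of_ne_zero fun h => by
    rw [h, zero_mul] at he'
    exact Fintype.card_ne_zero he'.symm
  obtain ⟨s, rfl⟩ := Nat.dvd_of_mul_dvd_mul_left hepos h1
  rw [mul_comm, pow_mul, Units.val_pow_eq_pow_val, map_pow, ← MulChar.pow_apply_coe,
    pow_orderOf_eq_one]
  simp

lemma exists_primitiveRoot_of_dvd_card_sub_one {n : ℕ} (hn : n ∣ Fintype.card K - 1) :
    ∃ ζ : K, IsPrimitiveRoot ζ n := by
  have hcard : Fintype.card Kˣ = Fintype.card K - 1 := Fintype.card_units K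
  obtain ⟨g, hg⟩ := IsCyclic.exists_generator (α := Kˣ)
  have hord : orderOf g = Fintype.card Kˣ := by
    rw [orderOf_eq_card_of_forall_mem_zpowers hg, Nat.card_eq_fintype_card]
  obtain ⟨t, ht⟩ := hn
  refine ⟨((g ^ t : Kˣ) : K), ?_⟩
  rw [IsPrimitiveRoot.coe_units_iff]
  have h1 : IsPrimitiveRoot g (Fintype.card Kˣ) := hord ▸ IsPrimitiveRoot.orderOf g
  exact h1.pow (Fintype.card_pos) (by rw [hcard, ht, mul_comm])

lemma pow_card_pow_eq_expand (F : K[X]) (a : ℕ) :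
    F ^ (Fintype.card K ^ a) = expand K (Fintype.card K ^ a) F := by
  induction a with
  | zero => simp
  | succ a ih =>
    rw [pow_succ, pow_mul, ih, ← FiniteField.expand_card, expand_expand, mul_comm]

theorem norm_charSum_norm_le (η : MulChar K ℂ) (hη : 2 ≤ orderOf η) {ι : Type*} [Fintype ι]
    (G : ι → K[X]) (hsep : ∀ j, (G j).Separable)
    (hco : Pairwise fun i j => IsCoprime (G i) (G j)) (hdeg : ∀ j, 0 < (G j).natDegree)
    (e : ι → ℕ) (he : ∀ r, r.Prime → r ∣ orderOf η → ∃ j, ¬ r ∣ e j) {a b d : ℕ}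
    (hL : Fintype.card L = Fintype.card K ^ b * Fintype.card K ^ a)
    (hd : (∏ j, G j ^ e j).natDegree = d)
    (hB : 2 * orderOf η * (Fintype.card K ^ b * (d + 1)) < Fintype.card K ^ a) :
    ‖∑ α : L, η (Algebra.norm K (aeval α (∏ j, G j ^ e j)))‖
      ≤ orderOf η * (Fintype.card K ^ b + Fintype.card K ^ a) * (d + 1) + d := by
  set n := orderOf η with hn
  set F := ∏ j, G j ^ e j with hF
  set k := Fintype.card K with hk
  have hk1 : 1 < k := Fintype.one_lt_card
  obtain ⟨m, hm⟩ : n ∣ k - 1 := orderOf_mulChar_dvd η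
  have hmpos : 0 < m := Nat.pos_of_ne_zero fun h => by rw [h] at hm; omega
  have hsub : ∀ i, ∃ w, k ^ i = n * w + 1 := by
    intro i
    have h1 : k - 1 ∣ k ^ i - 1 := by simpa using Nat.sub_dvd_pow_sub_pow k 1 i
    obtain ⟨w, hw⟩ := (Dvd.intro _ hm.symm : n ∣ k - 1).trans h1
    exact ⟨w, by have := Nat.pow_pos (n := i) (by omega : 0 < k); omega⟩
  obtain ⟨w, hw⟩ := hsub b
  obtain ⟨t, ht⟩ := hsub a
  obtain ⟨ζ₀, hζ₀⟩ := exists_primitiveRoot_of_dvd_card_sub_one (K := K) (n := n) ⟨m, hm⟩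
  have hζ := hζ₀.map_of_injective (algebraMap K L).injective
  have hFm : F.map (algebraMap K L) = ∏ j, (G j).map (algebraMap K L) ^ e j := by
    rw [hF, Polynomial.map_prod]
    simp
  have hFL : (∏ j, (G j).map (algebraMap K L) ^ e j) ^ k ^ a
      = expand L (k ^ a) (∏ j, (G j).map (algebraMap K L) ^ e j) := by
    rw [← hFm, ← map_expand, ← pow_card_pow_eq_expand, Polynomial.map_pow]
  have hst := fun (c : L) (hc : c ≠ 0) => stepanov_bound (by omega) hζ
    (fun j => (G j).map (algebraMap K L)) (fun j => (Separable.map (hsep j)).squarefree)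
    (fun i j hij => (hco hij).map (mapRingHom (algebraMap K L))) (fun j => by
      rw [natDegree_map]; exact hdeg j) e he ht hw hL hFL
      (d := d) (by rw [← hFm, natDegree_map, hd]) hB hc
  have hF0 : F ≠ 0 := by
    rw [hF]
    refine Finset.prod_ne_zero_iff.2 fun j _ => pow_ne_zero _ fun h => ?_
    have := hdeg j
    simp [h] at this
  have hexp : ∀ x : L, (algebraMap K L (Algebra.norm K x)) ^ m = x ^ (w * k ^ a + t) := by
    intro x
    rw [FiniteField.algebraMap_norm_eq_pow, ← pow_mul, Nat.card_eq_fintype_card,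
      Nat.card_eq_fintype_card, ← hk]
    congr 1
    have h1 : Fintype.card L - 1 = n * (w * k ^ a + t) := by
      rw [hL, hw, add_mul, one_mul]
      have : k ^ a = n * t + 1 := ht
      rw [mul_add, mul_assoc]
      omega
    have h2 : k - 1 ∣ Fintype.card L - 1 := by
      rw [hL, ← pow_add]
      simpa using Nat.sub_dvd_pow_sub_pow k 1 (b + a)
    have h3 := Nat.div_mul_cancel h2
    rw [h1] at h3 ⊢
    rw [hm] at h3 ⊢
    have hnpos : 0 < n := by omega
    refine Nat.eq_of_mul_eq_mul_left hnpos ?_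
    linarith
  set T : Kˣ → ℕ := fun y => (Finset.univ.filter fun α : L =>
    Algebra.norm K (aeval α F) ^ m = (y : K) ^ m).card with hT
  have hTle : ∀ y, n * T y ≤ k ^ b * k ^ a + n * ((k ^ b + k ^ a) * (d + 1)) := by
    intro y
    refine le_trans (le_of_eq ?_) (hst ((algebraMap K L y) ^ m)
      (pow_ne_zero _ ((_root_.map_ne_zero _).2 y.ne_zero)))
    rw [hT]
    congr 1
    refine congrArg Finset.card (Finset.filter_congr fun α _ => ?_)
    rw [← hFm, eval_map_algebraMap, ← hexp, ← map_pow (algebraMap K L), ← map_pow (algebraMap K L)]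
    exact (algebraMap K L).injective.eq_iff.symm
  have hker : ∀ x : Kˣ, (Finset.univ.filter fun y : Kˣ => x ^ m = y ^ m).card = m := by
    intro x
    have h1 := IsCyclic.card_powMonoidHom_ker (G := Kˣ) m
    rw [Nat.card_eq_fintype_card (α := Kˣ), Fintype.card_units, ← hk, hm, Nat.gcd_mul_left_left] at h1
    conv_rhs => rw [← h1]
    rw [Nat.card_eq_fintype_card, Fintype.card_subtype]
    refine Finset.card_bij' (fun y _ => y * x⁻¹) (fun y _ => y * x) ?_ ?_ ?_ ?_
    · intro y h
      simp only [Finset.mem_filter, Finset.mem_univ, true_and, MonoidHom.mem_ker,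
        powMonoidHom_apply] at h ⊢
      rw [mul_pow, ← h, ← mul_pow, mul_inv_cancel, one_pow]
    · intro y h
      simp only [Finset.mem_filter, Finset.mem_univ, true_and, MonoidHom.mem_ker,
        powMonoidHom_apply] at h ⊢
      rw [mul_pow, h, one_mul]
    · intro y _; simp
    · intro y _; simp
  have hker' : ∀ x : Kˣ, (Finset.univ.filter fun y : Kˣ => (x : K) ^ m = (y : K) ^ m).card = m := by
    intro x
    rw [← hker x]
    refine congrArg Finset.card (Finset.filter_congr fun y _ => ?_)
    rw [← Units.val_pow_eq_pow_val, ← Units.val_pow_eq_pow_val, Units.val_inj, hker x]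
  have hclass : ∀ x : K, (m : ℂ) * η x
      = ∑ y : Kˣ, if x ^ m = (y : K) ^ m then η y else 0 := by
    intro x
    by_cases hx : x = 0
    · rw [hx, MulChar.map_zero, mul_zero]
      symm
      refine Finset.sum_eq_zero fun y _ => if_neg ?_
      rw [zero_pow hmpos.ne']
      exact (pow_ne_zero _ y.ne_zero).symm
    · lift x to Kˣ using IsUnit.mk0 x hx
      rw [← Finset.sum_filter]
      have h1 : ∀ y ∈ Finset.univ.filter fun y : Kˣ => (x : K) ^ m = (y : K) ^ m, η y = η x := by
        intro y hy
        have hy' := (Finset.mem_filter.1 hy).2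
        have hy2 : (y * x⁻¹) ^ m = 1 := by
          rw [mul_pow, inv_pow, mul_inv_eq_one]
          exact Units.ext (by simpa using hy'.symm)
        have := mulChar_eq_one_of_pow_eq_one η (by rw [mul_comm, ← hn, ← hm]) hy2
        rw [Units.val_mul, map_mul] at this
        calc η y = η y * η ((x⁻¹ : Kˣ) : K) * η x := by
              rw [mul_assoc, ← map_mul, ← Units.val_mul, inv_mul_cancel, Units.val_one, map_one,
                mul_one]
          _ = η x := by rw [this, one_mul]
      rw [Finset.sum_congr rfl h1, Finset.sum_const, nsmul_eq_mul]
      rw [hker' x]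
  have hsumη : ∑ y : Kˣ, η y = 0 := by
    have h1 : η ≠ 1 := by
      intro h
      rw [hn, h, orderOf_one] at hη
      omega
    have h2 := MulChar.sum_eq_zero_of_ne_one h1
    rw [← h2]
    refine Finset.sum_of_injOn (fun y : Kˣ => (y : K)) (fun x _ y _ h => Units.ext h) (by simp) ?_ ?_
    · intro x _ hx
      refine MulChar.map_nonunit _ fun hu => hx ?_
      obtain ⟨u, rfl⟩ := hu
      exact ⟨u, by simp, rfl⟩
    · intro y _; rfl
  have hS : (m : ℂ) * ∑ α : L, η (Algebra.norm K (aeval α F)) = ∑ y : Kˣ, η y * (T y : ℂ) := by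
    rw [Finset.mul_sum, Finset.sum_congr rfl fun α _ => hclass _, Finset.sum_comm]
    refine Finset.sum_congr rfl fun y _ => ?_
    rw [hT, ← Finset.sum_filter, Finset.sum_const, nsmul_eq_mul, mul_comm]
  have hTsum : (m : ℝ) * ((k : ℝ) ^ b * k ^ a - d) ≤ ∑ y : Kˣ, (T y : ℝ) := by
    have h1 : ∑ y : Kˣ, T y
        = ∑ α : L, if Algebra.norm K (aeval α F) = 0 then 0 else m := by
      simp only [hT, Finset.card_filter]
      rw [Finset.sum_comm]
      refine Finset.sum_congr rfl fun α _ => ?_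
      rw [← Finset.card_filter]
      split_ifs with h
      · rw [h, Finset.card_eq_zero, Finset.filter_eq_empty_iff]
        intro y _ hy
        rw [zero_pow hmpos.ne'] at hy
        exact pow_ne_zero _ y.ne_zero hy.symm
      · exact hker' (Units.mk0 _ h)
    have h2 : (Finset.univ.filter fun α : L => Algebra.norm K (aeval α F) = 0).card ≤ d := by
      have h3 : (Finset.univ.filter fun α : L => Algebra.norm K (aeval α F) = 0)
          ⊆ (F.aroots L).toFinset := by
        intro α hα
        simp only [Finset.mem_filter, Finset.mem_univ, true_and, Algebra.norm_eq_zero_iff] at hα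
        rw [Multiset.mem_toFinset, mem_aroots]
        exact ⟨hF0, hα⟩
      refine (Finset.card_le_card h3).trans ((Multiset.toFinset_card_le _).trans ?_)
      refine (card_roots' _).trans ?_
      rw [natDegree_map, hd]
    have h4 : (Finset.univ.filter fun α : L => Algebra.norm K (aeval α F) = 0).card
        + (Finset.univ.filter fun α : L => ¬ Algebra.norm K (aeval α F) = 0).card
        = k ^ b * k ^ a := by
      rw [Finset.card_filter_add_card_filter_not, Finset.card_univ, hL]
    rw [Finset.sum_ite, Finset.sum_const_zero, zero_add, Finset.sum_const, smul_eq_mul] at h1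
    have h5 : (∑ y : Kˣ, (T y : ℝ))
        = (Finset.univ.filter fun α : L => ¬ Algebra.norm K (aeval α F) = 0).card * m := by
      exact_mod_cast h1
    rw [h5, mul_comm]
    refine mul_le_mul_of_nonneg_right ?_ (by positivity)
    have h2' : ((Finset.univ.filter fun α : L => Algebra.norm K (aeval α F) = 0).card : ℝ) ≤ d := by
      exact_mod_cast h2
    have h4' : ((Finset.univ.filter fun α : L => Algebra.norm K (aeval α F) = 0).card : ℝ)
        + (Finset.univ.filter fun α : L => ¬ Algebra.norm K (aeval α F) = 0).card
        = k ^ b * k ^ a := by exact_mod_cast h4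
    linarith
  have hnpos : (0 : ℝ) < n := by exact_mod_cast (by omega : 0 < n)
  have hmpos' : (0 : ℝ) < m := by exact_mod_cast hmpos
  set M : ℝ := ((k : ℝ) ^ b * k ^ a + n * (((k : ℝ) ^ b + k ^ a) * (d + 1))) / n with hM
  have hTM : ∀ y, (T y : ℝ) ≤ M := by
    intro y
    rw [hM, le_div_iff₀ hnpos, mul_comm]
    exact_mod_cast hTle y
  have hfinal : ‖(m : ℂ) * ∑ α : L, η (Algebra.norm K (aeval α F))‖
      ≤ m * (n * ((k : ℝ) ^ b + k ^ a) * (d + 1) + d) := by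
    have h1 : (m : ℂ) * ∑ α : L, η (Algebra.norm K (aeval α F))
        = ∑ y : Kˣ, η y * ((T y : ℂ) - (M : ℂ)) := by
      rw [hS]
      simp only [mul_sub]
      rw [Finset.sum_sub_distrib, ← Finset.sum_mul, hsumη, zero_mul, sub_zero]
    rw [h1]
    refine (norm_sum_le _ _).trans ?_
    have h2 : ∀ y : Kˣ, ‖η y * ((T y : ℂ) - (M : ℂ))‖ ≤ M - T y := by
      intro y
      have h3 : ‖η (y : K)‖ = 1 := by
        have h4 : (η (y : K)) ^ (Fintype.card Kˣ) = 1 := by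
          rw [← map_pow, ← Units.val_pow_eq_pow_val, pow_card_eq_one]
          simp
        exact Complex.norm_eq_one_of_pow_eq_one h4 Fintype.card_ne_zero
      rw [norm_mul, h3, one_mul, ← Complex.ofReal_natCast, ← Complex.ofReal_sub,
        Complex.norm_real, Real.norm_eq_abs, abs_sub_comm, abs_of_nonneg (by linarith [hTM y])]
    refine (Finset.sum_le_sum fun y _ => h2 y).trans ?_
    rw [Finset.sum_sub_distrib, Finset.sum_const, Finset.card_univ, Fintype.card_units, ← hk, hm,
      nsmul_eq_mul]
    have h5 : ((n * m : ℕ) : ℝ) * M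
        = m * ((k : ℝ) ^ b * k ^ a + n * (((k : ℝ) ^ b + k ^ a) * (d + 1))) := by
      rw [hM]
      push_cast
      field_simp
    rw [h5]
    nlinarith [hTsum]
  rw [norm_mul, Complex.norm_natCast] at hfinal
  exact le_of_mul_le_mul_left hfinal hmpos'

end NormCharSum

section ResultantResidue

variable {K : Type*} [Field K]

lemma resultant_mul_of_ne_zero (F : K[X]) {g h : K[X]} (hg : g ≠ 0) (hh : h ≠ 0) :
    resultant F (g * h) = resultant F g * resultant F h := by
  rw [natDegree_mul hg hh, resultant_mul_right _ _ _ _ le_rfl]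

lemma resultant_natDegree_le {F g : K[X]} (hF : F.Monic) {N : ℕ} (hN : g.natDegree ≤ N) :
    resultant F g F.natDegree N = resultant F g := by
  obtain ⟨k, rfl⟩ := Nat.exists_eq_add_of_le hN
  rw [resultant_add_right_deg _ _ _ _ _ le_rfl, coeff_natDegree, hF.leadingCoeff, one_pow, one_mul]

lemma resultant_add_mul_of_monic {F : K[X]} (hF : F.Monic) (g h : K[X]) :
    resultant F (g + F * h) = resultant F g := by
  set N := max g.natDegree ((g + F * h).natDegree) + h.natDegree + F.natDegree with hN
  rw [← resultant_natDegree_le hF (N := N) (by omega), ← resultant_natDegree_le hF (g := g) (N := N)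
    (by omega)]
  exact resultant_add_mul_right _ _ _ _ _ (by omega) le_rfl

lemma resultant_congr_mod {ι : Type*} [Fintype ι] {G : ι → K[X]} (hG : ∀ j, (G j).Monic)
    (e : ι → ℕ) (g h : K[X]) :
    resultant (∏ j, G j ^ e j) (g + (∏ j, G j) * h) = resultant (∏ j, G j ^ e j) g := by
  have hF : (∏ j, G j ^ e j).Monic := monic_prod_of_monic _ _ fun j _ => (hG j).pow _
  have key : ∀ (N : ℕ) (f : K[X]), f.natDegree ≤ N →
      resultant (∏ j, G j ^ e j) f = ∏ j, resultant (G j) f ^ e j := by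
    intro N f hf
    rw [resultant_prod_left _ _ _ _ (by
      rw [Finset.prod_congr rfl fun j _ => ((hG j).pow (e j)).leadingCoeff]; simp) le_rfl]
    refine Finset.prod_congr rfl fun j _ => ?_
    rw [resultant_pow_left _ _ _ _ (by rw [(hG j).leadingCoeff]; simp) le_rfl]
  rw [key _ _ le_rfl, key _ _ le_rfl]
  refine Finset.prod_congr rfl fun j _ => ?_
  obtain ⟨r, hr⟩ := Finset.dvd_prod_of_mem G (Finset.mem_univ j)
  rw [hr, mul_assoc, resultant_add_mul_of_monic (hG j)]

variable [Finite K]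

/-- Sums over monic polynomials of large degree of a nontrivial residue symbol vanish. -/
lemma sum_monics_residue_eq_zero (Φ : K[X] → ℂ) {H : K[X]} (hH : H.Monic)
    (hmul : ∀ g h : K[X], g ≠ 0 → h ≠ 0 → Φ (g * h) = Φ g * Φ h)
    (hper : ∀ g h, Φ (g + H * h) = Φ g) {w : K[X]} (hw : IsCoprime w H) (hw0 : w ≠ 0)
    (hΦ : Φ w ≠ 1)
    {n : ℕ} (hn : H.natDegree ≤ n) : ∑ g ∈ monicsOfDegree K n, Φ g = 0 := by
  set T : K[X] → K[X] := fun g => H * (g /ₘ H) + (w * g) %ₘ H with hT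
  have hdivdeg : ∀ g : K[X], g.Monic → g.natDegree = n → (g /ₘ H).Monic := by
    intro g hg hgn
    rw [Monic, leadingCoeff_divByMonic_of_monic hH, hg.leadingCoeff]
    rw [degree_eq_natDegree hg.ne_zero, degree_eq_natDegree hH.ne_zero, hgn]
    exact_mod_cast hn
  have hTmem : ∀ g ∈ monicsOfDegree K n, T g ∈ monicsOfDegree K n := by
    intro g hg
    rw [mem_monicsOfDegree] at hg ⊢
    have h1 := hdivdeg g hg.1 hg.2
    have h2 : ((w * g) %ₘ H).degree < (H * (g /ₘ H)).degree := by
      refine (degree_modByMonic_lt _ hH).trans_le ?_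
      exact degree_le_mul_left _ h1.ne_zero
    have h3 : (H * (g /ₘ H)).natDegree = n := by
      rw [hH.natDegree_mul h1, natDegree_divByMonic _ hH, hg.2]
      omega
    refine ⟨(hH.mul h1).add_of_left h2, ?_⟩
    rw [hT, natDegree_add_eq_left_of_degree_lt h2, h3]
  have hTinj : Set.InjOn T (monicsOfDegree K n) := by
    intro g _ g' _ h
    have h1 : T g /ₘ H = g /ₘ H ∧ T g %ₘ H = (w * g) %ₘ H :=
      div_modByMonic_unique _ _ hH ⟨by rw [hT]; ring, degree_modByMonic_lt _ hH⟩
    have h2 : T g' /ₘ H = g' /ₘ H ∧ T g' %ₘ H = (w * g') %ₘ H :=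
      div_modByMonic_unique _ _ hH ⟨by rw [hT]; ring, degree_modByMonic_lt _ hH⟩
    rw [h] at h1
    have hq : g /ₘ H = g' /ₘ H := h1.1.symm.trans h2.1
    have hr : (w * g) %ₘ H = (w * g') %ₘ H := h1.2.symm.trans h2.2
    have h3 : H ∣ w * (g - g') := by
      rw [← modByMonic_eq_zero_iff_dvd hH, mul_sub, sub_modByMonic, hr, sub_self]
    have h4 : H ∣ g - g' := hw.symm.dvd_of_dvd_mul_left h3
    rw [← modByMonic_eq_zero_iff_dvd hH, sub_modByMonic, sub_eq_zero] at h4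
    rw [← modByMonic_add_div g H, ← modByMonic_add_div g' H, h4, hq]
  have himg : (monicsOfDegree K n).image T = monicsOfDegree K n := by
    refine Finset.eq_of_subset_of_card_le ?_ ?_
    · intro g hg
      obtain ⟨g', hg', rfl⟩ := Finset.mem_image.1 hg
      exact hTmem _ hg'
    · rw [Finset.card_image_of_injOn hTinj]
  have h1 : ∑ g ∈ monicsOfDegree K n, Φ g = Φ w * ∑ g ∈ monicsOfDegree K n, Φ g := by
    conv_lhs => rw [← himg]
    rw [Finset.sum_image hTinj, Finset.mul_sum]
    refine Finset.sum_congr rfl fun g hg => ?_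
    have hg0 := (mem_monicsOfDegree.1 hg).1.ne_zero
    rw [← hmul _ _ hw0 hg0]
    have : w * g = T g + H * ((w * g) /ₘ H - g /ₘ H) := by
      rw [hT]
      conv_lhs => rw [← modByMonic_add_div (w * g) H]
      ring
    rw [this, hper]
  have h2 : (Φ w - 1) * ∑ g ∈ monicsOfDegree K n, Φ g = 0 := by rw [sub_mul, ← h1]; ring
  exact (mul_eq_zero.1 h2).resolve_left (sub_ne_zero.2 hΦ)

end ResultantResidue

section PowerSums

lemma tsum_mul_eval_eq {P : ℂ[X]} {s : ℕ → ℂ}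
    (hN : ∀ n : ℕ, (n : ℂ) * P.coeff n = ∑ k ∈ Finset.Icc 1 n, s k * P.coeff (n - k))
    (hs0 : s 0 = 0) {t : ℂ} (hsumS : Summable fun n => ‖s n * t ^ n‖) :
    t * P.derivative.eval t = P.eval t * ∑' k, s k * t ^ k := by
  have hz : ∀ n ∉ Finset.range (P.natDegree + 1), P.coeff n = 0 := fun n hn =>
    coeff_eq_zero_of_natDegree_lt (by simpa using hn)
  have hsumP : Summable fun n => ‖P.coeff n * t ^ n‖ := by
    refine summable_of_ne_finset_zero (s := Finset.range (P.natDegree + 1)) fun n hn => ?_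
    rw [hz n hn]; simp
  have hPe : P.eval t = ∑' n, P.coeff n * t ^ n := by
    rw [tsum_eq_sum (s := Finset.range (P.natDegree + 1)) fun n hn => by rw [hz n hn]; simp,
      eval_eq_sum_range]
  have hPd : t * P.derivative.eval t = ∑' n : ℕ, (n : ℂ) * P.coeff n * t ^ n := by
    rw [tsum_eq_sum (s := Finset.range (P.natDegree + 1)) fun n hn => by rw [hz n hn]; simp]
    conv_lhs => rw [P.as_sum_range_C_mul_X_pow]
    simp only [derivative_sum, derivative_C_mul_X_pow, eval_finsetSum, eval_mul, eval_C,
      eval_pow, eval_X, Finset.mul_sum]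
    refine Finset.sum_congr rfl fun n _ => ?_
    rcases n with _ | n
    · simp
    · simp only [Nat.add_sub_cancel]; ring
  rw [hPd, hPe, mul_comm]
  rw [tsum_mul_tsum_eq_tsum_sum_antidiagonal_of_summable_norm hsumS hsumP]
  refine tsum_congr fun n => ?_
  rw [hN, Finset.Nat.sum_antidiagonal_eq_sum_range_succ_mk, Finset.sum_mul]
  rw [Finset.range_eq_Ico, Finset.sum_eq_sum_Ico_succ_bot (by omega), hs0]
  simp only [zero_mul, zero_add]
  refine Finset.sum_congr ?_ fun k hk => ?_
  · ext k; simp only [Finset.mem_Icc, Finset.mem_Ico]; omega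
  · rw [Finset.mem_Ico] at hk
    calc s k * P.coeff (n - k) * t ^ n = s k * P.coeff (n - k) * (t ^ k * t ^ (n - k)) := by
          rw [← pow_add]; congr 2; omega
      _ = _ := by ring

lemma eval_ne_zero_of_mul_derivative_eq {P : ℂ[X]} (hP0 : P ≠ 0) {f : ℂ → ℂ} {z : ℂ} (hz0 : z ≠ 0)
    {U : Set ℂ} (hU : U ∈ nhds z) (hfz : ContinuousAt f z)
    (hid : ∀ t ∈ U, t * P.derivative.eval t = P.eval t * f t) : ¬ P.IsRoot z := by
  intro hz
  set m := P.rootMultiplicity z with hm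
  have hmpos : 0 < m := (rootMultiplicity_pos hP0).2 hz
  obtain ⟨E, hE⟩ := pow_rootMultiplicity_dvd P z
  have hEz : E.eval z ≠ 0 := by
    intro h
    have h1 : (X - C z) ∣ E := dvd_iff_isRoot.2 h
    obtain ⟨E', rfl⟩ := h1
    have h2 : (X - C z) ^ (m + 1) ∣ P := ⟨E', by rw [hE, ← hm]; ring⟩
    exact absurd ((le_rootMultiplicity_iff hP0).2 h2) (by omega)
  rw [← hm] at hE
  obtain ⟨m', hm'⟩ : ∃ m', m = m' + 1 := ⟨m - 1, by omega⟩
  have hder : P.derivative = (X - C z) ^ m' * (C (m : ℂ) * E + (X - C z) * E.derivative) := by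
    rw [hE, hm']
    simp only [derivative_mul, derivative_X_sub_C_pow]
    simp only [Nat.add_sub_cancel, pow_succ]
    push_cast
    ring
  have hpunct : ∀ t ∈ U, t ≠ z →
      t * ((m : ℂ) * E.eval t + (t - z) * E.derivative.eval t)
        = (t - z) * E.eval t * f t := by
    intro t ht htz
    have h1 := hid t ht
    rw [hder, hE, hm'] at h1
    simp only [eval_mul, eval_pow, eval_sub, eval_X, eval_C, eval_add, pow_succ] at h1
    have h2 : (t - z) ^ m' ≠ 0 := pow_ne_zero _ (sub_ne_zero.2 htz)
    rw [← hm'] at h1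
    refine mul_left_cancel₀ h2 ?_
    linear_combination h1
  have hl : Filter.Tendsto (fun t : ℂ => t * ((m : ℂ) * E.eval t + (t - z) * E.derivative.eval t))
      (nhdsWithin z {z}ᶜ) (nhds (z * ((m : ℂ) * E.eval z + (z - z) * E.derivative.eval z))) := by
    refine Filter.Tendsto.mono_left (ContinuousAt.tendsto ?_) nhdsWithin_le_nhds
    fun_prop
  have hrr : Filter.Tendsto (fun t : ℂ => (t - z) * E.eval t * f t)
      (nhdsWithin z {z}ᶜ) (nhds ((z - z) * E.eval z * f z)) := by
    refine Filter.Tendsto.mono_left (ContinuousAt.tendsto ?_) nhdsWithin_le_nhds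
    fun_prop
  have hev : (fun t : ℂ => t * ((m : ℂ) * E.eval t + (t - z) * E.derivative.eval t))
      =ᶠ[nhdsWithin z {z}ᶜ] (fun t : ℂ => (t - z) * E.eval t * f t) := by
    filter_upwards [nhdsWithin_le_nhds hU, self_mem_nhdsWithin] with t ht htz
    exact hpunct t ht htz
  have := tendsto_nhds_unique (hl.congr' hev) hrr
  rw [sub_self, zero_mul, zero_mul, zero_mul, add_zero] at this
  have hm0 : (m : ℂ) ≠ 0 := by exact_mod_cast hmpos.ne'
  exact mul_ne_zero hz0 (mul_ne_zero hm0 hEz) this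

lemma inv_le_norm_of_isRoot {P : ℂ[X]} (hP0 : P ≠ 0) (hc0 : P.coeff 0 = 1) {S : ℕ → ℂ} {B r : ℝ}
    (hr : 0 < r)
    (hN : ∀ n : ℕ, (n : ℂ) * P.coeff n = ∑ k ∈ Finset.Icc 1 n, S k * P.coeff (n - k))
    (hS : ∀ k, 1 ≤ k → ‖S k‖ ≤ B * r ^ k) {z : ℂ} (hz : P.IsRoot z) : r⁻¹ ≤ ‖z‖ := by
  by_contra! hlt
  obtain ⟨ρ, hρ1, hρ2⟩ := exists_between hlt
  have hρ0 : 0 < ρ := (norm_nonneg z).trans_lt hρ1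
  have hrρ : r * ρ < 1 := by
    rw [lt_inv_comm₀ hρ0 hr] at hρ2
    calc r * ρ < ρ⁻¹ * ρ := mul_lt_mul_of_pos_right hρ2 hρ0
      _ = 1 := inv_mul_cancel₀ hρ0.ne'
  set s : ℕ → ℂ := fun k => if k = 0 then 0 else S k with hs
  have hsb : ∀ k (t : ℂ), ‖t‖ ≤ ρ → ‖s k * t ^ k‖ ≤ |B| * (r * ρ) ^ k := by
    intro k t ht
    by_cases hk : k = 0
    · simp [hs, hk]
    · rw [norm_mul, norm_pow, mul_pow, ← mul_assoc]
      have h1 : ‖s k‖ ≤ |B| * r ^ k := by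
        simp only [hs, if_neg hk]
        exact (hS k (by omega)).trans (mul_le_mul_of_nonneg_right (le_abs_self B) (by positivity))
      gcongr
  have hsum : Summable fun k => |B| * (r * ρ) ^ k :=
    (summable_geometric_of_lt_one (by positivity) hrρ).mul_left _
  set f : ℂ → ℂ := fun t => ∑' k, s k * t ^ k with hf
  have hcont : ContinuousOn f (Metric.closedBall 0 ρ) := by
    refine continuousOn_tsum (fun k => by fun_prop) hsum ?_
    intro k t ht
    exact hsb k t (by simpa using ht)
  have hzball : Metric.closedBall (0 : ℂ) ρ ∈ nhds z :=
    Filter.mem_of_superset (Metric.isOpen_ball.mem_nhds (by simpa using hρ1))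
      Metric.ball_subset_closedBall
  have hz0 : z ≠ 0 := by
    rintro rfl
    rw [coeff_zero_eq_eval_zero, hz.eq_zero] at hc0
    exact zero_ne_one hc0
  refine eval_ne_zero_of_mul_derivative_eq hP0 hz0 hzball (hcont.continuousAt hzball) ?_ hz
  intro t ht
  refine tsum_mul_eval_eq (fun n => ?_) (by simp [hs]) ?_
  · rw [hN]
    refine Finset.sum_congr rfl fun k hk => ?_
    rw [Finset.mem_Icc] at hk
    simp only [hs]
    rw [if_neg (by omega)]
  · exact Summable.of_nonneg_of_le (fun _ => norm_nonneg _)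
      (fun k => hsb k t (by simpa using ht)) hsum

lemma norm_coeff_one_prod_le {r : ℝ} (hr : 0 < r) (Q : Multiset ℂ) (h : ∀ z ∈ Q, r⁻¹ ≤ ‖z‖) :
    ‖((Q.map fun z => X - C z).prod).coeff 1‖
      ≤ Q.card * r * ‖((Q.map fun z => X - C z).prod).coeff 0‖ := by
  induction Q using Multiset.induction_on with
  | empty => simp [coeff_one]
  | cons a Q ih =>
    have h1 := ih fun z hz => h z (Multiset.mem_cons_of_mem hz)
    have h2 := h a (Multiset.mem_cons_self a Q)
    have h3 : 1 ≤ r * ‖a‖ := by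
      rw [inv_le_iff_one_le_mul₀ hr] at h2
      rwa [mul_comm]
    rw [Multiset.map_cons, Multiset.prod_cons, Multiset.card_cons]
    generalize (Q.map fun z => X - C z).prod = T at h1 ⊢
    have e1 : ((X - C a) * T).coeff 1 = T.coeff 0 - a * T.coeff 1 := by
      rw [sub_mul, coeff_sub, coeff_C_mul, coeff_X_mul]
    have e0 : ((X - C a) * T).coeff 0 = - (a * T.coeff 0) := by
      rw [mul_coeff_zero]; simp
    rw [e1, e0, norm_neg, norm_mul]
    have h4 : 1 * ‖T.coeff 0‖ ≤ (r * ‖a‖) * ‖T.coeff 0‖ :=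
      mul_le_mul_of_nonneg_right h3 (norm_nonneg _)
    have h5 := mul_le_mul_of_nonneg_left h1 (norm_nonneg a)
    have h6 := norm_sub_le (T.coeff 0) (a * T.coeff 1)
    rw [norm_mul] at h6
    push_cast
    nlinarith

lemma norm_first_coeff_le_of_powerSum_le {c S : ℕ → ℂ} {D : ℕ} {B r : ℝ} (hr : 0 < r)
    (hc0 : c 0 = 1) (hN : ∀ n : ℕ, (n : ℂ) * c n = ∑ k ∈ Finset.Icc 1 n, S k * c (n - k))
    (hcD : ∀ n, D ≤ n → c n = 0) (hS : ∀ k, 1 ≤ k → ‖S k‖ ≤ B * r ^ k) :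
    ‖c 1‖ ≤ (D - 1 : ℕ) * r := by
  set P : ℂ[X] := ∑ n ∈ Finset.range D, C (c n) * X ^ n with hP
  have hcoeff : ∀ n, P.coeff n = c n := by
    intro n
    rw [hP]
    simp only [finsetSum_coeff, coeff_C_mul_X_pow]
    rw [Finset.sum_ite_eq]
    split_ifs with h
    · rfl
    · exact (hcD n (by simpa using h)).symm
  have hDpos : 0 < D := Nat.pos_of_ne_zero fun h => by
    have := hcD 0 (by omega)
    rw [hc0] at this
    exact one_ne_zero this
  have hP0 : P ≠ 0 := fun h => by
    have := hcoeff 0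
    rw [h, hc0] at this
    simp at this
  have hdegP : P.natDegree ≤ D - 1 := by
    rw [natDegree_le_iff_coeff_eq_zero]
    intro n hn
    rw [hcoeff, hcD n (by omega)]
  have hsplit : P.Splits := IsAlgClosed.splits P
  have hfac := hsplit.eq_prod_roots
  have h1 := norm_coeff_one_prod_le hr P.roots fun z hz => inv_le_norm_of_isRoot hP0
    ((hcoeff 0).trans hc0) hr (fun n => by simpa only [hcoeff] using hN n) hS (isRoot_of_mem_roots hz)
  have hlc : P.leadingCoeff ≠ 0 := leadingCoeff_ne_zero.2 hP0
  have e0 : P.coeff 0 = P.leadingCoeff * ((P.roots.map fun z => X - C z).prod).coeff 0 := by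
    conv_lhs => rw [hfac]
    rw [coeff_C_mul]
  have e1 : P.coeff 1 = P.leadingCoeff * ((P.roots.map fun z => X - C z).prod).coeff 1 := by
    conv_lhs => rw [hfac]
    rw [coeff_C_mul]
  rw [← hcoeff 1, e1, norm_mul]
  have h2 : ‖P.leadingCoeff‖ * ‖((P.roots.map fun z => X - C z).prod).coeff 0‖ = 1 := by
    rw [← norm_mul, ← e0, hcoeff, hc0, norm_one]
  calc _ ≤ ‖P.leadingCoeff‖ * (P.roots.card * r *
        ‖((P.roots.map fun z => X - C z).prod).coeff 0‖) := by gcongr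
    _ = P.roots.card * r := by rw [mul_left_comm, h2, mul_one]
    _ ≤ _ := by
      gcongr
      exact (card_roots' P).trans hdegP

end PowerSums

section WeilBound

variable {p : ℕ} [Fact p.Prime]

lemma exists_irredPowerSum_resultant_le (η : MulChar (ZMod p) ℂ) (hη : 2 ≤ orderOf η)
    {ι : Type*} [Fintype ι] (G : ι → (ZMod p)[X]) (hsep : ∀ j, (G j).Separable)
    (hco : Pairwise fun i j => IsCoprime (G i) (G j)) (hdeg : ∀ j, 0 < (G j).natDegree)
    (e : ι → ℕ) (he : ∀ r : ℕ, r.Prime → r ∣ orderOf η → ∃ j, ¬ r ∣ e j) :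
    ∃ B : ℝ, ∀ k, 1 ≤ k →
      ‖irredPowerSum (fun g => η (resultant g (∏ j, G j ^ e j))) k‖ ≤ B * (√p) ^ k := by
  set F := ∏ j, G j ^ e j with hF
  set d := F.natDegree with hd
  set n := orderOf η with hn
  set S : ℕ → ℂ := fun k => irredPowerSum (fun g => η (resultant g F)) k with hS
  have hp1 : 1 < p := (Fact.out : p.Prime).one_lt
  have hp1' : (1 : ℝ) ≤ √p := by rw [Real.one_le_sqrt]; exact_mod_cast hp1.le
  obtain ⟨s, hs⟩ : ∃ s, 2 * n * (d + 1) < p ^ s := pow_unbounded_of_one_lt _ hp1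
  have hlarge : ∀ k, s ≤ k → 1 ≤ k →
      ‖S k‖ ≤ ((2 * n * (d + 1) + d : ℕ) * (√p) ^ (s + 1)) * (√p) ^ k := by
    intro k hk hk1
    set b := (k - s) / 2 with hb
    set a := k - b with ha
    let _ : Fintype (GaloisField p k) := Fintype.ofFinite _
    have hfr : Module.finrank (ZMod p) (GaloisField p k) = k := GaloisField.finrank p (by omega)
    have h1 := irredPowerSum_resultant (L := GaloisField p k) η F
    rw [hfr] at h1
    have hcK : Fintype.card (ZMod p) = p := ZMod.card p
    have hcL : Fintype.card (GaloisField p k)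
        = Fintype.card (ZMod p) ^ b * Fintype.card (ZMod p) ^ a := by
      rw [← Nat.card_eq_fintype_card, GaloisField.card p k (by omega), hcK, ← pow_add]
      congr 1; omega
    have hB : 2 * n * (Fintype.card (ZMod p) ^ b * (d + 1)) < Fintype.card (ZMod p) ^ a := by
      rw [hcK]
      calc 2 * n * (p ^ b * (d + 1)) = p ^ b * (2 * n * (d + 1)) := by ring
        _ < p ^ b * p ^ s := by
          have : 0 < p ^ b := by positivity
          exact mul_lt_mul_of_pos_left hs this
        _ = p ^ (b + s) := by rw [pow_add]
        _ ≤ p ^ a := Nat.pow_le_pow_right (by omega) (by omega)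
    have h2 := norm_charSum_norm_le η hη G hsep hco hdeg e he hcL rfl hB
    rw [hS]
    simp only
    rw [h1]
    refine h2.trans ?_
    rw [hcK]
    have hba : ((p ^ b : ℕ) : ℝ) ≤ (p ^ a : ℕ) := by
      exact_mod_cast Nat.pow_le_pow_right (by omega) (by omega)
    have hone : (1 : ℝ) ≤ (p ^ a : ℕ) := by exact_mod_cast Nat.one_le_pow _ _ (by omega)
    have hpa : ((p ^ a : ℕ) : ℝ) ≤ (√p) ^ (s + 1) * (√p) ^ k := by
      rw [← pow_add]
      have : (p : ℝ) = (√p) ^ 2 := (Real.sq_sqrt (by positivity)).symm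
      push_cast
      conv_lhs => rw [this]
      rw [← pow_mul]
      exact pow_le_pow_right₀ hp1' (by omega)
    push_cast at hba hone hpa ⊢
    calc _ ≤ (n : ℝ) * ((p : ℝ) ^ a + p ^ a) * (d + 1) + d * p ^ a := by
          gcongr
          exact le_mul_of_one_le_right (by positivity) hone
      _ = (2 * n * (d + 1) + d) * (p : ℝ) ^ a := by ring
      _ ≤ (2 * n * (d + 1) + d) * ((√p) ^ (s + 1) * (√p) ^ k) := by gcongr
      _ = _ := by ring
  refine ⟨(2 * n * (d + 1) + d : ℕ) * (√p) ^ (s + 1) + ∑ k ∈ Finset.range s, ‖S k‖, ?_⟩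
  intro k hk
  have hnn : 0 ≤ ∑ k ∈ Finset.range s, ‖S k‖ := Finset.sum_nonneg fun _ _ => norm_nonneg _
  rcases le_or_gt s k with h | h
  · refine (hlarge k h hk).trans ?_
    gcongr
    linarith
  · have h1 : ‖S k‖ ≤ ∑ k ∈ Finset.range s, ‖S k‖ :=
      Finset.single_le_sum (f := fun k => ‖S k‖) (fun _ _ => norm_nonneg _) (Finset.mem_range.2 h)
    have h2 : (1 : ℝ) ≤ (√p) ^ k := one_le_pow₀ hp1'
    have h3 : 0 ≤ ((2 * n * (d + 1) + d : ℕ) : ℝ) * (√p) ^ (s + 1) := by positivity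
    refine h1.trans ?_
    calc _ ≤ (∑ k ∈ Finset.range s, ‖S k‖) * (√p) ^ k := le_mul_of_one_le_right hnn h2
      _ ≤ _ := by gcongr; linarith

end WeilBound

section WeilMonic

variable {p : ℕ} [Fact p.Prime]

lemma exists_residue_symbol_ne_one (η : MulChar (ZMod p) ℂ) (hη : 2 ≤ orderOf η)
    {ι : Type*} [Fintype ι] (G : ι → (ZMod p)[X]) (hsep : ∀ j, (G j).Separable)
    (hco : Pairwise fun i j => IsCoprime (G i) (G j)) (hdeg : ∀ j, 0 < (G j).natDegree)
    (e : ι → ℕ) (he : ∀ r : ℕ, r.Prime → r ∣ orderOf η → ∃ j, ¬ r ∣ e j) :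
    ∃ w : (ZMod p)[X], w ≠ 0 ∧ IsCoprime w (∏ j, G j) ∧
      η (resultant (∏ j, G j ^ e j) w) ≠ 1 := by
  by_contra! hcon
  obtain ⟨B, hB⟩ := exists_irredPowerSum_resultant_le η hη G hsep hco hdeg e he
  set F := ∏ j, G j ^ e j with hF
  set H := ∏ j, G j with hH
  have hH0 : H ≠ 0 := Finset.prod_ne_zero_iff.2 fun j _ => (hsep j).ne_zero
  have hp1 : 1 < p := (Fact.out : p.Prime).one_lt
  have hp1' : (1 : ℝ) < √p := by rw [Real.lt_sqrt (by norm_num)]; simp; exact_mod_cast hp1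
  obtain ⟨k0, hk0⟩ : ∃ k0 : ℕ, B + 2 * H.natDegree < √p ^ k0 := pow_unbounded_of_one_lt _ hp1'
  set k := k0 + 1 with hk
  let _ : Fintype (GaloisField p k) := Fintype.ofFinite _
  have hfr : Module.finrank (ZMod p) (GaloisField p k) = k := GaloisField.finrank p (by omega)
  have h1 := irredPowerSum_resultant (L := GaloisField p k) η F
  rw [hfr] at h1
  have h2 := hB k (by omega)
  rw [h1] at h2
  set ε : ℂ := η (-1) ^ (F.natDegree * k) with hε
  have hnorm1 : ∀ z : ZMod p, ‖η z‖ ≤ 1 := fun z => by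
    by_cases hz : IsUnit z
    · obtain ⟨u, rfl⟩ := hz
      exact (Complex.norm_eq_one_of_pow_eq_one (n := orderOf η) (by
        rw [← MulChar.pow_apply_coe, pow_orderOf_eq_one, MulChar.one_apply_coe])
        (by omega)).le
    · rw [η.map_nonunit hz]; simp
  have hε1 : ‖ε‖ ≤ 1 := by
    rw [hε, norm_pow]
    exact pow_le_one₀ (norm_nonneg _) (hnorm1 _)
  have hval : ∀ α : GaloisField p k, aeval α H ≠ 0 →
      η (Algebra.norm (ZMod p) (aeval α F)) = ε := by
    intro α hα
    have h_int : IsIntegral (ZMod p) α := Algebra.IsIntegral.isIntegral α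
    have hdvd : (minpoly (ZMod p) α).natDegree ∣ k := by
      have := minpoly.degree_dvd h_int
      rwa [hfr] at this
    obtain ⟨c, hc⟩ := hdvd
    rw [norm_aeval_eq_resultant_pow F α (c := c) (hc.symm.trans hfr.symm)]
    have hirr := minpoly.irreducible h_int
    have hcop : IsCoprime (minpoly (ZMod p) α) H := by
      rw [hirr.coprime_iff_not_dvd]
      rw [minpoly.dvd_iff]
      exact hα
    have h3 := hcon _ hirr.ne_zero hcop
    rw [resultant_comm, map_pow η, map_mul η, h3, mul_one, map_pow η, ← pow_mul, hε]
    congr 1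
    calc _ = F.natDegree * ((minpoly (ZMod p) α).natDegree * c) := by ring
      _ = _ := by rw [← hc]
  have hcard : Fintype.card (GaloisField p k) = p ^ k := by
    rw [← Nat.card_eq_fintype_card, GaloisField.card p k (by omega)]
  have hdiff : ‖∑ α : GaloisField p k, η (Algebra.norm (ZMod p) (aeval α F)) - (p : ℂ) ^ k * ε‖
      ≤ 2 * H.natDegree := by
    have e1 : (p : ℂ) ^ k * ε = ∑ α : GaloisField p k, ε := by
      rw [Finset.sum_const, Finset.card_univ, hcard, nsmul_eq_mul]; push_cast; rfl
    rw [e1, ← Finset.sum_sub_distrib]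
    set Z : Finset (GaloisField p k) := (H.aroots (GaloisField p k)).toFinset with hZ
    rw [← Finset.sum_subset (Finset.subset_univ Z)]
    · refine (norm_sum_le _ _).trans ?_
      have h4 : (Z.card : ℝ) ≤ H.natDegree := by
        refine Nat.cast_le.2 ((Multiset.toFinset_card_le _).trans ?_)
        exact (card_roots' _).trans natDegree_map_le
      calc _ ≤ ∑ α ∈ Z, (2 : ℝ) := Finset.sum_le_sum fun α _ =>
            (norm_sub_le _ _).trans (by linarith [hnorm1 (Algebra.norm (ZMod p) (aeval α F))])
        _ = Z.card * 2 := by simp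
        _ ≤ _ := by linarith
    · intro α _ hα
      rw [hZ, Multiset.mem_toFinset, mem_aroots] at hα
      rw [hval α fun h => hα ⟨hH0, h⟩, sub_self]
  have hεn : ‖ε‖ = 1 := by
    rw [hε, norm_pow]
    have : ‖η (-1)‖ = 1 := by
      refine Complex.norm_eq_one_of_pow_eq_one (n := 2) ?_ (by norm_num)
      rw [← map_pow, neg_one_sq, map_one]
    rw [this, one_pow]
  have h5 : (p : ℝ) ^ k ≤ B * √p ^ k + 2 * H.natDegree := by
    have e2 : ‖(p : ℂ) ^ k * ε‖ = (p : ℝ) ^ k := by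
      rw [norm_mul, hεn, mul_one, norm_pow]; simp
    rw [← e2]
    calc _ = ‖∑ α : GaloisField p k, η (Algebra.norm (ZMod p) (aeval α F)) -
          (∑ α : GaloisField p k, η (Algebra.norm (ZMod p) (aeval α F)) - (p : ℂ) ^ k * ε)‖ := by
            congr 1; ring
      _ ≤ _ := (norm_sub_le _ _).trans (add_le_add h2 hdiff)
  have h6 : (p : ℝ) ^ k = √p ^ k * √p ^ k := by
    rw [← mul_pow, Real.mul_self_sqrt (by positivity)]
  have h7 : √p ^ k0 ≤ √p ^ k := pow_le_pow_right₀ hp1'.le (by omega)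
  have h8 : (1 : ℝ) ≤ √p ^ k := one_le_pow₀ hp1'.le
  have h9 : (0 : ℝ) ≤ H.natDegree := by positivity
  nlinarith

theorem weil_bound_monic (η : MulChar (ZMod p) ℂ) (hη : 2 ≤ orderOf η)
    {ι : Type*} [Fintype ι] (G : ι → (ZMod p)[X]) (hmon : ∀ j, (G j).Monic)
    (hsep : ∀ j, (G j).Separable)
    (hco : Pairwise fun i j => IsCoprime (G i) (G j)) (hdeg : ∀ j, 0 < (G j).natDegree)
    (e : ι → ℕ) (he : ∀ r : ℕ, r.Prime → r ∣ orderOf η → ∃ j, ¬ r ∣ e j) :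
    ‖∑ v : ZMod p, η ((∏ j, G j ^ e j).eval v)‖ ≤ ((∏ j, G j).natDegree : ℕ) * √p := by
  obtain ⟨w, hw0, hw, hw1⟩ := exists_residue_symbol_ne_one η hη G hsep hco hdeg e he
  obtain ⟨B, hB⟩ := exists_irredPowerSum_resultant_le η hη G hsep hco hdeg e he
  set F := ∏ j, G j ^ e j with hF
  set H := ∏ j, G j with hH
  have hHm : H.Monic := monic_prod_of_monic _ _ fun j _ => hmon j
  have hp1 : 1 < p := (Fact.out : p.Prime).one_lt
  set c : ℕ → ℂ := fun n => ∑ g ∈ monicsOfDegree (ZMod p) n, η (resultant g F) with hc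
  have hm0 : monicsOfDegree (ZMod p) 0 = {1} := by
    ext g
    rw [mem_monicsOfDegree, Finset.mem_singleton]
    constructor
    · rintro ⟨h1, h2⟩; exact h1.natDegree_eq_zero.1 h2
    · rintro rfl; exact ⟨monic_one, natDegree_one⟩
  have hc0 : c 0 = 1 := by
    rw [hc]; simp only
    rw [hm0, Finset.sum_singleton]
    simp
  have hc1 : c 1 = ∑ v : ZMod p, η (F.eval v) := by
    rw [hc]; simp only
    symm
    refine Finset.sum_bij (fun v _ => X - C v) ?_ ?_ ?_ ?_
    · intro v _; rw [mem_monicsOfDegree]; exact ⟨monic_X_sub_C v, natDegree_X_sub_C v⟩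
    · intro v _ v' _ h
      simpa using h
    · intro g hg
      rw [mem_monicsOfDegree] at hg
      refine ⟨- g.coeff 0, Finset.mem_univ _, ?_⟩
      conv_rhs => rw [hg.1.eq_X_add_C hg.2]
      simp
    · intro v _
      rw [natDegree_X_sub_C, resultant_X_sub_C_left _ _ _ le_rfl]
  have hcD : ∀ n, H.natDegree ≤ n → c n = 0 := by
    intro n hn
    have h1 := sum_monics_residue_eq_zero (fun g => η (resultant F g)) hHm
      (fun g h hg hh => by rw [resultant_mul_of_ne_zero F hg hh, map_mul])
      (fun g h => by rw [hF, hH, resultant_congr_mod hmon]) hw hw0 hw1 hn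
    rw [hc]; simp only
    have h2 : ∀ g ∈ monicsOfDegree (ZMod p) n, η (resultant g F)
        = η (-1) ^ (n * F.natDegree) * η (resultant F g) := by
      intro g hg
      rw [mem_monicsOfDegree] at hg
      rw [resultant_comm, hg.2, map_mul, map_pow]
    rw [Finset.sum_congr rfl h2, ← Finset.mul_sum, h1, mul_zero]
  have hN := newton_monic_sums (F := ZMod p) (fun g => η (resultant g F))
    (by simp)
    (fun g h hg hh => by
      rw [natDegree_mul hg.ne_zero hh.ne_zero, resultant_mul_left _ _ _ _ le_rfl, map_mul])
  have hsq : 0 < √(p : ℝ) := by rw [Real.sqrt_pos]; exact_mod_cast (by omega : 0 < p)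
  have key := norm_first_coeff_le_of_powerSum_le (D := H.natDegree) hsq hc0 hN hcD hB
  rw [hc1] at key
  refine key.trans ?_
  gcongr
  omega

end WeilMonic

section WeilGeneral

lemma exists_common_root_of_isCyclic {Γ : Type*} [CommGroup Γ] [Finite Γ] [IsCyclic Γ]
    {ι : Type*} (θ : ι → Γ) (hθ : ∃ j, θ j ≠ 1) :
    ∃ (η : Γ) (e : ι → ℕ), 2 ≤ orderOf η ∧ (∀ j, θ j = η ^ e j) ∧ (∀ j, 0 < e j) ∧
      ∀ r : ℕ, r.Prime → r ∣ orderOf η → ∃ j, ¬ r ∣ e j := by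
  set H := Subgroup.closure (Set.range θ) with hH
  obtain ⟨η, hη⟩ := (Subgroup.isCyclic_iff_exists_zpowers_eq_top H).1 inferInstance
  have hmem : ∀ j, θ j ∈ Subgroup.zpowers η := fun j => by
    rw [hη]; exact Subgroup.subset_closure (Set.mem_range_self j)
  have hpos : 0 < orderOf η := orderOf_pos η
  have hex : ∀ j, ∃ e : ℕ, θ j = η ^ e ∧ 0 < e := fun j => by
    obtain ⟨e, he⟩ := Submonoid.mem_powers_iff _ _ |>.1 (mem_powers_iff_mem_zpowers.2 (hmem j))
    exact ⟨e + orderOf η, by rw [pow_add, pow_orderOf_eq_one, mul_one, he], by omega⟩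
  choose e he using hex
  refine ⟨η, e, ?_, fun j => (he j).1, fun j => (he j).2, ?_⟩
  · by_contra! hlt
    have h1 : η = 1 := orderOf_eq_one_iff.1 (by omega)
    obtain ⟨j, hj⟩ := hθ
    exact hj (by rw [(he j).1, h1, one_pow])
  · intro r hr hrd
    by_contra! hall
    have h1 : H ≤ Subgroup.zpowers (η ^ r) := by
      rw [hH, Subgroup.closure_le]
      rintro _ ⟨j, rfl⟩
      obtain ⟨c, hc⟩ := hall j
      rw [(he j).1, hc, pow_mul]
      exact Subgroup.npow_mem_zpowers _ _
    have h2 : η ∈ Subgroup.zpowers (η ^ r) := h1 (by rw [← hη]; exact Subgroup.mem_zpowers η)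
    have h3 : orderOf η ∣ orderOf (η ^ r) := orderOf_dvd_of_mem_zpowers h2
    rw [orderOf_pow_of_dvd hr.ne_zero hrd] at h3
    have h4 := Nat.le_of_dvd (Nat.div_pos (Nat.le_of_dvd hpos hrd) hr.pos) h3
    exact absurd (Nat.div_lt_self hpos hr.one_lt) (by omega)

variable {p : ℕ} [Fact p.Prime]

instance : IsCyclic (MulChar (ZMod p) ℂ) := by
  obtain ⟨f⟩ := MulChar.mulEquiv_units (ZMod p) ℂ
  exact isCyclic_of_surjective f.symm f.symm.surjective

lemma mulChar_norm_le_one (θ : MulChar (ZMod p) ℂ) (z : ZMod p) : ‖θ z‖ ≤ 1 := by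
  by_cases hz : IsUnit z
  · obtain ⟨u, rfl⟩ := hz
    exact (Complex.norm_eq_one_of_pow_eq_one (n := orderOf θ) (by
      rw [← MulChar.pow_apply_coe, pow_orderOf_eq_one, MulChar.one_apply_coe])
      (orderOf_pos θ).ne').le
  · rw [θ.map_nonunit hz]; simp

/-- Weil's bound for complete multiplicative character sums over a prime field. -/
theorem weil_bound {ι : Type*} [Fintype ι] (θ : ι → MulChar (ZMod p) ℂ) (hθ : ∃ j, θ j ≠ 1)
    (G : ι → (ZMod p)[X]) (hsep : ∀ j, (G j).Separable)
    (hco : Pairwise fun i j => IsCoprime (G i) (G j)) (hdeg : ∀ j, 0 < (G j).natDegree) :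
    ‖∑ v : ZMod p, ∏ j, θ j ((G j).eval v)‖ ≤ (∑ j, (G j).natDegree : ℕ) * √p := by
  obtain ⟨η, e, hη, hθe, hepos, he⟩ := exists_common_root_of_isCyclic θ hθ
  have hlc : ∀ j, (G j).leadingCoeff ≠ 0 := fun j => leadingCoeff_ne_zero.2 (hsep j).ne_zero
  set M : ι → (ZMod p)[X] := fun j => C (G j).leadingCoeff⁻¹ * G j with hM
  have hunit : ∀ j, IsUnit (C (G j).leadingCoeff⁻¹) := fun j =>
    isUnit_C.2 (isUnit_iff_ne_zero.2 (inv_ne_zero (hlc j)))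
  have hMmon : ∀ j, (M j).Monic := fun j => by
    rw [hM, Monic, leadingCoeff_mul, leadingCoeff_C, inv_mul_cancel₀ (hlc j)]
  have hMdeg : ∀ j, (M j).natDegree = (G j).natDegree := fun j =>
    natDegree_C_mul (inv_ne_zero (hlc j))
  have hMsep : ∀ j, (M j).Separable := fun j => by
    change (C (G j).leadingCoeff⁻¹ * G j).Separable
    rw [mul_comm]
    exact (hsep j).mul_unit (hunit j)
  have hMco : Pairwise fun i j => IsCoprime (M i) (M j) := fun i j hij => by
    simp only [hM]
    rw [isCoprime_mul_unit_left_left (hunit i), isCoprime_mul_unit_left_right (hunit j)]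
    exact hco hij
  have hW := weil_bound_monic η hη M hMmon hMsep hMco (fun j => by rw [hMdeg]; exact hdeg j) e he
  have hGM : ∀ j, G j = C (G j).leadingCoeff * M j := fun j => by
    rw [hM, ← mul_assoc, ← C_mul, mul_inv_cancel₀ (hlc j), C_1, one_mul]
  have hterm : ∀ v : ZMod p, ∏ j, θ j ((G j).eval v)
      = (∏ j, θ j (G j).leadingCoeff) * η ((∏ j, M j ^ e j).eval v) := by
    intro v
    rw [eval_prod, map_prod, ← Finset.prod_mul_distrib]
    refine Finset.prod_congr rfl fun j _ => ?_
    conv_lhs => rw [hGM j]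
    rw [eval_mul, eval_C, map_mul, eval_pow, map_pow η]
    congr 1
    rw [hθe j, MulChar.pow_apply' _ (hepos j).ne']
  rw [Finset.sum_congr rfl fun v _ => hterm v, ← Finset.mul_sum, norm_mul]
  have h1 : ‖∏ j, θ j (G j).leadingCoeff‖ ≤ 1 := by
    rw [norm_prod]
    exact Finset.prod_le_one (fun _ _ => norm_nonneg _) fun j _ => mulChar_norm_le_one _ _
  have h2 : (∏ j, M j).natDegree = ∑ j, (G j).natDegree := by
    rw [natDegree_prod_of_monic _ _ fun j _ => hMmon j]
    exact Finset.sum_congr rfl fun j _ => hMdeg j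
  rw [h2] at hW
  exact (mul_le_of_le_one_left (norm_nonneg _) h1).trans hW

end WeilGeneral

section CharacterPartialSums

open Complex MeasureTheory Filter Asymptotics

variable {q : ℕ} [NeZero q]

lemma sum_range_zmod {M : Type*} [AddCommMonoid M] (g : ZMod q → M) :
    ∑ i ∈ Finset.range q, g (i : ZMod q) = ∑ z : ZMod q, g z := by
  refine Finset.sum_nbij' (fun i => (i : ZMod q)) ZMod.val (by simp) ?_ ?_ (by simp) (by simp)
  · intro z _; exact Finset.mem_range.2 (ZMod.val_lt z)
  · intro i hi; exact ZMod.val_cast_of_lt (Finset.mem_range.1 hi)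

/-- The summatory function of a Dirichlet character. -/
def charPartialSum (ψ : DirichletCharacter ℂ q) (t : ℝ) : ℂ :=
  ∑ k ∈ Finset.Icc 1 ⌊t⌋₊, ψ k

lemma norm_charPartialSum_le_self (ψ : DirichletCharacter ℂ q) {t : ℝ} (ht : 0 ≤ t) :
    ‖charPartialSum ψ t‖ ≤ t := by
  refine (norm_sum_le _ _).trans ?_
  refine (Finset.sum_le_sum fun k _ => ψ.norm_le_one _).trans ?_
  simpa using Nat.floor_le ht

lemma norm_charPartialSum_le (ψ : DirichletCharacter ℂ q) (hψ : ψ ≠ 1) (t : ℝ) :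
    ‖charPartialSum ψ t‖ ≤ q := by
  have hIcc : ∀ n : ℕ, ∑ k ∈ Finset.Icc 1 n, ψ (k : ZMod q)
      = ∑ k ∈ Finset.range n, ψ ((k + 1 : ℕ) : ZMod q) := by
    intro n
    rw [Finset.range_eq_Ico, Finset.sum_Ico_add' (fun k : ℕ => ψ (k : ZMod q)) 0 n 1]
    rfl
  have hper : ∀ n : ℕ, ∑ k ∈ Finset.range (n + q), ψ ((k + 1 : ℕ) : ZMod q)
      = ∑ k ∈ Finset.range n, ψ ((k + 1 : ℕ) : ZMod q) := by
    intro n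
    rw [Finset.sum_range_add, add_eq_left]
    have h1 := sum_range_zmod (q := q) fun z => ψ ((n : ZMod q) + z + 1)
    push_cast
    rw [h1]
    have h2 := Equiv.sum_comp ((Equiv.addLeft (n : ZMod q)).trans (Equiv.addRight (1 : ZMod q)))
      (fun z => ψ z)
    simp only [Equiv.trans_apply, Equiv.coe_addLeft, Equiv.coe_addRight] at h2
    rw [h2]
    exact MulChar.sum_eq_zero_of_ne_one hψ
  have hmod : ∀ n : ℕ, ∑ k ∈ Finset.range n, ψ ((k + 1 : ℕ) : ZMod q)
      = ∑ k ∈ Finset.range (n % q), ψ ((k + 1 : ℕ) : ZMod q) := by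
    intro n
    induction n using Nat.strong_induction_on with
    | _ n ih =>
      rcases lt_or_ge n q with h | h
      · rw [Nat.mod_eq_of_lt h]
      · obtain ⟨m, rfl⟩ := Nat.exists_eq_add_of_le' h
        rw [hper, Nat.add_mod_right]
        exact ih m (by have := NeZero.pos q; omega)
  rw [charPartialSum, hIcc, hmod]
  refine (norm_sum_le _ _).trans ?_
  refine (Finset.sum_le_sum fun k _ => ψ.norm_le_one _).trans ?_
  simp only [Finset.sum_const, Finset.card_range, nsmul_eq_mul, mul_one, Nat.cast_le]
  exact (Nat.mod_lt _ (NeZero.pos q)).le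

lemma norm_charPartialSum_le_rpow (ψ : DirichletCharacter ℂ q) (hψ : ψ ≠ 1) {t θ : ℝ}
    (ht : 0 < t) (hθ0 : 0 ≤ θ) (hθ1 : θ ≤ 1) :
    ‖charPartialSum ψ t‖ ≤ (q : ℝ) ^ θ * t ^ (1 - θ) := by
  have h1 := norm_charPartialSum_le ψ hψ t
  have h2 := norm_charPartialSum_le_self ψ ht.le
  have h0 := norm_nonneg (charPartialSum ψ t)
  calc ‖charPartialSum ψ t‖ = ‖charPartialSum ψ t‖ ^ (θ + (1 - θ)) := by
        rw [add_sub_cancel, Real.rpow_one]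
    _ = ‖charPartialSum ψ t‖ ^ θ * ‖charPartialSum ψ t‖ ^ (1 - θ) :=
        Real.rpow_add_of_nonneg h0 hθ0 (by linarith)
    _ ≤ _ := by gcongr

lemma measurable_charPartialSum (ψ : DirichletCharacter ℂ q) : Measurable (charPartialSum ψ) :=
  (measurable_from_nat (f := fun n => ∑ k ∈ Finset.Icc 1 n, ψ (k : ZMod q))).comp
    Nat.measurable_floor

/-- The integral representation of Dirichlet `L`-functions to the right of `0`. -/
lemma LFunction_eq_mul_integral (ψ : DirichletCharacter ℂ q) (hψ : ψ ≠ 1) {s : ℂ}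
    (hs : 0 < s.re) :
    ψ.LFunction s = s * ∫ t in Set.Ioi (1 : ℝ), charPartialSum ψ t * (t : ℂ) ^ (-(s + 1)) := by
  set g : ℝ → ℂ := (Set.Ioi (1 : ℝ)).indicator (charPartialSum ψ) with hg
  have hgm : Measurable g := (measurable_charPartialSum ψ).indicator measurableSet_Ioi
  have hgb : ∀ t, ‖g t‖ ≤ q := fun t => by
    rw [hg]
    refine (norm_indicator_le_norm_self _ _).trans (norm_charPartialSum_le ψ hψ t)
  have hmel : ∀ s : ℂ, mellin g (-s)
      = ∫ t in Set.Ioi (1 : ℝ), charPartialSum ψ t * (t : ℂ) ^ (-(s + 1)) := by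
    intro s
    rw [mellin]
    have : ∀ t : ℝ, (t : ℂ) ^ (-s - 1) • g t
        = (Set.Ioi (1 : ℝ)).indicator (fun t => charPartialSum ψ t * (t : ℂ) ^ (-(s + 1))) t := by
      intro t
      rw [hg]
      by_cases h : t ∈ Set.Ioi (1 : ℝ)
      · rw [Set.indicator_of_mem h, Set.indicator_of_mem h, smul_eq_mul, mul_comm]
        congr 2; ring
      · rw [Set.indicator_of_notMem h, Set.indicator_of_notMem h, smul_zero]
    simp_rw [this]
    rw [setIntegral_indicator measurableSet_Ioi, Set.inter_eq_self_of_subset_right]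
    exact Set.Ioi_subset_Ioi zero_le_one
  have hloc : LocallyIntegrableOn g (Set.Ioi 0) := by
    refine LocallyIntegrable.locallyIntegrableOn ?_ _
    have h1 : LocallyIntegrable (fun _ : ℝ => (q : ℝ)) := locallyIntegrable_const _
    refine h1.mono hgm.aestronglyMeasurable (ae_of_all _ fun t => ?_)
    simpa using hgb t
  have hdiff : ∀ s : ℂ, 0 < s.re → DifferentiableAt ℂ (mellin g) (-s) := by
    intro s hs
    refine mellin_differentiableAt_of_isBigO_rpow (a := 0) (b := -s.re - 1) hloc ?_ ?_ ?_ ?_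
    · refine IsBigO.of_bound q (Eventually.of_forall fun t => ?_)
      simpa using hgb t
    · simpa using hs
    · refine IsBigO.of_bound 0 ?_
      filter_upwards [nhdsWithin_le_nhds (Iio_mem_nhds (zero_lt_one' ℝ))] with t ht
      rw [hg, Set.indicator_of_notMem (by simpa using ht.le)]
      simp
    · simp
  set U : Set ℂ := {s | 0 < s.re} with hU
  have hUo : IsOpen U := isOpen_lt continuous_const continuous_re
  have hUc : IsPreconnected U := (convex_halfSpace_re_gt 0).isPreconnected
  have h1 : AnalyticOnNhd ℂ ψ.LFunction U :=
    (DirichletCharacter.differentiable_LFunction hψ).differentiableOn.analyticOnNhd hUo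
  have h2 : AnalyticOnNhd ℂ (fun s => s * mellin g (-s)) U := by
    refine DifferentiableOn.analyticOnNhd (fun s hs => ?_) hUo
    refine DifferentiableAt.differentiableWithinAt ?_
    refine differentiableAt_id.mul ?_
    exact (hdiff s hs).comp s differentiableAt_id.neg
  have h3 : Set.EqOn ψ.LFunction (fun s => s * mellin g (-s)) U := by
    refine h1.eqOn_of_preconnected_of_eventuallyEq h2 hUc (z₀ := 2) (by simp [hU]) ?_
    have : {s : ℂ | 1 < s.re} ∈ nhds (2 : ℂ) :=
      (isOpen_lt continuous_const continuous_re).mem_nhds (by simp)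
    filter_upwards [this] with s hs
    rw [DirichletCharacter.LFunction_eq_LSeries ψ hs, hmel]
    refine LSeries_eq_mul_integral (fun n : ℕ => ψ n) zero_le_one hs
      (ψ.LSeriesSummable_of_one_lt_re hs) ?_
    refine IsBigO.of_bound 1 (Eventually.of_forall fun n => ?_)
    have h := norm_charPartialSum_le_self ψ (Nat.cast_nonneg n)
    rw [charPartialSum, Nat.floor_natCast] at h
    simpa using h
  rw [h3 hs, ← hmel]

lemma norm_LFunction_le_rpow (ψ : DirichletCharacter ℂ q) (hψ : ψ ≠ 1) {η : ℝ} (hη0 : 0 < η)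
    (hη : η ≤ 1 / 2) {s : ℂ} (hs : 1 - η ≤ s.re) :
    ‖ψ.LFunction s‖ ≤ ‖s‖ * ((q : ℝ) ^ (2 * η) * η⁻¹) := by
  rw [LFunction_eq_mul_integral ψ hψ (by linarith), norm_mul]
  gcongr
  have h_int : IntegrableOn (fun t : ℝ => (q : ℝ) ^ (2 * η) * t ^ (-1 - η)) (Set.Ioi 1) :=
    (integrableOn_Ioi_rpow_of_lt (by linarith) zero_lt_one).const_mul _
  refine (norm_integral_le_of_norm_le h_int ?_).trans ?_
  · refine (ae_restrict_iff' measurableSet_Ioi).2 (ae_of_all _ fun t ht => ?_)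
    have ht1 : (1 : ℝ) < t := ht
    have ht0 : (0 : ℝ) < t := by linarith
    rw [norm_mul, norm_cpow_eq_rpow_re_of_pos ht0]
    calc _ ≤ ((q : ℝ) ^ (2 * η) * t ^ (1 - 2 * η)) * t ^ (-2 + η) := by
          refine mul_le_mul (norm_charPartialSum_le_rpow ψ hψ ht0 (by linarith) (by linarith)) ?_
            (by positivity) (by positivity)
          refine Real.rpow_le_rpow_of_exponent_le ht1.le ?_
          simp only [neg_re, add_re, one_re]
          linarith
      _ = _ := by
          rw [mul_assoc, ← Real.rpow_add ht0]
          congr 2; ring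
  · rw [integral_const_mul, integral_Ioi_rpow_of_lt (by linarith) zero_lt_one]
    rw [Real.one_rpow]
    refine le_of_eq ?_
    congr 1
    have h1 : -1 - η + 1 = -η := by ring
    rw [h1]
    field_simp

end CharacterPartialSums

section QuadraticConvolution

open Complex ArithmeticFunction
open scoped ComplexOrder ArithmeticFunction.zeta

/-- `c` is the logarithmic derivative of `a` as a formal Dirichlet series. -/
def IsLogDerivCoeff (a c : ArithmeticFunction ℂ) : Prop :=
  ∀ n : ℕ, (Real.log n : ℂ) * a n = (a * c) n

lemma IsLogDerivCoeff.mul {a b c d : ArithmeticFunction ℂ} (h : IsLogDerivCoeff a c)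
    (h' : IsLogDerivCoeff b d) : IsLogDerivCoeff (a * b) (c + d) := by
  intro n
  have key : (Real.log n : ℂ) * (a * b) n = ((a * c) * b) n + (a * (b * d)) n := by
    rw [ArithmeticFunction.mul_apply, ArithmeticFunction.mul_apply, ArithmeticFunction.mul_apply,
      Finset.mul_sum, ← Finset.sum_add_distrib]
    refine Finset.sum_congr rfl fun x hx => ?_
    obtain ⟨hx1, hx2⟩ := Nat.mem_divisorsAntidiagonal.1 hx
    rw [← h, ← h', ← hx1]
    have h0 : x.1 ≠ 0 ∧ x.2 ≠ 0 := by
      refine ⟨fun h => hx2 (by simp [← hx1, h]), fun h => hx2 (by simp [← hx1, h])⟩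
    rw [Nat.cast_mul, Real.log_mul (by exact_mod_cast h0.1) (by exact_mod_cast h0.2),
      Complex.ofReal_add]
    ring
  rw [key, ← ArithmeticFunction.add_apply]
  congr 1
  ring

lemma IsLogDerivCoeff.nonneg {a c : ArithmeticFunction ℂ} (h : IsLogDerivCoeff a c)
    (ha : a 1 = 1) (hc1 : c 1 = 0) (hc : ∀ n, 0 ≤ c n) (n : ℕ) : 0 ≤ a n := by
  induction n using Nat.strong_induction_on with
  | _ n ih =>
    rcases Nat.lt_or_ge 1 n with hn | hn
    · have hlog : 0 < Real.log n := Real.log_pos (by exact_mod_cast hn)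
      have h1 : a n = ((Real.log n)⁻¹ : ℝ) * (a * c) n := by
        rw [← h n, ← mul_assoc, ← Complex.ofReal_mul, inv_mul_cancel₀ hlog.ne', Complex.ofReal_one,
          one_mul]
      rw [h1]
      refine mul_nonneg (by exact_mod_cast (inv_pos.2 hlog).le) ?_
      rw [ArithmeticFunction.mul_apply]
      refine Finset.sum_nonneg fun x hx => ?_
      obtain ⟨hx1, hx2⟩ := Nat.mem_divisorsAntidiagonal.1 hx
      by_cases h2 : x.2 = 1
      · rw [h2, hc1, mul_zero]
      · refine mul_nonneg (ih _ ?_) (hc _)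
        have h0 : x.1 ≠ 0 ∧ x.2 ≠ 0 := by
          refine ⟨fun h => hx2 (by simp [← hx1, h]), fun h => hx2 (by simp [← hx1, h])⟩
        have : 2 ≤ x.2 := by omega
        have := Nat.pos_of_ne_zero h0.1
        nlinarith
    · interval_cases n
      · simp
      · rw [ha]; exact zero_le_one

variable {N : ℕ}

/-- A Dirichlet character as an arithmetic function. -/
def charArith (χ : DirichletCharacter ℂ N) : ArithmeticFunction ℂ := toArithmeticFunction (χ ·)

lemma charArith_apply (χ : DirichletCharacter ℂ N) {n : ℕ} (hn : n ≠ 0) :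
    charArith χ n = χ n := by
  simp [charArith, toArithmeticFunction, hn]

/-- The von Mangoldt function twisted by `g`. -/
def twistedVonMangoldt (g : ℕ → ℂ) : ArithmeticFunction ℂ := ⟨fun n => Λ n * g n, by simp⟩

lemma twistedVonMangoldt_apply (g : ℕ → ℂ) (n : ℕ) : twistedVonMangoldt g n = Λ n * g n := rfl

lemma isLogDerivCoeff_of_completelyMul {a : ArithmeticFunction ℂ} (g : ℕ → ℂ)
    (hg : ∀ m n, g (m * n) = g m * g n) (ha : ∀ n ≠ 0, a n = g n) :
    IsLogDerivCoeff a (twistedVonMangoldt g) := by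
  intro n
  rw [mul_comm a, ArithmeticFunction.mul_apply]
  rcases eq_or_ne n 0 with rfl | hn
  · simp
  have : ∀ x ∈ n.divisorsAntidiagonal, twistedVonMangoldt g x.1 * a x.2 = (Λ x.1 : ℂ) * g n := by
    intro x hx
    obtain ⟨hx1, hx2⟩ := Nat.mem_divisorsAntidiagonal.1 hx
    rw [ha, twistedVonMangoldt_apply, ← hx1, hg]
    · ring
    · intro h; exact hx2 (by simp [← hx1, h])
  rw [Finset.sum_congr rfl this, ← Finset.sum_mul, ha n hn,
    Nat.sum_divisorsAntidiagonal (f := fun i _ => (Λ i : ℂ)), ← Complex.ofReal_sum, vonMangoldt_sum]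

/-- The convolution `1 * χ * ψ * χψ`. -/
def quadConv (χ ψ : DirichletCharacter ℂ N) : ArithmeticFunction ℂ :=
  ((ζ : ArithmeticFunction ℂ) * charArith χ) * (charArith ψ * charArith (χ * ψ))

lemma isLogDerivCoeff_charArith (χ : DirichletCharacter ℂ N) :
    IsLogDerivCoeff (charArith χ) (twistedVonMangoldt fun n => χ n) :=
  isLogDerivCoeff_of_completelyMul (fun n => χ n) (by simp) (fun n hn => charArith_apply χ hn)

lemma isLogDerivCoeff_zeta :
    IsLogDerivCoeff (ζ : ArithmeticFunction ℂ) (twistedVonMangoldt fun _ => 1) :=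
  isLogDerivCoeff_of_completelyMul (fun n => 1) (by simp) (fun n hn => by simp [hn])

lemma quadConv_one (χ ψ : DirichletCharacter ℂ N) : quadConv χ ψ 1 = 1 := by
  simp [quadConv, charArith_apply]

lemma one_add_nonneg_of_sq_eq_one {χ : DirichletCharacter ℂ N} (hχ : χ ^ 2 = 1) (z : ZMod N) :
    0 ≤ 1 + χ z := by
  rcases MulChar.isQuadratic_iff_sq_eq_one.mpr hχ z with h | h | h <;> rw [h] <;> norm_num

lemma quadConv_nonneg {χ ψ : DirichletCharacter ℂ N} (hχ : χ ^ 2 = 1) (hψ : ψ ^ 2 = 1) (n : ℕ) :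
    0 ≤ quadConv χ ψ n := by
  have h := (isLogDerivCoeff_zeta.mul (isLogDerivCoeff_charArith χ)).mul
    ((isLogDerivCoeff_charArith ψ).mul (isLogDerivCoeff_charArith (χ * ψ)))
  refine h.nonneg (quadConv_one χ ψ) ?_ ?_ n
  · simp [twistedVonMangoldt_apply]
  · intro n
    simp only [ArithmeticFunction.add_apply, twistedVonMangoldt_apply, MulChar.mul_apply]
    have : (Λ n : ℂ) * 1 + Λ n * χ n + (Λ n * ψ n + Λ n * (χ n * ψ n))
        = Λ n * ((1 + χ n) * (1 + ψ n)) := by ring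
    rw [this]
    exact mul_nonneg (by exact_mod_cast vonMangoldt_nonneg)
      (mul_nonneg (one_add_nonneg_of_sq_eq_one hχ _) (one_add_nonneg_of_sq_eq_one hψ _))

lemma LSeries_charArith [NeZero N] (χ : DirichletCharacter ℂ N) {s : ℂ} (hs : 1 < s.re) :
    LSeriesSummable (charArith χ) s ∧ LSeries (charArith χ) s = χ.LFunction s := by
  constructor
  · exact (LSeriesSummable_congr _ fun h ↦ (χ.apply_eq_toArithmeticFunction_apply h).symm).mpr <|
      ZMod.LSeriesSummable_of_one_lt_re χ hs
  · rw [χ.LFunction_eq_LSeries hs]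
    exact LSeries_congr (fun h ↦ (χ.apply_eq_toArithmeticFunction_apply h).symm) s

lemma LSeries_zetaMul_eq [NeZero N] (χ : DirichletCharacter ℂ N) {s : ℂ} (hs : 1 < s.re) :
    LSeriesSummable ((ζ : ArithmeticFunction ℂ) * charArith χ : ArithmeticFunction ℂ) s ∧
      LSeries ((ζ : ArithmeticFunction ℂ) * charArith χ : ArithmeticFunction ℂ) s
        = riemannZeta s * χ.LFunction s := by
  have hz : LSeriesSummable (ζ : ArithmeticFunction ℂ) s := LSeriesSummable_zeta_iff.mpr hs
  obtain ⟨h1, h2⟩ := LSeries_charArith χ hs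
  refine ⟨ArithmeticFunction.LSeriesSummable_mul hz h1, ?_⟩
  rw [ArithmeticFunction.LSeries_mul' hz h1, h2]
  congr 1
  rw [← LSeries_zeta_eq_riemannZeta hs]
  simp_rw [← natCoe_apply]

lemma LSeries_quadConv [NeZero N] (χ ψ : DirichletCharacter ℂ N) {s : ℂ} (hs : 1 < s.re) :
    LSeriesSummable (quadConv χ ψ) s ∧ LSeries (quadConv χ ψ) s
      = riemannZeta s * (χ.LFunction s * (ψ.LFunction s * (χ * ψ).LFunction s)) := by
  obtain ⟨h1, h2⟩ := LSeries_zetaMul_eq χ hs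
  obtain ⟨h3, h4⟩ := LSeries_charArith ψ hs
  obtain ⟨h5, h6⟩ := LSeries_charArith (χ * ψ) hs
  have h7 := ArithmeticFunction.LSeriesSummable_mul h3 h5
  refine ⟨ArithmeticFunction.LSeriesSummable_mul h1 h7, ?_⟩
  rw [quadConv, ArithmeticFunction.LSeries_mul' h1 h7, ArithmeticFunction.LSeries_mul' h3 h5,
    h2, h4, h6, mul_assoc]

end QuadraticConvolution

section EstermannLowerBound

open Complex Metric
open scoped ComplexOrder Nat

lemma exists_pow_ge_and_pow_le {M δ : ℝ} (hM : 1 ≤ M) (hδ0 : 0 ≤ δ) (hδ1 : δ ≤ 1) :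
    ∃ n : ℕ, M ≤ (9 / 8 : ℝ) ^ n ∧ (1 + δ) ^ n ≤ Real.exp 1 * M ^ (9 * δ) := by
  have hlog : 1 / 9 ≤ Real.log (9 / 8) := by
    have := Real.one_sub_inv_le_log_of_pos (show (0 : ℝ) < 9 / 8 by norm_num)
    norm_num at this ⊢; linarith
  have hM0 : 0 ≤ Real.log M := Real.log_nonneg hM
  refine ⟨⌈Real.log M * 9⌉₊, ?_, ?_⟩
  · rw [← Real.log_le_log_iff (by linarith) (by positivity), Real.log_pow]
    have := Nat.le_ceil (Real.log M * 9)
    nlinarith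
  · have h1 : (⌈Real.log M * 9⌉₊ : ℝ) ≤ Real.log M * 9 + 1 :=
      (Nat.ceil_lt_add_one (by positivity)).le
    calc (1 + δ) ^ ⌈Real.log M * 9⌉₊ ≤ (Real.exp δ) ^ ⌈Real.log M * 9⌉₊ := by
          gcongr; linarith [Real.add_one_le_exp δ]
      _ = Real.exp (⌈Real.log M * 9⌉₊ * δ) := by rw [← Real.exp_nat_mul]
      _ ≤ Real.exp (1 + Real.log M * (9 * δ)) := by
          apply Real.exp_le_exp.2; nlinarith
      _ = _ := by rw [Real.exp_add, Real.rpow_def_of_pos (by linarith)]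

/-- Estermann's lower bound for the residue at `1` of a Dirichlet series with nonnegative
coefficients which is nonpositive at some point `β < 1`. -/
theorem residue_lower_bound {H : ℂ → ℂ} (hH : Differentiable ℂ H) {M : ℝ}
    (hM : ∀ s ∈ closedBall (2 : ℂ) (3 / 2), ‖H s‖ ≤ M) {a : ℕ → ℂ} (ha : 0 ≤ a) (ha1 : a 1 = 1)
    (hs : ∀ s : ℂ, 1 < s.re → LSeriesSummable a s)
    (hL : ∀ s : ℂ, 1 < s.re → LSeries a s = H s / (s - 1)) {β : ℝ} (hβ0 : 2 / 3 ≤ β) (hβ1 : β < 1)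
    (hβ : (H β / (β - 1)).re ≤ 0) :
    (1 - β) / (2 * (Real.exp 1 * (72 * M) ^ (9 * (1 - β)))) ≤ (H 1).re := by
  have habs : LSeries.abscissaOfAbsConv a < ((2 : ℝ) : EReal) := by
    refine lt_of_le_of_lt (LSeriesSummable.abscissaOfAbsConv_le (s := ((3 / 2 : ℝ) : ℂ))
      (hs _ ?_)) ?_
    · rw [ofReal_re]; norm_num
    · rw [ofReal_re]; exact_mod_cast (by norm_num : (3 / 2 : ℝ) < 2)
  set D : ℕ → ℂ := fun n => iteratedDeriv n (LSeries a) 2 with hD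
  have hDn : ∀ n, 0 ≤ (-1) ^ n * D n := fun n => by
    have := LSeries.iteratedDeriv_alternating ha habs n
    simpa [hD] using this
  have hD0 : 1 ≤ (D 0).re := by
    have h2 := hs 2 (by norm_num)
    have h3 : D 0 = ∑' n, LSeries.term a 2 n := by simp [hD, LSeries]
    rw [h3, Complex.re_tsum h2]
    have h4 : (LSeries.term a 2 1).re = 1 := by simp [LSeries.term, ha1]
    rw [← h4]
    refine (Complex.hasSum_re h2.hasSum).summable.le_tsum 1 fun n _ => ?_
    have : 0 ≤ LSeries.term a 2 n := by
      rw [LSeries.term_def]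
      split
      · exact le_rfl
      · rw [div_eq_mul_inv]
        refine mul_nonneg (ha n) ?_
        simp
    exact (Complex.le_def.1 this).1
  have hMone : 1 ≤ M := by
    have h1 := hM 2 (by simp; norm_num)
    have h2 := hL 2 (by norm_num)
    have h3 : D 0 = H 2 := by
      simp only [hD, iteratedDeriv_zero, h2]; norm_num
    refine (hD0.trans ?_).trans h1
    rw [h3]; exact Complex.re_le_norm _
  set Φ := dslope H 1 with hΦ
  have hΦd : Differentiable ℂ Φ := by
    rw [← differentiableOn_univ] at hH ⊢
    exact (differentiableOn_dslope Filter.univ_mem).2 hH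
  have hΦe : ∀ s : ℂ, s ≠ 1 → Φ s = H s / (s - 1) - H 1 * (s - 1)⁻¹ := by
    intro s h
    rw [hΦ, dslope_of_ne _ h, slope_def_field]; ring
  have hΦb : ∀ s ∈ sphere (2 : ℂ) (3 / 2), ‖Φ s‖ ≤ 4 * M := by
    intro s h
    have h2 : ‖s - 2‖ = 3 / 2 := by simpa [dist_eq_norm] using h
    have h1 : 1 / 2 ≤ ‖s - 1‖ := by
      have := norm_sub_norm_le (s - 2) (-1)
      rw [h2, norm_neg, norm_one] at this
      have h3 : s - 2 - -1 = s - 1 := by ring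
      rw [h3] at this; linarith
    have hne : s ≠ 1 := by rintro rfl; norm_num at h1
    rw [hΦ, dslope_of_ne _ hne, slope_def_field, norm_div, div_le_iff₀ (by linarith)]
    have h4 := hM s (sphere_subset_closedBall h)
    have h5 := hM 1 (by rw [mem_closedBall, dist_eq_norm]; norm_num)
    have := norm_sub_le (H s) (H 1)
    nlinarith
  have hder : ∀ n, iteratedDeriv n Φ 2 = D n - H 1 * ((-1) ^ n * n !) := by
    intro n
    have hev : Φ =ᶠ[nhds 2] (LSeries a - fun s => H 1 * (s - 1)⁻¹) := by
      have : {s : ℂ | 1 < s.re} ∈ nhds (2 : ℂ) :=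
        (isOpen_lt continuous_const continuous_re).mem_nhds (by norm_num)
      filter_upwards [this] with s h
      rw [Pi.sub_apply, hL s h, hΦe]
      rintro rfl; norm_num at h
    have hinv : AnalyticAt ℂ (fun s : ℂ => H 1 * (s - 1)⁻¹) 2 := by
      refine analyticAt_const.mul ((analyticAt_id.sub analyticAt_const).inv ?_)
      norm_num
    have hLa : AnalyticAt ℂ (LSeries a) 2 := by
      refine LSeries_analyticOnNhd a 2 ?_
      exact_mod_cast habs
    rw [hev.iteratedDeriv_eq, iteratedDeriv_sub hLa.contDiffAt hinv.contDiffAt,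
      iteratedDeriv_const_mul_field]
    congr 2
    rw [iteratedDeriv_comp_sub_const n (fun s : ℂ => s⁻¹) 1]
    have := iter_deriv_inv n ((2 : ℂ) - 1)
    rw [iteratedDeriv_eq_iterate]
    norm_num at this ⊢
  have hnb : ‖(β : ℂ) - 2‖ = 2 - β := by
    rw [← Complex.ofReal_ofNat, ← Complex.ofReal_sub, Complex.norm_real, Real.norm_eq_abs,
      abs_of_nonpos (by linarith)]
    ring
  have hsum := Complex.hasSum_taylorSeries_on_ball (f := Φ) (c := 2) (r := 3 / 2) (z := (β : ℂ))
    hΦd.differentiableOn (by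
      rw [mem_ball, dist_eq_norm, hnb]; linarith)
  set T : ℕ → ℂ := fun n => (n ! : ℂ)⁻¹ • ((β : ℂ) - 2) ^ n • iteratedDeriv n Φ 2 with hT
  have hTn : ∀ n, ‖T n‖ ≤ 4 * M * (8 / 9) ^ n := by
    intro n
    have h1 := Complex.norm_iteratedDeriv_le_of_forall_mem_sphere_norm_le n
      (by norm_num : (0 : ℝ) < 3 / 2) hΦd.diffContOnCl hΦb
    simp only [hT, norm_smul, norm_inv, norm_pow, hnb, Complex.norm_natCast]
    have hn : (0 : ℝ) < n ! := by positivity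
    calc ((n ! : ℝ))⁻¹ * ((2 - β) ^ n * ‖iteratedDeriv n Φ 2‖)
        ≤ ((n ! : ℝ))⁻¹ * ((4 / 3) ^ n * (n ! * (4 * M) / (3 / 2) ^ n)) := by
          gcongr
          · linarith
          · linarith
      _ = 4 * M * (8 / 9) ^ n := by
          have : (8 / 9 : ℝ) = (4 / 3) / (3 / 2) := by norm_num
          rw [this, div_pow (4 / 3 : ℝ) (3 / 2)]; field_simp
  have hTre : ∀ n, (2 - β) ^ n * (-(H 1).re) ≤ (T n).re := by
    intro n
    have h1 : T n = ((2 - β : ℝ) ^ n : ℝ) * ((n ! : ℝ)⁻¹ : ℝ) * ((-1) ^ n * D n)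
        - ((2 - β : ℝ) ^ n : ℝ) * H 1 := by
      have hn : (n ! : ℂ) ≠ 0 := by exact_mod_cast (Nat.factorial_pos n).ne'
      have h2 : ((β : ℂ) - 2) ^ n = (-1) ^ n * (2 - β) ^ n := by rw [← mul_pow]; congr 1; ring
      have h3 : ((-1 : ℂ) ^ n) * (-1) ^ n = 1 := by rw [← mul_pow]; norm_num
      simp only [hT, hder, smul_eq_mul, h2]
      push_cast
      field_simp
      linear_combination (-(2 - (β : ℂ)) ^ n * H 1 * n !) * h3
    have h4 : 0 ≤ ((-1) ^ n * D n).re := (Complex.le_def.1 (hDn n)).1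
    rw [h1, Complex.sub_re, ← Complex.ofReal_mul, Complex.re_ofReal_mul, Complex.re_ofReal_mul]
    have : 0 ≤ (2 - β) ^ n * (n ! : ℝ)⁻¹ * ((-1) ^ n * D n).re := by
      have : 0 ≤ 2 - β := by linarith
      positivity
    linarith
  have hT0 : 1 - (H 1).re ≤ (T 0).re := by
    simp only [hT, hder]
    simpa using hD0
  obtain ⟨n0, hn1, hn2⟩ := exists_pow_ge_and_pow_le (M := 72 * M) (δ := 1 - β) (by linarith)
    (by linarith) (by linarith)
  have hu : (1 : ℝ) + (1 - β) = 2 - β := by ring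
  rw [hu] at hn2
  have hn0 : n0 ≠ 0 := by
    rintro rfl; norm_num at hn1; linarith
  have hre := (Complex.hasSum_re hsum)
  have htail := (hasSum_nat_add_iff' n0).2 hre
  have hgeo : HasSum (fun n : ℕ => -(4 * M * (8 / 9) ^ n0) * (8 / 9 : ℝ) ^ n)
      (-(4 * M * (8 / 9) ^ n0) * (1 - 8 / 9)⁻¹) :=
    (hasSum_geometric_of_lt_one (by norm_num) (by norm_num)).mul_left _
  have htl := hasSum_le (fun n => by
    have h1 := hTn (n + n0)
    have h2 := Complex.abs_re_le_norm (T (n + n0))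
    have h3 := neg_abs_le (T (n + n0)).re
    change _ ≤ (T (n + n0)).re
    rw [pow_add] at h1
    nlinarith) hgeo htail
  have hhalf : 4 * M * (8 / 9 : ℝ) ^ n0 * 9 ≤ 1 / 2 := by
    have h1 : (8 / 9 : ℝ) ^ n0 * (9 / 8) ^ n0 = 1 := by rw [← mul_pow]; norm_num
    have h2 : (0 : ℝ) < (8 / 9) ^ n0 := by positivity
    nlinarith
  have hpart : 1 - (H 1).re * ∑ i ∈ Finset.range n0, (2 - β) ^ i
      ≤ ∑ i ∈ Finset.range n0, (T i).re := by
    obtain ⟨n1, rfl⟩ := Nat.exists_eq_succ_of_ne_zero hn0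
    rw [Finset.sum_range_succ', Finset.sum_range_succ', mul_add]
    have : ∑ i ∈ Finset.range n1, (2 - β) ^ (i + 1) * (-(H 1).re)
        ≤ ∑ i ∈ Finset.range n1, (T (i + 1)).re := Finset.sum_le_sum fun i _ => hTre _
    rw [← Finset.sum_mul] at this
    simp only [pow_zero]
    linarith
  have hΦβ : (Φ β).re ≤ (H 1).re / (1 - β) := by
    have hne : (β : ℂ) ≠ 1 := by exact_mod_cast hβ1.ne
    have h5 : (H 1 * ((β : ℂ) - 1)⁻¹) = ((-(1 - β)⁻¹ : ℝ) : ℂ) * H 1 := by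
      have : (1 : ℂ) - β ≠ 0 := sub_ne_zero.2 hne.symm
      have h6 : (β : ℂ) - 1 = -(1 - β) := by ring
      push_cast
      rw [h6, inv_neg]; ring
    rw [hΦe _ hne, Complex.sub_re, h5, Complex.re_ofReal_mul, div_eq_mul_inv (H 1).re]
    linarith
  have hgs : (∑ i ∈ Finset.range n0, (2 - β) ^ i) * (1 - β) = (2 - β) ^ n0 - 1 := by
    have := geom_sum_mul (2 - β) n0
    rw [← this]; ring
  have hδ : 0 < 1 - β := by linarith
  have key : (1 - β) / 2 ≤ (H 1).re * (2 - β) ^ n0 := by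
    have h1 : 1 / 2 - (H 1).re * ∑ i ∈ Finset.range n0, (2 - β) ^ i ≤ (H 1).re / (1 - β) := by
      have h7 : ((1 : ℝ) - 8 / 9)⁻¹ = 9 := by norm_num
      rw [h7] at htl
      change _ ≤ (Φ β).re - ∑ i ∈ Finset.range n0, (T i).re at htl
      linarith
    rw [le_div_iff₀ hδ] at h1
    have : (1 / 2 - (H 1).re * ∑ i ∈ Finset.range n0, (2 - β) ^ i) * (1 - β)
      = (1 - β) / 2 - (H 1).re * ((2 - β) ^ n0 - 1) := by rw [← hgs]; ring
    linarith
  have hpos : 0 < (H 1).re := by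
    have h0 : 0 < (2 - β) ^ n0 := pow_pos (by linarith) _
    by_contra hc
    push Not at hc
    nlinarith
  rw [div_le_iff₀ (by positivity)]
  nlinarith
end EstermannLowerBound

section SiegelTheorem

open Complex Metric MeasureTheory
open scoped ComplexOrder ComplexConjugate ArithmeticFunction.zeta

lemma riemannZeta₁_ofReal_im (σ : ℝ) : (riemannZeta₁ σ).im = 0 := by
  rcases eq_or_ne σ 1 with rfl | h
  · simp
  have h1 : (σ : ℂ) ≠ 1 := by exact_mod_cast h
  have h2 := riemannZeta_eq_inv_sub_mul h1
  have h3 : riemannZeta₁ σ = (σ - 1) * riemannZeta σ := by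
    rw [h2, ← mul_assoc, mul_inv_cancel₀ (sub_ne_zero.2 h1), one_mul]
  rw [← Complex.conj_eq_iff_im, h3, map_mul, ← riemannZeta_conj]
  simp

lemma LFunction_ofReal_im {q : ℕ} [NeZero q] {ψ : DirichletCharacter ℂ q} (hψ2 : ψ ^ 2 = 1)
    (hψ : ψ ≠ 1) {σ : ℝ} (hσ : 0 < σ) : (ψ.LFunction σ).im = 0 := by
  have hre : ∀ z, ((ψ z).re : ℂ) = ψ z := fun z => by
    rcases MulChar.isQuadratic_iff_sq_eq_one.mpr hψ2 z with h | h | h <;> rw [h] <;> simp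
  have h_int : ∫ t in Set.Ioi (1 : ℝ), charPartialSum ψ t * (t : ℂ) ^ (-((σ : ℂ) + 1))
      = ∫ t in Set.Ioi (1 : ℝ), (((charPartialSum ψ t).re * t ^ (-(σ + 1)) : ℝ) : ℂ) := by
    refine setIntegral_congr_fun measurableSet_Ioi fun t ht => ?_
    have ht0 : (0 : ℝ) ≤ t := by linarith [Set.mem_Ioi.1 ht]
    have h1 : charPartialSum ψ t = ((charPartialSum ψ t).re : ℂ) := by
      simp only [charPartialSum, Complex.re_sum, Complex.ofReal_sum, hre]
    rw [h1, Complex.ofReal_mul, Complex.ofReal_re, Complex.ofReal_cpow ht0]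
    push_cast
    rfl
  rw [LFunction_eq_mul_integral ψ hψ (by simpa using hσ), h_int, integral_complex_ofReal,
    ← Complex.ofReal_mul, Complex.ofReal_im]

/-- A bound for `(s - 1) ζ(s)` on the disc of radius `3/2` about `2`. -/
lemma exists_riemannZeta₁_bound :
    ∃ C : ℝ, 1 ≤ C ∧ ∀ s ∈ closedBall (2 : ℂ) (3 / 2), ‖riemannZeta₁ s‖ ≤ C := by
  obtain ⟨C, hC⟩ := (isCompact_closedBall (2 : ℂ) (3 / 2)).exists_bound_of_continuousOn
    differentiable_riemannZeta₁.continuous.continuousOn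
  exact ⟨max C 1, le_max_right _ _, fun s hs => (hC s hs).trans (le_max_left _ _)⟩

lemma norm_LFunction_le_on_closedBall {q : ℕ} [NeZero q] (ψ : DirichletCharacter ℂ q) (hψ : ψ ≠ 1)
    {s : ℂ} (hs : s ∈ closedBall (2 : ℂ) (3 / 2)) : ‖ψ.LFunction s‖ ≤ 7 * q := by
  have h1 : ‖s - 2‖ ≤ 3 / 2 := by simpa [dist_eq_norm] using hs
  have h2 : 1 - (1 / 2 : ℝ) ≤ s.re := by
    have := (Complex.abs_re_le_norm (s - 2)).trans h1
    have := (abs_le.1 this).1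
    simp at this; linarith
  have h3 : ‖s‖ ≤ 7 / 2 := by
    have := norm_add_le (s - 2) 2
    simp at this; linarith
  refine (norm_LFunction_le_rpow ψ hψ (by norm_num) le_rfl h2).trans ?_
  have h4 : (q : ℝ) ^ (2 * (1 / 2) : ℝ) * (1 / 2 : ℝ)⁻¹ = 2 * q := by norm_num; ring
  rw [h4]
  have : (0 : ℝ) ≤ q := by positivity
  nlinarith

variable {q : ℕ} [NeZero q]

lemma twofold_lower_bound {C : ℝ} (hC1 : 1 ≤ C)
    (hC : ∀ s ∈ closedBall (2 : ℂ) (3 / 2), ‖riemannZeta₁ s‖ ≤ C)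
    {ψ : DirichletCharacter ℂ q} (hψ2 : ψ ^ 2 = 1) (hψ : ψ ≠ 1) {β : ℝ} (hβ0 : 2 / 3 ≤ β)
    (hβ1 : β < 1) (hβ : (riemannZeta₁ β * ψ.LFunction β / (β - 1)).re ≤ 0) :
    (1 - β) / (2 * (Real.exp 1 * (72 * (C * (7 * q))) ^ (9 * (1 - β)))) ≤ ‖ψ.LFunction 1‖ := by
  have h := residue_lower_bound (H := fun s => riemannZeta₁ s * ψ.LFunction s)
    (differentiable_riemannZeta₁.mul (DirichletCharacter.differentiable_LFunction hψ))
    (M := C * (7 * q)) (fun s hs => by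
      rw [norm_mul]
      exact mul_le_mul (hC s hs) (norm_LFunction_le_on_closedBall ψ hψ hs) (norm_nonneg _)
        (by linarith))
    (a := ψ.zetaMul) (fun n => DirichletCharacter.zetaMul_nonneg hψ2 n)
    (by rw [DirichletCharacter.zetaMul, ArithmeticFunction.mul_apply_one]
        simp [toArithmeticFunction])
    (fun s hs => (LSeries_zetaMul_eq ψ hs).1)
    (fun s hs => by
      refine (LSeries_zetaMul_eq ψ hs).2.trans ?_
      rw [riemannZeta_eq_inv_sub_mul]
      · ring
      · rintro rfl; simp at hs) hβ0 hβ1 hβ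
  refine h.trans ((Complex.re_le_norm _).trans ?_)
  rw [riemannZeta₁_one, one_mul]

lemma fourfold_lower_bound {C : ℝ} (hC1 : 1 ≤ C)
    (hC : ∀ s ∈ closedBall (2 : ℂ) (3 / 2), ‖riemannZeta₁ s‖ ≤ C)
    {χ ψ : DirichletCharacter ℂ q} (hχ2 : χ ^ 2 = 1) (hψ2 : ψ ^ 2 = 1) (hχ : χ ≠ 1) (hψ : ψ ≠ 1)
    (hχψ : χ * ψ ≠ 1) {β : ℝ} (hβ0 : 2 / 3 ≤ β)
    (hβ1 : β < 1) (hβ : χ.LFunction β = 0) :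
    (1 - β) / (2 * (Real.exp 1 * (72 * (C * (7 * q) ^ 3)) ^ (9 * (1 - β))))
      ≤ ‖χ.LFunction 1‖ * (‖ψ.LFunction 1‖ * ‖(χ * ψ).LFunction 1‖) := by
  have h := residue_lower_bound
    (H := fun s => riemannZeta₁ s * (χ.LFunction s * (ψ.LFunction s * (χ * ψ).LFunction s)))
    (differentiable_riemannZeta₁.mul ((DirichletCharacter.differentiable_LFunction hχ).mul
      ((DirichletCharacter.differentiable_LFunction hψ).mul
        (DirichletCharacter.differentiable_LFunction hχψ))))
    (M := C * (7 * q) ^ 3) (fun s hs => by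
      rw [norm_mul, norm_mul, norm_mul, pow_succ', pow_two]
      have h1 := norm_LFunction_le_on_closedBall χ hχ hs
      have h2 := norm_LFunction_le_on_closedBall ψ hψ hs
      have h3 := norm_LFunction_le_on_closedBall (χ * ψ) hχψ hs
      have h4 := hC s hs
      gcongr)
    (a := quadConv χ ψ) (fun n => quadConv_nonneg hχ2 hψ2 n) (quadConv_one χ ψ)
    (fun s hs => (LSeries_quadConv χ ψ hs).1)
    (fun s hs => by
      refine (LSeries_quadConv χ ψ hs).2.trans ?_
      rw [riemannZeta_eq_inv_sub_mul]
      · ring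
      · rintro rfl; simp at hs) hβ0 hβ1 (by simp [hβ])
  refine h.trans ((Complex.re_le_norm _).trans ?_)
  rw [riemannZeta₁_one, one_mul, norm_mul, norm_mul]

/-- A real zero close to `1` is produced by a negative value of a real `L`-function. -/
lemma exists_zero_of_re_neg {χ : DirichletCharacter ℂ q} (hχ2 : χ ^ 2 = 1) (hχ : χ ≠ 1) {β : ℝ}
    (hβ0 : 0 < β) (hβ : (χ.LFunction β).re < 0) : ∃ β₁ : ℝ, β < β₁ ∧ β₁ < 1 ∧
      χ.LFunction β₁ = 0 := by
  have hlim : Filter.Tendsto (fun x : ℝ => (χ.LFunction x).re) Filter.atTop (nhds 1) := by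
    have h1 := LSeries.tendsto_atTop (f := fun n : ℕ => χ n) (by
      refine lt_of_le_of_lt (DirichletCharacter.absicssaOfAbsConv_eq_one (NeZero.ne q) χ).le ?_
      exact EReal.coe_lt_top 1)
    have h2 := (Complex.continuous_re.tendsto _).comp h1
    simp only [Nat.cast_one, map_one, one_re] at h2
    refine h2.congr' ?_
    filter_upwards [Filter.eventually_gt_atTop 1] with x hx
    rw [Function.comp_apply, χ.LFunction_eq_LSeries (by simpa using hx)]
  obtain ⟨x, hx, hxβ⟩ := ((hlim.eventually (lt_mem_nhds (show (0 : ℝ) < 1 by norm_num))).and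
    (Filter.eventually_gt_atTop β)).exists
  have hcont : Continuous fun x : ℝ => (χ.LFunction x).re :=
    Complex.continuous_re.comp ((DirichletCharacter.differentiable_LFunction hχ).continuous.comp
      Complex.continuous_ofReal)
  obtain ⟨β₁, ⟨h1, h2⟩, h3⟩ := intermediate_value_Icc hxβ.le hcont.continuousOn ⟨hβ.le, hx.le⟩
  have h4 : χ.LFunction β₁ = 0 :=
    Complex.ext h3 (LFunction_ofReal_im hχ2 hχ (hβ0.trans_le h1))
  refine ⟨β₁, lt_of_le_of_ne h1 ?_, ?_, h4⟩
  · rintro rfl; rw [h4] at hβ; simp at hβ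
  · by_contra hc
    exact DirichletCharacter.LFunction_ne_zero_of_one_le_re χ (.inl hχ)
      (by simpa using hc) h4

end SiegelTheorem

section SiegelTheorem

open Complex Metric DirichletCharacter
open scoped ComplexOrder

/-- Passing to a larger modulus changes `L(1, ψ)` by at most a factor depending on the cofactor. -/
lemma norm_LFunction_one_changeLevel_le {q r : ℕ} [NeZero q] [NeZero r]
    (ψ : DirichletCharacter ℂ q) (hψ : ψ ≠ 1) (h : q ∣ r * q) [NeZero (r * q)] :
    ‖(changeLevel h ψ).LFunction 1‖ ≤ ‖ψ.LFunction 1‖ * 2 ^ r := by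
  rw [LFunction_changeLevel h ψ (.inl hψ), norm_mul]
  gcongr
  rw [norm_prod]
  calc ∏ p ∈ (r * q).primeFactors, ‖1 - ψ p * (p : ℂ) ^ (-1 : ℂ)‖
      ≤ ∏ p ∈ (r * q).primeFactors, (if p ∈ r.primeFactors then 2 else 1 : ℝ) := by
        refine Finset.prod_le_prod (fun _ _ => norm_nonneg _) fun p hp => ?_
        have hpp := Nat.prime_of_mem_primeFactors hp
        split_ifs with hpr
        · refine (norm_sub_le _ _).trans ?_
          have h1 : ‖(p : ℂ) ^ (-1 : ℂ)‖ ≤ 1 := by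
            rw [cpow_neg_one, norm_inv, Complex.norm_natCast]
            exact inv_le_one_of_one_le₀ (by exact_mod_cast hpp.one_lt.le)
          have h2 := ψ.norm_le_one (p : ZMod q)
          rw [norm_one, norm_mul]
          have := mul_le_one₀ h2 (norm_nonneg _) h1
          linarith
        · have hpq : p ∣ q := by
            rcases (Nat.Prime.dvd_mul hpp).1 (Nat.dvd_of_mem_primeFactors hp) with h | h
            · exact absurd (Nat.mem_primeFactors.2 ⟨hpp, h, NeZero.ne r⟩) hpr
            · exact h
          have : ψ (p : ZMod q) = 0 := by
            refine MulChar.map_nonunit _ fun hu => ?_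
            have := (ZMod.isUnit_iff_coprime p q).1 hu
            rw [Nat.Prime.coprime_iff_not_dvd hpp] at this
            exact this hpq
          simp [this]
    _ = 2 ^ r.primeFactors.card := by
        rw [Finset.prod_ite, Finset.prod_const, Finset.prod_const_one, mul_one]
        congr 2
        ext p
        simp only [Finset.mem_filter, and_iff_right_iff_imp]
        exact fun hp => Nat.primeFactors_mono (Nat.dvd_mul_right r q) (NeZero.ne _) hp
    _ ≤ 2 ^ r := by
        gcongr
        · norm_num
        · calc r.primeFactors.card ≤ (Finset.Icc 1 r).card := Finset.card_le_card fun p hp => by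
                rw [Finset.mem_Icc]
                exact ⟨(Nat.prime_of_mem_primeFactors hp).one_lt.le,
                  Nat.le_of_dvd (Nat.pos_of_ne_zero (NeZero.ne r)) (Nat.dvd_of_mem_primeFactors hp)⟩
            _ = r := by simp

lemma rpow_le_of_exponent_le {A δ ε : ℝ} (N : ℕ) [NeZero N] (k : ℕ) (hA : 1 ≤ A) (hδ : δ ≤ ε) :
    (A * (N : ℝ) ^ k) ^ δ ≤ A ^ ε * (N : ℝ) ^ (k * ε) := by
  have hN : (1 : ℝ) ≤ N := by exact_mod_cast Nat.one_le_iff_ne_zero.2 (NeZero.ne N)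
  have h1 : 1 ≤ A * (N : ℝ) ^ k := one_le_mul_of_one_le_of_one_le hA (one_le_pow₀ hN)
  refine (Real.rpow_le_rpow_of_exponent_le h1 hδ).trans ?_
  rw [Real.mul_rpow (by linarith) (by positivity), ← Real.rpow_natCast, ← Real.rpow_mul (by linarith)]

/-- **Siegel's theorem** on real characters, for small exponents. -/
lemma siegel_aux : ∃ δ₀ > 0, ∀ ε : ℝ, 0 < ε → ε < δ₀ → ∃ c > 0, ∀ (q : ℕ) [NeZero q]
    (ψ : DirichletCharacter ℂ q), ψ ^ 2 = 1 → ψ ≠ 1 →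
      c * (q : ℝ) ^ (-(31 * ε)) ≤ ‖ψ.LFunction 1‖ := by
  obtain ⟨C, hC1, hC⟩ := exists_riemannZeta₁_bound
  have hev : ∀ᶠ s in nhds (1 : ℂ), 0 < (riemannZeta₁ s).re :=
    (Complex.continuous_re.comp differentiable_riemannZeta₁.continuous).continuousAt.eventually
      (lt_mem_nhds (by simp))
  obtain ⟨δ, hδ, hδE⟩ := Metric.eventually_nhds_iff.1 hev
  refine ⟨min δ (1 / 3), by positivity, fun ε hε hεδ => ?_⟩
  have hε1 : ε < δ := hεδ.trans_le (min_le_left _ _)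
  have hε3 : ε < 1 / 3 := hεδ.trans_le (min_le_right _ _)
  have hζ : 0 < (riemannZeta₁ ((1 - ε : ℝ) : ℂ)).re := by
    refine hδE ?_
    rw [dist_eq_norm]
    push_cast
    rw [show (1 : ℂ) - ε - 1 = -(ε : ℂ) by ring, norm_neg, Complex.norm_real, Real.norm_eq_abs,
      abs_of_pos hε]
    exact hε1
  by_cases hcase : ∀ (r : ℕ) [NeZero r] (χ : DirichletCharacter ℂ r), χ ^ 2 = 1 → χ ≠ 1 →
      0 ≤ (χ.LFunction ((1 - ε : ℝ) : ℂ)).re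
  · refine ⟨ε / (2 * (Real.exp 1 * (72 * (C * 7)) ^ (9 * ε))), by positivity, fun q _ ψ hψ2 hψ => ?_⟩
    have h := twofold_lower_bound hC1 hC hψ2 hψ (β := 1 - ε) (by linarith) (by linarith) ?_
    · refine le_trans ?_ h
      have h1 : (1 : ℝ) - (1 - ε) = ε := by ring
      rw [h1]
      have hq : (1 : ℝ) ≤ q := by exact_mod_cast Nat.one_le_iff_ne_zero.2 (NeZero.ne q)
      have h2 := rpow_le_of_exponent_le (A := 72 * (C * 7)) (δ := 9 * ε) (ε := 9 * ε) q 1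
        (by linarith) le_rfl
      have h3 : 72 * (C * 7) * (q : ℝ) ^ 1 = 72 * (C * (7 * q)) := by ring
      rw [h3] at h2
      have h4 : (q : ℝ) ^ (((1 : ℕ) : ℝ) * (9 * ε)) ≤ (q : ℝ) ^ (31 * ε) :=
        Real.rpow_le_rpow_of_exponent_le hq (by push_cast; linarith)
      rw [Real.rpow_neg (by linarith), ← div_eq_mul_inv, div_div]
      gcongr ε / ?_
      calc 2 * (Real.exp 1 * (72 * (C * (7 * q))) ^ (9 * ε))
          ≤ 2 * (Real.exp 1 * ((72 * (C * 7)) ^ (9 * ε) * (q : ℝ) ^ (31 * ε))) := by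
            gcongr
            exact h2.trans (by gcongr)
        _ = _ := by ring
    · have hre1 := riemannZeta₁_ofReal_im (1 - ε)
      have hre2 := LFunction_ofReal_im hψ2 hψ (σ := 1 - ε) (by linarith)
      have hL := hcase q ψ hψ2 hψ
      have h5 : riemannZeta₁ ((1 - ε : ℝ) : ℂ) * ψ.LFunction ((1 - ε : ℝ) : ℂ)
          / (((1 - ε : ℝ) : ℂ) - 1) = ((-ε⁻¹ : ℝ) : ℂ) *
            (riemannZeta₁ ((1 - ε : ℝ) : ℂ) * ψ.LFunction ((1 - ε : ℝ) : ℂ)) := by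
        have : ((1 - ε : ℝ) : ℂ) - 1 = -(ε : ℂ) := by push_cast; ring
        rw [this, div_eq_mul_inv, inv_neg]; push_cast; ring
      rw [h5, Complex.re_ofReal_mul, Complex.mul_re, hre1, hre2]
      have : 0 < ε⁻¹ := by positivity
      have := mul_nonneg hζ.le hL
      nlinarith
  · push Not at hcase
    obtain ⟨r, _, χ, hχ2, hχ, hneg⟩ := hcase
    obtain ⟨β, hβ0, hβ1, hzero⟩ := exists_zero_of_re_neg hχ2 hχ (by linarith) hneg
    have hδ0 : 0 < 1 - β := by linarith
    set A : ℝ := 72 * (C * 7 ^ 3) with hA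
    have hA1 : 1 ≤ A := by rw [hA]; linarith
    refine ⟨(1 - β) / (2 * (Real.exp 1 * A ^ (9 * ε))) * ε ^ 2 * (r : ℝ) ^ (-(31 * ε)) / 2 ^ r,
      ?_, fun q _ ψ hψ2 hψ => ?_⟩
    · have : 0 < r := Nat.pos_of_ne_zero (NeZero.ne r)
      positivity
    haveI : NeZero (r * q) := ⟨mul_ne_zero (NeZero.ne r) (NeZero.ne q)⟩
    set χ' := changeLevel (Nat.dvd_mul_right r q) χ with hχ'
    set ψ' := changeLevel (Nat.dvd_mul_left q r) ψ with hψ'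
    have hχ'2 : χ' ^ 2 = 1 := by rw [hχ', ← map_pow, hχ2, map_one]
    have hψ'2 : ψ' ^ 2 = 1 := by rw [hψ', ← map_pow, hψ2, map_one]
    have hχ'1 : χ' ≠ 1 := fun h => hχ ((changeLevel_eq_one_iff _).1 h)
    have hψ'1 : ψ' ≠ 1 := fun h => hψ ((changeLevel_eq_one_iff _).1 h)
    have hz' : χ'.LFunction β = 0 := by
      rw [hχ', LFunction_changeLevel _ _ (.inl hχ), hzero, zero_mul]
    have hN : (1 : ℝ) ≤ (r * q : ℕ) := by
      exact_mod_cast Nat.one_le_iff_ne_zero.2 (NeZero.ne (r * q))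
    set Nr : ℝ := ((r * q : ℕ) : ℝ) with hNr
    have hpow : (A * Nr ^ 3) ^ (9 * (1 - β)) ≤ A ^ (9 * ε) * Nr ^ (27 * ε) := by
      have := rpow_le_of_exponent_le (A := A) (δ := 9 * (1 - β)) (ε := 9 * ε) (r * q) 3 hA1
        (by linarith)
      refine this.trans (le_of_eq ?_)
      congr 2; push_cast; ring
    have hmain : (1 - β) / (2 * (Real.exp 1 * A ^ (9 * ε))) * ε ^ 2 * Nr ^ (-(31 * ε))
        ≤ ‖ψ'.LFunction 1‖ := by
      have hlow : (1 - β) / (2 * (Real.exp 1 * A ^ (9 * ε))) * Nr ^ (-(27 * ε))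
          ≤ (1 - β) / (2 * (Real.exp 1 * (A * Nr ^ 3) ^ (9 * (1 - β)))) := by
        rw [Real.rpow_neg (by linarith), ← div_eq_mul_inv, div_div]
        gcongr (1 - β) / ?_
        calc 2 * (Real.exp 1 * (A * Nr ^ 3) ^ (9 * (1 - β)))
            ≤ 2 * (Real.exp 1 * (A ^ (9 * ε) * Nr ^ (27 * ε))) := by gcongr
          _ = _ := by ring
      have hsplit : Nr ^ (-(31 * ε)) = Nr ^ (-(27 * ε)) * (Nr ^ (2 * ε))⁻¹ * (Nr ^ (2 * ε))⁻¹ := by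
        rw [← Real.rpow_neg (by linarith), ← Real.rpow_add (by linarith),
          ← Real.rpow_add (by linarith)]
        congr 1; ring
      have hN2 : 1 ≤ Nr ^ (2 * ε) := Real.one_le_rpow hN (by linarith)
      set c₁ := (1 - β) / (2 * (Real.exp 1 * A ^ (9 * ε))) with hc₁
      have hc₁0 : 0 < c₁ := by positivity
      have hN27 : 0 < Nr ^ (-(27 * ε)) := by positivity
      by_cases hprod : χ' * ψ' = 1
      · have heq : ψ' = χ' := by
          have h1 : χ' * χ' = 1 := by rw [← pow_two, hχ'2]
          exact mul_left_cancel (hprod.trans h1.symm)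
        have h := twofold_lower_bound hC1 hC hψ'2 hψ'1 (β := β) (by linarith) hβ1
          (by rw [heq, hz']; simp)
        refine le_trans ?_ h
        refine le_trans (b := c₁ * Nr ^ (-(27 * ε))) ?_ (hlow.trans ?_)
        · rw [hsplit]
          have h2 : (Nr ^ (2 * ε))⁻¹ ≤ 1 := inv_le_one_of_one_le₀ hN2
          have h20 : 0 ≤ (Nr ^ (2 * ε))⁻¹ := by positivity
          have h3 : ε ^ 2 ≤ 1 := by nlinarith
          calc c₁ * ε ^ 2 * (Nr ^ (-(27 * ε)) * (Nr ^ (2 * ε))⁻¹ * (Nr ^ (2 * ε))⁻¹)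
              ≤ c₁ * 1 * (Nr ^ (-(27 * ε)) * 1 * 1) := by gcongr
            _ = _ := by ring
        · gcongr (1 - β) / (2 * (Real.exp 1 * ?_ ^ (9 * (1 - β))))
          rw [hA]
          have h4 : Nr ≤ Nr ^ 3 := le_self_pow₀ hN (by norm_num)
          change 72 * (C * (7 * Nr)) ≤ _
          nlinarith
      · have h := fourfold_lower_bound hC1 hC hχ'2 hψ'2 hχ'1 hψ'1 hprod (β := β) (by linarith) hβ1 hz'
        have h5 : 72 * (C * (7 * ((r * q : ℕ) : ℝ)) ^ 3) = A * Nr ^ 3 := by rw [hA, hNr]; ring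
        rw [h5] at h
        have h6 := norm_LFunction_le_rpow χ' hχ'1 hε (by linarith) (s := 1) (by simp [hε.le])
        have h7 := norm_LFunction_le_rpow (χ' * ψ') hprod hε (by linarith) (s := 1) (by simp [hε.le])
        rw [norm_one, one_mul] at h6 h7
        change _ ≤ Nr ^ (2 * ε) * ε⁻¹ at h6
        change _ ≤ Nr ^ (2 * ε) * ε⁻¹ at h7
        have h8 : c₁ * Nr ^ (-(27 * ε)) ≤ (Nr ^ (2 * ε) * ε⁻¹) *
            (‖ψ'.LFunction 1‖ * (Nr ^ (2 * ε) * ε⁻¹)) := by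
          refine (hlow.trans h).trans ?_
          gcongr
        rw [hsplit]
        have h9 : 0 < Nr ^ (2 * ε) := by positivity
        calc c₁ * ε ^ 2 * (Nr ^ (-(27 * ε)) * (Nr ^ (2 * ε))⁻¹ * (Nr ^ (2 * ε))⁻¹)
            = (c₁ * Nr ^ (-(27 * ε))) * (ε ^ 2 * (Nr ^ (2 * ε))⁻¹ * (Nr ^ (2 * ε))⁻¹) := by ring
          _ ≤ ((Nr ^ (2 * ε) * ε⁻¹) * (‖ψ'.LFunction 1‖ * (Nr ^ (2 * ε) * ε⁻¹))) *
              (ε ^ 2 * (Nr ^ (2 * ε))⁻¹ * (Nr ^ (2 * ε))⁻¹) := by gcongr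
          _ = ‖ψ'.LFunction 1‖ := by field_simp
    have hch := norm_LFunction_one_changeLevel_le (r := r) ψ hψ (Nat.dvd_mul_left q r)
    have h10 := hmain.trans hch
    have h11 : Nr ^ (-(31 * ε)) = (r : ℝ) ^ (-(31 * ε)) * (q : ℝ) ^ (-(31 * ε)) := by
      rw [hNr, Nat.cast_mul, Real.mul_rpow (by positivity) (by positivity)]
    rw [h11] at h10
    have h12 : (0 : ℝ) < 2 ^ r := by positivity
    rw [div_mul_eq_mul_div, div_le_iff₀ h12]
    linarith

/-- **Siegel's theorem**. -/
theorem siegel {ε : ℝ} (hε : 0 < ε) : ∃ c > 0, ∀ (q : ℕ) [NeZero q]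
    (ψ : DirichletCharacter ℂ q), ψ ^ 2 = 1 → ψ ≠ 1 → c * (q : ℝ) ^ (-ε) ≤ ‖ψ.LFunction 1‖ := by
  obtain ⟨δ, hδ, h⟩ := siegel_aux
  obtain ⟨c, hc, h⟩ := h (min (ε / 31) (δ / 2)) (by positivity)
    ((min_le_right _ _).trans_lt (by linarith))
  refine ⟨c, hc, fun q _ ψ h1 h2 => le_trans ?_ (h q ψ h1 h2)⟩
  have hq : (1 : ℝ) ≤ q := by exact_mod_cast Nat.one_le_iff_ne_zero.2 (NeZero.ne q)
  have h3 := min_le_left (ε / 31) (δ / 2)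
  gcongr
  linarith

end SiegelTheorem

section LowerBound

open Complex Metric

lemma exists_two_pow_card_primeFactors_le {η : ℝ} (hη : 0 < η) :
    ∃ C : ℝ, 1 ≤ C ∧ ∀ q : ℕ, q ≠ 0 → (2 : ℝ) ^ q.primeFactors.card ≤ C * (q : ℝ) ^ η := by
  obtain ⟨P, hP⟩ := exists_nat_ge ((2 : ℝ) ^ (1 / η))
  have hP2 : ∀ p : ℕ, P ≤ p → (2 : ℝ) ≤ (p : ℝ) ^ η := fun p hp => by
    calc (2 : ℝ) = ((2 : ℝ) ^ (1 / η)) ^ η := by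
          rw [← Real.rpow_mul (by norm_num), one_div_mul_cancel hη.ne', Real.rpow_one]
      _ ≤ (p : ℝ) ^ η := by
          gcongr
          exact hP.trans (by exact_mod_cast hp)
  refine ⟨2 ^ P, one_le_pow₀ (by norm_num), fun q hq => ?_⟩
  have h1 : ∀ p ∈ q.primeFactors, (2 : ℝ) ≤ (if p < P then 2 else 1) * (p : ℝ) ^ η := by
    intro p hp
    have hp1 : (1 : ℝ) ≤ (p : ℝ) ^ η :=
      Real.one_le_rpow (by exact_mod_cast (Nat.prime_of_mem_primeFactors hp).one_le) hη.le
    split_ifs with h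
    · linarith
    · rw [one_mul]; exact hP2 p (not_lt.1 h)
  calc (2 : ℝ) ^ q.primeFactors.card = ∏ p ∈ q.primeFactors, 2 := by simp
    _ ≤ ∏ p ∈ q.primeFactors, ((if p < P then 2 else 1) * (p : ℝ) ^ η) :=
        Finset.prod_le_prod (fun _ _ => by norm_num) h1
    _ = (2 : ℝ) ^ (q.primeFactors.filter (· < P)).card * (∏ p ∈ q.primeFactors, (p : ℝ)) ^ η := by
        rw [Finset.prod_mul_distrib, Finset.prod_ite, Real.finsetProd_rpow _ _ (by simp)]
        simp
    _ ≤ 2 ^ P * (q : ℝ) ^ η := by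
        gcongr
        · norm_num
        · calc (q.primeFactors.filter (· < P)).card ≤ (Finset.range P).card :=
                Finset.card_le_card fun p hp => by simpa using (Finset.mem_filter.1 hp).2
            _ = P := by simp
        · rw [← Nat.cast_prod]
          exact_mod_cast Nat.le_of_dvd (Nat.pos_of_ne_zero hq) (Nat.prod_primeFactors_dvd q)

lemma exists_LFunctionTrivChar_bound {η : ℝ} (hη : 0 < η) :
    ∃ C : ℝ, 1 ≤ C ∧ ∀ (q : ℕ) [NeZero q] (s : ℂ), 1 < s.re → s.re ≤ 2 → |s.im| ≤ 8 →
      ‖DirichletCharacter.LFunctionTrivChar q s‖ ≤ C * (q : ℝ) ^ η / ‖s - 1‖ := by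
  obtain ⟨C₁, hC₁, h₁⟩ := exists_two_pow_card_primeFactors_le hη
  obtain ⟨C₂, hC₂⟩ := (isCompact_closedBall (0 : ℂ) 10).exists_bound_of_continuousOn
    differentiable_riemannZeta₁.continuous.continuousOn
  refine ⟨C₁ * max C₂ 1, one_le_mul_of_one_le_of_one_le hC₁ (le_max_right _ _),
    fun q _ s hs1 hs2 hs3 => ?_⟩
  have hne : s ≠ 1 := by rintro rfl; simp at hs1
  rw [DirichletCharacter.LFunctionTrivChar_eq_mul_riemannZeta hne, riemannZeta_eq_inv_sub_mul hne,
    norm_mul, norm_mul, norm_inv]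
  have hprod : ‖∏ p ∈ q.primeFactors, (1 - (p : ℂ) ^ (-s))‖ ≤ C₁ * (q : ℝ) ^ η := by
    refine le_trans ?_ (h₁ q (NeZero.ne q))
    rw [norm_prod]
    rw [← Finset.prod_const]
    refine Finset.prod_le_prod (fun _ _ => norm_nonneg _) fun p hp => ?_
    have hp := Nat.prime_of_mem_primeFactors hp
    refine (norm_sub_le _ _).trans ?_
    rw [norm_one, norm_natCast_cpow_of_pos hp.pos, neg_re]
    have : (p : ℝ) ^ (-s.re) ≤ 1 :=
      Real.rpow_le_one_of_one_le_of_nonpos (by exact_mod_cast hp.one_le) (by linarith)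
    linarith
  have hz : ‖riemannZeta₁ s‖ ≤ max C₂ 1 := by
    refine (hC₂ s ?_).trans (le_max_left _ _)
    rw [mem_closedBall_zero_iff]
    refine (norm_le_abs_re_add_abs_im s).trans ?_
    rw [abs_of_pos (by linarith)]
    linarith
  calc _ ≤ (C₁ * (q : ℝ) ^ η) * (‖s - 1‖⁻¹ * max C₂ 1) := by gcongr
    _ = _ := by ring

variable {q : ℕ} [NeZero q]

lemma norm_deriv_LFunction_le (ψ : DirichletCharacter ℂ q) (hψ : ψ ≠ 1) {η : ℝ} (hη0 : 0 < η)
    (hη : η ≤ 1 / 2) {z : ℂ} (hz1 : 1 - η / 2 ≤ z.re) (hz2 : ‖z‖ ≤ 7) :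
    ‖deriv ψ.LFunction z‖ ≤ 16 * (η ^ 2)⁻¹ * (q : ℝ) ^ (2 * η) := by
  have h := Complex.norm_deriv_le_of_forall_mem_sphere_norm_le (c := z) (R := η / 2)
    (C := 8 * ((q : ℝ) ^ (2 * η) * η⁻¹)) (by positivity)
    (DirichletCharacter.differentiable_LFunction hψ).diffContOnCl fun w hw => ?_
  · refine h.trans (le_of_eq ?_)
    field_simp
    ring
  · have hw1 : ‖w - z‖ = η / 2 := by simpa [dist_eq_norm] using hw
    have hre : -(η / 2) ≤ (w - z).re := by
      have := Complex.abs_re_le_norm (w - z)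
      rw [hw1] at this
      linarith [(abs_le.1 this).1]
    rw [sub_re] at hre
    refine (norm_LFunction_le_rpow ψ hψ hη0 hη (s := w) (by linarith)).trans ?_
    have hw8 : ‖w‖ ≤ 8 := by
      calc ‖w‖ = ‖z + (w - z)‖ := by congr 1; ring
        _ ≤ ‖z‖ + ‖w - z‖ := norm_add_le _ _
        _ ≤ 8 := by rw [hw1]; linarith
    gcongr

lemma norm_LFunction_sub_le (ψ : DirichletCharacter ℂ q) (hψ : ψ ≠ 1) {η : ℝ} (hη0 : 0 < η)
    (hη : η ≤ 1 / 2) {s s' : ℂ} (hs : 1 - η / 2 ≤ s.re) (hs' : 1 - η / 2 ≤ s'.re)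
    (hn : ‖s‖ ≤ 7) (hn' : ‖s'‖ ≤ 7) :
    ‖ψ.LFunction s - ψ.LFunction s'‖ ≤ 16 * (η ^ 2)⁻¹ * (q : ℝ) ^ (2 * η) * ‖s - s'‖ := by
  have hconv : Convex ℝ ({z : ℂ | 1 - η / 2 ≤ z.re} ∩ closedBall 0 7) :=
    (convex_halfSpace_re_ge _).inter (convex_closedBall _ _)
  exact hconv.norm_image_sub_le_of_norm_deriv_le
    (fun z _ => (DirichletCharacter.differentiable_LFunction hψ).differentiableAt)
    (fun z hz => norm_deriv_LFunction_le ψ hψ hη0 hη hz.1 (by simpa using hz.2))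
    ⟨hs', by simpa using hn'⟩ ⟨hs, by simpa using hn⟩

lemma norm_LFunction_ge_of_product {ψ : DirichletCharacter ℂ q} {t E B D : ℝ}
    (hE : 1 ≤ E) (hB : 1 ≤ B) (hD : 1 ≤ D)
    (hEb : ∀ x : ℝ, 0 < x → x ≤ 1 → ‖DirichletCharacter.LFunctionTrivChar q (1 + x)‖ ≤ E / x)
    (hBb : ∀ x : ℝ, 0 < x → x ≤ 1 → ‖(ψ ^ 2).LFunction (1 + x + 2 * I * t)‖ ≤ B)
    (hDb : ∀ x y : ℝ, 0 < x → x ≤ 1 → 0 < y → y ≤ 1 →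
      ‖ψ.LFunction (1 + x + I * t) - ψ.LFunction (1 + y + I * t)‖ ≤ D * |x - y|)
    {x : ℝ} (hx : 0 < x) (hx1 : x ≤ 1) :
    (16 * E ^ 3 * B * D ^ 3)⁻¹ ≤ ‖ψ.LFunction (1 + x + I * t)‖ := by
  set x₀ : ℝ := (16 * E ^ 3 * B * D ^ 4)⁻¹ with hx₀
  have hE0 : 0 < E := by linarith
  have hB0 : 0 < B := by linarith
  have hD0 : 0 < D := by linarith
  have hx₀0 : 0 < x₀ := by positivity
  have hx₀1 : x₀ ≤ 1 := by
    apply inv_le_one_of_one_le₀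
    have h1 : 1 ≤ E ^ 3 := one_le_pow₀ hE
    have h2 : 1 ≤ D ^ 4 := one_le_pow₀ hD
    have : 1 ≤ E ^ 3 * B * D ^ 4 :=
      one_le_mul_of_one_le_of_one_le (one_le_mul_of_one_le_of_one_le h1 hB) h2
    nlinarith
  have key : ∀ y : ℝ, x₀ ≤ y → y ≤ 1 → 2 * D * x₀ ≤ ‖ψ.LFunction (1 + y + I * t)‖ := by
    intro y hy hy1
    have hy0 : 0 < y := hx₀0.trans_le hy
    have h := ψ.norm_LFunction_product_ge_one hy0 t
    rw [norm_mul, norm_mul, norm_pow, norm_pow] at h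
    set l := ‖ψ.LFunction (1 + y + I * t)‖
    have h2 : 1 ≤ (E / y) ^ 3 * l ^ 4 * B := by
      refine le_trans h ?_
      gcongr
      · exact hEb y hy0 hy1
      · exact hBb y hy0 hy1
    have h3 : y ^ 3 ≤ E ^ 3 * B * l ^ 4 := by
      have : (E / y) ^ 3 * l ^ 4 * B = (E ^ 3 * B * l ^ 4) / y ^ 3 := by field_simp
      rw [this, le_div_iff₀ (by positivity)] at h2
      linarith
    have h4 : x₀ ^ 3 ≤ E ^ 3 * B * l ^ 4 := (pow_le_pow_left₀ hx₀0.le hy 3).trans h3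
    have h5 : E ^ 3 * B * (2 * D * x₀) ^ 4 = x₀ ^ 3 := by
      have : x₀ * (16 * E ^ 3 * B * D ^ 4) = 1 := by
        rw [hx₀]; exact inv_mul_cancel₀ (by positivity)
      calc E ^ 3 * B * (2 * D * x₀) ^ 4 = x₀ ^ 3 * (x₀ * (16 * E ^ 3 * B * D ^ 4)) := by ring
        _ = _ := by rw [this, mul_one]
    rw [← h5] at h4
    have h6 := le_of_mul_le_mul_left h4 (by positivity)
    exact le_of_pow_le_pow_left₀ (by norm_num) (norm_nonneg _) h6
  have hval : (16 * E ^ 3 * B * D ^ 3)⁻¹ = D * x₀ := by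
    rw [hx₀]; field_simp
  rw [hval]
  rcases le_total x₀ x with h | h
  · exact le_trans (by nlinarith) (key x h hx1)
  · have h1 := key x₀ le_rfl hx₀1
    have h2 := hDb x₀ x hx₀0 hx₀1 hx hx1
    rw [abs_of_nonneg (by linarith)] at h2
    have h3 := norm_sub_norm_le (ψ.LFunction (1 + x₀ + I * t)) (ψ.LFunction (1 + x + I * t))
    nlinarith

/-- A lower bound of the shape `q ^ (-ε)` to the right of the line `re s = 1`. -/
theorem exists_norm_LFunction_ge {ε : ℝ} (hε : 0 < ε) (hε1 : ε ≤ 1) :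
    ∃ c > 0, ∀ (q : ℕ) [NeZero q] (ψ : DirichletCharacter ℂ q), ψ ≠ 1 →
      ∀ x t : ℝ, 0 < x → x ≤ 1 → |t| ≤ 4 →
        c * (q : ℝ) ^ (-ε) ≤ ‖ψ.LFunction (1 + x + I * t)‖ := by
  obtain ⟨η, hη⟩ : ∃ η, η = ε / 20 := ⟨_, rfl⟩
  have hη0 : 0 < η := by rw [hη]; positivity
  have hη1 : η ≤ 1 / 2 := by rw [hη]; linarith
  obtain ⟨c₁, hc₁, hsieg⟩ := siegel hη0
  obtain ⟨C₂, hC₂, htriv⟩ := exists_LFunctionTrivChar_bound hη0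
  obtain ⟨d, hd⟩ : ∃ d, d = 16 * (η ^ 2)⁻¹ := ⟨_, rfl⟩
  have hd1 : 16 ≤ d := by
    have : 1 ≤ (η ^ 2)⁻¹ := (one_le_inv₀ (by positivity)).2 (by nlinarith)
    rw [hd]; linarith
  obtain ⟨c₂, hc₂⟩ : ∃ c₂, c₂ = min c₁ 1 / (4 * d) := ⟨_, rfl⟩
  have hc₂0 : 0 < c₂ := by rw [hc₂]; positivity
  obtain ⟨b, hb⟩ : ∃ b, b = max 1 (max (10 * η⁻¹) (C₂ / c₂)) := ⟨_, rfl⟩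
  have hb1 : 1 ≤ b := by rw [hb]; exact le_max_left _ _
  refine ⟨min (16 * C₂ ^ 3 * b * d ^ 3)⁻¹ (min (c₂ / C₂) (c₁ / 2)), by positivity, ?_⟩
  intro q _ ψ hψ x t hx hx1 ht
  obtain ⟨Q, hQ⟩ : ∃ Q, Q = (q : ℝ) ^ η := ⟨_, rfl⟩
  have hq1 : (1 : ℝ) ≤ q := by exact_mod_cast Nat.one_le_iff_ne_zero.2 (NeZero.ne q)
  have hQ1 : 1 ≤ Q := by rw [hQ]; exact Real.one_le_rpow hq1 hη0.le
  have hQ0 : 0 < Q := by linarith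
  have hQpow : ∀ n : ℕ, (q : ℝ) ^ ((n : ℝ) * η) = Q ^ n := fun n => by
    rw [hQ, ← Real.rpow_natCast, ← Real.rpow_mul (by linarith), mul_comm]
  have hQ2 : (q : ℝ) ^ (2 * η) = Q ^ 2 := by exact_mod_cast hQpow 2
  have hQinv : (q : ℝ) ^ (-η) = Q⁻¹ := by rw [hQ, Real.rpow_neg (by linarith)]
  have hQε : (q : ℝ) ^ (-ε) = (Q ^ 20)⁻¹ := by
    rw [← hQpow 20, ← Real.rpow_neg (by linarith), hη]
    congr 1; push_cast; ring
  rw [hQε]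
  have hre : ∀ (y u : ℝ), (1 + (y : ℂ) + I * u).re = 1 + y := fun y u => by simp
  have him : ∀ (y u : ℝ), (1 + (y : ℂ) + I * u).im = u := fun y u => by simp
  have hnorm : ∀ (y u : ℝ), 0 < y → y ≤ 1 → |u| ≤ 4 → ‖1 + (y : ℂ) + I * u‖ ≤ 6 := by
    intro y u h1 h2 h3
    refine (norm_le_abs_re_add_abs_im _).trans ?_
    rw [hre, him, abs_of_pos (by linarith)]
    linarith
  have hEb : ∀ x : ℝ, 0 < x → x ≤ 1 →
      ‖DirichletCharacter.LFunctionTrivChar q (1 + x)‖ ≤ C₂ * Q / x := by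
    intro x hx hx1
    have h := htriv q (1 + x) (by simpa using hx) (by simp; linarith) (by simp)
    rwa [add_sub_cancel_left, norm_real, Real.norm_of_nonneg hx.le, ← hQ] at h
  have hDb : ∀ x y : ℝ, 0 < x → x ≤ 1 → 0 < y → y ≤ 1 →
      ‖ψ.LFunction (1 + x + I * t) - ψ.LFunction (1 + y + I * t)‖ ≤ (d * Q ^ 2) * |x - y| := by
    intro x y hx hx1 hy hy1
    have h := norm_LFunction_sub_le ψ hψ hη0 hη1 (s := 1 + x + I * t) (s' := 1 + y + I * t)
      (by rw [hre]; linarith) (by rw [hre]; linarith)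
      ((hnorm x t hx hx1 ht).trans (by norm_num)) ((hnorm y t hy hy1 ht).trans (by norm_num))
    rw [hQ2, ← hd] at h
    refine h.trans (le_of_eq ?_)
    congr 1
    rw [show (1 + (x : ℂ) + I * t - (1 + y + I * t)) = ((x - y : ℝ) : ℂ) by push_cast; ring,
      norm_real, Real.norm_eq_abs]
  have hfin : (∀ x : ℝ, 0 < x → x ≤ 1 → ‖(ψ ^ 2).LFunction (1 + x + 2 * I * t)‖ ≤ b * Q ^ 4) →
      min (16 * C₂ ^ 3 * b * d ^ 3)⁻¹ (min (c₂ / C₂) (c₁ / 2)) * (Q ^ 20)⁻¹ ≤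
        ‖ψ.LFunction (1 + x + I * t)‖ := by
    intro hBb
    have h := norm_LFunction_ge_of_product (E := C₂ * Q) (B := b * Q ^ 4) (D := d * Q ^ 2)
      (one_le_mul_of_one_le_of_one_le hC₂ hQ1)
      (one_le_mul_of_one_le_of_one_le hb1 (one_le_pow₀ hQ1))
      (one_le_mul_of_one_le_of_one_le (by linarith) (one_le_pow₀ hQ1)) hEb hBb hDb hx hx1
    refine le_trans ?_ h
    calc _ ≤ (16 * C₂ ^ 3 * b * d ^ 3)⁻¹ * (Q ^ 13)⁻¹ := by
          gcongr
          · exact min_le_left _ _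
          · norm_num
      _ = _ := by rw [← mul_inv]; congr 1; ring
  by_cases hψ2 : ψ ^ 2 = 1
  · obtain ⟨τ, hτ⟩ : ∃ τ, τ = c₂ * (Q ^ 3)⁻¹ := ⟨_, rfl⟩
    have hτ0 : 0 < τ := by rw [hτ]; positivity
    rcases le_or_gt τ |t| with htτ | htτ
    · apply hfin
      intro y hy hy1
      rw [hψ2]
      have h := htriv q (1 + y + 2 * I * t) (by simpa using hy) (by simp; linarith)
        (by simp [abs_mul]; linarith)
      refine h.trans ?_
      rw [← hQ]
      have h1 : τ ≤ ‖(1 + y + 2 * I * t : ℂ) - 1‖ := by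
        refine le_trans ?_ (abs_im_le_norm _)
        simp [abs_mul]
        linarith
      calc C₂ * Q / ‖(1 + y + 2 * I * t : ℂ) - 1‖ ≤ C₂ * Q / τ := by gcongr
        _ = C₂ / c₂ * Q ^ 4 := by rw [hτ]; field_simp
        _ ≤ b * Q ^ 4 := by
          gcongr
          rw [hb]
          exact (le_max_right _ _).trans (le_max_right _ _)
    · rcases le_or_gt τ x with hxτ | hxτ
      · have h := ψ.norm_LFunction_product_ge_one hx t
        rw [norm_mul, norm_mul, norm_pow, norm_pow, hψ2] at h
        have h1 : ‖DirichletCharacter.LFunction (1 : DirichletCharacter ℂ q)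
            (1 + x + 2 * I * t)‖ ≤ C₂ * Q / x := by
          have h2 := htriv q (1 + x + 2 * I * t) (by simpa using hx) (by simp; linarith)
            (by simp [abs_mul]; linarith)
          refine h2.trans ?_
          rw [← hQ]
          have h3 : x ≤ ‖(1 + x + 2 * I * t : ℂ) - 1‖ := by
            refine le_trans ?_ (re_le_norm _)
            simp
          gcongr
        set l := ‖ψ.LFunction (1 + x + I * t)‖
        have h2 : 1 ≤ (C₂ * Q / x) ^ 3 * l ^ 4 * (C₂ * Q / x) := by
          refine le_trans h ?_
          gcongr
          exact hEb x hx hx1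
        have h3 : 1 ≤ (C₂ * Q / x * l) ^ 4 := by
          refine h2.trans (le_of_eq (by ring))
        have h4 : 1 ≤ C₂ * Q / x * l := by
          by_contra hcon
          exact absurd h3 (not_le.2 (pow_lt_one₀ (by positivity) (not_le.1 hcon) (by norm_num)))
        have h5 : x / (C₂ * Q) ≤ l := by
          rw [div_le_iff₀ (by positivity)]
          have : C₂ * Q / x * l = l * (C₂ * Q) / x := by ring
          rw [this, le_div_iff₀ hx] at h4
          linarith
        refine le_trans ?_ h5
        calc _ ≤ (c₂ / C₂) * (Q ^ 4)⁻¹ := by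
              gcongr
              · exact (min_le_right _ _).trans (min_le_left _ _)
              · norm_num
          _ = τ / (C₂ * Q) := by rw [hτ]; field_simp
          _ ≤ x / (C₂ * Q) := by gcongr
      · have h := norm_LFunction_sub_le ψ hψ hη0 hη1 (s := 1) (s' := 1 + x + I * t)
          (by rw [one_re]; linarith) (by rw [hre]; linarith)
          (by simp) ((hnorm x t hx hx1 ht).trans (by norm_num))
        rw [hQ2, ← hd] at h
        have h1 : ‖(1 : ℂ) - (1 + x + I * t)‖ ≤ 2 * τ := by
          refine (norm_le_abs_re_add_abs_im _).trans ?_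
          simp [abs_of_pos hx]
          linarith
        have h2 := hsieg q ψ hψ2 hψ
        rw [hQinv] at h2
        have h3 := norm_sub_norm_le (ψ.LFunction 1) (ψ.LFunction (1 + x + I * t))
        have h4 : d * Q ^ 2 * ‖(1 : ℂ) - (1 + x + I * t)‖ ≤ c₁ / 2 * Q⁻¹ := by
          calc d * Q ^ 2 * ‖(1 : ℂ) - (1 + x + I * t)‖ ≤ d * Q ^ 2 * (2 * τ) := by gcongr
            _ = min c₁ 1 / 2 * Q⁻¹ := by
              rw [hτ, hc₂]; field_simp; norm_num
            _ ≤ c₁ / 2 * Q⁻¹ := by gcongr; exact min_le_left _ _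
        calc _ ≤ (c₁ / 2) * (Q ^ 1)⁻¹ := by
              gcongr
              · exact (min_le_right _ _).trans (min_le_right _ _)
              · norm_num
          _ ≤ _ := by rw [pow_one]; linarith
  · apply hfin
    intro y hy hy1
    have h2 : (2 : ℂ) * I * t = I * ((2 * t : ℝ) : ℂ) := by push_cast; ring
    have hn : ‖1 + (y : ℂ) + 2 * I * t‖ ≤ 10 := by
      refine (norm_le_abs_re_add_abs_im _).trans ?_
      rw [h2, hre, him, abs_of_pos (by linarith), abs_mul, abs_two]
      linarith
    have h := norm_LFunction_le_rpow (ψ ^ 2) hψ2 hη0 hη1 (s := 1 + y + 2 * I * t)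
      (by rw [h2, hre]; linarith)
    rw [hQ2] at h
    refine h.trans ?_
    calc _ ≤ 10 * (Q ^ 2 * η⁻¹) := by gcongr
      _ = 10 * η⁻¹ * Q ^ 2 := by ring
      _ ≤ b * Q ^ 4 := by
        gcongr
        · rw [hb]
          exact (le_max_left _ _).trans (le_max_right _ _)
        · norm_num

end LowerBound

section LogDeriv

open Complex Metric Filter Topology LSeries
open scoped ArithmeticFunction.vonMangoldt

/-- The weight `Λ(n) (log n)^j n^{-(1+σ)}`. -/
def vonMangoldtWeight (j : ℕ) (σ : ℝ) (n : ℕ) : ℝ := Λ n * Real.log n ^ j * (n : ℝ) ^ (-(1 + σ))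

lemma vonMangoldtWeight_nonneg (j : ℕ) (σ : ℝ) (n : ℕ) : 0 ≤ vonMangoldtWeight j σ n := by
  have := Real.log_natCast_nonneg n
  have := ArithmeticFunction.vonMangoldt_nonneg (n := n)
  unfold vonMangoldtWeight
  positivity

lemma term_logMul_iterate_vonMangoldt {q : ℕ} (ψ : DirichletCharacter ℂ q) (j : ℕ) (σ t : ℝ)
    (n : ℕ) :
    LSeries.term (LSeries.logMul^[j] ((fun n : ℕ => (ψ n : ℂ)) * fun n : ℕ => (Λ n : ℂ))) (1 + σ + I * t) n =
      vonMangoldtWeight j σ n * ψ n * cexp (-(I * t * Real.log n)) := by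
  have hiter : ∀ (g : ℕ → ℂ) (m : ℕ), (LSeries.logMul^[j] g) m = (Complex.log m) ^ j * g m := by
    intro g m
    induction j generalizing g with
    | zero => simp
    | succ j ih => rw [Function.iterate_succ_apply, ih, pow_succ, mul_assoc]
  rcases eq_or_ne n 0 with rfl | hn
  · simp [vonMangoldtWeight]
  rw [LSeries.term_of_ne_zero hn, hiter, vonMangoldtWeight]
  have hn0 : (0 : ℝ) < n := by positivity
  have hnc : (n : ℂ) ≠ 0 := by exact_mod_cast hn
  have h1 : (n : ℂ) ^ (1 + (σ : ℂ) + I * t) =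
      ((n : ℝ) ^ (1 + σ) : ℝ) * cexp (I * t * Real.log n) := by
    rw [cpow_add _ _ hnc, Complex.ofReal_cpow hn0.le, Complex.cpow_def_of_ne_zero hnc (I * t),
      ← Complex.natCast_log]
    push_cast
    rw [mul_comm (Complex.log n) (I * t)]
  rw [h1, Real.rpow_neg hn0.le, Complex.exp_neg, ← Complex.natCast_log]
  simp only [Pi.mul_apply]
  push_cast
  have h2 : (((n : ℝ) ^ (1 + σ) : ℝ) : ℂ) ≠ 0 := by
    exact_mod_cast (Real.rpow_pos_of_pos hn0 _).ne'
  field_simp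

lemma abscissaOfAbsConv_twist_vonMangoldt_lt {q : ℕ} (ψ : DirichletCharacter ℂ q) {s : ℂ}
    (hs : 1 < s.re) : LSeries.abscissaOfAbsConv ((fun n : ℕ => (ψ n : ℂ)) * fun n : ℕ => (Λ n : ℂ)) < s.re := by
  have h : LSeries.abscissaOfAbsConv ((fun n : ℕ => (ψ n : ℂ)) * fun n : ℕ => (Λ n : ℂ)) ≤ 1 := by
    refine LSeries.abscissaOfAbsConv_le_of_forall_lt_LSeriesSummable fun y hy => ?_
    exact DirichletCharacter.LSeriesSummable_twist_vonMangoldt ψ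
      (by rw [ofReal_re]; exact_mod_cast hy)
  exact h.trans_lt (by exact_mod_cast hs)

lemma summable_vonMangoldtWeight (j : ℕ) {σ : ℝ} (hσ : 0 < σ) :
    Summable (vonMangoldtWeight j σ) := by
  have h := LSeriesSummable_of_abscissaOfAbsConv_lt_re
    (f := LSeries.logMul^[j] ((fun n : ℕ => ((1 : DirichletCharacter ℂ 1) n : ℂ)) *
      fun n : ℕ => (Λ n : ℂ))) (s := 1 + σ + I * (0 : ℝ))
    (by
      rw [LSeries.absicssaOfAbsConv_logPowMul]
      exact abscissaOfAbsConv_twist_vonMangoldt_lt _ (by simpa using hσ))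
  have h2 : Summable fun n => ((vonMangoldtWeight j σ n : ℝ) : ℂ) := by
    refine h.congr fun n => ?_
    rw [term_logMul_iterate_vonMangoldt]
    simp [Subsingleton.eq_one (n : ZMod 1)]
  exact_mod_cast h2

theorem exists_norm_tsum_vonMangoldtWeight_le (j : ℕ) {ε : ℝ} (hε : 0 < ε) (hε1 : ε ≤ 1) :
    ∃ C > 0, ∀ (q : ℕ) [NeZero q] (ψ : DirichletCharacter ℂ q), ψ ≠ 1 →
      ∀ σ t : ℝ, 0 < σ → σ ≤ 1 → |t| ≤ 4 →
        ‖∑' n : ℕ, (vonMangoldtWeight j σ n : ℂ) * ψ n * cexp (-(I * t * Real.log n))‖ ≤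
          C * (q : ℝ) ^ ε := by
  obtain ⟨η, hη⟩ : ∃ η, η = ε / (3 * (j + 1)) := ⟨_, rfl⟩
  have hj0 : (0 : ℝ) ≤ j := Nat.cast_nonneg j
  have hη0 : 0 < η := by rw [hη]; positivity
  have hη1 : η ≤ 1 / 2 := by
    rw [hη, div_le_div_iff₀ (by positivity) (by norm_num)]
    linarith
  obtain ⟨c, hc, hlow⟩ := exists_norm_LFunction_ge hη0 (by linarith)
  obtain ⟨d, hd⟩ : ∃ d, d = 16 * (η ^ 2)⁻¹ := ⟨_, rfl⟩
  have hd0 : 0 < d := by rw [hd]; positivity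
  obtain ⟨r, hr⟩ : ∃ r, r = min (η / 2) (c / (2 * d)) := ⟨_, rfl⟩
  have hr0 : 0 < r := by rw [hr]; positivity
  refine ⟨j.factorial * (2 * d / c) / r ^ j, by positivity, fun q _ ψ hψ σ t hσ hσ1 ht => ?_⟩
  obtain ⟨Q, hQ⟩ : ∃ Q, Q = (q : ℝ) ^ η := ⟨_, rfl⟩
  have hq1 : (1 : ℝ) ≤ q := by exact_mod_cast Nat.one_le_iff_ne_zero.2 (NeZero.ne q)
  have hQ1 : 1 ≤ Q := by rw [hQ]; exact Real.one_le_rpow hq1 hη0.le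
  have hQ0 : 0 < Q := by linarith
  have hQpow : ∀ n : ℕ, (q : ℝ) ^ ((n : ℝ) * η) = Q ^ n := fun n => by
    rw [hQ, ← Real.rpow_natCast, ← Real.rpow_mul (by linarith), mul_comm]
  have hQ2 : (q : ℝ) ^ (2 * η) = Q ^ 2 := by exact_mod_cast hQpow 2
  have hQinv : (q : ℝ) ^ (-η) = Q⁻¹ := by rw [hQ, Real.rpow_neg (by linarith)]
  have hQε : (q : ℝ) ^ ε = (Q ^ 3) ^ (j + 1) := by
    rw [← pow_mul, ← hQpow, hη]
    congr 1; push_cast; field_simp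
  obtain ⟨s, hs⟩ : ∃ s : ℂ, s = 1 + σ + I * t := ⟨_, rfl⟩
  have hsre : s.re = 1 + σ := by simp [hs]
  have hsim : s.im = t := by simp [hs]
  have hsn : ‖s‖ ≤ 6 := by
    refine (norm_le_abs_re_add_abs_im _).trans ?_
    rw [hsre, hsim, abs_of_pos (by linarith)]
    linarith
  have hL := hlow q ψ hψ σ t hσ hσ1 ht
  rw [← hs, hQinv] at hL
  have hρ0 : 0 < r / Q ^ 3 := by positivity
  have hρ1 : r / Q ^ 3 ≤ η / 2 :=
    (div_le_self hr0.le (one_le_pow₀ hQ1)).trans (hr ▸ min_le_left _ _)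
  have hpt : ∀ w ∈ closedBall s (r / Q ^ 3), 1 - η / 2 ≤ w.re ∧ ‖w‖ ≤ 7 := by
    intro w hw
    have h1 : ‖w - s‖ ≤ r / Q ^ 3 := by simpa [dist_eq_norm] using hw
    constructor
    · have := (abs_le.1 ((Complex.abs_re_le_norm (w - s)).trans h1)).1
      rw [sub_re, hsre] at this
      linarith
    · calc ‖w‖ = ‖s + (w - s)‖ := by congr 1; ring
        _ ≤ ‖s‖ + ‖w - s‖ := norm_add_le _ _
        _ ≤ 7 := by linarith
  have hLw : ∀ w ∈ closedBall s (r / Q ^ 3), c / 2 * Q⁻¹ ≤ ‖ψ.LFunction w‖ := by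
    intro w hw
    have h1 : ‖s - w‖ ≤ r / Q ^ 3 := by
      rw [norm_sub_rev]; simpa [dist_eq_norm] using hw
    have h := norm_LFunction_sub_le ψ hψ hη0 hη1 (s := s) (s' := w)
      (by rw [hsre]; linarith) (hpt w hw).1 (by linarith) (hpt w hw).2
    rw [hQ2, ← hd] at h
    have h3 := norm_sub_norm_le (ψ.LFunction s) (ψ.LFunction w)
    have h4 : d * Q ^ 2 * ‖s - w‖ ≤ c / 2 * Q⁻¹ := by
      calc d * Q ^ 2 * ‖s - w‖ ≤ d * Q ^ 2 * ((c / (2 * d)) / Q ^ 3) := by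
            gcongr
            exact h1.trans (by gcongr; exact hr ▸ min_le_right _ _)
        _ = c / 2 * Q⁻¹ := by field_simp
    linarith [show c * Q⁻¹ = c / 2 * Q⁻¹ + c / 2 * Q⁻¹ by ring]
  have hLw0 : ∀ w ∈ closedBall s (r / Q ^ 3), ψ.LFunction w ≠ 0 := fun w hw h => by
    have := hLw w hw
    rw [h, norm_zero] at this
    have : 0 < c / 2 * Q⁻¹ := by positivity
    linarith
  have hdiff := DirichletCharacter.differentiable_LFunction hψ
  have hDCC : DiffContOnCl ℂ (fun w => -deriv ψ.LFunction w / ψ.LFunction w)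
      (ball s (r / Q ^ 3)) := by
    apply DifferentiableOn.diffContOnCl
    rw [closure_ball _ hρ0.ne']
    intro w hw
    exact ((hdiff.deriv w).neg.div (hdiff w) (hLw0 w hw)).differentiableWithinAt
  have hbd := Complex.norm_iteratedDeriv_le_of_forall_mem_sphere_norm_le j hρ0 hDCC
    (C := 2 * d / c * Q ^ 3) fun w hw => by
      have hw' := sphere_subset_closedBall hw
      rw [norm_div, norm_neg, div_le_iff₀ (norm_pos_iff.2 (hLw0 w hw'))]
      have h1 := norm_deriv_LFunction_le ψ hψ hη0 hη1 (hpt w hw').1 (hpt w hw').2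
      rw [hQ2, ← hd] at h1
      calc _ ≤ d * Q ^ 2 := h1
        _ = 2 * d / c * Q ^ 3 * (c / 2 * Q⁻¹) := by field_simp
        _ ≤ _ := by gcongr; exact hLw w hw'
  have hev : (fun w => -deriv ψ.LFunction w / ψ.LFunction w) =ᶠ[𝓝 s] LSeries ((fun n : ℕ => (ψ n : ℂ)) * fun n : ℕ => (Λ n : ℂ)) := by
    have hopen : {w : ℂ | 1 < w.re} ∈ 𝓝 s :=
      (isOpen_lt continuous_const continuous_re).mem_nhds (by
        change 1 < s.re; rw [hsre]; linarith)
    filter_upwards [hopen] with w hw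
    have hw : 1 < w.re := hw
    rw [DirichletCharacter.LSeries_twist_vonMangoldt_eq ψ hw,
      DirichletCharacter.LFunction_eq_LSeries ψ hw,
      DirichletCharacter.deriv_LFunction_eq_deriv_LSeries ψ hw]
  rw [hev.iteratedDeriv_eq, LSeries_iteratedDeriv j
    (abscissaOfAbsConv_twist_vonMangoldt_lt ψ (by rw [hsre]; linarith))] at hbd
  have hsum : LSeries (LSeries.logMul^[j] ((fun n : ℕ => (ψ n : ℂ)) * fun n : ℕ => (Λ n : ℂ))) s =
      ∑' n : ℕ, (vonMangoldtWeight j σ n : ℂ) * ψ n * cexp (-(I * t * Real.log n)) := by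
    rw [LSeries, hs]
    exact tsum_congr fun n => term_logMul_iterate_vonMangoldt ψ j σ t n
  rw [norm_mul, norm_pow, norm_neg, norm_one, one_pow, one_mul, hsum] at hbd
  refine hbd.trans (le_of_eq ?_)
  rw [hQε, pow_succ, div_pow]
  field_simp
  ring

end LogDeriv

section BandLimited

open Complex Filter Topology MeasureTheory

/-- `h` is bounded by `C`, and weighted sums of `h` are bounded by `C` times any bound
for the corresponding exponential sums at frequencies of absolute value at most `T`. -/
def IsBandLimited (h : ℝ → ℝ) (T C : ℝ) : Prop :=
  (∀ u, |h u| ≤ C) ∧ ∀ (w : ℕ → ℂ) (u : ℕ → ℝ) (B : ℝ), Summable w →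
    (∀ t : ℝ, |t| ≤ T → ‖∑' n, w n * cexp (I * t * u n)‖ ≤ B) →
    ‖∑' n, w n * (h (u n) : ℂ)‖ ≤ C * B

lemma Complex.norm_exp_I_mul_mul (t u : ℝ) : ‖cexp (I * t * u)‖ = 1 := by
  rw [show I * (t : ℂ) * u = ((t * u : ℝ) : ℂ) * I by push_cast; ring]
  exact norm_exp_ofReal_mul_I _

lemma Summable.mul_of_norm_le {w : ℕ → ℂ} (hw : Summable w) {g : ℕ → ℂ} {C : ℝ}
    (hg : ∀ n, ‖g n‖ ≤ C) : Summable fun n => w n * g n :=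
  Summable.of_norm_bounded (hw.norm.mul_right C) fun n => by
    rw [norm_mul]; exact mul_le_mul_of_nonneg_left (hg n) (norm_nonneg _)

lemma IsBandLimited.mul {h g : ℝ → ℝ} {T S C D : ℝ} (hh : IsBandLimited h T C)
    (hg : IsBandLimited g S D) :
    IsBandLimited (fun u => h u * g u) (T + S) (D * C) := by
  have hD0 : 0 ≤ D := (abs_nonneg _).trans (hg.1 0)
  refine ⟨fun u => ?_, fun w u B hw hB => ?_⟩
  · rw [abs_mul, mul_comm]
    exact mul_le_mul (hg.1 u) (hh.1 u) (abs_nonneg _) hD0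
  · have h1 : ∀ t : ℝ, |t| ≤ S →
        ‖∑' n, w n * (h (u n) : ℂ) * cexp (I * t * u n)‖ ≤ C * B := by
      intro t ht
      have := hh.2 (fun n => w n * cexp (I * t * u n)) u B
        (hw.mul_of_norm_le fun n => (Complex.norm_exp_I_mul_mul t (u n)).le) fun t' ht' => by
          have := hB (t + t') ((abs_add_le t t').trans (by linarith))
          convert this using 3
          ext n
          rw [mul_assoc, ← Complex.exp_add]
          push_cast; ring_nf
      convert this using 3
      ext n; ring
    have h2 := hg.2 (fun n => w n * (h (u n) : ℂ)) u (C * B)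
      (hw.mul_of_norm_le (C := C) fun n => by
        rw [norm_real, Real.norm_eq_abs]; exact hh.1 _) h1
    rw [mul_assoc]
    convert h2 using 3
    ext n; push_cast; ring

lemma isBandLimited_sin : IsBandLimited Real.sin 1 1 := by
  refine ⟨Real.abs_sin_le_one, fun w u B hw hB => ?_⟩
  have h1 := hB 1 (by simp)
  have h2 := hB (-1) (by simp)
  have hs : ∀ t : ℝ, Summable fun n => w n * cexp (I * t * u n) := fun t =>
    hw.mul_of_norm_le fun n => (Complex.norm_exp_I_mul_mul t (u n)).le
  have : ∑' n, w n * (Real.sin (u n) : ℂ) =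
      (I / 2) * ((∑' n, w n * cexp (I * (-1 : ℝ) * u n)) -
        ∑' n, w n * cexp (I * (1 : ℝ) * u n)) := by
    rw [← (hs _).tsum_sub (hs _), ← tsum_mul_left]
    refine tsum_congr fun n => ?_
    rw [ofReal_sin, Complex.sin]
    push_cast
    ring_nf
  rw [this, norm_mul, norm_div, norm_I, Complex.norm_ofNat]
  have := norm_sub_le (∑' n, w n * cexp (I * (-1 : ℝ) * u n))
    (∑' n, w n * cexp (I * (1 : ℝ) * u n))
  linarith

lemma integral_exp_eq_two_mul_sinc (u : ℝ) :
    ∫ t in (-1 : ℝ)..1, cexp (I * t * u) = 2 * (Real.sinc u : ℂ) := by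
  by_cases hu : u = 0
  · simp [hu]; norm_num
  · have h := integral_exp_mul_complex (a := -1) (b := 1) (c := I * u)
      (mul_ne_zero I_ne_zero (ofReal_ne_zero.2 hu))
    have h' : ∀ t : ℝ, I * (t : ℂ) * u = I * u * t := fun t => by ring
    simp_rw [h']
    rw [h, Real.sinc_of_ne_zero hu]
    have hu' : (u : ℂ) ≠ 0 := ofReal_ne_zero.2 hu
    push_cast
    rw [Complex.sin]
    field_simp
    ring_nf
    simp only [I_sq]
    ring_nf

lemma isBandLimited_sinc : IsBandLimited Real.sinc 1 1 := by
  refine ⟨Real.abs_sinc_le_one, fun w u B hw hB => ?_⟩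
  have h := intervalIntegral.hasSum_integral_of_dominated_convergence (μ := volume)
    (a := -1) (b := 1) (F := fun n (t : ℝ) => w n * cexp (I * t * u n))
    (f := fun t => ∑' n, w n * cexp (I * t * u n)) (fun n _ => ‖w n‖)
    (fun n => (by fun_prop : Continuous fun t : ℝ =>
      w n * cexp (I * t * u n)).aestronglyMeasurable)
    (fun n => ae_of_all _ fun t _ => by
      rw [norm_mul, Complex.norm_exp_I_mul_mul, mul_one])
    (ae_of_all _ fun t _ => hw.norm)
    (by simp)
    (ae_of_all _ fun t _ => (hw.mul_of_norm_le fun n =>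
      (Complex.norm_exp_I_mul_mul t (u n)).le).hasSum)
  have h2 : ∀ n, ∫ t in (-1 : ℝ)..1, w n * cexp (I * t * u n) =
      2 * (w n * (Real.sinc (u n) : ℂ)) := fun n => by
    rw [intervalIntegral.integral_const_mul, integral_exp_eq_two_mul_sinc]; ring
  simp_rw [h2] at h
  have h3 := h.tsum_eq
  rw [tsum_mul_left] at h3
  have h4 := intervalIntegral.norm_integral_le_of_norm_le_const (a := -1) (b := 1) (C := B)
    (f := fun t : ℝ => ∑' n, w n * cexp (I * t * u n)) fun t ht => hB t (by
      rw [Set.uIoc_of_le (by norm_num)] at ht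
      exact abs_le.2 ⟨ht.1.le, ht.2⟩)
  rw [← h3, norm_mul] at h4
  norm_num at h4 ⊢
  linarith

/-- A band-limited kernel that is negative outside `[-A, A]`. -/
def localizingKernel (A u : ℝ) : ℝ := (A ^ 2 - u ^ 2) * Real.sinc u ^ 4

lemma mul_sinc (u : ℝ) : u * Real.sinc u = Real.sin u := by
  by_cases hu : u = 0
  · simp [hu]
  · rw [Real.sinc_of_ne_zero hu]; field_simp

lemma localizingKernel_le (A u : ℝ) : localizingKernel A u ≤ A ^ 2 := by
  have h1 : Real.sinc u ^ 4 ≤ 1 := by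
    rw [← Even.pow_abs (by decide)]; exact pow_le_one₀ (abs_nonneg _) (Real.abs_sinc_le_one u)
  have h0 : 0 ≤ Real.sinc u ^ 4 := by positivity
  unfold localizingKernel
  nlinarith [mul_nonneg (sq_nonneg u) h0, sq_nonneg A]

lemma localizingKernel_nonpos {A u : ℝ} (hA : 0 ≤ A) (hu : A ≤ |u|) :
    localizingKernel A u ≤ 0 := by
  have h1 : A ^ 2 ≤ u ^ 2 := by rw [← sq_abs u]; gcongr
  have h0 : 0 ≤ Real.sinc u ^ 4 := by positivity
  unfold localizingKernel
  nlinarith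

lemma norm_tsum_mul_localizingKernel_le (A : ℝ) {w : ℕ → ℂ} {u : ℕ → ℝ} {B : ℝ}
    (hw : Summable w) (hB : ∀ t : ℝ, |t| ≤ 4 → ‖∑' n, w n * cexp (I * t * u n)‖ ≤ B) :
    ‖∑' n, w n * (localizingKernel A (u n) : ℂ)‖ ≤ (A ^ 2 + 1) * B := by
  have hc2 := isBandLimited_sinc.mul isBandLimited_sinc
  have hs2 := isBandLimited_sin.mul isBandLimited_sin
  have hc4 := hc2.mul hc2
  have hsc := hs2.mul hc2
  norm_num at hc4 hsc
  have e1 := hc4.2 w u B hw hB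
  have e2 := hsc.2 w u B hw hB
  have hs1 := hw.mul_of_norm_le (g := fun n => ((Real.sinc (u n) * Real.sinc (u n) *
    (Real.sinc (u n) * Real.sinc (u n)) : ℝ) : ℂ)) (C := 1) fun n => by
      rw [norm_real]; exact hc4.1 _
  have hs2 := hw.mul_of_norm_le (g := fun n => ((Real.sin (u n) * Real.sin (u n) *
    (Real.sinc (u n) * Real.sinc (u n)) : ℝ) : ℂ)) (C := 1) fun n => by
      rw [norm_real]; exact hsc.1 _
  have : ∑' n, w n * (localizingKernel A (u n) : ℂ) =
      (A ^ 2 : ℂ) * (∑' n, w n * ((Real.sinc (u n) * Real.sinc (u n) *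
        (Real.sinc (u n) * Real.sinc (u n)) : ℝ) : ℂ)) -
      ∑' n, w n * ((Real.sin (u n) * Real.sin (u n) *
        (Real.sinc (u n) * Real.sinc (u n)) : ℝ) : ℂ) := by
    rw [← tsum_mul_left, ← (hs1.mul_left _).tsum_sub hs2]
    refine tsum_congr fun n => ?_
    rw [localizingKernel, ← mul_sinc]
    push_cast
    ring
  rw [this]
  refine (norm_sub_le _ _).trans ?_
  rw [norm_mul]
  have hA2 : ‖(A ^ 2 : ℂ)‖ = A ^ 2 := by
    rw [norm_pow, norm_real, Real.norm_eq_abs, sq_abs]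
  rw [hA2]
  nlinarith [mul_le_mul_of_nonneg_left e1 (sq_nonneg A)]

end BandLimited

section ChebyshevSums

open Filter Topology
open scoped ArithmeticFunction.vonMangoldt

lemma summable_one_div_one_add_int_sq : Summable fun i : ℤ => 1 / (1 + (i : ℝ) ^ 2) := by
  have h1 : Summable fun i : ℤ => 1 / (i : ℝ) ^ 2 :=
    Real.summable_one_div_int_pow.2 one_lt_two
  have h2 : Summable fun i : ℤ => if i = 0 then (1 : ℝ) else 0 :=
    summable_of_ne_finset_zero (s := {0}) fun b hb => if_neg (by simpa using hb)
  refine Summable.of_nonneg_of_le (fun i => by positivity) (fun i => ?_) (h1.add h2)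
  by_cases hi : i = 0
  · simp [hi]
  · have : (0 : ℝ) < (i : ℝ) ^ 2 := by positivity
    rw [if_neg hi, add_zero]
    exact one_div_le_one_div_of_le this (by linarith)

lemma exists_sum_vonMangoldt_div_le : ∃ C > 0, ∀ Y : ℝ, 0 < Y → ∀ s : Finset ℕ,
    ∑ n ∈ s, Λ n / n * (1 / (1 + (Real.log n - Real.log Y) ^ 2)) ≤ C := by
  have hlog4 : 0 < Real.log 4 := Real.log_pos (by norm_num)
  set c : ℝ := (Real.log 4 + 4) * Real.exp 1 with hc
  have hc0 : 0 < c := by positivity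
  refine ⟨4 * c * (∑' i : ℤ, 1 / (1 + (i : ℝ) ^ 2) + 1), by
    have : 0 ≤ ∑' i : ℤ, 1 / (1 + (i : ℝ) ^ 2) := tsum_nonneg fun i => by positivity
    positivity, fun Y hY s => ?_⟩
  set i : ℕ → ℤ := fun n => ⌊Real.log n - Real.log Y⌋ with hi
  have hblock : ∀ z : ℤ, ∑ n ∈ s with i n = z, Λ n / n ≤ c := by
    intro z
    have hE : 0 < Y * Real.exp z := by positivity
    have h1 : ∀ n ∈ s.filter (fun n => i n = z), Λ n / n ≤ Λ n / (Y * Real.exp z) := by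
      intro n hn
      rcases Nat.eq_zero_or_pos n with rfl | hn0
      · simp
      have hz := (Finset.mem_filter.1 hn).2
      have h2 : (z : ℝ) ≤ Real.log n - Real.log Y := hz ▸ Int.floor_le _
      have h3 : Y * Real.exp z ≤ n := by
        rw [← Real.log_le_log_iff hE (by positivity), Real.log_mul hY.ne' (by positivity),
          Real.log_exp]
        linarith
      exact div_le_div_of_nonneg_left ArithmeticFunction.vonMangoldt_nonneg hE h3
    refine (Finset.sum_le_sum h1).trans ?_
    rw [← Finset.sum_div, div_le_iff₀ hE]
    have h4 : ∑ n ∈ s with i n = z, Λ n ≤ Chebyshev.psi (Y * Real.exp (z + 1)) := by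
      rw [Chebyshev.psi, ← Finset.sum_filter_ne_zero]
      refine Finset.sum_le_sum_of_subset_of_nonneg (fun n hn => ?_)
        fun _ _ _ => ArithmeticFunction.vonMangoldt_nonneg
      simp only [Finset.mem_filter] at hn
      have hn0 : 0 < n := Nat.pos_of_ne_zero fun h => hn.2 (by simp [h])
      have h2 : Real.log n - Real.log Y < z + 1 := hn.1.2 ▸ Int.lt_floor_add_one _
      refine Finset.mem_Ioc.2 ⟨hn0, Nat.le_floor ?_⟩
      rw [← Real.log_le_log_iff (by positivity) (by positivity),
        Real.log_mul hY.ne' (by positivity), Real.log_exp]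
      linarith
    refine h4.trans ((Chebyshev.psi_le_const_mul_self (by positivity)).trans (le_of_eq ?_))
    rw [Real.exp_add, hc]; ring
  have hle : ∀ n ∈ s, Λ n / n * (1 / (1 + (Real.log n - Real.log Y) ^ 2)) ≤
      4 * (1 / (1 + (i n : ℝ) ^ 2)) * (Λ n / n) := by
    intro n _
    set u := Real.log n - Real.log Y with hu
    have h1 : (i n : ℝ) ≤ u := Int.floor_le _
    have h2 : u < i n + 1 := Int.lt_floor_add_one _
    have hb : 1 / (1 + u ^ 2) ≤ 4 * (1 / (1 + (i n : ℝ) ^ 2)) := by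
      rw [mul_one_div, div_le_div_iff₀ (by positivity) (by positivity)]
      nlinarith [sq_nonneg (2 * u - i n), sq_nonneg (u - i n)]
    rw [mul_comm (Λ n / n)]
    gcongr
  refine (Finset.sum_le_sum hle).trans ?_
  rw [← Finset.sum_fiberwise_of_maps_to (g := i) (t := s.image i)
    fun n hn => Finset.mem_image_of_mem i hn]
  have hz : ∀ z ∈ s.image i, ∑ n ∈ s with i n = z, 4 * (1 / (1 + (i n : ℝ) ^ 2)) * (Λ n / n) ≤
      4 * c * (1 / (1 + (z : ℝ) ^ 2)) := by
    intro z _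
    have : ∑ n ∈ s with i n = z, 4 * (1 / (1 + (i n : ℝ) ^ 2)) * (Λ n / n) =
        4 * (1 / (1 + (z : ℝ) ^ 2)) * ∑ n ∈ s with i n = z, Λ n / n := by
      rw [Finset.mul_sum]
      refine Finset.sum_congr rfl fun n hn => ?_
      rw [(Finset.mem_filter.1 hn).2]
    rw [this]
    calc _ ≤ 4 * (1 / (1 + (z : ℝ) ^ 2)) * c := by gcongr; exact hblock z
      _ = _ := by ring
  refine (Finset.sum_le_sum hz).trans ?_
  rw [← Finset.mul_sum]
  gcongr
  have := summable_one_div_one_add_int_sq.sum_le_tsum (s.image i) fun i _ => by positivity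
  linarith

lemma vonMangoldtWeight_le (j : ℕ) {ℒ : ℝ} (hℒ : 0 < ℒ) (n : ℕ) :
    vonMangoldtWeight j (1 / ℒ) n ≤ j.factorial * ℒ ^ j * (Λ n / n) := by
  rcases Nat.eq_zero_or_pos n with rfl | hn
  · simp [vonMangoldtWeight]
  have hn1 : (0 : ℝ) < n := by exact_mod_cast hn
  have hl : 0 ≤ Real.log n := Real.log_natCast_nonneg n
  have h1 : Real.log n ^ j * (n : ℝ) ^ (-(1 / ℒ)) ≤ j.factorial * ℒ ^ j := by
    have h2 := Real.pow_div_factorial_le_exp (Real.log n / ℒ) (by positivity) j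
    rw [div_le_iff₀ (by positivity), div_pow, div_le_iff₀ (by positivity)] at h2
    rw [Real.rpow_def_of_pos hn1, mul_neg, Real.exp_neg, ← div_eq_mul_inv,
      div_le_iff₀ (Real.exp_pos _), mul_one_div]
    linarith
  rw [vonMangoldtWeight, neg_add, Real.rpow_add hn1, Real.rpow_neg_one]
  calc _ = Λ n / n * (Real.log n ^ j * (n : ℝ) ^ (-(1 / ℒ))) := by ring
    _ ≤ Λ n / n * (j.factorial * ℒ ^ j) := by
      gcongr
    _ = _ := by ring

lemma eventually_theta_sub_theta_ge : ∀ᶠ Y : ℝ in atTop,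
    Y ≤ Chebyshev.theta (Real.exp 1 * Y) - Chebyshev.theta (Y / Real.exp 1) := by
  have hlog : Tendsto (fun x : ℝ => (Real.log (x + 2) + 2 * √x * Real.log x + 1) / x) atTop
      (𝓝 0) := by
    have h1 : (fun x : ℝ => Real.log (x + 2)) =o[atTop] (fun x : ℝ => x) := by
      have h2 : (fun x : ℝ => Real.log (x + 2)) =o[atTop] (fun x : ℝ => x + 2) :=
        Real.isLittleO_log_id_atTop.comp_tendsto
          (tendsto_atTop_add_const_right _ 2 tendsto_id)
      refine h2.trans_isBigO ?_
      refine (Asymptotics.isBigO_refl _ _).add ?_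
      exact (Asymptotics.isLittleO_const_id_atTop (2 : ℝ)).isBigO
    have h3 : (fun x : ℝ => 2 * √x * Real.log x) =o[atTop] (fun x : ℝ => x) := by
      have h4 := (isLittleO_log_rpow_atTop (r := 1 / 2) (by norm_num))
      have h5 := ((Asymptotics.isBigO_refl (fun x : ℝ => √x) atTop).const_mul_left 2).mul_isLittleO
        h4
      refine h5.congr' EventuallyEq.rfl ?_
      filter_upwards [eventually_ge_atTop 0] with x hx
      rw [← Real.sqrt_eq_rpow, Real.mul_self_sqrt hx]
    exact ((h1.add h3).add (Asymptotics.isLittleO_const_id_atTop (1 : ℝ))).tendsto_div_nhds_zero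
  have he : Tendsto (fun Y : ℝ => Real.exp 1 * Y) atTop atTop :=
    tendsto_id.const_mul_atTop (Real.exp_pos 1)
  have h0 := (hlog.comp he).eventually (gt_mem_nhds (show (0 : ℝ) < 1 / 100 by norm_num))
  filter_upwards [h0, eventually_ge_atTop 1] with Y hY hY1
  have e1 := Real.exp_one_gt_d9
  have e2 := Real.exp_one_lt_d9
  have l1 := Real.log_two_gt_d9
  have l2 := Real.log_two_lt_d9
  have hl4 : Real.log 4 = 2 * Real.log 2 := by
    rw [show (4 : ℝ) = 2 ^ 2 by norm_num, Real.log_pow]; norm_num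
  have hpos : 0 < Real.exp 1 * Y := by positivity
  simp only [Function.comp] at hY
  rw [div_lt_iff₀ hpos] at hY
  have ha := Chebyshev.theta_ge' (x := Real.exp 1 * Y) (by nlinarith)
  have hb := Chebyshev.theta_le_log4_mul_x (x := Y / Real.exp 1) (by positivity)
  have hb2 : Y / Real.exp 1 ≤ Y * (2 / 5) := by
    rw [div_le_iff₀ (Real.exp_pos 1)]; nlinarith
  rw [hl4] at hb
  have hb3 : Chebyshev.theta (Y / Real.exp 1) ≤ 2 * Real.log 2 * (Y * (2 / 5)) :=
    hb.trans (by gcongr)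
  have h7 : Real.exp 1 * Y * (Real.log 2 - 1 / 100) ≥ 2.7 * Y * 0.68 := by
    have : 0 ≤ Y := by linarith
    gcongr <;> linarith
  nlinarith

end ChebyshevSums

section PrimesInProgressions

open Filter Topology
open scoped ArithmeticFunction.vonMangoldt

lemma one_fourth_le_sinc_pow_four {u : ℝ} (hu : |u| ≤ 1) : 1 / 4 ≤ Real.sinc u ^ 4 := by
  have key : ∀ v : ℝ, 0 < v → v ≤ 1 → 3 / 4 ≤ Real.sinc v := fun v hv hv1 => by
    rw [Real.sinc_of_ne_zero hv.ne', le_div_iff₀ hv]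
    have := Real.sin_gt_sub_cube hv
    nlinarith [mul_pos hv hv, mul_nonneg hv.le (sub_nonneg.2 hv1)]
  have h : 3 / 4 ≤ Real.sinc u := by
    rcases lt_trichotomy u 0 with h | h | h
    · rw [← Real.sinc_neg]
      exact key _ (by linarith) (by linarith [neg_abs_le u])
    · rw [h, Real.sinc_zero]; norm_num
    · exact key u h ((le_abs_self u).trans hu)
  calc (1 : ℝ) / 4 ≤ (3 / 4) ^ 4 := by norm_num
    _ ≤ _ := by gcongr

lemma le_localizingKernel (A u : ℝ) :
    A ^ 2 / 4 * (if |u| ≤ 1 then 1 else 0) - 2 * (1 / (1 + u ^ 2)) ≤ localizingKernel A u := by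
  have h1 : A ^ 2 / 4 * (if |u| ≤ 1 then 1 else 0) ≤ A ^ 2 * Real.sinc u ^ 4 := by
    split_ifs with h
    · nlinarith [one_fourth_le_sinc_pow_four h, sq_nonneg A]
    · rw [mul_zero]; positivity
  have h2 : u ^ 2 * Real.sinc u ^ 4 ≤ 2 * (1 / (1 + u ^ 2)) := by
    have hs : (u * Real.sinc u) ^ 2 ≤ 1 := by rw [mul_sinc]; exact Real.sin_sq_le_one u
    have hc : Real.sinc u ^ 2 ≤ 1 := by
      rw [← sq_abs]; exact pow_le_one₀ (abs_nonneg _) (Real.abs_sinc_le_one u)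
    rw [mul_one_div, le_div_iff₀ (by positivity)]
    have e1 : u ^ 2 * Real.sinc u ^ 4 = (u * Real.sinc u) ^ 2 * Real.sinc u ^ 2 := by ring
    have e2 : u ^ 2 * Real.sinc u ^ 4 * u ^ 2 = (u * Real.sinc u) ^ 2 * (u * Real.sinc u) ^ 2 := by
      ring
    have f1 := mul_le_one₀ hs (sq_nonneg _) hc
    have f2 := mul_le_one₀ hs (sq_nonneg _) hs
    linarith
  unfold localizingKernel
  linarith

lemma abs_localizingKernel_le (A u : ℝ) : |localizingKernel A u| ≤ A ^ 2 + 2 := by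
  rw [abs_le]
  refine ⟨?_, (localizingKernel_le A u).trans (by linarith)⟩
  have h := le_localizingKernel A u
  have h2 : 1 / (1 + u ^ 2) ≤ 1 := by
    rw [div_le_one (by positivity)]; nlinarith
  have h3 : (0 : ℝ) ≤ A ^ 2 / 4 * (if |u| ≤ 1 then 1 else 0) := by
    split_ifs <;> positivity
  nlinarith [sq_nonneg A]

lemma eventually_sum_primes_vonMangoldtWeight_ge (j : ℕ) : ∀ᶠ Y : ℝ in atTop,
    Real.log Y ^ j / (2 ^ j * Real.exp 3) ≤
      ∑ p ∈ (Finset.Ioc ⌊Y / Real.exp 1⌋₊ ⌊Real.exp 1 * Y⌋₊).filter Nat.Prime,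
        vonMangoldtWeight j (1 / Real.log Y) p := by
  filter_upwards [eventually_theta_sub_theta_ge, eventually_ge_atTop (Real.exp 2)] with Y hY hY2
  have hY0 : 0 < Y := (Real.exp_pos 2).trans_le hY2
  have hℒ : 2 ≤ Real.log Y := by rwa [Real.le_log_iff_exp_le hY0]
  have hle : ⌊Y / Real.exp 1⌋₊ ≤ ⌊Real.exp 1 * Y⌋₊ := by
    refine Nat.floor_le_floor ?_
    have h1 : (1 : ℝ) ≤ Real.exp 1 := Real.one_le_exp zero_le_one
    calc Y / Real.exp 1 ≤ Y := div_le_self hY0.le h1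
      _ ≤ _ := by nlinarith
  have hsub : Chebyshev.theta (Real.exp 1 * Y) - Chebyshev.theta (Y / Real.exp 1) =
      ∑ p ∈ (Finset.Ioc ⌊Y / Real.exp 1⌋₊ ⌊Real.exp 1 * Y⌋₊).filter Nat.Prime, Real.log p := by
    rw [Chebyshev.theta, Chebyshev.theta, sub_eq_iff_eq_add', Finset.sum_filter,
      Finset.sum_filter, Finset.sum_filter]
    exact (Finset.sum_Ioc_consecutive _ (Nat.zero_le _) hle).symm
  rw [hsub] at hY
  have hpt : ∀ p ∈ (Finset.Ioc ⌊Y / Real.exp 1⌋₊ ⌊Real.exp 1 * Y⌋₊).filter Nat.Prime,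
      Real.log p * (Real.log Y ^ j / (2 ^ j * Real.exp 3) / Y) ≤
        vonMangoldtWeight j (1 / Real.log Y) p := by
    intro p hp
    obtain ⟨hp1, hpp⟩ := Finset.mem_filter.1 hp
    obtain ⟨ha, hb⟩ := Finset.mem_Ioc.1 hp1
    have ha' : Y / Real.exp 1 < p := (Nat.floor_lt (by positivity)).1 ha
    have hb' : (p : ℝ) ≤ Real.exp 1 * Y := (Nat.le_floor_iff (by positivity)).1 hb
    have hp0 : (0 : ℝ) < p := by exact_mod_cast hpp.pos
    have hlog : Real.log Y / 2 ≤ Real.log p := by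
      have := Real.log_le_log (by positivity) ha'.le
      rw [Real.log_div hY0.ne' (Real.exp_pos 1).ne', Real.log_exp] at this
      linarith
    have hpow : Real.exp (-3) / Y ≤ (p : ℝ) ^ (-(1 + 1 / Real.log Y)) := by
      have h1 : (Real.exp 1 * Y) ^ (-(1 + 1 / Real.log Y)) ≤
          (p : ℝ) ^ (-(1 + 1 / Real.log Y)) :=
        Real.rpow_le_rpow_of_nonpos hp0 hb' (by
          have : 0 < 1 / Real.log Y := by positivity
          linarith)
      refine le_trans ?_ h1
      rw [Real.rpow_def_of_pos (by positivity), Real.log_mul (Real.exp_pos 1).ne' hY0.ne',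
        Real.log_exp]
      have h2 : (1 + Real.log Y) * -(1 + 1 / Real.log Y) =
          -(2 + 1 / Real.log Y) - Real.log Y := by
        field_simp; ring
      rw [h2, Real.exp_sub, Real.exp_log hY0]
      gcongr
      have : 1 / Real.log Y ≤ 1 := by rw [div_le_one (by linarith)]; linarith
      linarith
    rw [vonMangoldtWeight, ArithmeticFunction.vonMangoldt_apply_prime hpp, mul_assoc]
    refine mul_le_mul_of_nonneg_left ?_ (Real.log_natCast_nonneg p)
    calc Real.log Y ^ j / (2 ^ j * Real.exp 3) / Y
        = (Real.log Y / 2) ^ j * (Real.exp (-3) / Y) := by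
          rw [Real.exp_neg, div_pow]; field_simp
      _ ≤ _ := by gcongr
  refine le_trans ?_ (Finset.sum_le_sum hpt)
  rw [← Finset.sum_mul]
  have hpos : 0 ≤ Real.log Y ^ j / (2 ^ j * Real.exp 3) / Y := by positivity
  calc Real.log Y ^ j / (2 ^ j * Real.exp 3) =
      Y * (Real.log Y ^ j / (2 ^ j * Real.exp 3) / Y) := by field_simp
    _ ≤ _ := mul_le_mul_of_nonneg_right hY hpos

/-- The summand attached to `n` in the localized weighted prime sum. -/
def localizedWeight (j : ℕ) (A Y : ℝ) (n : ℕ) : ℝ :=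
  vonMangoldtWeight j (1 / Real.log Y) n * localizingKernel A (Real.log n - Real.log Y)

lemma summable_localizedWeight (j : ℕ) (A : ℝ) {Y : ℝ} (hY : 1 < Y) :
    Summable (localizedWeight j A Y) := by
  refine Summable.of_norm_bounded ((summable_vonMangoldtWeight j
    (one_div_pos.2 (Real.log_pos hY))).mul_right (A ^ 2 + 2)) fun n => ?_
  rw [localizedWeight, norm_mul, Real.norm_of_nonneg (vonMangoldtWeight_nonneg _ _ _)]
  exact mul_le_mul_of_nonneg_left (abs_localizingKernel_le _ _) (vonMangoldtWeight_nonneg _ _ _)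

lemma exists_tsum_localizedWeight_coprime_ge (j : ℕ) : ∃ A > 0, ∀ᶠ Y : ℝ in atTop,
    ∀ q : ℕ, q ≠ 0 → (q : ℝ) ≤ Y / Real.exp 1 →
      Real.log Y ^ j ≤ ∑' n : ℕ, if n.Coprime q then localizedWeight j A Y n else 0 := by
  obtain ⟨C, hC, hCb⟩ := exists_sum_vonMangoldt_div_le
  set D : ℝ := 4 * (2 ^ j * Real.exp 3) * (1 + 2 * (j.factorial * C)) with hD
  have hD0 : 0 < D := by positivity
  refine ⟨√D, Real.sqrt_pos.2 hD0, ?_⟩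
  filter_upwards [eventually_sum_primes_vonMangoldtWeight_ge j, eventually_gt_atTop 1]
    with Y hY hY1 q hq0 hq
  have hY0 : 0 < Y := by linarith
  have hℒ : 0 < Real.log Y := Real.log_pos hY1
  set w := vonMangoldtWeight j (1 / Real.log Y) with hw
  set u : ℕ → ℝ := fun n => Real.log n - Real.log Y with hu
  have hw0 : ∀ n, 0 ≤ w n := fun n => vonMangoldtWeight_nonneg _ _ _
  set S := (Finset.Ioc ⌊Y / Real.exp 1⌋₊ ⌊Real.exp 1 * Y⌋₊).filter Nat.Prime with hS
  have hA2 : √D ^ 2 = D := Real.sq_sqrt hD0.le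
  have hSw : ∀ n ∈ S, |u n| ≤ 1 ∧ n.Coprime q := by
    intro p hp
    obtain ⟨hp1, hpp⟩ := Finset.mem_filter.1 hp
    obtain ⟨ha, hb⟩ := Finset.mem_Ioc.1 hp1
    have ha' : Y / Real.exp 1 < p := (Nat.floor_lt (by positivity)).1 ha
    have hb' : (p : ℝ) ≤ Real.exp 1 * Y := (Nat.le_floor_iff (by positivity)).1 hb
    have hp0 : (0 : ℝ) < p := by exact_mod_cast hpp.pos
    constructor
    · have h1 := Real.log_le_log (by positivity) ha'.le
      have h2 := Real.log_le_log hp0 hb'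
      rw [Real.log_div hY0.ne' (Real.exp_pos 1).ne', Real.log_exp] at h1
      rw [Real.log_mul (Real.exp_pos 1).ne' hY0.ne', Real.log_exp] at h2
      exact abs_le.2 ⟨by simp only [hu]; linarith, by simp only [hu]; linarith⟩
    · refine (Nat.Prime.coprime_iff_not_dvd hpp).2 fun hd => ?_
      have : (p : ℝ) ≤ q := by exact_mod_cast Nat.le_of_dvd (Nat.pos_of_ne_zero hq0) hd
      linarith
  have hb_nn : ∀ n, 0 ≤ w n * (1 / (1 + u n ^ 2)) := fun n => by
    have := hw0 n; positivity
  have hb_le : ∀ s : Finset ℕ, ∑ n ∈ s, w n * (1 / (1 + u n ^ 2)) ≤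
      j.factorial * Real.log Y ^ j * C := by
    intro s
    calc _ ≤ ∑ n ∈ s, j.factorial * Real.log Y ^ j *
          (Λ n / n * (1 / (1 + (Real.log n - Real.log Y) ^ 2))) := by
          refine Finset.sum_le_sum fun n _ => ?_
          rw [← mul_assoc]
          exact mul_le_mul_of_nonneg_right (vonMangoldtWeight_le j hℒ n) (by positivity)
      _ ≤ _ := by
          rw [← Finset.mul_sum]
          exact mul_le_mul_of_nonneg_left (hCb Y hY0 s) (by positivity)
  have hb_sum : Summable fun n => w n * (1 / (1 + u n ^ 2)) :=
    summable_of_sum_le hb_nn hb_le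
  have hb_tsum : ∑' n, w n * (1 / (1 + u n ^ 2)) ≤ j.factorial * Real.log Y ^ j * C :=
    Real.tsum_le_of_sum_le hb_nn hb_le
  set F : ℕ → ℝ := fun n => if n ∈ S then D / 4 * w n else 0 with hF
  have hFs : Summable F := summable_of_ne_finset_zero (s := S) fun n hn => if_neg hn
  have hFt : ∑' n, F n = D / 4 * ∑ n ∈ S, w n := by
    rw [tsum_eq_sum (s := S) fun n hn => if_neg hn, Finset.mul_sum]
    exact Finset.sum_congr rfl fun n hn => if_pos hn
  have hpt : ∀ n, F n - 2 * (w n * (1 / (1 + u n ^ 2))) ≤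
      if n.Coprime q then localizedWeight j (√D) Y n else 0 := by
    intro n
    have hk := mul_le_mul_of_nonneg_left (le_localizingKernel (√D) (u n)) (hw0 n)
    rw [hA2] at hk
    by_cases hn : n ∈ S
    · rw [if_pos (hSw n hn).2]
      simp only [hF, if_pos hn]
      rw [if_pos (hSw n hn).1] at hk
      refine le_trans (le_of_eq ?_) hk
      ring
    · simp only [hF, if_neg hn]
      split_ifs with hc
      · refine le_trans ?_ hk
        have : (0 : ℝ) ≤ w n * (D / 4 * (if |u n| ≤ 1 then 1 else 0)) := by
          have := hw0 n
          split_ifs <;> positivity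
        linarith [mul_sub (w n) (D / 4 * (if |u n| ≤ 1 then 1 else 0)) (2 * (1 / (1 + u n ^ 2)))]
      · linarith [hb_nn n]
  have hgs : Summable fun n : ℕ => if n.Coprime q then localizedWeight j (√D) Y n else 0 := by
    refine Summable.of_norm_bounded (summable_localizedWeight j (√D) hY1).norm fun n => ?_
    split_ifs <;> simp
  refine le_trans ?_ (Summable.tsum_le_tsum hpt (hFs.sub (hb_sum.mul_left 2)) hgs)
  rw [hFs.tsum_sub (hb_sum.mul_left 2), tsum_mul_left, hFt]
  have h1 : D / 4 * (Real.log Y ^ j / (2 ^ j * Real.exp 3)) =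
      (1 + 2 * (j.factorial * C)) * Real.log Y ^ j := by
    rw [hD]; field_simp
  have h2 := mul_le_mul_of_nonneg_left hY (by positivity : 0 ≤ D / 4)
  rw [h1] at h2
  linarith

end PrimesInProgressions

section PrimesInProgressionsMain

open Filter Topology
open scoped ArithmeticFunction.vonMangoldt

lemma exists_norm_tsum_localizedWeight_char_le (j : ℕ) (A : ℝ) : ∃ C > 0, ∀ Y : ℝ,
    Real.exp 1 ≤ Y → ∀ (q : ℕ) [NeZero q] (ψ : DirichletCharacter ℂ q), ψ ≠ 1 →
      ‖∑' n : ℕ, (localizedWeight j A Y n : ℂ) * ψ n‖ ≤ C * q := by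
  obtain ⟨C, hC, hCb⟩ := exists_norm_tsum_vonMangoldtWeight_le j one_pos le_rfl
  refine ⟨(A ^ 2 + 1) * C, by positivity, fun Y hY q _ ψ hψ => ?_⟩
  have hℒ : 1 ≤ Real.log Y := by rwa [Real.le_log_iff_exp_le ((Real.exp_pos 1).trans_le hY)]
  have hσ : 0 < 1 / Real.log Y := by positivity
  have hs : Summable fun n : ℕ => (vonMangoldtWeight j (1 / Real.log Y) n : ℂ) * ψ n :=
    (Complex.ofRealCLM.summable (summable_vonMangoldtWeight j hσ)).mul_of_norm_le
      (C := 1) fun n => DirichletCharacter.norm_le_one ψ n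
  have h := norm_tsum_mul_localizingKernel_le A (u := fun n => Real.log n - Real.log Y)
    (B := C * q) hs fun t ht => by
      have h1 := hCb q ψ hψ (1 / Real.log Y) (-t) hσ
        (by rw [div_le_one (by linarith)]; exact hℒ) (by rwa [abs_neg])
      rw [Real.rpow_one] at h1
      refine le_trans (le_of_eq ?_) h1
      have h2 : ∀ n : ℕ, (vonMangoldtWeight j (1 / Real.log Y) n : ℂ) * ψ n *
          Complex.exp (Complex.I * t * ((Real.log n - Real.log Y : ℝ) : ℂ)) =
          Complex.exp (Complex.I * t * ((-Real.log Y : ℝ) : ℂ)) *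
          ((vonMangoldtWeight j (1 / Real.log Y) n : ℂ) * ψ n *
            Complex.exp (-(Complex.I * ((-t : ℝ) : ℂ) * (Real.log n : ℝ)))) := fun n => by
        rw [mul_left_comm, ← Complex.exp_add]
        push_cast; ring_nf
      simp_rw [h2]
      rw [tsum_mul_left, norm_mul, Complex.norm_exp_I_mul_mul, one_mul]
  rw [mul_assoc]
  refine le_trans (le_of_eq ?_) h
  congr 2
  ext n
  rw [localizedWeight]; push_cast; ring

lemma totient_mul_tsum_localizedWeight (j : ℕ) (A : ℝ) {Y : ℝ} (hY : 1 < Y) (q : ℕ) [NeZero q]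
    {v : ZMod q} (hv : IsUnit v) :
    ((q.totient * ∑' n : ℕ, if (n : ZMod q) = v then localizedWeight j A Y n else 0 : ℝ) : ℂ) =
      ∑ ψ : DirichletCharacter ℂ q, ψ v⁻¹ * ∑' n : ℕ, (localizedWeight j A Y n : ℂ) * ψ n := by
  have hs : ∀ ψ : DirichletCharacter ℂ q,
      Summable fun n : ℕ => (localizedWeight j A Y n : ℂ) * ψ n := fun ψ =>
    (Complex.ofRealCLM.summable (summable_localizedWeight j A hY)).mul_of_norm_le
      (C := 1) fun n => DirichletCharacter.norm_le_one ψ n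
  simp_rw [← tsum_mul_left]
  rw [← Summable.tsum_finsetSum fun ψ _ => (hs ψ).mul_left _]
  push_cast
  refine tsum_congr fun n => ?_
  have h := DirichletCharacter.sum_char_inv_mul_char_eq ℂ hv (n : ZMod q)
  have h2 : ∑ ψ : DirichletCharacter ℂ q, ψ v⁻¹ * ((localizedWeight j A Y n : ℂ) * ψ n) =
      localizedWeight j A Y n * ∑ ψ : DirichletCharacter ℂ q, ψ v⁻¹ * ψ n := by
    rw [Finset.mul_sum]
    exact Finset.sum_congr rfl fun ψ _ => by ring
  rw [h2, h]
  by_cases hn : (n : ZMod q) = v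
  · rw [if_pos hn, if_pos hn.symm, mul_comm]
  · rw [if_neg hn, if_neg (Ne.symm hn)]; simp

lemma eventually_tsum_localizedWeight_ge (j : ℕ) {B : ℝ} (hB : 2 * B + 1 ≤ j) :
    ∃ A > 0, ∀ᶠ Y : ℝ in atTop,
    ∀ (q : ℕ) [NeZero q], (q : ℝ) ≤ Real.log Y ^ B → ∀ v : ZMod q, IsUnit v →
      Real.log Y ^ j / (2 * q.totient) ≤
        ∑' n : ℕ, if (n : ZMod q) = v then localizedWeight j A Y n else 0 := by
  obtain ⟨A, hA, hcop⟩ := exists_tsum_localizedWeight_coprime_ge j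
  obtain ⟨C, hC, hchar⟩ := exists_norm_tsum_localizedWeight_char_le j A
  refine ⟨A, hA, ?_⟩
  have hlogB : ∀ᶠ Y : ℝ in atTop, Real.log Y ^ B ≤ Y / Real.exp 1 := by
    have := (isLittleO_log_rpow_rpow_atTop B one_pos).bound
      (show (0 : ℝ) < 1 / Real.exp 1 by positivity)
    filter_upwards [this, eventually_ge_atTop 1] with Y hY hY1
    rw [Real.rpow_one, Real.norm_of_nonneg (by linarith : 0 ≤ Y), one_div, inv_mul_eq_div] at hY
    exact (Real.le_norm_self _).trans hY
  filter_upwards [hcop, hlogB, eventually_ge_atTop (Real.exp 1),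
    Real.tendsto_log_atTop.eventually_ge_atTop (2 * C)] with Y hY hYB hYe hYC q _ hq v hv
  have hℒ : 1 ≤ Real.log Y := by rwa [Real.le_log_iff_exp_le ((Real.exp_pos 1).trans_le hYe)]
  have hY1 : 1 < Y := by linarith [Real.add_one_lt_exp (one_ne_zero)]
  have hq0 : q ≠ 0 := NeZero.ne q
  have hφ : 0 < (q.totient : ℝ) := by exact_mod_cast Nat.totient_pos.2 (Nat.pos_of_ne_zero hq0)
  have hmain := hY q hq0 (hq.trans hYB)
  have hid := totient_mul_tsum_localizedWeight j A hY1 q hv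
  rw [← Finset.add_sum_erase _ _ (Finset.mem_univ (1 : DirichletCharacter ℂ q))] at hid
  have h1 : (1 : DirichletCharacter ℂ q) v⁻¹ *
      ∑' n : ℕ, (localizedWeight j A Y n : ℂ) * (1 : DirichletCharacter ℂ q) n =
      ((∑' n : ℕ, if n.Coprime q then localizedWeight j A Y n else 0 : ℝ) : ℂ) := by
    have hvi : IsUnit v⁻¹ := IsUnit.of_mul_eq_one v (ZMod.inv_mul_of_unit v hv)
    rw [MulChar.one_apply hvi, one_mul, Complex.ofReal_tsum]
    refine tsum_congr fun n => ?_
    by_cases hn : n.Coprime q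
    · rw [if_pos hn, MulChar.one_apply ((ZMod.isUnit_iff_coprime n q).2 hn), mul_one]
    · rw [if_neg hn, MulChar.map_nonunit _ (mt (ZMod.isUnit_iff_coprime n q).1 hn)]
      simp
  rw [h1] at hid
  have herr : ‖∑ ψ ∈ Finset.univ.erase (1 : DirichletCharacter ℂ q),
      ψ v⁻¹ * ∑' n : ℕ, (localizedWeight j A Y n : ℂ) * ψ n‖ ≤ q.totient * (C * q) := by
    have hcard : Fintype.card (DirichletCharacter ℂ q) = q.totient := by
      rw [← Nat.card_eq_fintype_card]
      exact DirichletCharacter.card_eq_totient_of_hasEnoughRootsOfUnity ℂ q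
    calc _ ≤ ∑ ψ ∈ Finset.univ.erase (1 : DirichletCharacter ℂ q), C * (q : ℝ) := by
          refine (norm_sum_le _ _).trans (Finset.sum_le_sum fun ψ hψ => ?_)
          rw [norm_mul]
          have := hchar Y hYe q ψ (Finset.ne_of_mem_erase hψ)
          calc _ ≤ 1 * (C * (q : ℝ)) := by
                gcongr
                exact DirichletCharacter.norm_le_one ψ _
            _ = _ := one_mul _
      _ ≤ _ := by
          rw [Finset.sum_const, nsmul_eq_mul, ← hcard]
          gcongr
          exact Finset.card_le_univ _
  set S := ∑' n : ℕ, if (n : ZMod q) = v then localizedWeight j A Y n else 0 with hS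
  set P := ∑' n : ℕ, if n.Coprime q then localizedWeight j A Y n else 0 with hP
  have h2 : |q.totient * S - P| ≤ q.totient * (C * q) := by
    rw [← Real.norm_eq_abs, ← Complex.norm_real]
    rw [Complex.ofReal_sub, hid, add_sub_cancel_left]
    exact herr
  have h3 : P - q.totient * (C * q) ≤ q.totient * S := by
    have := (abs_le.1 h2).1; linarith
  have h4 : (q.totient : ℝ) * (C * q) ≤ Real.log Y ^ j / 2 := by
    have hφq : (q.totient : ℝ) ≤ q := by exact_mod_cast Nat.totient_le q
    have hqq : (q : ℝ) * q ≤ Real.log Y ^ (2 * B) := by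
      rw [two_mul, Real.rpow_add (by linarith)]; gcongr
    have h5 : Real.log Y ^ (2 * B) * Real.log Y ≤ Real.log Y ^ j := by
      rw [← Real.rpow_natCast, ← Real.rpow_add_one (by linarith)]
      exact Real.rpow_le_rpow_of_exponent_le hℒ hB
    calc (q.totient : ℝ) * (C * q) ≤ q * (C * q) := by gcongr
      _ = C * (q * q) := by ring
      _ ≤ (Real.log Y / 2) * Real.log Y ^ (2 * B) := by
        gcongr; linarith
      _ ≤ _ := by linarith
  rw [div_le_iff₀ (by positivity)]
  linarith

/-- A lower bound of the expected order for the number of primes in short multiplicative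
ranges in residue classes to moduli up to a power of the logarithm. -/
theorem exists_card_primes_residue_ge (B : ℝ) : ∃ c > 0, ∃ A > 0, ∀ᶠ Y : ℝ in atTop,
    ∀ (q : ℕ) [NeZero q], (q : ℝ) ≤ Real.log Y ^ B → ∀ v : ZMod q, IsUnit v →
      c * Y / (q.totient * Real.log Y) ≤
        (((Finset.Icc ⌈Y * Real.exp (-A)⌉₊ ⌊Y * Real.exp A⌋₊).filter
          fun p : ℕ => p.Prime ∧ (p : ZMod q) = v).card : ℝ) := by
  set B' := max B 0 with hB'
  obtain ⟨A, hA, hS⟩ := eventually_tsum_localizedWeight_ge (⌈2 * B' + 1⌉₊) (B := B')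
    (Nat.le_ceil _)
  set j := ⌈2 * B' + 1⌉₊ with hj
  set c₀ : ℝ := 1 / (2 * A ^ 2 * 2 ^ j * Real.exp A) with hc₀
  have hc₀pos : 0 < c₀ := by positivity
  refine ⟨c₀ / 4, by positivity, A, hA, ?_⟩
  have hsmall : ∀ᶠ Y : ℝ in atTop, 2 * √(Y * Real.exp A) * Real.log (Y * Real.exp A) *
      Real.log Y ^ B' ≤ c₀ / 2 * Y := by
    set d : ℝ := c₀ / (8 * √(Real.exp A)) with hd
    have hd0 : 0 < d := by positivity
    have := (isLittleO_log_rpow_rpow_atTop (B' + 1) (show (0 : ℝ) < 1 / 2 by norm_num)).bound hd0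
    filter_upwards [this, eventually_ge_atTop (Real.exp 1),
      Real.tendsto_log_atTop.eventually_ge_atTop A] with Y hY hYe hYA
    have hY0 : 0 < Y := (Real.exp_pos 1).trans_le hYe
    have hℒ : 1 ≤ Real.log Y := by rwa [Real.le_log_iff_exp_le hY0]
    rw [← Real.sqrt_eq_rpow, Real.norm_of_nonneg (Real.sqrt_nonneg _)] at hY
    have h1 := (Real.le_norm_self _).trans hY
    rw [Real.rpow_add_one (by linarith)] at h1
    have h2 : Real.log (Y * Real.exp A) ≤ 2 * Real.log Y := by
      rw [Real.log_mul hY0.ne' (Real.exp_pos A).ne', Real.log_exp]; linarith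
    have hYY : √Y * √Y = Y := Real.mul_self_sqrt hY0.le
    calc 2 * √(Y * Real.exp A) * Real.log (Y * Real.exp A) * Real.log Y ^ B'
        ≤ 2 * √(Y * Real.exp A) * (2 * Real.log Y) * Real.log Y ^ B' := by gcongr
      _ = 4 * √(Real.exp A) * √Y * (Real.log Y ^ B' * Real.log Y) := by
        rw [Real.sqrt_mul hY0.le]; ring
      _ ≤ 4 * √(Real.exp A) * √Y * (d * √Y) := by gcongr
      _ = 4 * √(Real.exp A) * d * (√Y * √Y) := by ring
      _ = c₀ / 2 * Y := by rw [hYY, hd]; field_simp; ring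
  filter_upwards [hS, hsmall, eventually_ge_atTop (Real.exp 1),
    Real.tendsto_log_atTop.eventually_ge_atTop A] with Y hY hsm hYe hYA q _ hq v hv
  have hY0 : 0 < Y := (Real.exp_pos 1).trans_le hYe
  have hℒ : 1 ≤ Real.log Y := by rwa [Real.le_log_iff_exp_le hY0]
  have hY1 : 1 < Y := by linarith [Real.add_one_lt_exp (one_ne_zero)]
  have hq0 : q ≠ 0 := NeZero.ne q
  have hφ : 0 < (q.totient : ℝ) := by exact_mod_cast Nat.totient_pos.2 (Nat.pos_of_ne_zero hq0)
  have hqB : (q : ℝ) ≤ Real.log Y ^ B' :=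
    hq.trans (Real.rpow_le_rpow_of_exponent_le hℒ (le_max_left _ _))
  have hmain := hY q hqB v hv
  set I := (Finset.Icc ⌈Y * Real.exp (-A)⌉₊ ⌊Y * Real.exp A⌋₊) with hI
  have hmemI : ∀ n ∈ I, Y * Real.exp (-A) ≤ n ∧ (n : ℝ) ≤ Y * Real.exp A := fun n hn =>
    ⟨Nat.ceil_le.1 (Finset.mem_Icc.1 hn).1,
      (Nat.le_floor_iff (by positivity)).1 (Finset.mem_Icc.1 hn).2⟩
  have hlogI : ∀ n ∈ I, 0 ≤ Real.log n ∧ Real.log n ≤ 2 * Real.log Y := fun n hn => by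
    obtain ⟨h1, h2⟩ := hmemI n hn
    have hn0 : (0 : ℝ) < n := lt_of_lt_of_le (by positivity) h1
    have h3 := Real.log_le_log hn0 h2
    rw [Real.log_mul hY0.ne' (Real.exp_pos A).ne', Real.log_exp] at h3
    exact ⟨Real.log_natCast_nonneg n, by linarith⟩
  set T := ∑ n ∈ I.filter (fun n : ℕ => (n : ZMod q) = v), Λ n with hT
  have hupper : (∑' n : ℕ, if (n : ZMod q) = v then localizedWeight j A Y n else 0) ≤
      A ^ 2 * (2 * Real.log Y) ^ j * Real.exp A / Y * T := by
    set G : ℕ → ℝ := fun n => if n ∈ I.filter (fun n : ℕ => (n : ZMod q) = v) then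
      A ^ 2 * (2 * Real.log Y) ^ j * Real.exp A / Y * Λ n else 0 with hG
    have hGs : Summable G := summable_of_ne_finset_zero
      (s := I.filter (fun n : ℕ => (n : ZMod q) = v)) fun n hn => if_neg hn
    have hGt : ∑' n, G n = A ^ 2 * (2 * Real.log Y) ^ j * Real.exp A / Y * T := by
      rw [tsum_eq_sum (s := I.filter (fun n : ℕ => (n : ZMod q) = v)) fun n hn => if_neg hn,
        hT, Finset.mul_sum]
      exact Finset.sum_congr rfl fun n hn => if_pos hn
    have hls : Summable fun n : ℕ => if (n : ZMod q) = v then localizedWeight j A Y n else 0 := by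
      refine Summable.of_norm_bounded (summable_localizedWeight j A hY1).norm fun n => ?_
      split_ifs <;> simp
    rw [← hGt]
    refine Summable.tsum_le_tsum (fun n => ?_) hls hGs
    have hw0 : 0 ≤ vonMangoldtWeight j (1 / Real.log Y) n := vonMangoldtWeight_nonneg _ _ _
    by_cases hn : (n : ZMod q) = v
    swap
    · rw [if_neg hn, hG]
      simp [hn]
    rw [if_pos hn]
    by_cases hnI : n ∈ I
    · rw [hG]
      simp only [Finset.mem_filter, hnI, hn, and_self, if_true]
      obtain ⟨h1, h2⟩ := hmemI n hnI
      obtain ⟨h3, h4⟩ := hlogI n hnI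
      have hn0 : (0 : ℝ) < n := lt_of_lt_of_le (by positivity) h1
      have hn1 : (1 : ℝ) ≤ n := by exact_mod_cast Nat.pos_of_ne_zero (by rintro rfl; simp at hn0)
      have h5 : (n : ℝ) ^ (-(1 + 1 / Real.log Y)) ≤ Real.exp A / Y := by
        calc (n : ℝ) ^ (-(1 + 1 / Real.log Y)) ≤ (n : ℝ) ^ (-1 : ℝ) := by
              refine Real.rpow_le_rpow_of_exponent_le hn1 ?_
              have : 0 < 1 / Real.log Y := by positivity
              linarith
          _ ≤ (Y * Real.exp (-A))⁻¹ := by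
              rw [Real.rpow_neg_one]; gcongr
          _ = Real.exp A / Y := by rw [Real.exp_neg]; field_simp
      have hΛ : 0 ≤ Λ n := ArithmeticFunction.vonMangoldt_nonneg
      have h6 : vonMangoldtWeight j (1 / Real.log Y) n ≤
          Λ n * (2 * Real.log Y) ^ j * (Real.exp A / Y) := by
        unfold vonMangoldtWeight; gcongr
      calc localizedWeight j A Y n ≤ vonMangoldtWeight j (1 / Real.log Y) n * A ^ 2 := by
            unfold localizedWeight; gcongr; exact localizingKernel_le _ _
        _ ≤ Λ n * (2 * Real.log Y) ^ j * (Real.exp A / Y) * A ^ 2 := by gcongr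
        _ = _ := by ring
    · have hz : localizedWeight j A Y n ≤ 0 := by
        rcases Nat.eq_zero_or_pos n with rfl | hnp
        · simp [localizedWeight, vonMangoldtWeight]
        have hnp' : (0 : ℝ) < n := by exact_mod_cast hnp
        refine mul_nonpos_of_nonneg_of_nonpos hw0 (localizingKernel_nonpos hA.le ?_)
        by_contra! hu
        obtain ⟨h1, h2⟩ := abs_lt.1 hu
        refine hnI (Finset.mem_Icc.2 ⟨Nat.ceil_le.2 ?_, Nat.le_floor ?_⟩)
        · rw [← Real.log_le_log_iff (by positivity) hnp', Real.log_mul hY0.ne' (by positivity),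
            Real.log_exp]
          linarith
        · rw [← Real.log_le_log_iff hnp' (by positivity), Real.log_mul hY0.ne' (by positivity),
            Real.log_exp]
          linarith
      rw [hG]
      simpa [hnI] using hz
  have hTge : c₀ * Y / q.totient ≤ T := by
    have h := hmain.trans hupper
    have h1 : A ^ 2 * (2 * Real.log Y) ^ j * Real.exp A / Y * T =
        Real.log Y ^ j / (2 * c₀ * Y) * T := by
      rw [hc₀, mul_pow]; field_simp
    rw [h1] at h
    have h2 : 0 < Real.log Y ^ j := by positivity
    rw [div_le_iff₀ (by positivity)] at h ⊢
    rw [div_mul_eq_mul_div, div_mul_eq_mul_div, le_div_iff₀ (by positivity)] at h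
    have h3 : Real.log Y ^ j * (c₀ * Y) ≤ Real.log Y ^ j * (T * q.totient) := by linarith
    exact le_of_mul_le_mul_left h3 h2
  have hTle : T ≤ 2 * √(Y * Real.exp A) * Real.log (Y * Real.exp A) +
      2 * Real.log Y * ((I.filter fun p : ℕ => p.Prime ∧ (p : ZMod q) = v).card : ℝ) := by
    have hYA1 : 1 ≤ Y * Real.exp A := by nlinarith [Real.one_le_exp hA.le]
    rw [hT, ← Finset.sum_filter_add_sum_filter_not _ Nat.Prime, add_comm]
    refine add_le_add ?_ ?_
    · refine le_trans ?_ (Chebyshev.psi_sub_theta_le hYA1)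
      rw [Chebyshev.psi_sub_theta_eq_sum_not_prime, ← Finset.sum_filter_ne_zero]
      refine Finset.sum_le_sum_of_subset_of_nonneg (fun n hn => ?_)
        fun _ _ _ => ArithmeticFunction.vonMangoldt_nonneg
      simp only [Finset.mem_filter] at hn
      refine Finset.mem_filter.2 ⟨Finset.mem_Ioc.2 ⟨Nat.pos_of_ne_zero ?_,
        (Finset.mem_Icc.1 hn.1.1.1).2⟩, hn.1.2⟩
      rintro rfl
      exact hn.2 (by simp)
    · rw [Finset.filter_filter, mul_comm, ← nsmul_eq_mul]
      have hfe : (I.filter fun n : ℕ => (n : ZMod q) = v ∧ n.Prime) =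
          I.filter fun p : ℕ => p.Prime ∧ (p : ZMod q) = v :=
        Finset.filter_congr fun n _ => and_comm
      rw [hfe]
      refine Finset.sum_le_card_nsmul _ _ _ fun p hp => ?_
      obtain ⟨hp1, hp2, -⟩ := Finset.mem_filter.1 hp
      rw [ArithmeticFunction.vonMangoldt_apply_prime hp2]
      exact (hlogI p hp1).2
  have hsm2 : 2 * √(Y * Real.exp A) * Real.log (Y * Real.exp A) ≤ c₀ / 2 * Y / q.totient := by
    rw [le_div_iff₀ hφ]
    refine le_trans ?_ hsm
    have hφq : (q.totient : ℝ) ≤ Real.log Y ^ B' :=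
      le_trans (by exact_mod_cast Nat.totient_le q) hqB
    refine mul_le_mul_of_nonneg_left hφq ?_
    have : 0 ≤ Real.log (Y * Real.exp A) := by
      rw [Real.log_mul hY0.ne' (Real.exp_pos A).ne', Real.log_exp]; linarith
    positivity
  have hfin : c₀ / 2 * Y / q.totient ≤
      2 * Real.log Y * ((I.filter fun p : ℕ => p.Prime ∧ (p : ZMod q) = v).card : ℝ) := by
    have : c₀ * Y / q.totient = c₀ / 2 * Y / q.totient + c₀ / 2 * Y / q.totient := by ring
    linarith
  rw [div_le_iff₀ (by positivity)] at hfin ⊢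
  linarith

end PrimesInProgressionsMain

section ReciprocalSums

open Filter Topology

lemma log_div_le_sum_one_div {a D : ℝ} (ha : 0 < a) (hD : 0 < D) (M : ℕ) :
    Real.log ((a + D * M) / a) / D ≤ ∑ i ∈ Finset.range M, 1 / (a + D * i) := by
  have h : ∀ i ∈ Finset.range M,
      Real.log (a + D * ((i + 1 : ℕ) : ℝ)) / D - Real.log (a + D * (i : ℕ)) / D ≤
        1 / (a + D * i) := by
    intro i _
    have hp : 0 < a + D * i := by positivity
    rw [← sub_div, ← Real.log_div (by positivity) hp.ne', div_le_iff₀ hD]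
    refine (Real.log_le_sub_one_of_pos (by positivity)).trans (le_of_eq ?_)
    push_cast
    field_simp
    ring
  refine le_trans (le_of_eq ?_) (Finset.sum_le_sum h)
  rw [Finset.sum_range_sub (fun i : ℕ => Real.log (a + D * i) / D), Real.log_div
    (by positivity) ha.ne']
  simp [sub_div]

/-- The primes `p ≡ v` with `exp a ≤ p ≤ exp b`. -/
def primesInClass {q : ℕ} (v : ZMod q) (a b : ℝ) : Finset ℕ :=
  (Finset.Icc ⌈Real.exp a⌉₊ ⌊Real.exp b⌋₊).filter fun p : ℕ => p.Prime ∧ (p : ZMod q) = v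

lemma mem_primesInClass {q : ℕ} {v : ZMod q} {a b : ℝ} {p : ℕ} :
    p ∈ primesInClass v a b ↔
      (Real.exp a ≤ p ∧ (p : ℝ) ≤ Real.exp b) ∧ p.Prime ∧ (p : ZMod q) = v := by
  rw [primesInClass, Finset.mem_filter, Finset.mem_Icc, Nat.ceil_le,
    Nat.le_floor_iff (Real.exp_pos b).le]

theorem exists_card_primesInClass_ge (B : ℝ) : ∃ c > 0, ∃ A > 0, ∀ᶠ y : ℝ in atTop,
    ∀ (q : ℕ) [NeZero q], (q : ℝ) ≤ y ^ B → ∀ v : ZMod q, IsUnit v →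
      c * Real.exp y / (q.totient * y) ≤ ((primesInClass v (y - A) (y + A)).card : ℝ) := by
  obtain ⟨c, hc, A, hA, h⟩ := exists_card_primes_residue_ge B
  refine ⟨c, hc, A, hA, ?_⟩
  filter_upwards [Real.tendsto_exp_atTop.eventually h] with y hy q _ hq v hv
  have := hy q (by rwa [Real.log_exp]) v hv
  rwa [Real.log_exp, ← Real.exp_add, ← Real.exp_add, ← sub_eq_add_neg] at this

theorem exists_sum_primesInClass_ge {B : ℝ} (hB : 0 ≤ B) :
    ∃ c > 0, ∀ᶠ a : ℝ in atTop, ∀ b : ℝ, 4 * a ≤ b →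
      ∀ (q : ℕ) [NeZero q], (q : ℝ) ≤ a ^ B → ∀ v : ZMod q, IsUnit v →
        c * Real.log (b / (4 * a)) / q.totient ≤
          ∑ p ∈ primesInClass v a b, (1 : ℝ) / p := by
  obtain ⟨c, hc, A, hA, h⟩ := exists_card_primesInClass_ge B
  obtain ⟨y₀, hy₀⟩ := eventually_atTop.1 h
  set D : ℝ := 2 * A + 1 with hD
  have hD0 : 0 < D := by positivity
  refine ⟨c * Real.exp (-A) / D, by positivity, ?_⟩
  filter_upwards [eventually_ge_atTop (max y₀ (D + 1))] with a ha b hb q _ hq v hv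
  have ha1 : y₀ ≤ a := (le_max_left _ _).trans ha
  have ha2 : D + 1 ≤ a := (le_max_right _ _).trans ha
  have hq0 : q ≠ 0 := NeZero.ne q
  have hφ : 0 < (q.totient : ℝ) := by exact_mod_cast Nat.totient_pos.2 (Nat.pos_of_ne_zero hq0)
  set M := ⌊(b - a) / D⌋₊ with hM
  set y : ℕ → ℝ := fun i => a + A + D * i with hy
  have hM1 : (M : ℝ) * D ≤ b - a := by
    rw [← le_div_iff₀ hD0]; exact Nat.floor_le (div_nonneg (by linarith) hD0.le)
  have hM2 : b - a < (M + 1) * D := by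
    rw [← div_lt_iff₀ hD0]; exact Nat.lt_floor_add_one _
  have hsub : (Finset.range M).biUnion (fun i => primesInClass v (y i - A) (y i + A)) ⊆
      primesInClass v a b := by
    intro p hp
    obtain ⟨i, hi, hp⟩ := Finset.mem_biUnion.1 hp
    obtain ⟨⟨h1, h2⟩, h3⟩ := mem_primesInClass.1 hp
    refine mem_primesInClass.2 ⟨⟨le_trans ?_ h1, h2.trans ?_⟩, h3⟩
    · refine Real.exp_le_exp.2 ?_
      have : 0 ≤ D * i := by positivity
      simp only [hy]; linarith
    · refine Real.exp_le_exp.2 ?_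
      have h4 : (i : ℝ) + 1 ≤ M := by exact_mod_cast Finset.mem_range.1 hi
      have h5 : D * ((i : ℝ) + 1) ≤ D * M := by gcongr
      simp only [hy]
      linarith
  have hdisj : ((Finset.range M : Finset ℕ) : Set ℕ).PairwiseDisjoint
      (fun i => primesInClass v (y i - A) (y i + A)) := by
    have key : ∀ i j : ℕ, i < j → Disjoint (primesInClass v (y i - A) (y i + A))
        (primesInClass v (y j - A) (y j + A)) := by
      intro i j hij
      rw [Finset.disjoint_left]
      intro p hp hp'
      have h1 := (mem_primesInClass.1 hp).1.2
      have h2 := (mem_primesInClass.1 hp').1.1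
      have h3 := Real.exp_le_exp.1 (h2.trans h1)
      have h4 : (i : ℝ) + 1 ≤ j := by exact_mod_cast hij
      have h5 : D * ((i : ℝ) + 1) ≤ D * j := by gcongr
      simp only [hy] at h3
      linarith
    intro i _ j _ hij
    rcases lt_or_gt_of_ne hij with h | h
    · exact key i j h
    · exact (key j i h).symm
  have hwin : ∀ i ∈ Finset.range M, c * Real.exp (-A) / q.totient * (1 / (a + A + D * i)) ≤
      ∑ p ∈ primesInClass v (y i - A) (y i + A), (1 : ℝ) / p := by
    intro i _
    have hyi : a ≤ y i := by
      have : 0 ≤ D * i := by positivity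
      simp only [hy]; linarith
    have hyi0 : 0 < y i := by linarith
    have h1 := hy₀ (y i) (ha1.trans hyi) q
      (hq.trans (Real.rpow_le_rpow (by linarith) hyi hB)) v hv
    have h2 : ∀ p ∈ primesInClass v (y i - A) (y i + A), Real.exp (-(y i + A)) ≤ (1 : ℝ) / p := by
      intro p hp
      obtain ⟨⟨-, h2⟩, h3, -⟩ := mem_primesInClass.1 hp
      rw [Real.exp_neg, ← one_div]
      exact one_div_le_one_div_of_le (by exact_mod_cast h3.pos) h2
    refine le_trans ?_ (Finset.card_nsmul_le_sum _ _ _ h2)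
    rw [nsmul_eq_mul]
    refine le_trans (le_of_eq ?_) (mul_le_mul_of_nonneg_right h1 (Real.exp_pos _).le)
    have h5 : Real.exp (y i) * Real.exp (-(y i + A)) = Real.exp (-A) := by
      rw [← Real.exp_add]; congr 1; ring
    have h6 : a + A + D * i = y i := rfl
    rw [h6, ← h5]
    field_simp
  have hharm := log_div_le_sum_one_div (a := a + A) (by linarith) hD0 M
  have hlog : Real.log (b / (4 * a)) ≤ Real.log ((a + A + D * M) / (a + A)) := by
    refine Real.log_le_log (div_pos (by linarith) (by linarith)) ?_
    rw [div_le_div_iff₀ (by linarith) (by linarith)]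
    nlinarith
  calc c * Real.exp (-A) / D * Real.log (b / (4 * a)) / q.totient
      = c * Real.exp (-A) / q.totient * (Real.log (b / (4 * a)) / D) := by field_simp
    _ ≤ c * Real.exp (-A) / q.totient * ∑ i ∈ Finset.range M, 1 / (a + A + D * i) := by
      gcongr
      exact le_trans (by gcongr) hharm
    _ ≤ ∑ i ∈ Finset.range M, ∑ p ∈ primesInClass v (y i - A) (y i + A), (1 : ℝ) / p := by
      rw [Finset.mul_sum]; exact Finset.sum_le_sum hwin
    _ = ∑ p ∈ (Finset.range M).biUnion (fun i => primesInClass v (y i - A) (y i + A)),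
        (1 : ℝ) / p := (Finset.sum_biUnion hdisj).symm
    _ ≤ _ := Finset.sum_le_sum_of_subset_of_nonneg hsub fun _ _ _ => by positivity

end ReciprocalSums

section EulerProduct

open scoped ArithmeticFunction.vonMangoldt

lemma exists_sum_primes_log_div_le : ∃ C > 0, ∀ z : ℝ, 1 ≤ z → ∀ s : Finset ℕ,
    (∀ p ∈ s, p.Prime ∧ (p : ℝ) ≤ z) → ∑ p ∈ s, Real.log p / p ≤ C * (Real.log z + 1) := by
  obtain ⟨C, hC, h⟩ := exists_sum_vonMangoldt_div_le
  refine ⟨2 * C, by positivity, fun z hz s hs => ?_⟩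
  have hlz : 0 ≤ Real.log z := Real.log_nonneg hz
  have h1 : ∀ p ∈ s, Real.log p / p ≤ ∑ i ∈ Finset.range (⌊Real.log z⌋₊ + 1),
      2 * (Λ p / p * (1 / (1 + (Real.log p - Real.log (Real.exp i)) ^ 2))) := by
    intro p hp
    obtain ⟨hpp, hpz⟩ := hs p hp
    have hp0 : (0 : ℝ) < p := by exact_mod_cast hpp.pos
    have hlp : 0 ≤ Real.log p := Real.log_natCast_nonneg p
    have hΛ : 0 ≤ Λ p / p := div_nonneg ArithmeticFunction.vonMangoldt_nonneg hp0.le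
    have hmem : ⌊Real.log p⌋₊ ∈ Finset.range (⌊Real.log z⌋₊ + 1) :=
      Finset.mem_range.2 (Nat.lt_succ_of_le (Nat.floor_le_floor (Real.log_le_log hp0 hpz)))
    refine le_trans ?_ (Finset.single_le_sum (fun i _ => by positivity) hmem)
    rw [Real.log_exp, ArithmeticFunction.vonMangoldt_apply_prime hpp]
    have h2 := Nat.floor_le hlp
    have h3 := Nat.lt_floor_add_one (Real.log p)
    have h4 : 1 / 2 ≤ 1 / (1 + (Real.log p - ⌊Real.log p⌋₊) ^ 2) :=
      one_div_le_one_div_of_le (by positivity) (by nlinarith)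
    have h5 : 0 ≤ Real.log p / p := by positivity
    nlinarith [mul_le_mul_of_nonneg_left h4 h5]
  refine (Finset.sum_le_sum h1).trans ?_
  rw [Finset.sum_comm]
  calc _ ≤ ∑ i ∈ Finset.range (⌊Real.log z⌋₊ + 1), 2 * C := by
        refine Finset.sum_le_sum fun i _ => ?_
        rw [← Finset.mul_sum]
        exact mul_le_mul_of_nonneg_left (h _ (Real.exp_pos _) s) zero_le_two
    _ ≤ _ := by
        rw [Finset.sum_const, Finset.card_range, nsmul_eq_mul, mul_comm]
        gcongr
        push_cast
        linarith [Nat.floor_le hlz]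

lemma exp_neg_two_mul_le {t : ℝ} (h0 : 0 ≤ t) (h1 : t ≤ 1 / 2) : Real.exp (-(2 * t)) ≤ 1 - t := by
  rw [Real.exp_neg, inv_le_comm₀ (Real.exp_pos _) (by linarith)]
  refine le_trans ?_ (Real.add_one_le_exp (2 * t))
  rw [inv_le_comm₀ (by linarith) (by linarith), inv_le_iff_one_le_mul₀ (by linarith)]
  nlinarith

lemma card_primeFactors_le_two_mul_log {q : ℕ} (hq : q ≠ 0) :
    (q.primeFactors.card : ℝ) ≤ 2 * Real.log q := by
  have h1 : 2 ^ q.primeFactors.card ≤ q := by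
    calc 2 ^ q.primeFactors.card ≤ ∏ p ∈ q.primeFactors, p :=
          Finset.pow_card_le_prod _ _ _ fun p hp => (Nat.prime_of_mem_primeFactors hp).two_le
      _ ≤ q := Nat.le_of_dvd (Nat.pos_of_ne_zero hq) (Nat.prod_primeFactors_dvd q)
  have h2 : ((2 : ℝ) ^ q.primeFactors.card) ≤ q := by exact_mod_cast h1
  have h3 := Real.log_le_log (by positivity) h2
  rw [Real.log_pow] at h3
  have h4 : (0 : ℝ) ≤ q.primeFactors.card := by positivity
  nlinarith [Real.log_two_gt_d9]

theorem exists_prod_one_sub_div_primeFactors_ge {D : ℝ} (hD : 0 < D) :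
    ∃ C > 2 * D, ∃ c > 0, ∀ q : ℕ, q ≠ 0 → (∀ ℓ ∈ q.primeFactors, C < ℓ) →
      c / (1 + Real.log q) ≤ ∏ ℓ ∈ q.primeFactors, (1 - D / ℓ) := by
  obtain ⟨c₁, hc₁, hM⟩ := exists_sum_primes_log_div_le
  set C : ℝ := 2 * D + Real.exp (2 * D * c₁) with hC
  have hCe : Real.exp (2 * D * c₁) ≤ C := by linarith
  refine ⟨C, by linarith [Real.exp_pos (2 * D * c₁)], Real.exp (-(2 * D + 1)) / 2, by positivity,
    fun q hq hℓ => ?_⟩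
  have hlq : 0 ≤ Real.log q := Real.log_natCast_nonneg q
  have hCpos : 0 < C := (Real.exp_pos _).trans_le hCe
  have hlogC : 2 * D * c₁ ≤ Real.log C := by rwa [Real.le_log_iff_exp_le hCpos]
  have hlogC0 : 0 < Real.log C := lt_of_lt_of_le (by positivity) hlogC
  set z : ℝ := 2 * (1 + Real.log q) with hz
  have hz1 : 1 ≤ z := by linarith
  have hsum : 2 * D * ∑ ℓ ∈ q.primeFactors, (1 : ℝ) / ℓ ≤ 2 * D + (Real.log z + 1) := by
    rw [← Finset.sum_filter_add_sum_filter_not q.primeFactors fun ℓ : ℕ => z < (ℓ : ℝ), mul_add]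
    refine add_le_add ?_ ?_
    · have : ∑ ℓ ∈ q.primeFactors with z < ((ℓ : ℕ) : ℝ), (1 : ℝ) / ℓ ≤
          (q.primeFactors.card : ℝ) * (1 / z) := by
        calc _ ≤ ∑ ℓ ∈ q.primeFactors with z < ((ℓ : ℕ) : ℝ), 1 / z := by
              refine Finset.sum_le_sum fun ℓ hℓ' => ?_
              exact one_div_le_one_div_of_le (by linarith) (Finset.mem_filter.1 hℓ').2.le
          _ ≤ _ := by
              rw [Finset.sum_const, nsmul_eq_mul]
              gcongr
              exact Finset.filter_subset _ _
      have h2 : (q.primeFactors.card : ℝ) * (1 / z) ≤ 1 := by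
        rw [mul_one_div, div_le_one (by linarith)]
        linarith [card_primeFactors_le_two_mul_log hq]
      nlinarith
    · have h3 : ∑ ℓ ∈ q.primeFactors with ¬ z < ((ℓ : ℕ) : ℝ), (1 : ℝ) / ℓ ≤
          (1 / Real.log C) * ∑ ℓ ∈ q.primeFactors with ¬ z < ((ℓ : ℕ) : ℝ), Real.log ℓ / ℓ := by
        rw [Finset.mul_sum]
        refine Finset.sum_le_sum fun ℓ hℓ' => ?_
        have h4 := hℓ ℓ (Finset.mem_filter.1 hℓ').1
        have h5 := Real.log_le_log hCpos h4.le
        have h6 : (0 : ℝ) < ℓ := hCpos.trans h4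
        rw [div_mul_div_comm, one_mul, div_le_div_iff₀ h6 (by positivity)]
        nlinarith
      have h4 := hM z hz1 (q.primeFactors.filter fun ℓ : ℕ => ¬ z < (ℓ : ℝ)) fun p hp =>
        ⟨Nat.prime_of_mem_primeFactors (Finset.mem_filter.1 hp).1,
          not_lt.1 (Finset.mem_filter.1 hp).2⟩
      have h5 : 0 ≤ Real.log z + 1 := by linarith [Real.log_nonneg hz1]
      calc 2 * D * ∑ ℓ ∈ q.primeFactors with ¬ z < ((ℓ : ℕ) : ℝ), (1 : ℝ) / ℓ
          ≤ 2 * D * ((1 / Real.log C) * (c₁ * (Real.log z + 1))) := by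
            gcongr; exact h3.trans (by gcongr)
        _ = (2 * D * c₁) / Real.log C * (Real.log z + 1) := by ring
        _ ≤ 1 * (Real.log z + 1) := by
            gcongr; rwa [div_le_one hlogC0]
        _ = _ := one_mul _
  have hprod : Real.exp (-(2 * D * ∑ ℓ ∈ q.primeFactors, (1 : ℝ) / ℓ)) ≤
      ∏ ℓ ∈ q.primeFactors, (1 - D / ℓ) := by
    rw [Finset.mul_sum, ← Finset.sum_neg_distrib, Real.exp_sum]
    refine Finset.prod_le_prod (fun _ _ => (Real.exp_pos _).le) fun ℓ h => ?_
    have h4 := hℓ ℓ h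
    have h6 : (0 : ℝ) < ℓ := hCpos.trans h4
    rw [show 2 * D * (1 / (ℓ : ℝ)) = 2 * (D / ℓ) by ring]
    refine exp_neg_two_mul_le (by positivity) ?_
    rw [div_le_iff₀ h6]
    linarith [Real.exp_pos (2 * D * c₁)]
  refine le_trans ?_ hprod
  calc Real.exp (-(2 * D + 1)) / 2 / (1 + Real.log q)
      = Real.exp (-(2 * D + 1)) * Real.exp (-Real.log z) := by
        rw [Real.exp_neg (Real.log z), Real.exp_log (by linarith), hz]; field_simp
    _ = Real.exp (-(2 * D + (Real.log z + 1))) := by rw [← Real.exp_add]; congr 1; ring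
    _ ≤ _ := by gcongr

end EulerProduct

/-- Two integer matrices are equivalent if they differ by invertible row and column operations. -/
def MatEquiv {M m : ℕ} (A B : Matrix (Fin M) (Fin m) ℤ) : Prop :=
  ∃ (P : Matrix (Fin M) (Fin M) ℤ) (Q : Matrix (Fin m) (Fin m) ℤ),
    IsUnit P ∧ IsUnit Q ∧ B = P * A * Q

namespace MatEquiv

variable {M m : ℕ} {A B D : Matrix (Fin M) (Fin m) ℤ}

theorem refl (A : Matrix (Fin M) (Fin m) ℤ) : MatEquiv A A :=
  ⟨1, 1, isUnit_one, isUnit_one, by simp⟩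

theorem trans (h : MatEquiv A B) (h' : MatEquiv B D) : MatEquiv A D := by
  obtain ⟨P, Q, hP, hQ, rfl⟩ := h
  obtain ⟨P', Q', hP', hQ', rfl⟩ := h'
  exact ⟨P' * P, Q * Q', hP'.mul hP, hQ.mul hQ', by simp only [Matrix.mul_assoc]⟩

theorem transpose (h : MatEquiv A B) : MatEquiv A.transpose B.transpose := by
  obtain ⟨P, Q, hP, hQ, rfl⟩ := h
  exact ⟨Q.transpose, P.transpose, (Matrix.isUnit_transpose Q).2 hQ, (Matrix.isUnit_transpose P).2 hP, by
    simp only [Matrix.transpose_mul, Matrix.mul_assoc]⟩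

theorem add_row (B : Matrix (Fin M) (Fin m) ℤ) (i₀ : Fin M) (u : Fin M → ℤ) (hu : u i₀ = 0) :
    MatEquiv B (Matrix.of fun i j => B i j + u i * B i₀ j) := by
  refine ⟨1 + Matrix.vecMulVec u (Pi.single i₀ 1), 1, ?_, isUnit_one, ?_⟩
  · refine IsNilpotent.isUnit_one_add ⟨2, ?_⟩
    rw [pow_two, Matrix.vecMulVec_mul_vecMulVec]
    simp [hu]
  · rw [Matrix.mul_one, Matrix.add_mul, Matrix.one_mul]
    ext i j
    simp [Matrix.vecMulVec, Matrix.mul_apply, Pi.single_apply]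

theorem add_col (B : Matrix (Fin M) (Fin m) ℤ) (j₀ : Fin m) (u : Fin m → ℤ) (hu : u j₀ = 0) :
    MatEquiv B (Matrix.of fun i j => B i j + u j * B i j₀) := by
  exact (add_row B.transpose j₀ u hu).transpose

end MatEquiv

/-- The nonzero corner entry is minimal in absolute value among equivalent matrices. -/
def MinCorner {M m : ℕ} (B : Matrix (Fin (M + 1)) (Fin (m + 1)) ℤ) : Prop :=
  B 0 0 ≠ 0 ∧ ∀ B', MatEquiv B B' → B' 0 0 ≠ 0 → (B 0 0).natAbs ≤ (B' 0 0).natAbs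

theorem MinCorner.transpose {M m : ℕ} {B : Matrix (Fin (M + 1)) (Fin (m + 1)) ℤ}
    (h : MinCorner B) : MinCorner B.transpose :=
  ⟨h.1, fun B' hB' h0 => by
    simpa using h.2 B'.transpose (by simpa using hB'.transpose) (by simpa using h0)⟩

theorem MinCorner.of_matEquiv {M m : ℕ} {B B' : Matrix (Fin (M + 1)) (Fin (m + 1)) ℤ}
    (h : MinCorner B) (hB : MatEquiv B B') (h0 : B' 0 0 = B 0 0) : MinCorner B' :=
  ⟨h0 ▸ h.1, fun D hD hD0 => h0 ▸ h.2 D (hB.trans hD) hD0⟩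

theorem MinCorner.dvd_col {M m : ℕ} {B : Matrix (Fin (M + 1)) (Fin (m + 1)) ℤ}
    (h : MinCorner B) (i : Fin (M + 1)) : B 0 0 ∣ B i 0 := by
  rcases eq_or_ne i 0 with rfl | hi
  · exact dvd_rfl
  by_contra hnd
  have hd := h.1
  set d := B 0 0 with hd'
  set r := B i 0 % d with hr'
  have hr0 : r ≠ 0 := fun h0 => hnd (Int.dvd_of_emod_eq_zero h0)
  have hrpos : 0 ≤ r := Int.emod_nonneg _ hd
  have hrlt : r < |d| := Int.emod_lt_abs _ hd
  have e1 := MatEquiv.add_row B 0 (Pi.single i (-(B i 0 / d))) (by simp [hi.symm])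
  set B1 : Matrix (Fin (M + 1)) (Fin (m + 1)) ℤ :=
    Matrix.of fun s j => B s j + (Pi.single i (-(B i 0 / d)) : Fin (M + 1) → ℤ) s * B 0 j with hB1
  have hB1i : B1 i 0 = r := by
    simp only [hB1, Matrix.of_apply, Pi.single_eq_same, hr', ← hd']
    rw [Int.emod_def]; ring
  have hB10 : B1 0 0 = d := by
    simp [hB1, Pi.single_apply, hi.symm, hd']
  have key : ∀ c : ℤ, d + c * r ≠ 0 → |d| ≤ |d + c * r| := by
    intro c hc
    have e2 := MatEquiv.add_row B1 i (Pi.single 0 c) (by simp [hi])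
    have := h.2 _ (e1.trans e2) (by simpa [hB1i, hB10] using hc)
    simp only [Matrix.of_apply, Pi.single_eq_same, hB1i, hB10] at this
    rw [← Int.natCast_natAbs, ← Int.natCast_natAbs]
    exact_mod_cast this
  have hmod : d + (-(d / r)) * r = d % r := by rw [Int.emod_def]; ring
  have hmlt : d % r < r := by
    have := Int.emod_lt_abs d hr0
    rwa [abs_of_nonneg hrpos] at this
  have hmnn : 0 ≤ d % r := Int.emod_nonneg _ hr0
  by_cases hz : d % r = 0
  · have h2 : d + (-(d / r) + 1) * r = r := by linear_combination hmod + hz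
    have := key _ (by rw [h2]; exact hr0)
    rw [h2, abs_of_nonneg hrpos] at this
    omega
  · have := key _ (by rw [hmod]; exact hz)
    rw [hmod, abs_of_nonneg hmnn] at this
    omega

theorem MinCorner.dvd_row {M m : ℕ} {B : Matrix (Fin (M + 1)) (Fin (m + 1)) ℤ}
    (h : MinCorner B) (j : Fin (m + 1)) : B 0 0 ∣ B 0 j :=
  h.transpose.dvd_col j

theorem exists_minCorner {M m : ℕ} {A : Matrix (Fin (M + 1)) (Fin (m + 1)) ℤ} (hA : A ≠ 0) :
    ∃ B, MatEquiv A B ∧ MinCorner B := by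
  have hne : ∃ n : ℕ, ∃ B, MatEquiv A B ∧ B 0 0 ≠ 0 ∧ (B 0 0).natAbs = n := by
    obtain ⟨i, j, hij⟩ : ∃ i j, A i j ≠ 0 := by
      by_contra! h
      exact hA (by ext i j; exact h i j)
    obtain ⟨B, hB, hB0⟩ : ∃ B, MatEquiv A B ∧ B 0 j ≠ 0 := by
      by_cases h0 : A 0 j = 0
      · have hi : i ≠ 0 := by rintro rfl; exact hij h0
        exact ⟨_, MatEquiv.add_row A i (Pi.single 0 1) (by simp [hi]), by simpa [h0] using hij⟩
      · exact ⟨A, MatEquiv.refl A, h0⟩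
    by_cases h0 : B 0 0 = 0
    · have hj : j ≠ 0 := by rintro rfl; exact hB0 h0
      exact ⟨_, _, hB.trans (MatEquiv.add_col B j (Pi.single 0 1) (by simp [hj])),
        by simpa [h0] using hB0, rfl⟩
    · exact ⟨_, B, hB, h0, rfl⟩
  obtain ⟨B, hB, hB0, hBn⟩ := Nat.find_spec hne
  refine ⟨B, hB, hB0, fun B' hB' h0 => ?_⟩
  rw [hBn]
  exact Nat.find_min' hne ⟨B', hB.trans hB', h0, rfl⟩

/-- The block-diagonal matrix with a scalar corner. -/
def cornerBlock {M m : ℕ} (d : ℤ) (E : Matrix (Fin M) (Fin m) ℤ) :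
    Matrix (Fin (M + 1)) (Fin (m + 1)) ℤ :=
  Matrix.of fun i j => Fin.cases (Fin.cases d (fun _ => 0) j) (fun i' => Fin.cases 0 (E i') j) i

@[simp] theorem cornerBlock_zero_zero {M m : ℕ} (d : ℤ) (E : Matrix (Fin M) (Fin m) ℤ) :
    cornerBlock d E 0 0 = d := rfl
@[simp] theorem cornerBlock_zero_succ {M m : ℕ} (d : ℤ) (E : Matrix (Fin M) (Fin m) ℤ) (j) :
    cornerBlock d E 0 (Fin.succ j) = 0 := rfl
@[simp] theorem cornerBlock_succ_zero {M m : ℕ} (d : ℤ) (E : Matrix (Fin M) (Fin m) ℤ) (i) :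
    cornerBlock d E (Fin.succ i) 0 = 0 := rfl
@[simp] theorem cornerBlock_succ_succ {M m : ℕ} (d : ℤ) (E : Matrix (Fin M) (Fin m) ℤ) (i j) :
    cornerBlock d E (Fin.succ i) (Fin.succ j) = E i j := rfl

theorem cornerBlock_mul {M m n : ℕ} (d d' : ℤ) (E : Matrix (Fin M) (Fin m) ℤ)
    (E' : Matrix (Fin m) (Fin n) ℤ) :
    cornerBlock d E * cornerBlock d' E' = cornerBlock (d * d') (E * E') := by
  ext i j
  refine Fin.cases ?_ (fun i => ?_) i <;> refine Fin.cases ?_ (fun j => ?_) j <;>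
    simp [Matrix.mul_apply, Fin.sum_univ_succ]

theorem cornerBlock_one {M : ℕ} : cornerBlock 1 (1 : Matrix (Fin M) (Fin M) ℤ) = 1 := by
  ext i j
  refine Fin.cases ?_ (fun i => ?_) i <;> refine Fin.cases ?_ (fun j => ?_) j <;>
    simp [Matrix.one_apply, Fin.succ_ne_zero, (Fin.succ_ne_zero _).symm]

theorem MatEquiv.cornerBlock {M m : ℕ} {A B : Matrix (Fin M) (Fin m) ℤ} (h : MatEquiv A B)
    (d : ℤ) : MatEquiv (cornerBlock d A) (cornerBlock d B) := by
  have hu : ∀ {n : ℕ} {P : Matrix (Fin n) (Fin n) ℤ}, IsUnit P → IsUnit (_root_.cornerBlock 1 P) := by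
    intro n P hP
    obtain ⟨Q, hQ⟩ := hP.exists_right_inv
    refine IsUnit.of_mul_eq_one (_root_.cornerBlock 1 Q) ?_
    rw [cornerBlock_mul, hQ, mul_one, cornerBlock_one]
  obtain ⟨P, Q, hP, hQ, rfl⟩ := h
  exact ⟨_, _, hu hP, hu hQ, by rw [cornerBlock_mul, cornerBlock_mul]; simp⟩

theorem exists_matEquiv_cornerBlock {M m : ℕ} {A : Matrix (Fin (M + 1)) (Fin (m + 1)) ℤ}
    (hA : A ≠ 0) : ∃ (d : ℤ) (E : Matrix (Fin M) (Fin m) ℤ), MatEquiv A (cornerBlock d (d • E)) := by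
  obtain ⟨B, hAB, hB⟩ := exists_minCorner hA
  choose q hq using hB.dvd_col
  have e1 := MatEquiv.add_row B 0 (Fin.cases 0 fun i => - q i.succ) rfl
  have hB1 := hB.of_matEquiv e1 (by simp)
  set B1 : Matrix (Fin (M + 1)) (Fin (m + 1)) ℤ :=
    Matrix.of fun i j => B i j + (Fin.cases 0 fun i => - q i.succ : Fin (M + 1) → ℤ) i * B 0 j
    with hB1def
  have h1col : ∀ i : Fin M, B1 i.succ 0 = 0 := fun i => by
    have := hq i.succ
    simp only [hB1def, Matrix.of_apply, Fin.cases_succ]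
    linear_combination this
  choose q' hq' using hB1.dvd_row
  have e2 := MatEquiv.add_col B1 0 (Fin.cases 0 fun i => - q' i.succ) rfl
  have hB2 := hB1.of_matEquiv e2 (by simp)
  set B2 : Matrix (Fin (M + 1)) (Fin (m + 1)) ℤ :=
    Matrix.of fun i j => B1 i j + (Fin.cases 0 fun i => - q' i.succ : Fin (m + 1) → ℤ) j * B1 i 0
    with hB2def
  have h2row : ∀ j : Fin m, B2 0 j.succ = 0 := fun j => by
    have := hq' j.succ
    simp only [hB2def, Matrix.of_apply, Fin.cases_succ]
    linear_combination this
  have h2col : ∀ i : Fin M, B2 i.succ 0 = 0 := fun i => by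
    simp [hB2def, h1col]
  have hdvd : ∀ (i : Fin M) (j : Fin m), B2 0 0 ∣ B2 i.succ j.succ := by
    intro i j
    have e3 := MatEquiv.add_row B2 i.succ (Pi.single 0 1) (by simp [Fin.succ_ne_zero])
    have := (hB2.of_matEquiv e3 (by simp [h2col])).dvd_row j.succ
    simpa [h2row, h2col] using this
  choose E hE using hdvd
  refine ⟨B2 0 0, Matrix.of E, ?_⟩
  have : cornerBlock (B2 0 0) (B2 0 0 • Matrix.of E) = B2 := by
    ext i j
    refine Fin.cases ?_ (fun i => ?_) i <;> refine Fin.cases ?_ (fun j => ?_) j <;>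
      simp [h2row, h2col, hE]
  rw [this]
  exact hAB.trans (e1.trans e2)

/-- Existence of the **Smith normal form** over the integers. -/
theorem exists_smith_normal_form {M m : ℕ} (A : Matrix (Fin M) (Fin m) ℤ) :
    ∃ B, MatEquiv A B ∧ (∀ (s : Fin M) (t : Fin m), (s : ℕ) ≠ t → B s t = 0) ∧
      ∀ (s s' : Fin M) (t t' : Fin m), (s : ℕ) = t → (s' : ℕ) = t' → (s : ℕ) + 1 = s' →
        B s t ∣ B s' t' := by
  induction M generalizing m with
  | zero => exact ⟨A, MatEquiv.refl A, fun s => s.elim0, fun s => s.elim0⟩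
  | succ M ih =>
    cases m with
    | zero => exact ⟨A, MatEquiv.refl A, fun _ t => t.elim0, fun _ _ t => t.elim0⟩
    | succ m =>
      by_cases hA : A = 0
      · subst hA
        exact ⟨0, MatEquiv.refl 0, by simp, by simp⟩
      obtain ⟨d, E, hE⟩ := exists_matEquiv_cornerBlock hA
      obtain ⟨B, ⟨P, Q, hP, hQ, hPQ⟩, hdiag, hchain⟩ := ih E
      have hdE : MatEquiv (d • E) (d • B) := ⟨P, Q, hP, hQ, by rw [hPQ]; simp⟩
      refine ⟨_, hE.trans (hdE.cornerBlock d), ?_, ?_⟩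
      · intro s t
        refine Fin.cases ?_ (fun s => ?_) s <;> refine Fin.cases ?_ (fun t => ?_) t
        · simp
        · simp
        · simp
        · intro hst
          simp [hdiag s t (by simpa using hst)]
      · intro s s' t t'
        refine Fin.cases ?_ (fun s => ?_) s <;> refine Fin.cases ?_ (fun t => ?_) t <;>
          refine Fin.cases ?_ (fun s' => ?_) s' <;> refine Fin.cases ?_ (fun t' => ?_) t'
        all_goals intro h1 h2 h3
        all_goals simp at h1 h2 h3 ⊢
        exact mul_dvd_mul_left d (hchain s s' t t' h1 h2 h3)

/-- Factorization of a finite family of integer polynomials into common primitive irreducibles. -/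
theorem exists_common_factorization {m : ℕ} (F : Fin m → ℤ[X]) :
    ∃ (M : ℕ) (G : Fin M → ℤ[X]) (c : Fin m → ℤ) (μ : Fin M → Fin m → ℕ),
      (∀ j, Irreducible (G j)) ∧ (∀ j, (G j).IsPrimitive) ∧
      (∀ j j', j ≠ j' → ¬ Associated (G j) (G j')) ∧
      (∀ i, F i = C (c i) * ∏ j, G j ^ μ j i) ∧ (∀ j, ∃ i, 0 < μ j i) := by
  set N : Fin m → Multiset ℤ[X] := fun i =>
    UniqueFactorizationMonoid.normalizedFactors (F i).primPart with hN
  set S : Finset ℤ[X] := Finset.univ.biUnion fun i => (N i).toFinset with hS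
  have hmem : ∀ g : S, ∃ i, g.1 ∈ N i := fun g => by
    obtain ⟨i, -, hi⟩ := Finset.mem_biUnion.1 g.2
    exact ⟨i, Multiset.mem_toFinset.1 hi⟩
  have hp0 : ∀ i, (F i).primPart ≠ 0 := fun i => (F i).isPrimitive_primPart.ne_zero
  have hu : ∀ i, ∃ u : ℤ, (F i).primPart = C u * (N i).prod := fun i => by
    obtain ⟨u, hu⟩ := (UniqueFactorizationMonoid.prod_normalizedFactors (hp0 i))
    obtain ⟨r, -, hr⟩ := Polynomial.isUnit_iff.1 u.isUnit
    exact ⟨r, by rw [hr, mul_comm]; exact hu.symm⟩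
  choose u hu using hu
  have hprod : ∀ i, (N i).prod = ∏ g : S, g.1 ^ (N i).count g.1 := fun i => by
    rw [Finset.prod_multiset_count, Finset.prod_coe_sort S (fun g => g ^ (N i).count g)]
    refine Finset.prod_subset ?_ ?_
    · intro g hg
      simp only [hS, Finset.mem_biUnion, Finset.mem_univ, true_and]
      exact ⟨i, hg⟩
    · intro g _ hg
      rw [Multiset.count_eq_zero_of_notMem (by simpa using hg), pow_zero]
  refine ⟨S.card, fun j => (S.equivFin.symm j).1, fun i => (F i).content * u i,
    fun j i => (N i).count (S.equivFin.symm j).1, fun j => ?_, fun j => ?_, fun j j' hjj' h => ?_,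
    fun i => ?_, fun j => ?_⟩
  · obtain ⟨i, hi⟩ := hmem (S.equivFin.symm j)
    exact UniqueFactorizationMonoid.irreducible_of_normalized_factor _ hi
  · obtain ⟨i, hi⟩ := hmem (S.equivFin.symm j)
    exact isPrimitive_of_dvd (F i).isPrimitive_primPart
      (UniqueFactorizationMonoid.dvd_of_mem_normalizedFactors hi)
  · obtain ⟨i, hi⟩ := hmem (S.equivFin.symm j)
    obtain ⟨i', hi'⟩ := hmem (S.equivFin.symm j')
    have h1 := UniqueFactorizationMonoid.normalize_normalized_factor _ hi
    have h2 := UniqueFactorizationMonoid.normalize_normalized_factor _ hi'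
    have := normalize_eq_normalize h.dvd h.symm.dvd
    rw [h1, h2] at this
    exact hjj' (S.equivFin.symm.injective (Subtype.ext this))
  · rw [Equiv.prod_comp S.equivFin.symm (fun g : S => g.1 ^ (N i).count g.1), ← hprod, C_mul,
      mul_assoc, ← hu, ← Polynomial.eq_C_content_mul_primPart]
  · obtain ⟨i, hi⟩ := hmem (S.equivFin.symm j)
    exact ⟨i, Multiset.count_pos.2 hi⟩

theorem prod_zpow_sum {ι K : Type*} [Field K] (s : Finset ι) {g : K} (hg : g ≠ 0) (a : ι → ℤ) :
    ∏ i ∈ s, g ^ a i = g ^ ∑ i ∈ s, a i := by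
  induction s using Finset.induction_on with
  | empty => simp
  | insert i s hi ih => rw [Finset.prod_insert hi, Finset.sum_insert hi, ih, zpow_add₀ hg]

/-- Multiplicative independence makes the exponent matrix injective. -/
theorem MultIndep.exponent_injective {m M : ℕ} {F : Fin m → ℤ[X]} (hF : MultIndep F)
    {G : Fin M → ℤ[X]} (hG : ∀ j, G j ≠ 0) {c : Fin m → ℤ} {μ : Fin M → Fin m → ℕ}
    (hfac : ∀ i, F i = C (c i) * ∏ j, G j ^ μ j i) (e : Fin m → ℤ)
    (he : ∀ j, ∑ i, (μ j i : ℤ) * e i = 0) : e = 0 := by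
  by_contra hne
  refine hF ⟨e, hne, ∏ i, (c i : ℚ) ^ e i, ?_⟩
  set φ : ℤ[X] →+* RatFunc ℚ :=
    (algebraMap ℚ[X] (RatFunc ℚ)).comp (Polynomial.mapRingHom (Int.castRingHom ℚ)) with hφ
  have hφ0 : ∀ j, φ (G j) ≠ 0 := fun j => by
    simp only [hφ, RingHom.comp_apply, coe_mapRingHom]
    exact (_root_.map_ne_zero_iff _ (IsFractionRing.injective ℚ[X] (RatFunc ℚ))).2
      ((Polynomial.map_ne_zero_iff Int.cast_injective).2 (hG j))
  have hφc : ∀ a : ℤ, φ (C a) = algebraMap ℚ (RatFunc ℚ) a := fun a => by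
    simp [hφ]
  change ∏ i, φ (F i) ^ e i = _
  calc ∏ i, φ (F i) ^ e i
      = ∏ i, ((algebraMap ℚ (RatFunc ℚ) (c i)) ^ e i * ∏ j, φ (G j) ^ ((μ j i : ℤ) * e i)) := by
        refine Finset.prod_congr rfl fun i _ => ?_
        rw [hfac i, map_mul, hφc, mul_zpow, map_prod, ← Finset.prod_zpow]
        congr 1
        refine Finset.prod_congr rfl fun j _ => ?_
        rw [map_pow, zpow_mul, zpow_natCast]
    _ = (∏ i, (algebraMap ℚ (RatFunc ℚ) (c i)) ^ e i) * ∏ j, φ (G j) ^ (∑ i, (μ j i : ℤ) * e i) := by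
        rw [Finset.prod_mul_distrib, Finset.prod_comm]
        congr 1
        exact Finset.prod_congr rfl fun j _ => prod_zpow_sum _ (hφ0 j) _
    _ = _ := by
        simp [he, map_prod, map_zpow₀]

/-- The last invariant factor exists, and if it is coprime to `L` the exponent matrix is injective
modulo `L`. -/
theorem exists_isLastInvFactor {m M : ℕ} {F : Fin m → ℤ[X]} (hF : MultIndep F)
    {G : Fin M → ℤ[X]} {c : Fin m → ℤ} {μ : Fin M → Fin m → ℕ}
    (hirr : ∀ j, Irreducible (G j)) (hprim : ∀ j, (G j).IsPrimitive)
    (hass : ∀ j j', j ≠ j' → ¬ Associated (G j) (G j'))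
    (hfac : ∀ i, F i = C (c i) * ∏ j, G j ^ μ j i) (huse : ∀ j, ∃ i, 0 < μ j i) :
    ∃ β : ℤ, IsLastInvFactor F β ∧ ∀ L : ℤ, Int.gcd L β = 1 → ∀ e : Fin m → ℤ,
      (∀ j, L ∣ ∑ i, (μ j i : ℤ) * e i) → ∀ i, L ∣ e i := by
  set E : Matrix (Fin M) (Fin m) ℤ := Matrix.of fun u v => (μ u v : ℤ) with hE
  have hinj : ∀ e : Fin m → ℤ, E.mulVec e = 0 → e = 0 := fun e he =>
    hF.exponent_injective (fun j => (hirr j).ne_zero) hfac e fun j => congrFun he j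
  obtain ⟨B, ⟨P, Q, hP, hQ, hB⟩, hdiag, hchain⟩ := exists_smith_normal_form E
  obtain ⟨Q', hQ'⟩ := hQ.exists_left_inv
  obtain ⟨Q'', hQ''⟩ := hQ.exists_right_inv
  obtain ⟨P', hP'⟩ := hP.exists_left_inv
  have hBinj : ∀ e : Fin m → ℤ, B.mulVec e = 0 → e = 0 := by
    intro e he
    have h1 : E.mulVec (Q.mulVec e) = 0 := by
      have : P'.mulVec (B.mulVec e) = E.mulVec (Q.mulVec e) := by
        rw [hB, Matrix.mulVec_mulVec, Matrix.mulVec_mulVec, ← Matrix.mul_assoc, ← Matrix.mul_assoc,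
          hP', Matrix.one_mul]
      rw [← this, he, Matrix.mulVec_zero]
    have h2 := congrArg Q'.mulVec (hinj _ h1)
    rwa [Matrix.mulVec_mulVec, hQ', Matrix.one_mulVec, Matrix.mulVec_zero] at h2
  have hcol : ∀ t : Fin m, ∃ s : Fin M, (s : ℕ) = t ∧ B s t ≠ 0 := by
    intro t
    by_contra! hcon
    have hz : B.mulVec (Pi.single t 1) = 0 := by
      ext s
      rw [Matrix.mulVec_single_one]
      by_cases hs : (s : ℕ) = t
      · exact hcon s hs
      · exact hdiag s t hs
    have := congrFun (hBinj _ hz) t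
    simp at this
  choose σ hσ hσ0 using hcol
  have hmul : ∀ (v : Fin m → ℤ) (t : Fin m), B.mulVec v (σ t) = B (σ t) t * v t := by
    intro v t
    rw [Matrix.mulVec, dotProduct]
    refine Finset.sum_eq_single t (fun t' _ ht' => ?_) (by simp)
    rw [hdiag _ _ (fun h => ht' (Fin.ext (by rw [← h, hσ]))), zero_mul]
  obtain ⟨β, hβ, hβd⟩ : ∃ β : ℤ, (∀ (s : Fin M) (t : Fin m), (s : ℕ) = (t : ℕ) →
      (s : ℕ) + 1 = min M m → β = B s t) ∧ ∀ t, B (σ t) t ∣ β := by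
    cases m with
    | zero => exact ⟨0, fun _ t => t.elim0, fun t => t.elim0⟩
    | succ m =>
      refine ⟨B (σ (Fin.last m)) (Fin.last m), ?_, ?_⟩
      · intro s t hst hs
        have hM : m < M := by
          have := (σ (Fin.last m)).2
          rw [hσ] at this
          simpa using this
        have ht : t = Fin.last m := Fin.ext (by simp; omega)
        subst ht
        congr 1
        exact Fin.ext (by rw [hσ]; exact hst.symm)
      · intro t
        induction t using Fin.reverseInduction with
        | last => exact dvd_rfl
        | cast i ih =>
          exact (hchain _ _ _ _ (hσ _) (hσ _) (by rw [hσ, hσ]; simp)).trans ih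
  refine ⟨β, ⟨M, G, c, μ, hirr, hprim, hass, hfac, huse, P, Q,
    (Matrix.isUnit_iff_isUnit_det _).1 hP, (Matrix.isUnit_iff_isUnit_det _).1 hQ, ?_, ?_, ?_⟩, ?_⟩
  · rw [← hE, ← hB]; exact hdiag
  · rw [← hE, ← hB]; exact hchain
  · rw [← hE, ← hB]; exact hβ
  · intro L hL e he
    have hBe : ∀ t, L ∣ Q''.mulVec e t := by
      intro t
      have h1 : B.mulVec (Q''.mulVec e) = P.mulVec (E.mulVec e) := by
        rw [hB, Matrix.mulVec_mulVec, Matrix.mulVec_mulVec, Matrix.mul_assoc, hQ'', Matrix.mul_one]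
      have h2 : L ∣ B (σ t) t * Q''.mulVec e t := by
        rw [← hmul, h1, Matrix.mulVec, dotProduct]
        exact Finset.dvd_sum fun j _ => Dvd.dvd.mul_left (he j) _
      have hcop : IsCoprime L (B (σ t) t) :=
        (Int.isCoprime_iff_gcd_eq_one.2 hL).of_isCoprime_of_dvd_right (hβd t)
      exact hcop.dvd_of_dvd_mul_left h2
    intro i
    have h3 : e = Q.mulVec (Q''.mulVec e) := by
      rw [Matrix.mulVec_mulVec, hQ'', Matrix.one_mulVec]
    rw [h3, Matrix.mulVec, dotProduct]
    exact Finset.dvd_sum fun j _ => Dvd.dvd.mul_left (hBe j) _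

/-- The polynomials `F_i' ∏_{i' ≠ i} F_{i'}`: the logarithmic derivatives of the `F_i`, cleared of
denominators. -/
def jacPoly {m : ℕ} (F : Fin m → ℤ[X]) (i : Fin m) : ℤ[X] :=
  derivative (F i) * ∏ i' ∈ Finset.univ.erase i, F i'

/-- The logarithmic derivative of an integer polynomial in the fraction field. -/
def polyLogDeriv (f : ℤ[X]) : FractionRing ℤ[X] :=
  algebraMap ℤ[X] (FractionRing ℤ[X]) (derivative f) / algebraMap ℤ[X] (FractionRing ℤ[X]) f

theorem algebraMap_fractionRing_ne_zero {f : ℤ[X]} (hf : f ≠ 0) :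
    algebraMap ℤ[X] (FractionRing ℤ[X]) f ≠ 0 :=
  (_root_.map_ne_zero_iff _ (IsFractionRing.injective ℤ[X] (FractionRing ℤ[X]))).2 hf

theorem polyLogDeriv_mul {f g : ℤ[X]} (hf : f ≠ 0) (hg : g ≠ 0) :
    polyLogDeriv (f * g) = polyLogDeriv f + polyLogDeriv g := by
  have h1 := algebraMap_fractionRing_ne_zero hf
  have h2 := algebraMap_fractionRing_ne_zero hg
  simp only [polyLogDeriv, derivative_mul, map_add, map_mul]
  field_simp

theorem polyLogDeriv_pow {f : ℤ[X]} (hf : f ≠ 0) (n : ℕ) :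
    polyLogDeriv (f ^ n) = n * polyLogDeriv f := by
  induction n with
  | zero => simp [polyLogDeriv]
  | succ n ih => rw [pow_succ, polyLogDeriv_mul (pow_ne_zero _ hf) hf, ih]; push_cast; ring

theorem polyLogDeriv_prod {ι : Type*} (s : Finset ι) {f : ι → ℤ[X]} (hf : ∀ i ∈ s, f i ≠ 0) :
    polyLogDeriv (∏ i ∈ s, f i) = ∑ i ∈ s, polyLogDeriv (f i) := by
  induction s using Finset.induction_on with
  | empty => simp [polyLogDeriv]
  | insert i s hi ih =>
    have hs : ∀ j ∈ s, f j ≠ 0 := fun j hj => hf j (Finset.mem_insert_of_mem hj)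
    rw [Finset.prod_insert hi, Finset.sum_insert hi,
      polyLogDeriv_mul (hf i (Finset.mem_insert_self i s)) (Finset.prod_ne_zero_iff.2 hs), ih hs]

theorem algebraMap_jacPoly {m : ℕ} {F : Fin m → ℤ[X]} (hF : ∀ i, F i ≠ 0) (i : Fin m) :
    algebraMap ℤ[X] (FractionRing ℤ[X]) (jacPoly F i) =
      polyLogDeriv (F i) * algebraMap ℤ[X] (FractionRing ℤ[X]) (∏ i', F i') := by
  have h1 := algebraMap_fractionRing_ne_zero (hF i)
  rw [jacPoly, polyLogDeriv, ← Finset.mul_prod_erase Finset.univ F (Finset.mem_univ i), map_mul,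
    map_mul]
  field_simp

theorem linearIndependent_jacPoly_of_irreducible {M : ℕ} {G : Fin M → ℤ[X]}
    (hirr : ∀ j, Irreducible (G j)) (hdeg : ∀ j, 0 < (G j).natDegree)
    (hass : ∀ j j', j ≠ j' → ¬ Associated (G j) (G j')) (a : Fin M → ℤ)
    (ha : ∑ j, C (a j) * jacPoly G j = 0) : a = 0 := by
  ext j
  have h1 : G j ∣ C (a j) * jacPoly G j := by
    rw [← Finset.add_sum_erase _ _ (Finset.mem_univ j)] at ha
    rw [eq_neg_of_add_eq_zero_left ha, dvd_neg]
    refine Finset.dvd_sum fun j' hj' => ?_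
    refine Dvd.dvd.mul_left (Dvd.dvd.mul_left (Finset.dvd_prod_of_mem _ ?_) _) _
    exact Finset.mem_erase.2 ⟨(Finset.ne_of_mem_erase hj').symm, Finset.mem_univ _⟩
  have hp : Prime (G j) := (hirr j).prime
  by_contra hne
  rcases hp.dvd_or_dvd h1 with h | h
  · have := natDegree_le_of_dvd h (by simpa using hne)
    rw [natDegree_C] at this
    exact absurd this (by have := hdeg j; omega)
  rcases hp.dvd_or_dvd h with h | h
  · have h0 : derivative (G j) ≠ 0 := fun h0 =>
      (hdeg j).ne' (derivative_eq_zero.1 h0)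
    exact absurd (natDegree_le_of_dvd h h0) (not_le.2 (natDegree_derivative_lt (hdeg j).ne'))
  · obtain ⟨j', hj', hd⟩ := (Prime.dvd_finsetProd_iff hp _).1 h
    exact hass j j' (Finset.ne_of_mem_erase hj').symm ((hirr j).associated_of_dvd (hirr j') hd)

theorem linearIndependent_jacPoly {m M : ℕ} {F : Fin m → ℤ[X]} (hF : MultIndep F)
    (hF0 : ∀ i, F i ≠ 0) {G : Fin M → ℤ[X]} {c : Fin m → ℤ} {μ : Fin M → Fin m → ℕ}
    (hirr : ∀ j, Irreducible (G j)) (hdeg : ∀ j, 0 < (G j).natDegree)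
    (hass : ∀ j j', j ≠ j' → ¬ Associated (G j) (G j'))
    (hfac : ∀ i, F i = C (c i) * ∏ j, G j ^ μ j i) :
    LinearIndependent ℤ (jacPoly F) := by
  rw [Fintype.linearIndependent_iff]
  intro e he
  have hG0 : ∀ j, G j ≠ 0 := fun j => (hirr j).ne_zero
  have hc : ∀ i, c i ≠ 0 := fun i h => hF0 i (by rw [hfac, h]; simp)
  have hld : ∀ i, polyLogDeriv (F i) = ∑ j, (μ j i : FractionRing ℤ[X]) * polyLogDeriv (G j) := by
    intro i
    rw [hfac, polyLogDeriv_mul (by simpa using hc i)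
      (Finset.prod_ne_zero_iff.2 fun j _ => pow_ne_zero _ (hG0 j)),
      polyLogDeriv_prod _ fun j _ => pow_ne_zero _ (hG0 j)]
    simp only [polyLogDeriv_pow (hG0 _)]
    simp [polyLogDeriv]
  have h1 : ∑ i, (e i : FractionRing ℤ[X]) * polyLogDeriv (F i) = 0 := by
    have h2 := congrArg (algebraMap ℤ[X] (FractionRing ℤ[X])) he
    rw [map_sum, map_zero] at h2
    have h3 : (∑ i, (e i : FractionRing ℤ[X]) * polyLogDeriv (F i)) *
        algebraMap ℤ[X] (FractionRing ℤ[X]) (∏ i', F i') = 0 := by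
      rw [← h2, Finset.sum_mul]
      refine Finset.sum_congr rfl fun i _ => ?_
      rw [map_zsmul, algebraMap_jacPoly hF0, zsmul_eq_mul, mul_assoc]
    exact (mul_eq_zero.1 h3).resolve_right
      (algebraMap_fractionRing_ne_zero (Finset.prod_ne_zero_iff.2 fun i _ => hF0 i))
  have h4 : (fun j => ∑ i, (μ j i : ℤ) * e i) = 0 := by
    refine linearIndependent_jacPoly_of_irreducible hirr hdeg hass _ ?_
    apply IsFractionRing.injective ℤ[X] (FractionRing ℤ[X])
    rw [map_sum, map_zero]
    simp only [map_mul, algebraMap_jacPoly hG0, ← mul_assoc]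
    rw [← Finset.sum_mul]
    have : ∑ j, algebraMap ℤ[X] (FractionRing ℤ[X]) (C (∑ i, (μ j i : ℤ) * e i)) *
        polyLogDeriv (G j) = 0 := by
      rw [← h1]
      simp only [hld, Finset.mul_sum]
      rw [Finset.sum_comm]
      refine Finset.sum_congr rfl fun j _ => ?_
      rw [map_sum, map_sum, Finset.sum_mul]
      refine Finset.sum_congr rfl fun i _ => ?_
      simp
      ring
    rw [this, zero_mul]
  exact fun i => congrFun (hF.exponent_injective hG0 hfac e (congrFun h4)) i

theorem exists_det_eval_ne_zero {m : ℕ} {V : Fin m → ℤ[X]} (hV : LinearIndependent ℤ V) :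
    ∃ u : Fin m → ℤ, (Matrix.of fun i j => (V i).eval (u j)).det ≠ 0 := by
  induction m with
  | zero => exact ⟨fun i => i.elim0, by simp⟩
  | succ m ih =>
    obtain ⟨u, hu⟩ := ih (hV.comp Fin.succ (Fin.succ_injective m))
    by_contra! hcon
    set d : Fin (m + 1) → ℤ := fun i =>
      (Matrix.of fun i' j => (V (i.succAbove i')).eval (u j)).det with hd
    have h0 : ∑ i : Fin (m + 1), ((-1) ^ (i : ℕ) * d i) • V i = 0 := by
      refine Polynomial.funext fun T => ?_
      have := hcon (Fin.cons T u)
      rw [Matrix.det_succ_column_zero] at this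
      rw [eval_finsetSum, eval_zero, ← this]
      refine Finset.sum_congr rfl fun i _ => ?_
      simp only [eval_smul, Matrix.of_apply, Fin.cons_zero, smul_eq_mul, hd]
      rw [mul_right_comm]
      rfl
    have h1 := Fintype.linearIndependent_iff.1 hV _ h0 0
    simp only [Fin.val_zero, pow_zero, one_mul, hd] at h1
    exact hu (by simpa using h1)

theorem eventually_intCast_zmod_ne_zero {n : ℤ} (hn : n ≠ 0) :
    ∀ᶠ ℓ : ℕ in Filter.atTop, (n : ZMod ℓ) ≠ 0 := by
  filter_upwards [Filter.eventually_gt_atTop n.natAbs] with ℓ hℓ h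
  rw [ZMod.intCast_zmod_eq_zero_iff_dvd, Int.natCast_dvd] at h
  exact absurd (Nat.le_of_dvd (Int.natAbs_pos.2 hn) h) (not_le.2 hℓ)

theorem eventually_isCoprime_map_zmod {f g : ℤ[X]}
    (h : IsCoprime (f.map (Int.castRingHom ℚ)) (g.map (Int.castRingHom ℚ))) :
    ∀ᶠ ℓ : ℕ in Filter.atTop, ∀ [Fact ℓ.Prime],
      IsCoprime (f.map (Int.castRingHom (ZMod ℓ))) (g.map (Int.castRingHom (ZMod ℓ))) := by
  obtain ⟨a, b, hab⟩ := h
  obtain ⟨s, hs, hs'⟩ := IsLocalization.integerNormalization_spec (nonZeroDivisors ℤ) a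
  obtain ⟨t, ht, ht'⟩ := IsLocalization.integerNormalization_spec (nonZeroDivisors ℤ) b
  set A := IsLocalization.integerNormalization (nonZeroDivisors ℤ) a
  set B := IsLocalization.integerNormalization (nonZeroDivisors ℤ) b
  have hid : C t * A * f + C s * B * g = C (s * t) := by
    apply Polynomial.map_injective (Int.castRingHom ℚ) Int.cast_injective
    have h1 : A.map (Int.castRingHom ℚ) = C (s : ℚ) * a := by
      rw [← algebraMap_int_eq, hs', ← smul_eq_C_mul]; simp [Algebra.smul_def]
    have h2 : B.map (Int.castRingHom ℚ) = C (t : ℚ) * b := by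
      rw [← algebraMap_int_eq, ht', ← smul_eq_C_mul]; simp [Algebra.smul_def]
    simp only [Polynomial.map_add, Polynomial.map_mul, h1, h2, map_C]
    simp only [eq_intCast, map_mul]
    linear_combination (C (s : ℚ) * C (t : ℚ)) * hab
  have hst : s * t ≠ 0 := mul_ne_zero (nonZeroDivisors.ne_zero hs) (nonZeroDivisors.ne_zero ht)
  filter_upwards [eventually_intCast_zmod_ne_zero hst] with ℓ hℓ _
  have h3 := congrArg (Polynomial.map (Int.castRingHom (ZMod ℓ))) hid
  simp only [Polynomial.map_add, Polynomial.map_mul, map_C] at h3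
  simp only [eq_intCast] at h3
  refine ⟨C (((s * t : ℤ) : ZMod ℓ)⁻¹) * (C (t : ZMod ℓ) * A.map (Int.castRingHom (ZMod ℓ))),
    C (((s * t : ℤ) : ZMod ℓ)⁻¹) * (C (s : ZMod ℓ) * B.map (Int.castRingHom (ZMod ℓ))), ?_⟩
  have h4 : C (((s * t : ℤ) : ZMod ℓ)⁻¹) * C ((s * t : ℤ) : ZMod ℓ) = 1 := by
    rw [← C_mul, inv_mul_cancel₀ hℓ, C_1]
  linear_combination (C (((s * t : ℤ) : ZMod ℓ)⁻¹)) * h3 + h4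

theorem natDegree_pos_of_irreducible_of_isPrimitive {g : ℤ[X]} (h : Irreducible g)
    (hp : g.IsPrimitive) : 0 < g.natDegree := by
  rw [Nat.pos_iff_ne_zero]
  intro h0
  rw [natDegree_eq_zero] at h0
  obtain ⟨a, rfl⟩ := h0
  exact h.not_isUnit (isUnit_C.2 (hp a dvd_rfl))

theorem aeval_zmod_eq {ℓ : ℕ} (v : ZMod ℓ) (f : ℤ[X]) :
    aeval v f = (f.map (Int.castRingHom (ZMod ℓ))).eval v := by
  rw [aeval_def, eval₂_eq_eval_map, algebraMap_int_eq]

theorem sum_eq_add_sum_units {ℓ : ℕ} [Fact ℓ.Prime] {A : Type*} [AddCommMonoid A]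
    (g : ZMod ℓ → A) : ∑ v, g v = g 0 + ∑ v : (ZMod ℓ)ˣ, g v := by
  rw [← Finset.add_sum_erase _ _ (Finset.mem_univ (0 : ZMod ℓ))]
  congr 1
  symm
  refine Finset.sum_bij (fun v _ => (v : ZMod ℓ)) (fun v _ => ?_) (fun _ _ _ _ h => Units.ext h)
    (fun v hv => ?_) (fun _ _ => rfl)
  · exact Finset.mem_erase.2 ⟨v.ne_zero, Finset.mem_univ _⟩
  · exact ⟨Units.mk0 v (Finset.ne_of_mem_erase hv), Finset.mem_univ _, rfl⟩

theorem prod_mulChar_pow_eq_one_iff {ℓ m M : ℕ} [Fact ℓ.Prime] {μ : Fin M → Fin m → ℕ}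
    (hμ : ∀ e : Fin m → ℤ, (∀ j, ((ℓ : ℤ) - 1) ∣ ∑ i, (μ j i : ℤ) * e i) →
      ∀ i, ((ℓ : ℤ) - 1) ∣ e i)
    (χ : Fin m → MulChar (ZMod ℓ) ℂ) (h : ∀ j, ∏ i, χ i ^ μ j i = 1) : χ = 1 := by
  obtain ⟨ω, hω⟩ := IsCyclic.exists_generator (α := MulChar (ZMod ℓ) ℂ)
  have hord : (orderOf ω : ℤ) = (ℓ : ℤ) - 1 := by
    have h1 := orderOf_eq_card_of_forall_mem_zpowers hω
    have h2 := DirichletCharacter.card_eq_totient_of_hasEnoughRootsOfUnity ℂ ℓ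
    rw [Nat.totient_prime Fact.out] at h2
    have h3 : Nat.card (MulChar (ZMod ℓ) ℂ) = ℓ - 1 := h2
    rw [h1, h3, Nat.cast_sub (Fact.out : ℓ.Prime).one_le, Nat.cast_one]
  choose e he using fun i => Subgroup.mem_zpowers_iff.1 (hω (χ i))
  have hdvd := hμ e fun j => by
    rw [← hord, orderOf_dvd_iff_zpow_eq_one, ← h j]
    have : ∀ s : Finset (Fin m), ω ^ (∑ i ∈ s, (μ j i : ℤ) * e i) = ∏ i ∈ s, χ i ^ μ j i := by
      intro s
      induction s using Finset.induction_on with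
      | empty => simp
      | insert i s hi ih =>
        rw [Finset.sum_insert hi, Finset.prod_insert hi, zpow_add, ih, mul_comm (μ j i : ℤ),
          zpow_mul, he, zpow_natCast]
    exact this _
  funext i
  rw [← he i, Pi.one_apply, ← orderOf_dvd_iff_zpow_eq_one, hord]
  exact hdvd i

theorem mulChar_prod_pow_apply {ι R R' : Type*} [CommMonoid R] [CommMonoidWithZero R']
    (s : Finset ι) (χ : ι → MulChar R R') (n : ι → ℕ) (u : Rˣ) :
    (∏ i ∈ s, χ i ^ n i) u = ∏ i ∈ s, χ i u ^ n i := by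
  induction s using Finset.induction_on with
  | empty => simp
  | insert i s hi ih =>
    rw [Finset.prod_insert hi, Finset.prod_insert hi, MulChar.mul_apply, ih, MulChar.pow_apply_coe]

theorem eventually_norm_charSum_le {m M : ℕ} {F : Fin m → ℤ[X]}
    {G : Fin M → ℤ[X]} {c : Fin m → ℤ} {μ : Fin M → Fin m → ℕ}
    (hirr : ∀ j, Irreducible (G j)) (hprim : ∀ j, (G j).IsPrimitive)
    (hass : ∀ j j', j ≠ j' → ¬ Associated (G j) (G j'))
    (hfac : ∀ i, F i = C (c i) * ∏ j, G j ^ μ j i) (huse : ∀ j, ∃ i, 0 < μ j i) :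
    ∀ᶠ ℓ : ℕ in Filter.atTop, ∀ [Fact ℓ.Prime],
      (∀ e : Fin m → ℤ, (∀ j, ((ℓ : ℤ) - 1) ∣ ∑ i, (μ j i : ℤ) * e i) →
        ∀ i, ((ℓ : ℤ) - 1) ∣ e i) →
      ∀ χ : Fin m → MulChar (ZMod ℓ) ℂ, χ ≠ 1 →
        ‖∑ v : (ZMod ℓ)ˣ, ∏ i, χ i (aeval (v : ZMod ℓ) (F i))‖ ≤
          (∑ j, (G j).natDegree : ℕ) * √ℓ + 1 := by
  have hdeg : ∀ j, 0 < (G j).natDegree := fun j =>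
    natDegree_pos_of_irreducible_of_isPrimitive (hirr j) (hprim j)
  have hQ : ∀ j, Irreducible ((G j).map (Int.castRingHom ℚ)) := fun j =>
    ((hprim j).irreducible_iff_irreducible_map_fraction_map (K := ℚ)).1 (hirr j)
  have hsep : ∀ᶠ ℓ : ℕ in Filter.atTop, ∀ j, ∀ [Fact ℓ.Prime],
      ((G j).map (Int.castRingHom (ZMod ℓ))).Separable := by
    rw [Filter.eventually_all]
    intro j
    have := (hQ j).separable
    rw [Polynomial.Separable, derivative_map] at this
    filter_upwards [eventually_isCoprime_map_zmod this] with ℓ hℓ _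
    rw [Polynomial.Separable, derivative_map]
    exact hℓ
  have hcop : ∀ᶠ ℓ : ℕ in Filter.atTop, ∀ j j', j ≠ j' → ∀ [Fact ℓ.Prime],
      IsCoprime ((G j).map (Int.castRingHom (ZMod ℓ))) ((G j').map (Int.castRingHom (ZMod ℓ))) := by
    rw [Filter.eventually_all]
    intro j
    rw [Filter.eventually_all]
    intro j'
    by_cases hjj' : j = j'
    · exact Filter.Eventually.of_forall fun _ h => absurd hjj' h
    filter_upwards [eventually_isCoprime_map_zmod ((hQ j).coprime_iff_not_dvd.2 fun h =>
      hass j j' hjj' ((hirr j).associated_of_dvd (hirr j')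
        ((IsPrimitive.Int.dvd_iff_map_cast_dvd_map_cast _ _ (hprim j)).2 h)))]
      with ℓ hℓ _ _
    exact hℓ
  have hlead : ∀ᶠ ℓ : ℕ in Filter.atTop, ∀ j, ((G j).leadingCoeff : ZMod ℓ) ≠ 0 := by
    rw [Filter.eventually_all]
    exact fun j => eventually_intCast_zmod_ne_zero (leadingCoeff_ne_zero.2 (hirr j).ne_zero)
  filter_upwards [hsep, hcop, hlead] with ℓ hsep hcop hlead _ hμ χ hχ
  set g : Fin M → (ZMod ℓ)[X] := fun j => (G j).map (Int.castRingHom (ZMod ℓ)) with hg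
  have hgdeg : ∀ j, (g j).natDegree = (G j).natDegree := fun j =>
    natDegree_map_of_leadingCoeff_ne_zero _ (hlead j)
  set θ : Fin M → MulChar (ZMod ℓ) ℂ := fun j => ∏ i, χ i ^ μ j i with hθ
  have hθ1 : ∃ j, θ j ≠ 1 := by
    by_contra! h
    exact hχ (prod_mulChar_pow_eq_one_iff hμ χ h)
  have hweil := weil_bound θ hθ1 g (fun j => hsep j) (fun j j' h => hcop j j' h)
    (fun j => by rw [hgdeg]; exact hdeg j)
  simp only [hgdeg] at hweil
  have hpt : ∀ v : ZMod ℓ, ∏ i, χ i (aeval v (F i)) =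
      (∏ i, χ i (c i)) * ∏ j, θ j ((g j).eval v) := by
    intro v
    have hev : ∀ i, aeval v (F i) = (c i : ZMod ℓ) * ∏ j, (g j).eval v ^ μ j i := by
      intro i
      rw [hfac, map_mul, aeval_C, map_prod]
      simp only [map_pow, aeval_zmod_eq, hg]
      simp
    by_cases h0 : ∃ j, (g j).eval v = 0
    · obtain ⟨j, hj⟩ := h0
      obtain ⟨i, hi⟩ := huse j
      rw [Finset.prod_eq_zero (Finset.mem_univ i), Finset.prod_eq_zero (Finset.mem_univ j), mul_zero]
      · rw [hj, MulChar.map_zero]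
      · rw [hev, Finset.prod_eq_zero (Finset.mem_univ j), mul_zero, MulChar.map_zero]
        rw [hj, zero_pow hi.ne']
    · push Not at h0
      have hθe : ∀ j, θ j ((g j).eval v) = ∏ i, χ i ((g j).eval v) ^ μ j i := by
        intro j
        have hu : (g j).eval v = ((Units.mk0 _ (h0 j) : (ZMod ℓ)ˣ) : ZMod ℓ) := rfl
        rw [hu, hθ]
        exact mulChar_prod_pow_apply _ _ _ _
      simp only [hev, hθe, map_mul, map_prod, map_pow, Finset.prod_mul_distrib]
      rw [Finset.prod_comm]
  have hsum : ∑ v : ZMod ℓ, ∏ i, χ i (aeval v (F i)) =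
      (∏ i, χ i (c i)) * ∑ v, ∏ j, θ j ((g j).eval v) := by
    rw [Finset.mul_sum]
    exact Finset.sum_congr rfl fun v _ => hpt v
  have hnorm : ∀ z : Fin m → ZMod ℓ, ‖∏ i, χ i (z i)‖ ≤ 1 := fun z => by
    rw [norm_prod]
    exact Finset.prod_le_one (fun _ _ => norm_nonneg _) fun i _ => mulChar_norm_le_one _ _
  have h1 : ∑ v : (ZMod ℓ)ˣ, ∏ i, χ i (aeval (v : ZMod ℓ) (F i)) =
      (∏ i, χ i (c i)) * ∑ v, ∏ j, θ j ((g j).eval v) - ∏ i, χ i (aeval (0 : ZMod ℓ) (F i)) := by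
    rw [← hsum, sum_eq_add_sum_units]
    ring
  rw [h1]
  refine (norm_sub_le _ _).trans (add_le_add ?_ (hnorm _))
  rw [norm_mul]
  exact (mul_le_of_le_one_left (norm_nonneg _) (hnorm _)).trans hweil

/-- The determinant of the cleared logarithmic derivatives at a tuple of points. -/
def jacDet {m : ℕ} {A : Type*} [CommRing A] (F : Fin m → ℤ[X]) (u : Fin m → A) : A :=
  (Matrix.of fun i j => aeval (u j) (jacPoly F i)).det

/-- The multivariate polynomial whose nonvanishing locus consists of the tuples of nonzero points
at which all `F i` and the Jacobian determinant are nonzero. -/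
def regularityPoly {m : ℕ} (F : Fin m → ℤ[X]) : MvPolynomial (Fin m) ℤ :=
  (∏ j, (MvPolynomial.X j * ∏ i, aeval (MvPolynomial.X j) (F i))) * jacDet F MvPolynomial.X

theorem aeval_regularityPoly {m : ℕ} {A : Type*} [CommRing A] (F : Fin m → ℤ[X]) (u : Fin m → A) :
    MvPolynomial.aeval u (regularityPoly F) =
      (∏ j, (u j * ∏ i, aeval (u j) (F i))) * jacDet F u := by
  have h : ∀ (j : Fin m) (f : ℤ[X]), MvPolynomial.aeval u (aeval (MvPolynomial.X j) f) =
      aeval (u j) f := fun j f => by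
    rw [← Polynomial.aeval_algHom_apply, MvPolynomial.aeval_X]
  simp only [regularityPoly, map_mul, map_prod, h, MvPolynomial.aeval_X, jacDet, AlgHom.map_det]
  congr 2
  ext i j
  exact h j _

theorem regularityPoly_ne_zero {m : ℕ} {F : Fin m → ℤ[X]} (hF0 : ∀ i, F i ≠ 0)
    (hV : LinearIndependent ℤ (jacPoly F)) : regularityPoly F ≠ 0 := by
  have hX : ∀ (j : Fin m) (f : ℤ[X]), f ≠ 0 →
      (aeval (MvPolynomial.X j) f : MvPolynomial (Fin m) ℤ) ≠ 0 := by
    intro j f hf h0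
    refine hf (Polynomial.funext fun t => ?_)
    have := congrArg (MvPolynomial.aeval (fun _ : Fin m => t)) h0
    rw [← Polynomial.aeval_algHom_apply, MvPolynomial.aeval_X, map_zero] at this
    simpa using this
  refine mul_ne_zero (Finset.prod_ne_zero_iff.2 fun j _ => mul_ne_zero (MvPolynomial.X_ne_zero j)
    (Finset.prod_ne_zero_iff.2 fun i _ => hX j _ (hF0 i))) fun h0 => ?_
  obtain ⟨u, hu⟩ := exists_det_eval_ne_zero hV
  refine hu ?_
  have := congrArg (MvPolynomial.aeval u) h0
  rw [jacDet, AlgHom.map_det, map_zero] at this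
  rw [← this]
  congr 1
  ext i j
  simp only [Matrix.of_apply, AlgHom.mapMatrix_apply, Matrix.map_apply]
  rw [← Polynomial.aeval_algHom_apply, MvPolynomial.aeval_X]
  simp

theorem eventually_card_regular_ge {m : ℕ} {F : Fin m → ℤ[X]} (hF0 : ∀ i, F i ≠ 0)
    (hV : LinearIndependent ℤ (jacPoly F)) :
    ∃ D : ℕ, ∀ᶠ ℓ : ℕ in Filter.atTop, ∀ [Fact ℓ.Prime],
      (ℓ : ℝ) ^ m * (1 - D / ℓ) ≤ ((Finset.univ.filter fun u : Fin m → ZMod ℓ =>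
        (∀ j, u j ≠ 0) ∧ (∀ i j, aeval (u j) (F i) ≠ 0) ∧ jacDet F u ≠ 0).card : ℝ) := by
  refine ⟨(regularityPoly F).totalDegree, ?_⟩
  have h0 := regularityPoly_ne_zero hF0 hV
  obtain ⟨u, hu⟩ : ∃ u : Fin m → ℤ, MvPolynomial.aeval u (regularityPoly F) ≠ 0 := by
    by_contra! h
    exact h0 (MvPolynomial.funext fun u => by simpa using h u)
  filter_upwards [eventually_intCast_zmod_ne_zero hu] with ℓ hℓ hfact
  set p : MvPolynomial (Fin m) (ZMod ℓ) := MvPolynomial.map (Int.castRingHom _) (regularityPoly F)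
    with hp
  have hev : ∀ v : Fin m → ZMod ℓ, MvPolynomial.eval v p =
      MvPolynomial.aeval v (regularityPoly F) := fun v => by
    rw [hp, MvPolynomial.eval_map, MvPolynomial.aeval_def, algebraMap_int_eq]
  have hp0 : p ≠ 0 := by
    intro h
    have h1 := hev (fun i => (u i : ZMod ℓ))
    rw [h, map_zero] at h1
    refine hℓ ?_
    have h2 := MvPolynomial.aeval_algebraMap_apply (ZMod ℓ) u (regularityPoly F)
    rw [algebraMap_int_eq] at h2
    simp only [eq_intCast, Function.comp_def] at h2
    rw [← h2]
    exact h1.symm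
  have hsz := MvPolynomial.schwartz_zippel_totalDegree hp0 (Finset.univ : Finset (ZMod ℓ))
  rw [Finset.card_univ, ZMod.card, Fintype.piFinset_univ] at hsz
  have hsz' : ((Finset.univ.filter fun f : Fin m → ZMod ℓ => MvPolynomial.eval f p = 0).card : ℝ) /
      (ℓ : ℝ) ^ m ≤ (p.totalDegree : ℝ) / ℓ := by
    have h1 := (NNRat.cast_le (K := ℝ)).2 hsz
    push_cast at h1
    convert h1
  have hdeg : (p.totalDegree : ℝ) ≤ (regularityPoly F).totalDegree := by
    exact_mod_cast Finset.sup_mono (MvPolynomial.support_map_subset _ _)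
  have hℓ0 : (0 : ℝ) < ℓ := by exact_mod_cast hfact.out.pos
  have hcard : (Finset.univ.filter fun f : Fin m → ZMod ℓ => MvPolynomial.eval f p = 0).card +
      (Finset.univ.filter fun f : Fin m → ZMod ℓ => ¬ MvPolynomial.eval f p = 0).card = ℓ ^ m := by
    rw [Finset.card_filter_add_card_filter_not]
    simp [ZMod.card]
  have hsub : (Finset.univ.filter fun f : Fin m → ZMod ℓ => ¬ MvPolynomial.eval f p = 0) =
      Finset.univ.filter fun u : Fin m → ZMod ℓ =>
        (∀ j, u j ≠ 0) ∧ (∀ i j, aeval (u j) (F i) ≠ 0) ∧ jacDet F u ≠ 0 := by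
    ext v
    simp only [Finset.mem_filter, Finset.mem_univ, true_and, hev, aeval_regularityPoly,
      mul_eq_zero, Finset.prod_eq_zero_iff]
    push Not
    constructor
    · rintro ⟨h1, h2⟩
      exact ⟨fun j => (h1 j).1, fun i j => (h1 j).2 i, h2⟩
    · rintro ⟨h1, h2, h3⟩
      exact ⟨fun j => ⟨h1 j, fun i => h2 i j⟩, h3⟩
  rw [← hsub]
  have hcard' : ((Finset.univ.filter fun f : Fin m → ZMod ℓ => MvPolynomial.eval f p = 0).card : ℝ) +
      (Finset.univ.filter fun f : Fin m → ZMod ℓ => ¬ MvPolynomial.eval f p = 0).card = (ℓ : ℝ) ^ m := by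
    exact_mod_cast hcard
  rw [div_le_iff₀ (by positivity)] at hsz'
  have h3 : (p.totalDegree : ℝ) / ℓ * (ℓ : ℝ) ^ m ≤ (regularityPoly F).totalDegree / ℓ * (ℓ : ℝ) ^ m := by
    gcongr
  linarith

theorem card_mulChar_zmod (ℓ : ℕ) [hℓ : Fact ℓ.Prime] :
    Fintype.card (MulChar (ZMod ℓ) ℂ) = ℓ - 1 := by
  have h2 := DirichletCharacter.card_eq_totient_of_hasEnoughRootsOfUnity ℂ ℓ
  rw [Nat.totient_prime hℓ.out, Nat.card_eq_fintype_card] at h2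
  exact h2

/-- Fourier inversion on `((ℤ/ℓ)ˣ)^m` for the number of representations by products. -/
theorem card_prod_eq_fourier {ℓ m : ℕ} [hℓ : Fact ℓ.Prime] (N : ℕ)
    (g : (ZMod ℓ)ˣ → Fin m → ZMod ℓ) (b : Fin m → (ZMod ℓ)ˣ) :
    ∑ χ : Fin m → MulChar (ZMod ℓ) ℂ, (∏ i, χ i ((b i : ZMod ℓ)⁻¹)) *
        (∑ v : (ZMod ℓ)ˣ, ∏ i, χ i (g v i)) ^ N =
      (ℓ - 1 : ℂ) ^ m * ((Finset.univ.filter fun w : Fin N → (ZMod ℓ)ˣ =>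
        ∀ i, ∏ j, g (w j) i = b i).card : ℂ) := by
  have h1 : ∀ χ : Fin m → MulChar (ZMod ℓ) ℂ, (∏ i, χ i ((b i : ZMod ℓ)⁻¹)) *
      (∑ v : (ZMod ℓ)ˣ, ∏ i, χ i (g v i)) ^ N =
      ∑ w : Fin N → (ZMod ℓ)ˣ, ∏ i, (χ i ((b i : ZMod ℓ)⁻¹) * χ i (∏ j, g (w j) i)) := by
    intro χ
    rw [Fintype.sum_pow, Finset.mul_sum]
    refine Finset.sum_congr rfl fun w _ => ?_
    rw [Finset.prod_mul_distrib, Finset.prod_comm]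
    simp only [map_prod]
  simp only [h1]
  rw [Finset.sum_comm, Finset.card_filter, Nat.cast_sum, Finset.mul_sum]
  refine Finset.sum_congr rfl fun w _ => ?_
  have h2 := Finset.prod_univ_sum (fun _ : Fin m => (Finset.univ : Finset (MulChar (ZMod ℓ) ℂ)))
    (fun i χ => χ ((b i : ZMod ℓ)⁻¹) * χ (∏ j, g (w j) i))
  rw [Fintype.piFinset_univ] at h2
  rw [← h2]
  have h3 : ∀ i, ∑ χ : MulChar (ZMod ℓ) ℂ, χ ((b i : ZMod ℓ)⁻¹) * χ (∏ j, g (w j) i) =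
      if (b i : ZMod ℓ) = ∏ j, g (w j) i then (ℓ - 1 : ℂ) else 0 := by
    intro i
    have := DirichletCharacter.sum_char_inv_mul_char_eq ℂ (b i).isUnit (∏ j, g (w j) i)
    rw [Nat.totient_prime hℓ.out, Nat.cast_sub hℓ.out.one_le, Nat.cast_one] at this
    convert this
  simp only [h3]
  by_cases h : ∀ i, ∏ j, g (w j) i = b i
  · rw [if_pos h]
    simp [h]
  · rw [if_neg h]
    push Not at h
    obtain ⟨i, hi⟩ := h
    rw [Finset.prod_eq_zero (Finset.mem_univ i) (if_neg hi.symm)]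
    simp

theorem card_prod_ge {ℓ m : ℕ} [hℓ : Fact ℓ.Prime] (N : ℕ)
    (g : (ZMod ℓ)ˣ → Fin m → ZMod ℓ) (b : Fin m → (ZMod ℓ)ˣ) {B : ℝ} (hB : 0 ≤ B)
    (hS : ∀ χ : Fin m → MulChar (ZMod ℓ) ℂ, χ ≠ 1 → ‖∑ v : (ZMod ℓ)ˣ, ∏ i, χ i (g v i)‖ ≤ B) :
    ((Finset.univ.filter fun v : (ZMod ℓ)ˣ => ∀ i, g v i ≠ 0).card : ℝ) ^ N -
      (ℓ - 1 : ℝ) ^ m * B ^ N ≤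
      (ℓ - 1 : ℝ) ^ m * ((Finset.univ.filter fun w : Fin N → (ZMod ℓ)ˣ =>
        ∀ i, ∏ j, g (w j) i = b i).card : ℝ) := by
  have h := card_prod_eq_fourier N g b
  set T := (Finset.univ.filter fun w : Fin N → (ZMod ℓ)ˣ => ∀ i, ∏ j, g (w j) i = b i).card
  set s := (Finset.univ.filter fun v : (ZMod ℓ)ˣ => ∀ i, g v i ≠ 0).card with hs
  have htriv : ∑ v : (ZMod ℓ)ˣ, ∏ i, (1 : Fin m → MulChar (ZMod ℓ) ℂ) i (g v i) = s := by
    rw [hs, Finset.card_filter, Nat.cast_sum]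
    refine Finset.sum_congr rfl fun v _ => ?_
    by_cases hv : ∀ i, g v i ≠ 0
    · rw [if_pos hv, Nat.cast_one]
      exact Finset.prod_eq_one fun i _ => MulChar.one_apply (hv i).isUnit
    · rw [if_neg hv, Nat.cast_zero]
      push Not at hv
      obtain ⟨i, hi⟩ := hv
      exact Finset.prod_eq_zero (Finset.mem_univ i) (by rw [hi, MulChar.map_zero])
  have htrivb : ∏ i, (1 : Fin m → MulChar (ZMod ℓ) ℂ) i ((b i : ZMod ℓ)⁻¹) = 1 :=
    Finset.prod_eq_one fun i _ => MulChar.one_apply (b i).ne_zero.isUnit.inv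
  rw [← Finset.add_sum_erase _ _ (Finset.mem_univ (1 : Fin m → MulChar (ZMod ℓ) ℂ)), htriv,
    htrivb, one_mul] at h
  have herr : ‖∑ χ ∈ Finset.univ.erase (1 : Fin m → MulChar (ZMod ℓ) ℂ),
      (∏ i, χ i ((b i : ZMod ℓ)⁻¹)) * (∑ v : (ZMod ℓ)ˣ, ∏ i, χ i (g v i)) ^ N‖ ≤
      (ℓ - 1 : ℝ) ^ m * B ^ N := by
    refine (norm_sum_le _ _).trans ((Finset.sum_le_card_nsmul _ _ (B ^ N) fun χ hχ => ?_).trans ?_)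
    · rw [norm_mul, norm_pow, norm_prod]
      refine (mul_le_of_le_one_left (by positivity) (Finset.prod_le_one
        (fun _ _ => norm_nonneg _) fun i _ => mulChar_norm_le_one _ _)).trans ?_
      exact pow_le_pow_left₀ (norm_nonneg _) (hS χ (Finset.ne_of_mem_erase hχ)) N
    · rw [nsmul_eq_mul]
      refine mul_le_mul_of_nonneg_right ?_ (by positivity)
      have h1 : (Finset.univ.erase (1 : Fin m → MulChar (ZMod ℓ) ℂ)).card ≤ (ℓ - 1) ^ m := by
        refine (Finset.card_le_univ _).trans ?_
        rw [Fintype.card_fun, card_mulChar_zmod, Fintype.card_fin]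
      have h2 : (((ℓ - 1 : ℕ) ^ m : ℕ) : ℝ) = (ℓ - 1 : ℝ) ^ m := by
        rw [Nat.cast_pow, Nat.cast_sub hℓ.out.one_le, Nat.cast_one]
      rw [← h2]
      exact_mod_cast h1
  set Err := ∑ χ ∈ Finset.univ.erase (1 : Fin m → MulChar (ZMod ℓ) ℂ),
      (∏ i, χ i ((b i : ZMod ℓ)⁻¹)) * (∑ v : (ZMod ℓ)ˣ, ∏ i, χ i (g v i)) ^ N
  have h3 : Err = (((ℓ - 1 : ℝ) ^ m * T - s ^ N : ℝ) : ℂ) := by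
    push_cast
    rw [← h]; ring
  rw [h3, Complex.norm_real, Real.norm_eq_abs] at herr
  linarith [neg_abs_le ((ℓ - 1 : ℝ) ^ m * T - (s : ℝ) ^ N)]

theorem eventually_card_units_nonvanishing_ge {m : ℕ} {F : Fin m → ℤ[X]} (hF0 : ∀ i, F i ≠ 0) :
    ∀ᶠ ℓ : ℕ in Filter.atTop, ∀ [Fact ℓ.Prime],
      (ℓ : ℝ) - 1 - (∏ i, F i).natDegree ≤
        ((Finset.univ.filter fun v : (ZMod ℓ)ˣ => ∀ i, aeval (v : ZMod ℓ) (F i) ≠ 0).card : ℝ) := by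
  have hP0 : ∏ i, F i ≠ 0 := Finset.prod_ne_zero_iff.2 fun i _ => hF0 i
  filter_upwards [eventually_intCast_zmod_ne_zero (leadingCoeff_ne_zero.2 hP0)] with ℓ hℓ hfact
  set f : (ZMod ℓ)[X] := (∏ i, F i).map (Int.castRingHom _) with hf
  have hf0 : f ≠ 0 := by
    intro h
    have := congrArg (fun p => p.coeff (∏ i, F i).natDegree) h
    simp only [hf, coeff_map, coeff_natDegree, coeff_zero, eq_intCast] at this
    exact hℓ this
  have hbad : (Finset.univ.filter fun v : (ZMod ℓ)ˣ =>
      ¬ ∀ i, aeval (v : ZMod ℓ) (F i) ≠ 0).card ≤ (∏ i, F i).natDegree := by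
    calc _ ≤ f.roots.toFinset.card := by
          refine Finset.card_le_card_of_injOn (fun v => (v : ZMod ℓ)) ?_
            (fun _ _ _ _ h => Units.ext h)
          intro v hv
          simp only [Finset.coe_filter, Finset.mem_univ, true_and, Set.mem_ofPred_eq] at hv
          push Not at hv
          obtain ⟨i, hi⟩ := hv
          simp only [Finset.mem_coe, Multiset.mem_toFinset, mem_roots hf0, IsRoot.def]
          rw [hf, ← aeval_zmod_eq, map_prod]
          exact Finset.prod_eq_zero (Finset.mem_univ i) hi
      _ ≤ f.natDegree := (Multiset.toFinset_card_le _).trans (card_roots' f)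
      _ ≤ _ := natDegree_map_le
  have hsum : (Finset.univ.filter fun v : (ZMod ℓ)ˣ => ∀ i, aeval (v : ZMod ℓ) (F i) ≠ 0).card +
      (Finset.univ.filter fun v : (ZMod ℓ)ˣ => ¬ ∀ i, aeval (v : ZMod ℓ) (F i) ≠ 0).card + 1 = ℓ := by
    rw [Finset.card_filter_add_card_filter_not, Finset.card_univ, ZMod.card_units]
    have := hfact.out.pos
    omega
  have hsum' : ((Finset.univ.filter fun v : (ZMod ℓ)ˣ =>
      ∀ i, aeval (v : ZMod ℓ) (F i) ≠ 0).card : ℝ) +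
      (Finset.univ.filter fun v : (ZMod ℓ)ˣ => ¬ ∀ i, aeval (v : ZMod ℓ) (F i) ≠ 0).card + 1 = ℓ := by
    exact_mod_cast hsum
  have hbad' : ((Finset.univ.filter fun v : (ZMod ℓ)ˣ =>
      ¬ ∀ i, aeval (v : ZMod ℓ) (F i) ≠ 0).card : ℝ) ≤ (∏ i, F i).natDegree := by
    exact_mod_cast hbad
  linarith

/-- A unit solution `(u, w)` of the system `∏ F_i(u_j) ∏ F_i(w_j) = a_i` at which the Jacobian with
respect to `u` is invertible. -/
def IsRegSol {m N : ℕ} {A : Type*} [CommRing A] (F : Fin m → ℤ[X]) (a : Fin m → A)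
    (z : (Fin m → A) × (Fin N → A)) : Prop :=
  (∀ j, IsUnit (z.1 j)) ∧ (∀ j, IsUnit (z.2 j)) ∧ IsUnit (jacDet F z.1) ∧
    ∀ i, (∏ j, aeval (z.1 j) (F i)) * ∏ j, aeval (z.2 j) (F i) = a i

/-- The number of regular unit solutions. -/
def regSolCount {m : ℕ} {A : Type*} [CommRing A] (F : Fin m → ℤ[X]) (N : ℕ) (a : Fin m → A) : ℕ :=
  Nat.card {z : (Fin m → A) × (Fin N → A) // IsRegSol F a z}

theorem sub_pow_ge {x d : ℝ} (hx : 0 < x) (hd : d ≤ x) (N : ℕ) :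
    x ^ N * (1 - N * d / x) ≤ (x - d) ^ N := by
  have h1 : -2 ≤ -(d / x) := by
    have : d / x ≤ 1 := (div_le_one hx).2 hd
    linarith
  have h2 := one_add_mul_le_pow h1 N
  have h3 : (x - d) ^ N = x ^ N * (1 + -(d / x)) ^ N := by
    rw [← mul_pow]; congr 1; field_simp; ring
  rw [h3]
  refine mul_le_mul_of_nonneg_left (le_trans (le_of_eq ?_) h2) (by positivity)
  ring

theorem le_regSolCount_zmod_prime {ℓ m N : ℕ} [Fact ℓ.Prime] {F : Fin m → ℤ[X]}
    {a : Fin m → ZMod ℓ} (ha : ∀ i, IsUnit (a i)) {t : ℝ}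
    (ht : ∀ b : Fin m → (ZMod ℓ)ˣ, t ≤ ((Finset.univ.filter fun w : Fin N → (ZMod ℓ)ˣ =>
        ∀ i, ∏ j, aeval (w j : ZMod ℓ) (F i) = b i).card : ℝ)) :
    ((Finset.univ.filter fun u : Fin m → ZMod ℓ =>
        (∀ j, u j ≠ 0) ∧ (∀ i j, aeval (u j) (F i) ≠ 0) ∧ jacDet F u ≠ 0).card : ℝ) * t ≤
      regSolCount F N a := by
  set U := Finset.univ.filter fun u : Fin m → ZMod ℓ =>
        (∀ j, u j ≠ 0) ∧ (∀ i j, aeval (u j) (F i) ≠ 0) ∧ jacDet F u ≠ 0 with hU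
  set T : (Fin m → ZMod ℓ) → Finset (Fin N → (ZMod ℓ)ˣ) := fun u => Finset.univ.filter fun w =>
    ∀ i, ∏ j, aeval (w j : ZMod ℓ) (F i) = a i * (∏ j, aeval (u j) (F i))⁻¹ with hT
  have hTu : ∀ u ∈ U, t ≤ (T u).card := by
    intro u hu
    simp only [hU, Finset.mem_filter, Finset.mem_univ, true_and] at hu
    have hne : ∀ i, a i * (∏ j, aeval (u j) (F i))⁻¹ ≠ 0 := fun i =>
      mul_ne_zero (ha i).ne_zero (inv_ne_zero (Finset.prod_ne_zero_iff.2 fun j _ => hu.2.1 i j))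
    exact ht fun i => Units.mk0 _ (hne i)
  have h1 : (U.card : ℝ) * t ≤ ((U.sigma T).card : ℝ) := by
    rw [Finset.card_sigma, Nat.cast_sum, ← nsmul_eq_mul]
    exact Finset.card_nsmul_le_sum U _ t hTu
  refine h1.trans ?_
  rw [regSolCount, Nat.card_eq_fintype_card, Fintype.card_subtype, Nat.cast_le]
  refine Finset.card_le_card_of_injOn (fun z => (z.1, fun j => (z.2 j : ZMod ℓ))) ?_ ?_
  · rintro ⟨u, w⟩ hz
    simp only [Finset.coe_sigma, Set.mem_sigma_iff, Finset.mem_coe, hU, hT, Finset.mem_filter,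
      Finset.mem_univ, true_and] at hz
    obtain ⟨⟨h1, h2, h3⟩, h4⟩ := hz
    simp only [Finset.mem_coe, Finset.mem_filter, Finset.mem_univ, true_and]
    refine ⟨fun j => (h1 j).isUnit, fun j => (w j).isUnit, h3.isUnit, fun i => ?_⟩
    have h5 : ∏ j, aeval (u j) (F i) ≠ 0 := Finset.prod_ne_zero_iff.2 fun j _ => h2 i j
    simp only [h4]
    field_simp
  · rintro ⟨u, w⟩ _ ⟨u', w'⟩ _ h
    simp only [Prod.mk.injEq] at h
    obtain ⟨rfl, h⟩ := h
    congr 1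
    funext j
    exact Units.ext (congrFun h j)

theorem mul_one_sub_div_le {x l D E t u c : ℝ} {m : ℕ} (hl : l = x + 1) (hx : 1 ≤ x)
    (hD : 0 ≤ D) (hDl : D ≤ l) (hE : 0 ≤ E) (hEx : E ≤ x) (ht : 0 ≤ t)
    (hu : l ^ m * (1 - D / l) ≤ u) (hc : u * (t * (1 - E / x) / x ^ m) ≤ c) :
    t * (1 - (D + 2 * E) / l) ≤ c := by
  have hx0 : 0 < x := by linarith
  have hl0 : 0 < l := by linarith
  have hxm : 0 < x ^ m := by positivity
  have hE1 : 0 ≤ 1 - E / x := by rw [sub_nonneg, div_le_one hx0]; exact hEx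
  have hD1 : 0 ≤ 1 - D / l := by rw [sub_nonneg, div_le_one hl0]; exact hDl
  have h0 : x ^ m * (1 - D / l) ≤ u := le_trans
    (mul_le_mul_of_nonneg_right (pow_le_pow_left₀ hx0.le (by linarith) _) hD1) hu
  refine le_trans ?_ (le_trans (mul_le_mul_of_nonneg_right h0
    (div_nonneg (mul_nonneg ht hE1) hxm.le)) hc)
  have h1 : (x ^ m * (1 - D / l)) * (t * (1 - E / x) / x ^ m) =
      t * ((1 - D / l) * (1 - E / x)) := by
    field_simp
  rw [h1]
  refine mul_le_mul_of_nonneg_left ?_ ht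
  have h2 : E / x ≤ 2 * E / l := by
    rw [div_le_div_iff₀ hx0 hl0]
    nlinarith
  have h3 : 0 ≤ D / l * (E / x) := by positivity
  have h4 : (D + 2 * E) / l = D / l + 2 * E / l := by ring
  rw [h4]
  linarith

theorem eventually_regSolCount_prime_ge {m M r : ℕ} (hr : m + 1 ≤ r) {F : Fin m → ℤ[X]}
    (hF0 : ∀ i, F i ≠ 0) (hV : LinearIndependent ℤ (jacPoly F))
    {G : Fin M → ℤ[X]} {c : Fin m → ℤ} {μ : Fin M → Fin m → ℕ}
    (hirr : ∀ j, Irreducible (G j)) (hprim : ∀ j, (G j).IsPrimitive)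
    (hass : ∀ j j', j ≠ j' → ¬ Associated (G j) (G j'))
    (hfac : ∀ i, F i = C (c i) * ∏ j, G j ^ μ j i) (huse : ∀ j, ∃ i, 0 < μ j i) :
    ∃ D : ℝ, 0 < D ∧ ∀ᶠ ℓ : ℕ in Filter.atTop, ∀ [Fact ℓ.Prime],
      (∀ e : Fin m → ℤ, (∀ j, ((ℓ : ℤ) - 1) ∣ ∑ i, (μ j i : ℤ) * e i) →
        ∀ i, ((ℓ : ℤ) - 1) ∣ e i) →
      ∀ a : Fin m → ZMod ℓ, (∀ i, IsUnit (a i)) →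
        (ℓ - 1 : ℝ) ^ (2 * r) * (1 - D / ℓ) ≤ regSolCount F (2 * r) a := by
  obtain ⟨D₀, hD₀⟩ := eventually_card_regular_ge hF0 hV
  set d : ℕ := (∏ i, F i).natDegree with hd
  set D₁ : ℕ := ∑ j, (G j).natDegree with hD₁
  set E : ℝ := (2 * r : ℕ) * d + (2 * D₁ + 1) ^ (2 * r) with hE
  have hE0 : 0 < E := by positivity
  refine ⟨D₀ + 2 * E, by positivity, ?_⟩
  filter_upwards [hD₀, eventually_norm_charSum_le hirr hprim hass hfac huse,
    eventually_card_units_nonvanishing_ge hF0, Filter.eventually_ge_atTop (D₀ + d + 2),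
    tendsto_natCast_atTop_atTop.eventually_ge_atTop (E + 1)]
    with ℓ hU hchar hs hlarge hlargeE hfact hμ a ha
  have hU := @hU hfact
  have hs := @hs hfact
  have hℓ : (D₀ : ℝ) + d + 2 ≤ ℓ := by exact_mod_cast hlarge
  have hD₀0 : (0 : ℝ) ≤ D₀ := Nat.cast_nonneg _
  have hd0 : (0 : ℝ) ≤ d := Nat.cast_nonneg _
  set x : ℝ := (ℓ : ℝ) - 1 with hx
  have hx1 : 1 ≤ x := by rw [hx]; linarith
  have hℓ0 : (0 : ℝ) < ℓ := by linarith
  have hB : (D₁ : ℝ) * √ℓ + 1 ≤ (2 * D₁ + 1) * √x := by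
    have h1 : √(ℓ : ℝ) ≤ 2 * √x := by
      rw [Real.sqrt_le_left (by positivity), mul_pow, Real.sq_sqrt (by linarith)]
      rw [hx]; linarith
    have h2 : 1 ≤ √x := Real.one_le_sqrt.2 hx1
    have h3 : (D₁ : ℝ) * √ℓ ≤ D₁ * (2 * √x) := by gcongr
    linarith
  have hT : ∀ b : Fin m → (ZMod ℓ)ˣ, x ^ (2 * r) * (1 - E / x) ≤
      x ^ m * ((Finset.univ.filter fun w : Fin (2 * r) → (ZMod ℓ)ˣ =>
        ∀ i, ∏ j, aeval (w j : ZMod ℓ) (F i) = b i).card : ℝ) := by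
    intro b
    refine le_trans ?_ (card_prod_ge (2 * r) (fun v i => aeval (v : ZMod ℓ) (F i)) b
      (B := (2 * D₁ + 1) * √x) (by positivity) fun χ hχ => (hchar hμ χ hχ).trans hB)
    have h1 : x ^ (2 * r) * (1 - (2 * r : ℕ) * d / x) ≤ ((Finset.univ.filter fun v : (ZMod ℓ)ˣ =>
        ∀ i, aeval (v : ZMod ℓ) (F i) ≠ 0).card : ℝ) ^ (2 * r) :=
      (sub_pow_ge (by linarith) (by rw [hx]; linarith) _).trans
        (pow_le_pow_left₀ (by rw [hx]; linarith) hs _)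
    have h2 : x ^ m * ((2 * D₁ + 1) * √x) ^ (2 * r) ≤
        x ^ (2 * r) * ((2 * D₁ + 1) ^ (2 * r) / x) := by
      have h3 : √x ^ (2 * r) = x ^ r := by rw [pow_mul, Real.sq_sqrt (by linarith)]
      rw [mul_pow, h3]
      have h4 : x ^ (2 * r) = x ^ (2 * r - 1) * x := by
        rw [← pow_succ]; congr 1; omega
      have h5 : x ^ (m + r) ≤ x ^ (2 * r - 1) := pow_le_pow_right₀ hx1 (by omega)
      calc x ^ m * ((2 * D₁ + 1) ^ (2 * r) * x ^ r) = (2 * D₁ + 1) ^ (2 * r) * x ^ (m + r) := by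
            rw [pow_add]; ring
        _ ≤ (2 * D₁ + 1) ^ (2 * r) * x ^ (2 * r - 1) := by gcongr
        _ = _ := by rw [h4]; field_simp
    have h6 : x ^ (2 * r) * (1 - E / x) = x ^ (2 * r) * (1 - (2 * r : ℕ) * d / x) -
        x ^ (2 * r) * ((2 * D₁ + 1) ^ (2 * r) / x) := by
      rw [hE]; ring
    rw [h6]
    linarith
  have hxm : 0 < x ^ m := pow_pos (by linarith) m
  have hfin := le_regSolCount_zmod_prime (N := 2 * r) ha
    (t := x ^ (2 * r) * (1 - E / x) / x ^ m) fun b => by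
      rw [div_le_iff₀ hxm, mul_comm _ (x ^ m)]; exact hT b
  exact mul_one_sub_div_le (by rw [hx]; ring) hx1 hD₀0 (by linarith) hE0.le
    (by rw [hx]; linarith) (pow_nonneg (by linarith) _) hU hfin

theorem aeval_map_int {A B : Type*} [CommRing A] [CommRing B] (π : A →+* B) (P : ℤ[X]) (x : A) :
    aeval (π x) P = π (aeval x P) :=
  Polynomial.aeval_algHom_apply π.toIntAlgHom x P

theorem jacDet_map {A B : Type*} [CommRing A] [CommRing B] (π : A →+* B) {m : ℕ}
    (F : Fin m → ℤ[X]) (u : Fin m → A) : jacDet F (fun j => π (u j)) = π (jacDet F u) := by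
  simp only [jacDet, RingHom.map_det]
  congr 1
  ext i j
  simp [aeval_map_int π]

theorem isUnit_of_isUnit_map {A B : Type*} [CommRing A] [CommRing B] {π : A →+* B}
    (hπ : Function.Surjective π) (hI : ∀ x y, π x = 0 → π y = 0 → x * y = 0) {x : A}
    (hx : IsUnit (π x)) : IsUnit x := by
  obtain ⟨b, hb⟩ := hx.exists_right_inv
  obtain ⟨y, rfl⟩ := hπ b
  have h1 : π (x * y - 1) = 0 := by simp [hb]
  have h2 : IsNilpotent (x * y - 1) := ⟨2, by rw [pow_two]; exact hI _ _ h1 h1⟩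
  have h3 := h2.isUnit_one_add
  rw [add_sub_cancel] at h3
  exact isUnit_of_mul_isUnit_left h3

theorem prod_one_add_of_mul_eq_zero {A ι : Type*} [CommRing A] (s : Finset ι) (y : ι → A)
    (I : Ideal A) (hI : ∀ x ∈ I, ∀ y ∈ I, x * y = 0) (hy : ∀ j, y j ∈ I) :
    ∏ j ∈ s, (1 + y j) = 1 + ∑ j ∈ s, y j := by
  induction s using Finset.induction_on with
  | empty => simp
  | insert j s hj ih =>
    rw [Finset.prod_insert hj, Finset.sum_insert hj, ih]
    have := hI _ (hy j) _ (I.sum_mem fun i (_ : i ∈ s) => hy i)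
    linear_combination this

theorem exists_isRegSol_lift {A B : Type*} [CommRing A] [CommRing B] {π : A →+* B}
    (hπ : Function.Surjective π) (hI : ∀ x y, π x = 0 → π y = 0 → x * y = 0) {m N : ℕ}
    {F : Fin m → ℤ[X]} {a : Fin m → A} (ha : ∀ i, IsUnit (a i))
    {ū : Fin m → B} {w : Fin N → A} (h : IsRegSol F (fun i => π (a i)) (ū, fun j => π (w j))) :
    ∃ u : Fin m → A, (∀ j, π (u j) = ū j) ∧ IsRegSol F a (u, w) := by
  have hker : ∀ x ∈ RingHom.ker π, ∀ y ∈ RingHom.ker π, x * y = 0 := fun x hx y hy =>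
    hI x y ((RingHom.mem_ker).1 hx) ((RingHom.mem_ker).1 hy)
  choose v hv using fun j => hπ (ū j)
  obtain rfl : (fun j => π (v j)) = ū := funext hv
  obtain ⟨h1, h2, h3, h4⟩ := h
  simp only at h1 h2 h3 h4
  have hunit : ∀ {x : A}, IsUnit (π x) → IsUnit x := fun hx => isUnit_of_isUnit_map hπ hI hx
  rw [jacDet_map] at h3
  set J : Matrix (Fin m) (Fin m) A := Matrix.of fun i j => aeval (v j) (jacPoly F i) with hJ
  have hJu : IsUnit J.det := hunit h3
  set e : Fin m → A := fun i => (∏ j, aeval (v j) (F i)) * ∏ j, aeval (w j) (F i) with he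
  have hπe : ∀ i, π (e i) = π (a i) := fun i => by
    rw [← h4 i, he]
    simp [map_prod, aeval_map_int π]
  have heu : ∀ i, IsUnit (e i) := fun i => hunit (by rw [hπe]; exact (ha i).map π)
  choose b hb using fun i => (heu i).exists_right_inv
  set y : Fin m → A := fun i => a i * b i - 1 with hy
  have hyI : ∀ i, y i ∈ RingHom.ker π := fun i => by
    rw [RingHom.mem_ker, hy]
    have : π (e i * b i) = 1 := by rw [hb, map_one]
    rw [map_mul, hπe, ← map_mul] at this
    simp [map_sub, this]
  set x : Fin m → A := J⁻¹.mulVec y with hx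
  have hxI : ∀ j, x j ∈ RingHom.ker π := fun j => by
    rw [hx, Matrix.mulVec, dotProduct]
    exact Ideal.sum_mem _ fun i _ => Ideal.mul_mem_left _ _ (hyI i)
  have hJx : J.mulVec x = y := by
    rw [hx, Matrix.mulVec_mulVec, Matrix.mul_nonsing_inv _ hJu, Matrix.one_mulVec]
  set u : Fin m → A := fun j => v j + (∏ i, aeval (v j) (F i)) * x j with hu
  have huI : ∀ j, (∏ i, aeval (v j) (F i)) * x j ∈ RingHom.ker π := fun j =>
    Ideal.mul_mem_left _ _ (hxI j)
  have hπu : ∀ j, π (u j) = π (v j) := fun j => by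
    rw [hu]; simp only [map_add]; rw [(RingHom.mem_ker).1 (huI j), add_zero]
  have hFu : ∀ i j, aeval (u j) (F i) = aeval (v j) (F i) * (1 + J i j * x j) := by
    intro i j
    rw [hu]
    simp only
    rw [aeval_add_of_sq_eq_zero _ _ _ (by rw [pow_two]; exact hker _ (huI j) _ (huI j)),
      ← Finset.mul_prod_erase Finset.univ (fun i => aeval (v j) (F i)) (Finset.mem_univ i)]
    have : J i j = aeval (v j) (derivative (F i)) *
        ∏ i' ∈ Finset.univ.erase i, aeval (v j) (F i') := by
      rw [hJ, Matrix.of_apply, jacPoly, map_mul, map_prod]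
    rw [this]
    ring
  refine ⟨u, hπu, fun j => hunit (by rw [hπu]; exact h1 j), fun j => hunit (h2 j), hunit ?_, ?_⟩
  · rw [← jacDet_map]
    simp only [hπu]
    rw [jacDet_map]
    exact h3
  · intro i
    simp only [hFu]
    rw [Finset.prod_mul_distrib, prod_one_add_of_mul_eq_zero _ _ (RingHom.ker π) hker
      fun j => Ideal.mul_mem_left _ _ (hxI j)]
    have h5 : ∑ j, J i j * x j = y i := congrFun hJx i
    rw [h5, hy]
    have h6 := hb i
    simp only [he] at h6 ⊢
    linear_combination a i * h6

theorem card_ker_pow_mul_regSolCount_le {A B : Type*} [CommRing A] [CommRing B] [Finite A]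
    {π : A →+* B} (hπ : Function.Surjective π) (hI : ∀ x y, π x = 0 → π y = 0 → x * y = 0)
    {m N : ℕ} {F : Fin m → ℤ[X]} {a : Fin m → A} (ha : ∀ i, IsUnit (a i)) :
    Nat.card (RingHom.ker π) ^ N * regSolCount F N (fun i => π (a i)) ≤ regSolCount F N a := by
  have hB : Finite B := Finite.of_surjective π hπ
  choose s hs using hπ
  have key : ∀ t : (Fin N → RingHom.ker π) ×
      {z : (Fin m → B) × (Fin N → B) // IsRegSol F (fun i => π (a i)) z},
      ∃ u : Fin m → A, (∀ j, π (u j) = t.2.1.1 j) ∧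
        IsRegSol F a (u, fun j => s (t.2.1.2 j) + t.1 j) := by
    rintro ⟨κ, ⟨⟨ū, w⟩, hz⟩⟩
    refine exists_isRegSol_lift (fun b => ⟨s b, hs b⟩) hI ha ?_
    have : ∀ j, π (s (w j) + κ j) = w j := fun j => by
      rw [map_add, hs, (RingHom.mem_ker).1 (κ j).2, add_zero]
    simpa only [this] using hz
  choose u hu hreg using key
  have hcard : Nat.card (RingHom.ker π) ^ N * regSolCount F N (fun i => π (a i)) =
      Nat.card ((Fin N → RingHom.ker π) ×
        {z : (Fin m → B) × (Fin N → B) // IsRegSol F (fun i => π (a i)) z}) := by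
    rw [Nat.card_prod, Nat.card_fun, Nat.card_fin, regSolCount]
  rw [hcard, regSolCount]
  refine Nat.card_le_card_of_injective (fun t => ⟨_, hreg t⟩) ?_
  intro t t' h
  have h1 : u t = u t' := congrArg (fun z => z.1.1) h
  have h2 : (fun j => s (t.2.1.2 j) + (t.1 j : A)) = fun j => s (t'.2.1.2 j) + (t'.1 j : A) :=
    congrArg (fun z => z.1.2) h
  have h3 : t.2.1.2 = t'.2.1.2 := funext fun j => by
    have := congrArg π (congrFun h2 j)
    simpa [map_add, hs, (RingHom.mem_ker).1 (t.1 j).2, (RingHom.mem_ker).1 (t'.1 j).2] using this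
  have h4 : t.2.1.1 = t'.2.1.1 := funext fun j => by rw [← hu t j, ← hu t' j, h1]
  refine Prod.ext (funext fun j => Subtype.ext ?_) (Subtype.ext (Prod.ext h4 h3))
  have := congrFun h2 j
  rw [h3] at this
  exact add_left_cancel this

theorem card_ker_castHom_pow_succ {ℓ e : ℕ} (hℓ : ℓ ≠ 0) :
    Nat.card (RingHom.ker (ZMod.castHom (pow_dvd_pow ℓ e.le_succ) (ZMod (ℓ ^ e)))) = ℓ := by
  have hinst : NeZero (ℓ ^ (e + 1)) := ⟨pow_ne_zero _ hℓ⟩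
  set π := ZMod.castHom (pow_dvd_pow ℓ e.le_succ) (ZMod (ℓ ^ e)) with hπ
  have h1 := AddSubgroup.card_eq_card_quotient_mul_card_addSubgroup π.toAddMonoidHom.ker
  have h2 : Nat.card (ZMod (ℓ ^ (e + 1)) ⧸ π.toAddMonoidHom.ker) = ℓ ^ e := by
    rw [Nat.card_congr (QuotientAddGroup.quotientKerEquivOfSurjective π.toAddMonoidHom
      (ZMod.castHom_surjective (pow_dvd_pow ℓ e.le_succ))).toEquiv, Nat.card_zmod]
  rw [h2, Nat.card_zmod] at h1
  exact (Nat.eq_of_mul_eq_mul_left (pow_pos (Nat.pos_of_ne_zero hℓ) e)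
    ((pow_succ ℓ e).symm.trans h1)).symm

theorem mul_eq_zero_of_castHom_pow_succ {ℓ e : ℕ} (he : 1 ≤ e) (hℓ : ℓ ≠ 0)
    (x y : ZMod (ℓ ^ (e + 1)))
    (hx : ZMod.castHom (pow_dvd_pow ℓ e.le_succ) (ZMod (ℓ ^ e)) x = 0)
    (hy : ZMod.castHom (pow_dvd_pow ℓ e.le_succ) (ZMod (ℓ ^ e)) y = 0) : x * y = 0 := by
  have hinst : NeZero (ℓ ^ (e + 1)) := ⟨pow_ne_zero _ hℓ⟩
  obtain ⟨a, rfl⟩ := ZMod.natCast_zmod_surjective x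
  obtain ⟨b, rfl⟩ := ZMod.natCast_zmod_surjective y
  rw [map_natCast, ZMod.natCast_eq_zero_iff] at hx hy
  rw [← Nat.cast_mul, ZMod.natCast_eq_zero_iff]
  refine (pow_dvd_pow ℓ ?_).trans ((pow_add ℓ e e).symm ▸ mul_dvd_mul hx hy)
  omega

theorem le_regSolCount_prime_pow {ℓ m N : ℕ} [hℓ : Fact ℓ.Prime] {F : Fin m → ℤ[X]} {t : ℝ}
    (h : ∀ a : Fin m → ZMod ℓ, (∀ i, IsUnit (a i)) →
      (ℓ - 1 : ℝ) ^ N * t ≤ regSolCount F N a) (e : ℕ) :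
    ∀ a : Fin m → ZMod (ℓ ^ (e + 1)), (∀ i, IsUnit (a i)) →
      (Nat.totient (ℓ ^ (e + 1)) : ℝ) ^ N * t ≤ regSolCount F N a := by
  have hℓ0 : ℓ ≠ 0 := hℓ.1.ne_zero
  induction e with
  | zero =>
    rw [zero_add, pow_one, Nat.totient_prime hℓ.1, Nat.cast_sub hℓ.1.one_le, Nat.cast_one]
    exact h
  | succ e ih =>
    intro a ha
    have hinst : NeZero (ℓ ^ (e + 1 + 1)) := ⟨pow_ne_zero _ hℓ0⟩
    have h1 := card_ker_pow_mul_regSolCount_le (N := N) (F := F)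
      (ZMod.castHom_surjective (pow_dvd_pow ℓ (e + 1).le_succ))
      (mul_eq_zero_of_castHom_pow_succ (by omega) hℓ0) ha
    rw [card_ker_castHom_pow_succ hℓ0] at h1
    have h2 := ih (fun i => ZMod.castHom (pow_dvd_pow ℓ (e + 1).le_succ) (ZMod (ℓ ^ (e + 1))) (a i))
      fun i => (ha i).map _
    have h3 : (Nat.totient (ℓ ^ (e + 1 + 1)) : ℝ) = ℓ * Nat.totient (ℓ ^ (e + 1)) := by
      rw [Nat.totient_prime_pow_succ hℓ.1, Nat.totient_prime_pow_succ hℓ.1]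
      push_cast
      ring
    rw [h3, mul_pow, mul_assoc]
    refine le_trans (mul_le_mul_of_nonneg_left h2 (by positivity)) ?_
    exact_mod_cast h1

theorem regSolCount_mul_le_of_ringEquiv {A B S : Type*} [CommRing A] [CommRing B] [CommRing S]
    [Finite S] (φ : S ≃+* A × B) {m N : ℕ} {F : Fin m → ℤ[X]} (a : Fin m → S) :
    regSolCount F N (fun i => (φ (a i)).1) * regSolCount F N (fun i => (φ (a i)).2) ≤
      regSolCount F N a := by
  have hAB : Finite (A × B) := Finite.of_equiv S φ.toEquiv
  have hfst : ∀ (P : ℤ[X]) (x : A) (y : B), aeval (φ.symm (x, y)) P =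
      φ.symm (aeval x P, aeval y P) := by
    intro P x y
    apply φ.injective
    have h1 := aeval_map_int (φ : S →+* A × B) P (φ.symm (x, y))
    simp only [RingEquiv.coe_toRingHom, RingEquiv.apply_symm_apply] at h1 ⊢
    rw [← h1]
    refine Prod.ext ?_ ?_
    · exact (aeval_map_int (RingHom.fst A B) P (x, y)).symm
    · exact (aeval_map_int (RingHom.snd A B) P (x, y)).symm
  have hdet : ∀ (x : Fin m → A) (y : Fin m → B),
      jacDet F (fun j => φ.symm (x j, y j)) = φ.symm (jacDet F x, jacDet F y) := by
    intro x y
    apply φ.injective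
    have h1 := jacDet_map (φ : S →+* A × B) F (fun j => φ.symm (x j, y j))
    simp only [RingEquiv.coe_toRingHom, RingEquiv.apply_symm_apply] at h1 ⊢
    rw [← h1]
    refine Prod.ext ?_ ?_
    · exact (jacDet_map (RingHom.fst A B) F fun j => (x j, y j)).symm
    · exact (jacDet_map (RingHom.snd A B) F fun j => (x j, y j)).symm
  have hunit : ∀ (x : A) (y : B), IsUnit x → IsUnit y → IsUnit (φ.symm (x, y)) :=
    fun x y hx hy => (Prod.isUnit_iff.2 ⟨hx, hy⟩).map φ.symm
  have hreg : ∀ (z : (Fin m → A) × (Fin N → A)) (z' : (Fin m → B) × (Fin N → B)),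
      IsRegSol F (fun i => (φ (a i)).1) z → IsRegSol F (fun i => (φ (a i)).2) z' →
      IsRegSol F a (fun j => φ.symm (z.1 j, z'.1 j), fun j => φ.symm (z.2 j, z'.2 j)) := by
    rintro z z' ⟨h1, h2, h3, h4⟩ ⟨h1', h2', h3', h4'⟩
    refine ⟨fun j => hunit _ _ (h1 j) (h1' j), fun j => hunit _ _ (h2 j) (h2' j), ?_, fun i => ?_⟩
    · rw [hdet]; exact hunit _ _ h3 h3'
    · simp only [hfst]
      rw [← map_prod, ← map_prod, ← map_mul, RingEquiv.symm_apply_eq]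
      refine Prod.ext ?_ ?_
      · rw [Prod.fst_mul, Prod.fst_prod, Prod.fst_prod]; exact h4 i
      · rw [Prod.snd_mul, Prod.snd_prod, Prod.snd_prod]; exact h4' i
  rw [regSolCount, regSolCount, regSolCount, ← Nat.card_prod]
  refine Nat.card_le_card_of_injective (fun t => ⟨_, hreg t.1.1 t.2.1 t.1.2 t.2.2⟩) ?_
  rintro ⟨⟨z, hz⟩, ⟨z', hz'⟩⟩ ⟨⟨y, hy⟩, ⟨y', hy'⟩⟩ h
  simp only [Subtype.mk.injEq, Prod.mk.injEq, funext_iff, EmbeddingLike.apply_eq_iff_eq] at h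
  obtain ⟨h1, h2⟩ := h
  simp only [Prod.mk.injEq, Subtype.mk.injEq]
  exact ⟨Prod.ext (funext fun j => (h1 j).1) (funext fun j => (h2 j).1),
    Prod.ext (funext fun j => (h1 j).2) (funext fun j => (h2 j).2)⟩

theorem le_regSolCount_of_primeFactors {m N : ℕ} {F : Fin m → ℤ[X]} {D : ℝ} :
    ∀ q : ℕ, q ≠ 0 →
    (∀ ℓ ∈ q.primeFactors, D ≤ ℓ) →
    (∀ ℓ ∈ q.primeFactors, ∀ a : Fin m → ZMod ℓ, (∀ i, IsUnit (a i)) →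
      (ℓ - 1 : ℝ) ^ N * (1 - D / ℓ) ≤ regSolCount F N a) →
    ∀ a : Fin m → ZMod q, (∀ i, IsUnit (a i)) →
      (q.totient : ℝ) ^ N * ∏ ℓ ∈ q.primeFactors, (1 - D / ℓ) ≤ regSolCount F N a := by
  intro q
  induction q using Nat.recOnPosPrimePosCoprime with
  | zero => intro h; exact absurd rfl h
  | one =>
    intro _ _ _ a _
    have : IsRegSol F a ((fun _ => 0), fun _ : Fin N => 0) :=
      ⟨fun j => isUnit_of_subsingleton _, fun j => isUnit_of_subsingleton _,
        isUnit_of_subsingleton _, fun i => Subsingleton.elim _ _⟩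
    have h1 : 0 < regSolCount F N a := by
      rw [regSolCount]
      have : Nonempty {z : (Fin m → ZMod 1) × (Fin N → ZMod 1) // IsRegSol F a z} := ⟨⟨_, this⟩⟩
      exact Nat.card_pos
    have h2 : (1 : ℝ) ≤ regSolCount F N a := by exact_mod_cast h1
    simpa using h2
  | prime_pow p n hp hn =>
    have hfact : Fact p.Prime := ⟨hp⟩
    obtain ⟨e, rfl⟩ := Nat.exists_eq_add_of_le' (show 1 ≤ n from hn)
    intro _ hD h a ha
    rw [Nat.primeFactors_prime_pow e.succ_ne_zero hp] at h ⊢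
    rw [Finset.prod_singleton]
    exact le_regSolCount_prime_pow (h p (Finset.mem_singleton_self p)) e a ha
  | coprime b c hb hc hbc ihb ihc =>
    intro hne hD h a ha
    have hb0 : b ≠ 0 := by omega
    have hc0 : c ≠ 0 := by omega
    have hinst : NeZero (b * c) := ⟨hne⟩
    rw [hbc.primeFactors_mul] at hD h ⊢
    have h1 := ihb hb0 (fun ℓ hl => hD ℓ (Finset.mem_union_left _ hl))
      (fun ℓ hl => h ℓ (Finset.mem_union_left _ hl))
      (fun i => (ZMod.chineseRemainder hbc (a i)).1)
      fun i => (Prod.isUnit_iff.1 ((ha i).map (ZMod.chineseRemainder hbc))).1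
    have h2 := ihc hc0 (fun ℓ hl => hD ℓ (Finset.mem_union_right _ hl))
      (fun ℓ hl => h ℓ (Finset.mem_union_right _ hl))
      (fun i => (ZMod.chineseRemainder hbc (a i)).2)
      fun i => (Prod.isUnit_iff.1 ((ha i).map (ZMod.chineseRemainder hbc))).2
    have h3 := regSolCount_mul_le_of_ringEquiv (N := N) (F := F) (ZMod.chineseRemainder hbc) a
    have h4 : (regSolCount F N (fun i => (ZMod.chineseRemainder hbc (a i)).1) : ℝ) *
        regSolCount F N (fun i => (ZMod.chineseRemainder hbc (a i)).2) ≤ regSolCount F N a := by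
      exact_mod_cast h3
    rw [Finset.prod_union hbc.disjoint_primeFactors, Nat.totient_mul hbc]
    refine le_trans ?_ h4
    have h5 : 0 ≤ ∏ ℓ ∈ c.primeFactors, (1 - D / ℓ) := Finset.prod_nonneg fun ℓ hl => by
      have h6 : (0 : ℝ) < ℓ := by exact_mod_cast (Nat.prime_of_mem_primeFactors hl).pos
      rw [sub_nonneg, div_le_one h6]
      exact hD ℓ (Finset.mem_union_right _ hl)
    calc _ = ((b.totient : ℝ) ^ N * ∏ ℓ ∈ b.primeFactors, (1 - D / ℓ)) *
          ((c.totient : ℝ) ^ N * ∏ ℓ ∈ c.primeFactors, (1 - D / ℓ)) := by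
          push_cast; ring
      _ ≤ _ := mul_le_mul h1 h2 (mul_nonneg (by positivity) h5) (Nat.cast_nonneg _)

theorem exists_regSolCount_ge {m r : ℕ} (hr : m + 1 ≤ r) {F : Fin m → ℤ[X]} (hF : MultIndep F)
    (hnc : ∀ i, 0 < (F i).natDegree) :
    ∃ B : ℝ, 0 < B ∧ ∃ c : ℝ, 0 < c ∧ ∀ q : ℕ, q ≠ 0 →
      (∀ ℓ : ℕ, ℓ.Prime → ℓ ∣ q → B < ℓ ∧
        ∀ β : ℤ, IsLastInvFactor F β → Int.gcd ((ℓ : ℤ) - 1) β = 1) →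
      ∀ a : Fin m → ZMod q, (∀ i, IsUnit (a i)) →
        (q.totient : ℝ) ^ (2 * r) * (c / (1 + Real.log q)) ≤ regSolCount F (2 * r) a := by
  have hF0 : ∀ i, F i ≠ 0 := fun i h => by simpa [h] using hnc i
  obtain ⟨M, G, c, μ, hirr, hprim, hass, hfac, huse⟩ := exists_common_factorization F
  obtain ⟨β, hβ, hβ'⟩ := exists_isLastInvFactor hF hirr hprim hass hfac huse
  have hV := linearIndependent_jacPoly hF hF0 hirr
    (fun j => natDegree_pos_of_irreducible_of_isPrimitive (hirr j) (hprim j)) hass hfac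
  obtain ⟨D, hD, hev⟩ := eventually_regSolCount_prime_ge hr hF0 hV hirr hprim hass hfac huse
  obtain ⟨L₀, hL₀⟩ := Filter.eventually_atTop.1 hev
  obtain ⟨B, hB, c', hc', hprod⟩ := exists_prod_one_sub_div_primeFactors_ge hD
  refine ⟨max B L₀, lt_of_lt_of_le (by linarith) (le_max_left _ _), c', hc', ?_⟩
  intro q hq hℓ a ha
  have hmem : ∀ ℓ ∈ q.primeFactors, ℓ.Prime ∧ B < ℓ ∧ L₀ ≤ ℓ ∧
      Int.gcd ((ℓ : ℤ) - 1) β = 1 := fun ℓ hl => by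
    have hp := Nat.prime_of_mem_primeFactors hl
    have h1 := hℓ ℓ hp (Nat.dvd_of_mem_primeFactors hl)
    refine ⟨hp, (le_max_left _ _).trans_lt h1.1, ?_, h1.2 β hβ⟩
    exact_mod_cast ((le_max_right _ _).trans_lt h1.1).le
  refine le_trans (mul_le_mul_of_nonneg_left (hprod q hq fun ℓ hl => (hmem ℓ hl).2.1)
    (by positivity)) ?_
  refine le_regSolCount_of_primeFactors q hq (fun ℓ hl => ?_) (fun ℓ hl => ?_) a ha
  · linarith [(hmem ℓ hl).2.1]
  · obtain ⟨hp, -, hl0, hg⟩ := hmem ℓ hl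
    have hfact : Fact ℓ.Prime := ⟨hp⟩
    exact hL₀ ℓ hl0 (hβ' _ hg)

theorem IsMultFn.map_prod_pow {f : ℕ → ℤ} (hf : IsMultFn f) {ι : Type*} {s : ι → ℕ}
    (hs : ∀ j, (s j).Prime) (hinj : Function.Injective s) (k : ℕ) (S : Finset ι) :
    f ((∏ j ∈ S, s j) ^ k) = ∏ j ∈ S, f (s j ^ k) := by
  induction S using Finset.induction_on with
  | empty => simpa using hf.1
  | insert j S hj ih =>
    rw [Finset.prod_insert hj, Finset.prod_insert hj, mul_pow, hf.2, ih]
    refine Nat.Coprime.pow _ _ (Nat.Coprime.prod_right fun i hi => ?_)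
    exact (Nat.coprime_primes (hs j) (hs i)).2 (hinj.ne fun h => hj (h ▸ hi))

theorem lt_Pj_of_lt_primeFactors {q j n : ℕ} (hj : 1 ≤ j)
    (hlen : j ≤ n.primeFactorsList.length) (hq : ∀ p : ℕ, p.Prime → p ∣ n → q < p) :
    q < Pj j n := by
  have h1 : j - 1 < n.primeFactorsList.reverse.length := by
    rw [List.length_reverse]; omega
  rw [Pj, List.getD_eq_getElem _ _ h1]
  have h2 := List.mem_reverse.1 (List.getElem_mem h1)
  exact hq _ (Nat.prime_of_mem_primeFactorsList h2) (Nat.dvd_of_mem_primeFactorsList h2)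

theorem length_primeFactorsList_prod_pow {ι : Type*} {s : ι → ℕ} (hs : ∀ j, (s j).Prime)
    (k : ℕ) (S : Finset ι) : ((∏ j ∈ S, s j) ^ k).primeFactorsList.length = k * S.card := by
  rw [← ArithmeticFunction.cardFactors_apply, ArithmeticFunction.cardFactors_pow]
  congr 1
  induction S using Finset.induction_on with
  | empty => simp
  | insert j S hj ih =>
    rw [Finset.prod_insert hj, ArithmeticFunction.cardFactors_mul (hs j).ne_zero
      (Finset.prod_ne_zero_iff.2 fun i _ => (hs i).ne_zero), ih, Finset.card_insert_of_notMem hj,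
      ArithmeticFunction.cardFactors_apply_prime (hs j), add_comm]

theorem exists_eq_of_prime_dvd_prod_pow {ι : Type*} [Fintype ι] {s : ι → ℕ}
    (hs : ∀ j, (s j).Prime) {k p : ℕ} (hp : p.Prime) (h : p ∣ (∏ j, s j) ^ k) :
    ∃ j, s j = p := by
  obtain ⟨j, -, hj⟩ := (Prime.dvd_finsetProd_iff hp.prime _).1 (hp.dvd_of_dvd_pow h)
  exact ⟨j, ((Nat.prime_dvd_prime_iff_eq hp (hs j)).1 hj).symm⟩

theorem StrictMono.eq_of_prod_pow_eq {N k : ℕ} (hk : k ≠ 0) {s s' : Fin N → ℕ}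
    (hs : StrictMono s) (hs' : StrictMono s') (hp : ∀ j, (s j).Prime) (hp' : ∀ j, (s' j).Prime)
    (h : (∏ j, s j) ^ k = (∏ j, s' j) ^ k) : s = s' := by
  refine (StrictMono.range_inj hs hs').1 (Set.Subset.antisymm ?_ ?_)
  · rintro _ ⟨j, rfl⟩
    refine exists_eq_of_prime_dvd_prod_pow hp' (k := k) (hp j) (h ▸ dvd_pow ?_ hk)
    exact Finset.dvd_prod_of_mem s (Finset.mem_univ j)
  · rintro _ ⟨j, rfl⟩
    refine exists_eq_of_prime_dvd_prod_pow hp (k := k) (hp' j) (h ▸ dvd_pow ?_ hk)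
    exact Finset.dvd_prod_of_mem s' (Finset.mem_univ j)

/-- The unit solutions of the system `∏ F_i(v_j) = a_i`. -/
def unitSols {q m : ℕ} [NeZero q] (F : Fin m → ℤ[X]) (N : ℕ) (a : Fin m → ZMod q) :
    Finset (Fin N → ZMod q) :=
  Finset.univ.filter fun v => (∀ j, IsUnit (v j)) ∧ ∀ i, ∏ j, aeval (v j) (F i) = a i

theorem regSolCount_le_card_unitSols {q m N : ℕ} [NeZero q] (F : Fin m → ℤ[X])
    (a : Fin m → ZMod q) : regSolCount F N a ≤ (unitSols F (m + N) a).card := by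
  rw [regSolCount, Nat.card_eq_fintype_card, Fintype.card_subtype]
  refine Finset.card_le_card_of_injOn (fun z => Fin.append z.1 z.2) ?_ ?_
  · rintro ⟨u, w⟩ hz
    obtain ⟨h1, h2, -, h4⟩ := (Finset.mem_filter.1 hz).2
    refine Finset.mem_filter.2 ⟨Finset.mem_univ _, fun j => ?_, fun i => ?_⟩
    · induction j using Fin.addCases with
      | left j => simpa using h1 j
      | right j => simpa using h2 j
    · rw [Fin.prod_univ_add]
      simpa using h4 i
  · rintro ⟨u, w⟩ _ ⟨u', w'⟩ _ h
    refine Prod.ext (funext fun j => ?_) (funext fun j => ?_)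
    · simpa using congrFun h (Fin.castAdd N j)
    · simpa using congrFun h (Fin.natAdd m j)

theorem strictMono_snoc {n : ℕ} {p : Fin n → ℕ} {P : ℕ} (hp : StrictMono p) (hP : ∀ j, p j < P) :
    StrictMono (Fin.snoc p P : Fin (n + 1) → ℕ) := by
  intro i j hij
  induction j using Fin.lastCases with
  | last =>
    obtain ⟨i, rfl⟩ := Fin.exists_castSucc_eq.2 hij.ne
    simpa using hP i
  | cast j =>
    obtain ⟨i, rfl⟩ := Fin.exists_castSucc_eq.2 (hij.trans_le (Fin.le_last _)).ne
    simpa using hp (Fin.castSucc_lt_castSucc_iff.1 hij)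

theorem sum_card_primesInClass_le {q n k : ℕ} [NeZero q] (hk : k ≠ 0) {α β : Fin n → ℝ}
    (S : Finset (Fin (n + 1) → ZMod q)) {lo hi : (Fin n → ℕ) → ℝ} {X : ℝ} {T : Finset ℕ}
    (hαβ : ∀ i j, i < j → β i < α j) (hqα : ∀ j, (q : ℝ) < Real.exp (α j))
    (hlo : ∀ v ∈ S, ∀ p ∈ Fintype.piFinset fun j : Fin n =>
      primesInClass (v j.castSucc) (α j) (β j), (q : ℝ) < Real.exp (lo p) ∧ (∀ j, β j < lo p) ∧
        Real.exp (hi p) * ∏ j, (p j : ℝ) ≤ X)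
    (hT : ∀ s : Fin (n + 1) → ℕ, StrictMono s → (∀ j, (s j).Prime) → (∀ j, q < s j) →
      ((∏ j, s j : ℕ) : ℝ) ≤ X → (fun j => (s j : ZMod q)) ∈ S → (∏ j, s j) ^ k ∈ T) :
    ∑ v ∈ S, ∑ p ∈ Fintype.piFinset fun j : Fin n => primesInClass (v j.castSucc) (α j) (β j),
      ((primesInClass (v (Fin.last n)) (lo p) (hi p)).card : ℝ) ≤ T.card := by
  have key : ∀ v ∈ S, ∀ p ∈ Fintype.piFinset (fun j : Fin n =>
      primesInClass (v j.castSucc) (α j) (β j)), ∀ P ∈ primesInClass (v (Fin.last n)) (lo p) (hi p),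
      StrictMono (Fin.snoc p P : Fin (n + 1) → ℕ) ∧
      (∀ j, ((Fin.snoc p P : Fin (n + 1) → ℕ) j).Prime) ∧
      (∀ j, q < (Fin.snoc p P : Fin (n + 1) → ℕ) j) ∧
      ((∏ j, (Fin.snoc p P : Fin (n + 1) → ℕ) j : ℕ) : ℝ) ≤ X ∧
      (fun j => ((Fin.snoc p P : Fin (n + 1) → ℕ) j : ZMod q)) = v := by
    intro v hv p hp P hP
    obtain ⟨hq, hβ, hX⟩ := hlo v hv p hp
    rw [Fintype.mem_piFinset] at hp
    have hp' := fun j => mem_primesInClass.1 (hp j)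
    obtain ⟨⟨hP1, hP2⟩, hP3, hP4⟩ := mem_primesInClass.1 hP
    refine ⟨strictMono_snoc (fun i j hij => ?_) fun j => ?_, fun j => ?_, fun j => ?_, ?_, ?_⟩
    · have := (hp' i).1.2.trans_lt ((Real.exp_lt_exp.2 (hαβ i j hij)).trans_le (hp' j).1.1)
      exact_mod_cast this
    · have := (hp' j).1.2.trans_lt ((Real.exp_lt_exp.2 (hβ j)).trans_le hP1)
      exact_mod_cast this
    · induction j using Fin.lastCases with
      | last => simpa using hP3
      | cast j => simpa using (hp' j).2.1
    · induction j using Fin.lastCases with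
      | last => simpa using (by exact_mod_cast hq.trans_le hP1 : q < P)
      | cast j => simpa using (by exact_mod_cast (hqα j).trans_le (hp' j).1.1 : q < p j)
    · rw [Fin.prod_univ_castSucc]
      simp only [Fin.snoc_castSucc, Fin.snoc_last]
      push_cast
      rw [mul_comm]
      exact (mul_le_mul_of_nonneg_right hP2 (by positivity)).trans hX
    · funext j
      induction j using Fin.lastCases with
      | last => simpa using hP4
      | cast j => simpa using (hp' j).2.2
  have h1 : ∑ v ∈ S, ∑ p ∈ Fintype.piFinset fun j : Fin n =>
        primesInClass (v j.castSucc) (α j) (β j),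
        ((primesInClass (v (Fin.last n)) (lo p) (hi p)).card : ℝ) =
      ((S.sigma fun v => (Fintype.piFinset fun j : Fin n =>
        primesInClass (v j.castSucc) (α j) (β j)).sigma fun p =>
          primesInClass (v (Fin.last n)) (lo p) (hi p)).card : ℝ) := by
    rw [Finset.card_sigma]
    simp only [Finset.card_sigma, Nat.cast_sum]
  rw [h1, Nat.cast_le]
  refine Finset.card_le_card_of_injOn
    (fun z => (∏ j, (Fin.snoc z.2.1 z.2.2 : Fin (n + 1) → ℕ) j) ^ k) ?_ ?_
  · rintro ⟨v, p, P⟩ hz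
    obtain ⟨hv, hz⟩ := Finset.mem_sigma.1 (Finset.mem_coe.1 hz)
    obtain ⟨hp, hP⟩ := Finset.mem_sigma.1 hz
    obtain ⟨h2, h3, h4, h5, h6⟩ := key v hv p hp P hP
    exact hT _ h2 h3 h4 h5 (h6 ▸ hv)
  · rintro ⟨v, p, P⟩ hz ⟨v', p', P'⟩ hz' h
    obtain ⟨hv, hz⟩ := Finset.mem_sigma.1 (Finset.mem_coe.1 hz)
    obtain ⟨hp, hP⟩ := Finset.mem_sigma.1 hz
    obtain ⟨hv', hz'⟩ := Finset.mem_sigma.1 (Finset.mem_coe.1 hz')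
    obtain ⟨hp', hP'⟩ := Finset.mem_sigma.1 hz'
    obtain ⟨h2, h3, h4, h5, h6⟩ := key v hv p hp P hP
    obtain ⟨h2', h3', h4', h5', h6'⟩ := key v' hv' p' hp' P' hP'
    have h7 := h2.eq_of_prod_pow_eq hk h2' h3 h3' h
    simp only [h7, h6'] at h6
    obtain ⟨h8, h9⟩ := Fin.snoc_inj.1 h7
    subst h6 h8 h9
    rfl

theorem add_le_pow_div_sub {t A : ℝ} {n k : ℕ} (hk : 1 ≤ k) (hA : 0 < A)
    (ht : (k : ℝ) + n + 2 * A + 2 ≤ t) :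
    t ^ (2 * n + 1) + 2 * A ≤ t ^ (4 * (n + 1)) / k - n * t ^ (2 * n) := by
  have hk1 : (1 : ℝ) ≤ k := by exact_mod_cast hk
  have hn : (0 : ℝ) ≤ n := Nat.cast_nonneg n
  have ht1 : 1 ≤ t := by linarith
  have h1 : t ^ (2 * n) * t ^ 3 ≤ t ^ (4 * (n + 1)) / k := by
    rw [le_div_iff₀ (by linarith)]
    calc t ^ (2 * n) * t ^ 3 * k ≤ t ^ (2 * n) * t ^ 3 * t := by
          gcongr; linarith
      _ = t ^ (2 * n + 4) := by ring
      _ ≤ t ^ (4 * (n + 1)) := pow_le_pow_right₀ ht1 (by omega)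
  have h2 : t + n + 2 * A ≤ t ^ 3 := by
    have h3 : t ^ 2 ≤ t ^ 3 := pow_le_pow_right₀ ht1 (by norm_num)
    nlinarith
  have h4 : 1 ≤ t ^ (2 * n) := one_le_pow₀ ht1
  have h5 : t ^ (2 * n) * (t + n + 2 * A) ≤ t ^ (2 * n) * t ^ 3 := by gcongr
  have h6 : 2 * A * 1 ≤ 2 * A * t ^ (2 * n) := by gcongr
  rw [pow_succ]
  linarith

theorem exists_sum_card_primesInClass_ge (n : ℕ) {k : ℕ} (hk : 1 ≤ k) {B : ℝ} (hB : 0 ≤ B) :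
    ∃ A : ℝ, 0 < A ∧ ∃ c : ℝ, 0 < c ∧ ∀ᶠ t : ℝ in Filter.atTop, ∀ (q : ℕ) [NeZero q],
      (q : ℝ) ≤ t ^ B → ∀ v : Fin (n + 1) → ZMod q, (∀ j, IsUnit (v j)) →
      ∀ y : (Fin n → ℕ) → ℝ, (∀ p, y p = t ^ (4 * (n + 1)) / k - ∑ j, Real.log (p j) - A) →
      (∀ p ∈ Fintype.piFinset fun j : Fin n =>
        primesInClass (v j.castSucc) (t ^ (2 * (j : ℕ) + 1)) (t ^ (2 * (j : ℕ) + 2)),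
        (q : ℝ) < Real.exp (y p - A) ∧ (∀ j : Fin n, t ^ (2 * (j : ℕ) + 2) < y p - A) ∧
        Real.exp (y p + A) * ∏ j, (p j : ℝ) ≤ Real.exp (t ^ (4 * (n + 1)) / k)) ∧
      c * Real.exp (t ^ (4 * (n + 1)) / k) / (q.totient * t ^ (4 * (n + 1))) *
          (Real.log t / q.totient) ^ n ≤
        ∑ p ∈ Fintype.piFinset fun j : Fin n =>
          primesInClass (v j.castSucc) (t ^ (2 * (j : ℕ) + 1)) (t ^ (2 * (j : ℕ) + 2)),
          ((primesInClass (v (Fin.last n)) (y p - A) (y p + A)).card : ℝ) := by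
  obtain ⟨c₁, hc₁, A, hA, hev₁⟩ := exists_card_primesInClass_ge B
  obtain ⟨c₂, hc₂, hev₂⟩ := exists_sum_primesInClass_ge hB
  obtain ⟨Y₁, hY₁⟩ := Filter.eventually_atTop.1 hev₁
  obtain ⟨Y₂, hY₂⟩ := Filter.eventually_atTop.1 hev₂
  refine ⟨A, hA, c₁ * Real.exp (-A) * (c₂ / 2) ^ n, by positivity, ?_⟩
  filter_upwards [Filter.eventually_ge_atTop ((k : ℝ) + n + 2 * A + 2),
    Filter.eventually_ge_atTop Y₁, Filter.eventually_ge_atTop Y₂, Filter.eventually_ge_atTop 16,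
    (isLittleO_rpow_exp_atTop B).bound (show (0 : ℝ) < 1 / 2 by norm_num)]
    with t ht htY₁ htY₂ ht16 htexp q hq0 hq v hv y hy
  have ht0 : 0 < t := by linarith
  have ht1 : 1 ≤ t := by linarith
  have hk1 : (1 : ℝ) ≤ k := by exact_mod_cast hk
  have hφ : (0 : ℝ) < q.totient := by exact_mod_cast Nat.totient_pos.2 (Nat.pos_of_neZero q)
  have hqe : (q : ℝ) < Real.exp t := by
    rw [Real.norm_of_nonneg (by positivity), Real.norm_of_nonneg (by positivity)] at htexp
    have := Real.exp_pos t
    linarith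
  set box := Fintype.piFinset fun j : Fin n =>
      primesInClass (v j.castSucc) (t ^ (2 * (j : ℕ) + 1)) (t ^ (2 * (j : ℕ) + 2)) with hbox
  have hmem : ∀ p ∈ box, ∀ j, 0 ≤ Real.log (p j) ∧ Real.log (p j) ≤ t ^ (2 * n) ∧
      0 < (p j : ℝ) := by
    intro p hp j
    obtain ⟨⟨-, h1⟩, h2, -⟩ := mem_primesInClass.1 (Fintype.mem_piFinset.1 hp j)
    have h3 : (0 : ℝ) < p j := by exact_mod_cast h2.pos
    refine ⟨Real.log_natCast_nonneg _, ((Real.log_le_iff_le_exp h3).2 h1).trans ?_, h3⟩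
    exact pow_le_pow_right₀ ht1 (by omega)
  have hylo : ∀ p ∈ box, t ^ (2 * n + 1) ≤ y p - A := by
    intro p hp
    have h1 : ∑ j, Real.log (p j) ≤ n * t ^ (2 * n) := by
      refine (Finset.sum_le_sum fun j _ => (hmem p hp j).2.1).trans ?_
      simp
    rw [hy]
    linarith [add_le_pow_div_sub hk hA ht]
  have htp : t ≤ t ^ (2 * n + 1) := le_self_pow₀ ht1 (by omega)
  have hyhi : ∀ p ∈ box, y p ≤ t ^ (4 * (n + 1)) := by
    intro p hp
    have h1 : 0 ≤ ∑ j, Real.log (p j) := Finset.sum_nonneg fun j _ => (hmem p hp j).1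
    have h2 : t ^ (4 * (n + 1)) / k ≤ t ^ (4 * (n + 1)) := div_le_self (by positivity) hk1
    rw [hy]
    linarith
  have hexp : ∀ p ∈ box, Real.exp (y p + A) * ∏ j, (p j : ℝ) =
      Real.exp (t ^ (4 * (n + 1)) / k) := by
    intro p hp
    have h1 : ∏ j, (p j : ℝ) = Real.exp (∑ j, Real.log (p j)) := by
      rw [Real.exp_sum]
      exact Finset.prod_congr rfl fun j _ => (Real.exp_log (hmem p hp j).2.2).symm
    rw [h1, ← Real.exp_add, hy]
    congr 1
    ring
  refine ⟨fun p hp => ⟨hqe.trans_le (Real.exp_le_exp.2 (htp.trans (hylo p hp))), fun j => ?_,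
    (hexp p hp).le⟩, ?_⟩
  · refine lt_of_lt_of_le ?_ (hylo p hp)
    exact pow_lt_pow_right₀ (by linarith) (by omega)
  have hterm : ∀ p ∈ box, c₁ * Real.exp (-A) * Real.exp (t ^ (4 * (n + 1)) / k) /
      (q.totient * t ^ (4 * (n + 1))) * ∏ j, (1 : ℝ) / p j ≤
      ((primesInClass (v (Fin.last n)) (y p - A) (y p + A)).card : ℝ) := by
    intro p hp
    have hty : t ≤ y p := by linarith [hylo p hp]
    refine le_trans ?_ (hY₁ (y p) (htY₁.trans hty) q
      (hq.trans (Real.rpow_le_rpow ht0.le hty hB)) _ (hv _))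
    have h1 : 0 < ∏ j, (p j : ℝ) := Finset.prod_pos fun j _ => (hmem p hp j).2.2
    have h2 : Real.exp (y p) = Real.exp (-A) * Real.exp (t ^ (4 * (n + 1)) / k) *
        ∏ j, (1 : ℝ) / p j := by
      rw [← hexp p hp, Finset.prod_div_distrib, Finset.prod_const_one, mul_one_div,
        eq_div_iff h1.ne', ← mul_assoc, ← Real.exp_add]
      congr 2
      ring
    rw [h2]
    have h3 : 0 < ∏ j, (1 : ℝ) / p j := Finset.prod_pos fun j _ =>
      one_div_pos.2 (hmem p hp j).2.2
    rw [div_mul_eq_mul_div]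
    have h4 : c₁ * Real.exp (-A) * Real.exp (t ^ (4 * (n + 1)) / k) * ∏ j, (1 : ℝ) / p j =
        c₁ * (Real.exp (-A) * Real.exp (t ^ (4 * (n + 1)) / k) * ∏ j, (1 : ℝ) / p j) := by ring
    rw [h4]
    refine div_le_div_of_nonneg_left (by positivity) (mul_pos hφ (by linarith)) ?_
    exact mul_le_mul_of_nonneg_left (hyhi p hp) hφ.le
  refine le_trans ?_ (Finset.sum_le_sum hterm)
  rw [← Finset.mul_sum]
  have hsum : (c₂ / 2) ^ n * (Real.log t / q.totient) ^ n ≤ ∑ p ∈ box, ∏ j, (1 : ℝ) / p j := by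
    rw [hbox, ← Finset.prod_univ_sum
      (fun j : Fin n => primesInClass (v j.castSucc) (t ^ (2 * (j : ℕ) + 1)) (t ^ (2 * (j : ℕ) + 2)))
      (fun _ (p : ℕ) => (1 : ℝ) / p), ← mul_pow]
    have h0 : 0 ≤ Real.log t := Real.log_nonneg ht1
    calc (c₂ / 2 * (Real.log t / q.totient)) ^ n
        = ∏ _j : Fin n, (c₂ / 2 * (Real.log t / q.totient)) := by simp
      _ ≤ _ := Finset.prod_le_prod (fun _ _ => by positivity) fun j _ => ?_
    have hα : t ≤ t ^ (2 * (j : ℕ) + 1) := le_self_pow₀ ht1 (by omega)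
    have hα0 : 0 < t ^ (2 * (j : ℕ) + 1) := by positivity
    have hβ : t ^ (2 * (j : ℕ) + 2) = t * t ^ (2 * (j : ℕ) + 1) := by ring
    refine le_trans ?_ (hY₂ _ (htY₂.trans hα) _ (by rw [hβ]; gcongr; linarith) q
      (hq.trans (Real.rpow_le_rpow ht0.le hα hB)) _ (hv _))
    have h1 : t ^ (2 * (j : ℕ) + 2) / (4 * t ^ (2 * (j : ℕ) + 1)) = t / 4 := by
      rw [hβ]; field_simp
    have h2 : Real.log t / 2 ≤ Real.log (t / 4) := by
      rw [Real.log_div ht0.ne' (by norm_num)]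
      have h3 : Real.log 16 ≤ Real.log t := Real.log_le_log (by norm_num) ht16
      have h4 : Real.log 16 = 2 * Real.log 4 := by
        rw [show (16 : ℝ) = 4 ^ 2 by norm_num, Real.log_pow]; norm_num
      linarith
    rw [h1]
    calc c₂ / 2 * (Real.log t / q.totient) = c₂ * (Real.log t / 2) / q.totient := by ring
      _ ≤ _ := by gcongr
  calc _ = c₁ * Real.exp (-A) * Real.exp (t ^ (4 * (n + 1)) / k) /
      (q.totient * t ^ (4 * (n + 1))) * ((c₂ / 2) ^ n * (Real.log t / q.totient) ^ n) := by ring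
    _ ≤ _ := mul_le_mul_of_nonneg_left hsum (by positivity)

theorem rpow_div_le_of_mul_le {t φ q X B c₁ c₂ S T : ℝ} {m r n M R : ℕ} (hφ : 0 < φ)
    (hq : 1 ≤ q) (hB : 0 ≤ B) (hqt : q ≤ t ^ B) (ht : 0 < t) (hlog : 1 ≤ Real.log t) (hX : 0 ≤ X)
    (hc₁ : 0 < c₁) (hc₂ : 0 < c₂) (hM : 1 ≤ M) (hn : m + 2 * r = n + 1 + 1) (hR : R ≤ n)
    (hS : φ ^ (2 * r) * (c₁ / (1 + Real.log q)) ≤ S)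
    (hT : S * (c₂ * X / (φ * t ^ M) * (Real.log t / φ) ^ (n + 1)) ≤ T) :
    c₁ * c₂ / ((1 + B) * M ^ n) * (φ ^ m)⁻¹ *
      (X * Real.log (t ^ M) ^ ((R : ℝ) - 2) / t ^ M) ≤ T := by
  set l := Real.log t with hl
  have hl0 : 0 < l := by linarith
  have hM0 : (1 : ℝ) ≤ M := by exact_mod_cast hM
  have hlq : 1 + Real.log q ≤ (1 + B) * l := by
    have h1 : Real.log q ≤ B * l := by
      rw [hl, ← Real.log_rpow ht]
      exact Real.log_le_log (by linarith) hqt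
    linarith
  have hlq0 : 0 ≤ Real.log q := Real.log_nonneg hq
  have hpow : Real.log (t ^ M) ^ ((R : ℝ) - 2) ≤ (M : ℝ) ^ n * l ^ n := by
    have h1 : (1 : ℝ) ≤ M * l := one_le_mul_of_one_le_of_one_le hM0 hlog
    rw [Real.log_pow, ← mul_pow, ← Real.rpow_natCast (M * l) n]
    refine Real.rpow_le_rpow_of_exponent_le h1 ?_
    have : (R : ℝ) ≤ n := by exact_mod_cast hR
    linarith
  have hS' : φ ^ (2 * r) * (c₁ / ((1 + B) * l)) ≤ S := by
    refine le_trans ?_ hS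
    gcongr
  refine le_trans ?_ ((mul_le_mul_of_nonneg_right hS' (by positivity)).trans hT)
  calc _ ≤ c₁ * c₂ / ((1 + B) * M ^ n) * (φ ^ m)⁻¹ * (X * (M ^ n * l ^ n) / t ^ M) := by
        gcongr
    _ = φ ^ (2 * r) * (c₁ / ((1 + B) * l)) * (c₂ * X / (φ * t ^ M) * (l / φ) ^ (n + 1)) := by
        have h1 : φ ^ m * φ ^ (2 * r) = φ * φ ^ (n + 1) := by
          rw [← pow_add, hn, pow_succ, mul_comm]
        have h2 : φ ^ (2 * r) = φ * φ ^ (n + 1) / φ ^ m := by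
          rw [eq_div_iff (by positivity), ← h1, mul_comm]
        rw [h2, div_pow, pow_succ l]
        field_simp

theorem sum_card_le_card {q m n R k : ℕ} [NeZero q] {K : ℕ} (hk : k ≠ 0) (hR : 1 ≤ R)
    (hRn : R ≤ n + 1) {f : Fin K → ℕ → ℤ} (hf : ∀ i, IsMultFn (f i)) {W : Fin K → ℤ[X]}
    (hfW : ∀ i, ∀ p : ℕ, p.Prime → f i (p ^ k) = (W i).eval (p : ℤ))
    {F : Fin m → ℤ[X]} {a : Fin m → ZMod q} {b : Fin K → ZMod q}
    (hW : ∀ s : Fin (n + 1) → ZMod q, (∀ i, ∏ j, aeval (s j) (F i) = a i) →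
      ∀ i, ∏ j, aeval (s j) (W i) = b i)
    {α β : Fin n → ℝ} {lo hi : (Fin n → ℕ) → ℝ} {X x : ℝ} (hX : X ^ k ≤ x)
    (hαβ : ∀ i j, i < j → β i < α j) (hqα : ∀ j, (q : ℝ) < Real.exp (α j))
    (hlo : ∀ v ∈ unitSols F (n + 1) a, ∀ p ∈ Fintype.piFinset fun j : Fin n =>
      primesInClass (v j.castSucc) (α j) (β j), (q : ℝ) < Real.exp (lo p) ∧ (∀ j, β j < lo p) ∧
        Real.exp (hi p) * ∏ j, (p j : ℝ) ≤ X) :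
    ∑ v ∈ unitSols F (n + 1) a, ∑ p ∈ Fintype.piFinset fun j : Fin n =>
        primesInClass (v j.castSucc) (α j) (β j),
      ((primesInClass (v (Fin.last n)) (lo p) (hi p)).card : ℝ) ≤
    (Nat.card {n : ℕ | 0 < n ∧ (n : ℝ) ≤ x ∧ q < Pj (R * k) n ∧
      ∀ i, (f i n : ZMod q) = b i} : ℝ) := by
  set T : Finset ℕ := (Finset.Icc 1 ⌊x⌋₊).filter fun n => q < Pj (R * k) n ∧
    ∀ i, (f i n : ZMod q) = b i with hTdef
  have hT : {n : ℕ | 0 < n ∧ (n : ℝ) ≤ x ∧ q < Pj (R * k) n ∧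
      ∀ i, (f i n : ZMod q) = b i} = T := by
    ext N
    rw [hTdef]
    simp only [Set.mem_ofPred_eq, Finset.coe_filter, Finset.mem_Icc]
    constructor
    · rintro ⟨h1, h2, h3⟩
      exact ⟨⟨h1, Nat.le_floor h2⟩, h3⟩
    · rintro ⟨⟨h1, h2⟩, h3⟩
      exact ⟨h1, (Nat.le_floor_iff' (by omega)).1 h2, h3⟩
  rw [hT, Nat.card_coe_set_eq, Set.ncard_coe_finset]
  refine sum_card_primesInClass_le hk _ hαβ hqα hlo fun s hs hp hq hsX hsol => ?_
  obtain ⟨-, -, hsol⟩ := Finset.mem_filter.1 hsol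
  refine Finset.mem_filter.2 ⟨Finset.mem_Icc.2 ⟨?_, Nat.le_floor ?_⟩, ?_, fun i => ?_⟩
  · exact Nat.pos_of_ne_zero (pow_ne_zero _ (Finset.prod_ne_zero_iff.2 fun j _ => (hp j).ne_zero))
  · refine le_trans ?_ hX
    rw [Nat.cast_pow]
    exact pow_le_pow_left₀ (Nat.cast_nonneg _) hsX _
  · refine lt_Pj_of_lt_primeFactors (Nat.mul_pos hR (Nat.pos_of_ne_zero hk)) ?_ ?_
    · rw [length_primeFactorsList_prod_pow hp, Finset.card_univ, Fintype.card_fin, mul_comm]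
      exact Nat.mul_le_mul_left _ hRn
    · intro p hpp hdvd
      obtain ⟨j, rfl⟩ := exists_eq_of_prime_dvd_prod_pow hp hpp hdvd
      exact hq j
  · rw [(hf i).map_prod_pow hp hs.injective, ← hW _ hsol i, Int.cast_prod]
    refine Finset.prod_congr rfl fun j _ => ?_
    rw [hfW i _ (hp j)]
    have := aeval_map_int (Int.castRingHom (ZMod q)) (W i) (s j : ℤ)
    simpa [Polynomial.coe_aeval_eq_eval] using this.symm

theorem necessity_of_multiplicative_independence
    (K V : ℕ) (hK1 : 1 < K) (hV : 1 ≤ V)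
    (K₀ B₀ : ℝ) (hK₀ : 0 < K₀) (hB₀ : 0 < B₀)
    (f : Fin K → ℕ → ℤ) (hf : ∀ i, IsMultFn (f i))
    (W : Fin K → ℕ → Polynomial ℤ)
    (hfW : ∀ (i : Fin K) (v : ℕ), 1 ≤ v → v ≤ V → ∀ p : ℕ, p.Prime →
      f i (p ^ v) = (W i v).eval (p : ℤ))
    (k : ℕ) (hk1 : 1 ≤ k) (hkV : k ≤ V)
    (hWnc : ∀ i, 0 < (W i k).natDegree)
    (R : ℕ) (hR : 1 ≤ R)
    (hMI' : MultIndep (fun i : Fin (K - 1) => W (Fin.castLE (Nat.sub_le K 1) i) k))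
    (hdeg : 1 < ∑ i : Fin (K - 1), (W (Fin.castLE (Nat.sub_le K 1) i) k).natDegree)
    (lam : Fin (K - 1) → ℕ) (hlam : lam ≠ 0)
    (hWK : W ⟨K - 1, by omega⟩ k
      = ∏ i : Fin (K - 1), (W (Fin.castLE (Nat.sub_le K 1) i) k) ^ lam i) :
    ∃ C : ℝ, 0 < C ∧ ∃ c : ℝ, 0 < c ∧ ∃ X₀ : ℝ, ∀ x : ℝ, X₀ < x →
      ∀ q : ℕ, 0 < q → (q : ℝ) ≤ Real.log x ^ K₀ →
        KAdmissible (fun v => ∏ i, W i v) k q →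
        (∀ ℓ : ℕ, ℓ.Prime → ℓ ∣ q → C < (ℓ : ℝ) ∧
          ∀ β : ℤ,
            IsLastInvFactor (fun i : Fin (K - 1) => W (Fin.castLE (Nat.sub_le K 1) i) k) β →
            Int.gcd ((ℓ : ℤ) - 1) β = 1) →
        ∀ a : Fin K → ZMod q, (∀ i, IsUnit (a i)) →
          a ⟨K - 1, by omega⟩ = ∏ i : Fin (K - 1), (a (Fin.castLE (Nat.sub_le K 1) i)) ^ lam i →
          c * ((q.totient : ℝ) ^ (K - 1))⁻¹ *
              (x ^ ((1 : ℝ) / (k : ℝ)) * Real.log (Real.log x) ^ ((R : ℝ) - 2) / Real.log x)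
            ≤ (Nat.card {n : ℕ | 0 < n ∧ (n : ℝ) ≤ x ∧ q < Pj (R * k) n ∧
                (∀ i, (f i n : ZMod q) = a i)} : ℝ) := by
  set F : Fin (K - 1) → ℤ[X] := fun i => W (Fin.castLE (Nat.sub_le K 1) i) k with hF
  obtain ⟨n, hn, hRn⟩ : ∃ n, (K - 1) + 2 * (K - 1 + 1 + R) = n + 1 + 1 ∧ R ≤ n :=
    ⟨(K - 1) + 2 * (K - 1) + 2 * R, by omega, by omega⟩
  have hk0 : k ≠ 0 := by omega
  set M : ℕ := 4 * (n + 1 + 1) with hM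
  have hM0 : M ≠ 0 := by omega
  set B : ℝ := M * K₀ with hB
  have hB0 : 0 ≤ B := by positivity
  obtain ⟨C, hC, c₁, hc₁, hsol⟩ := exists_regSolCount_ge (r := K - 1 + 1 + R) (by omega) hMI'
    fun i => hWnc _
  obtain ⟨A, hA, c₂, hc₂, hev⟩ := exists_sum_card_primesInClass_ge (n + 1) hk1 hB0
  obtain ⟨t₀, ht₀⟩ := Filter.eventually_atTop.1 (hev.and
    ((isLittleO_rpow_exp_atTop B).bound (show (0 : ℝ) < 1 / 2 by norm_num)))
  refine ⟨C, hC, c₁ * c₂ / ((1 + B) * M ^ n), by positivity,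
    Real.exp (max t₀ (Real.exp 1) ^ M), ?_⟩
  intro x hx q hq hqx _ hℓ a ha haK
  have hinst : NeZero q := ⟨hq.ne'⟩
  have hmax0 : 0 < max t₀ (Real.exp 1) := lt_of_lt_of_le (Real.exp_pos 1) (le_max_right _ _)
  have hx0 : 0 < x := (Real.exp_pos _).trans hx
  have hlogx : max t₀ (Real.exp 1) ^ M < Real.log x := (Real.lt_log_iff_exp_lt hx0).2 hx
  have hlogx0 : 0 < Real.log x := lt_trans (by positivity) hlogx
  obtain ⟨t, ht0, htM⟩ : ∃ t : ℝ, 0 < t ∧ t ^ M = Real.log x :=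
    ⟨Real.log x ^ ((M : ℝ)⁻¹), Real.rpow_pos_of_pos hlogx0 _,
      Real.rpow_inv_natCast_pow hlogx0.le hM0⟩
  have htmax : max t₀ (Real.exp 1) < t := lt_of_pow_lt_pow_left₀ M ht0.le (by rwa [htM])
  have hlogt : 1 ≤ Real.log t :=
    (Real.le_log_iff_exp_le ht0).2 ((le_max_right _ _).trans htmax.le)
  have ht1 : 1 < t := by
    have := Real.add_one_le_exp 1
    linarith [le_max_right t₀ (Real.exp 1)]
  obtain ⟨hcount, hexp⟩ := ht₀ t ((le_max_left _ _).trans htmax.le)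
  have hqt : (q : ℝ) ≤ t ^ B := by
    rw [hB, Real.rpow_mul ht0.le, Real.rpow_natCast, htM]
    exact hqx
  have hqexp : (q : ℝ) < Real.exp t := by
    rw [Real.norm_of_nonneg (by positivity), Real.norm_of_nonneg (by positivity)] at hexp
    have := Real.exp_pos t
    linarith
  have hX : x ^ ((1 : ℝ) / k) = Real.exp (t ^ M / k) := by
    rw [Real.rpow_def_of_pos hx0, htM, mul_one_div]
  have hXk : Real.exp (t ^ M / k) ^ k ≤ x := by
    rw [← Real.exp_nat_mul, mul_div_cancel₀ _ (by exact_mod_cast hk0), htM, Real.exp_log hx0]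
  set b : Fin (K - 1) → ZMod q := fun i => a (Fin.castLE (Nat.sub_le K 1) i) with hb
  have hcard := hsol q hq.ne' hℓ b fun i => ha _
  have hcard' := (Nat.cast_le (α := ℝ)).2
    (regSolCount_le_card_unitSols (N := 2 * (K - 1 + 1 + R)) F b)
  rw [hn] at hcard'
  have hφ : (0 : ℝ) < q.totient := by exact_mod_cast Nat.totient_pos.2 hq
  rw [← htM, hX]
  refine rpow_div_le_of_mul_le hφ (by exact_mod_cast hq) hB0 hqt ht0 hlogt (Real.exp_pos _).le
    hc₁ hc₂ (by omega) hn hRn (hcard.trans hcard') ?_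
  have hcount' := fun v (hv : v ∈ unitSols F (n + 1 + 1) b) =>
    hcount q hqt v (Finset.mem_filter.1 hv).2.1 _ fun p => rfl
  refine le_trans ?_ (sum_card_le_card (F := F) (a := b) hk0 hR (by omega) hf
    (fun i => hfW i k hk1 hkV) ?_ hXk ?_ ?_ fun v hv => (hcount' v hv).1)
  · rw [← nsmul_eq_mul]
    exact Finset.card_nsmul_le_sum _ _ _ fun v hv => (hcount' v hv).2
  · intro s hs i
    by_cases hi : (i : ℕ) < K - 1
    · exact hs ⟨i, hi⟩
    · have hi' : i = ⟨K - 1, by omega⟩ := Fin.ext (by have := i.2; simp only; omega)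
      rw [hi', hWK, haK]
      simp only [map_prod, map_pow]
      rw [Finset.prod_comm]
      refine Finset.prod_congr rfl fun i _ => ?_
      rw [Finset.prod_pow]
      exact congrArg (· ^ lam i) (hs i)
  · intro i j hij
    exact pow_lt_pow_right₀ ht1 (by have : (i : ℕ) < j := hij; omega)
  · intro j
    exact hqexp.trans_le (Real.exp_le_exp.2 (le_self_pow₀ ht1.le (by omega)))
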